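/- Let (x̄,ū) be a relaxed W^{1,2}×L²-local minimizer of problem (P), where the standing assumptions hold, PLICQ holds at x̄(t) for every t ∈ [0,T], and ū is right-continuous and of bounded variation on [0,T]. Then there exist λ ≥ 0, an absolutely continuous p : [0,T] → ℝⁿ with derivative ṗ ∈ L²([0,T];ℝⁿ), a function q : [0,T] → ℝⁿ of bounded variation, finite signed Borel measures γ¹,…,γˢ on [0,T], measurable functions η¹,…,ηˢ : [0,T] → [0,∞) with ∫₀ᵀ η^j(t)² dt < ∞, a function ψ ∈ L²([0,T];ℝ^d), and numbers η^j_T ≥ 0 for j ∈ I(x̄(T)), such that: (1) −ẋ̄(t) = Σ_{j=1}^s η^j(t) x*_j + g(x̄(t),ū(t)) for a.e. t ∈ [0,T]; (2) (ṗ(t), −ψ(t)) ∈ co ∂⟨q(t),g⟩(x̄(t),ū(t)) for a.e. t ∈ [0,T], where ∂⟨q(t),g⟩(x̄(t),ū(t)) is the limiting subdifferential at (x̄(t),ū(t)) of the function (x,u) ↦ ⟨q(t), g(x,u)⟩ and co denotes the convex hull; (3) ψ(t) ∈ co N(ū(t);U) (convexified limiting normal cone to U) for a.e. t ∈ [0,T];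 (4) q(t) = p(t) − Σ_{j=1}^s γ^j((t,T]) x*_j for all t ∈ [0,T] with the exception of at most countably many points; (5) if U is convex, then ⟨ψ(t), ū(t)⟩ = max_{u∈U} ⟨ψ(t), u⟩ for a.e. t ∈ [0,T]; (6) −p(T) − Σ_{j∈I(x̄(T))} η^j_T x*_j ∈ λ ∂φ(x̄(T)) and Σ_{j∈I(x̄(T))} η^j_T x*_j ∈ N(x̄(T);C) (convex normal cone); (7) for a.e. t ∈ [0,T] and every j ∈ {1,…,s}: ⟨x*_j, x̄(t)⟩ < c_j implies η^j(t) = 0, and also ⟨x*_j, x̄(T)⟩ < c_j implies η^j_T = 0; (8) if the vectors {x*_j : j ∈ I(x̄(t))} are linearly independent for a.e. t ∈ [0,T), then for a.e. t ∈ [0,T) and every j: η^j(t) > 0 implies ⟨x*_j, q(t)⟩ = 0; (9) for every t ∈ [0,T) with ⟨x*_j, x̄(t)⟩ < c_j for all j = 1,…,s, there is a relative neighborhood V_t of t in [0,T) such that |γ^j|(V) = 0 for every Borel set V ⊆ V_t and every j; (10) nontriviality: λ > 0, or p(t) ≠ 0 for some t ∈ [0,T], or Σ_{j=1}^s |γ^j|([0,T])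 > 0; (11) if ⟨x*_j, x̄(t)⟩ < c_j for all t ∈ [0,T) and all j = 1,…,s, then λ > 0 or p(t) ≠ 0 for some t ∈ [0,T]. -/

import Mathlib

open Filter Topology Set MeasureTheory
open scoped RealInnerProductSpace

noncomputable section

/-- The limiting (Mordukhovich) normal cone to a set `Ω` at `z`. -/
def limNormal {E : Type*} [NormedAddCommGroup E] [NormedSpace ℝ E]
    (Ω : Set E) (z : E) : Set E :=
  {v | ∃ (zk vk : ℕ → E) (tk : ℕ → ℝ) (yk : ℕ → E),
      Tendsto zk atTop (𝓝 z) ∧ Tendsto vk atTop (𝓝 v) ∧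
      (∀ k, 0 ≤ tk k) ∧ (∀ k, yk k ∈ Ω) ∧
      (∀ k, ‖zk k - yk k‖ = Metric.infDist (zk k) Ω) ∧
      (∀ k, vk k = tk k • (zk k - yk k))}

/-- The convex normal cone to a convex set `C` at `x` (empty if `x ∉ C`). -/
def convNormal {E : Type*} [NormedAddCommGroup E] [InnerProductSpace ℝ E]
    (C : Set E) (x : E) : Set E :=
  {v | x ∈ C ∧ ∀ y ∈ C, ⟪v, y - x⟫ ≤ 0}

/-- Pairing of two components into the `L²` product. -/
def pmk {E F : Type*} [NormedAddCommGroup E] [NormedAddCommGroup F]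
    (a : E) (b : F) : WithLp 2 (E × F) :=
  (WithLp.equiv 2 (E × F)).symm (a, b)

/-- First component of an `L²` product element. -/
def pfst {E F : Type*} [NormedAddCommGroup E] [NormedAddCommGroup F]
    (q : WithLp 2 (E × F)) : E := ((WithLp.equiv 2 (E × F)) q).1

/-- Second component of an `L²` product element. -/
def psnd {E F : Type*} [NormedAddCommGroup E] [NormedAddCommGroup F]
    (q : WithLp 2 (E × F)) : F := ((WithLp.equiv 2 (E × F)) q).2

/-- The coderivative of a set-valued map `G` at `(z, y) ∈ gph G`, applied to `w`. -/
def coderiv {E F : Type*} [NormedAddCommGroup E] [NormedSpace ℝ E]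
    [NormedAddCommGroup F] [NormedSpace ℝ F]
    (G : E → Set F) (z : E) (y : F) (w : F) : Set E :=
  {v | pmk v (-w) ∈ limNormal {q : WithLp 2 (E × F) | psnd q ∈ G (pfst q)} (pmk z y)}

/-- The limiting subdifferential of `h : E → ℝ` at `z`, via limiting normals to the epigraph. -/
def limSubdiff {E : Type*} [NormedAddCommGroup E] [NormedSpace ℝ E]
    (h : E → ℝ) (z : E) : Set E :=
  {v | pmk v (-1 : ℝ) ∈ limNormal {q : WithLp 2 (E × ℝ) | h (pfst q) ≤ psnd q} (pmk z (h z))}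
/-- `Euc n` is the Euclidean space `ℝⁿ`. -/
abbrev Euc (n : ℕ) := EuclideanSpace ℝ (Fin n)


/-- PLICQ (positive linear independence constraint qualification) for the polyhedron
determined by `xs` and `c`, at the point `x`. -/
def PLICQ {n s : ℕ} (xs : Fin s → Euc n) (c : Fin s → ℝ) (x : Euc n) : Prop :=
  ∀ α : Fin s → ℝ, (∀ j, 0 ≤ α j) → (∀ j, ⟪xs j, x⟫ ≠ c j → α j = 0) →
    (∑ j, α j • xs j) = 0 → ∀ j, α j = 0

/-- A feasible pair of the sweeping optimal control problem `(P)`: `x` is absolutely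
continuous on `[0,T]` with derivative `x' ∈ L²`, starts at `x0`, the control `u` is
measurable with values in `Uset` a.e., and the sweeping inclusion
`-ẋ(t) ∈ N(x(t);C) + g(x(t),u(t))` holds a.e. on `[0,T]`. -/
def FeasibleP {n d : ℕ} (T : ℝ) (x0 : Euc n)
    (C : Set (Euc n)) (Uset : Set (Euc d))
    (g : WithLp 2 (Euc n × Euc d) → Euc n)
    (x x' : ℝ → Euc n) (u : ℝ → Euc d) : Prop :=
  x 0 = x0 ∧
  (∀ t ∈ Set.Icc 0 T, x t = x0 + ∫ s in (0:ℝ)..t, x' s) ∧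
  IntegrableOn x' (Set.Icc 0 T) ∧
  IntegrableOn (fun t => ‖x' t‖ ^ 2) (Set.Icc 0 T) ∧
  AEStronglyMeasurable u (volume.restrict (Set.Icc 0 T)) ∧
  (∀ᵐ t ∂(volume : Measure ℝ), t ∈ Set.Icc 0 T → u t ∈ Uset) ∧
  (∀ᵐ t ∂(volume : Measure ℝ), t ∈ Set.Icc 0 T →
    ∃ v ∈ convNormal C (x t), -x' t = v + g (pmk (x t) (u t)))

/-- A function is piecewise constant on `[0,T]` if there is a finite partition of
`[0,T]` on each of whose subintervals the function is constant. -/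
def PiecewiseConstOn {F : Type*} (u : ℝ → F) (T : ℝ) : Prop :=
  ∃ (l : ℕ) (τ : ℕ → ℝ), τ 0 = 0 ∧ τ l = T ∧ (∀ i < l, τ i < τ (i + 1)) ∧
    ∀ i < l, ∀ t ∈ Set.Ico (τ i) (τ (i + 1)), u t = u (τ i)

/-- `(xb, ub)` (with `xb' ` the derivative of `xb`) is a relaxed `W^{1,2} × L²` local
minimizer of problem `(P)` with modulus `ε`. -/
def RelaxedLocalMin {n d : ℕ} (T : ℝ) (x0 : Euc n) (C : Set (Euc n)) (Uset : Set (Euc d))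
    (g : WithLp 2 (Euc n × Euc d) → Euc n) (φ : Euc n → ℝ)
    (xb xb' : ℝ → Euc n) (ub : ℝ → Euc d) (ε : ℝ) : Prop :=
  ∀ (y y' : ℝ → Euc n) (u : ℝ → Euc d),
    AEStronglyMeasurable u (volume.restrict (Set.Icc 0 T)) →
    (∀ᵐ t ∂(volume : Measure ℝ), t ∈ Set.Icc 0 T → u t ∈ convexHull ℝ Uset) →
    y 0 = x0 →
    (∀ t ∈ Set.Icc 0 T, y t = x0 + ∫ s in (0:ℝ)..t, y' s) →
    IntegrableOn y' (Set.Icc 0 T) →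
    IntegrableOn (fun t => ‖y' t‖ ^ 2) (Set.Icc 0 T) →
    (∀ᵐ t ∂(volume : Measure ℝ), t ∈ Set.Icc 0 T →
      ∃ v ∈ convNormal C (y t),
        ∃ w ∈ convexHull ℝ ((fun uu => g (pmk (y t) uu)) '' Uset), -y' t = v + w) →
    (∃ (yk yk' : ℕ → ℝ → Euc n) (uk : ℕ → ℝ → Euc d),
      (∀ k, FeasibleP T x0 C Uset g (yk k) (yk' k) (uk k) ∧ PiecewiseConstOn (uk k) T) ∧
      Tendsto (fun k => ∫ t in (0:ℝ)..T, (‖yk k t - y t‖ ^ 2 + ‖yk' k t - y' t‖ ^ 2))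
        atTop (𝓝 0) ∧
      (∃ v : ℕ → ℝ → Euc d,
        (∀ k, ∃ (M : ℕ) (lw : ℕ → ℝ), (∀ i, 0 ≤ lw i) ∧ (∑ i ∈ Finset.range M, lw i) = 1 ∧
          ∀ t, v k t = ∑ i ∈ Finset.range M, lw i • uk i t) ∧
        Tendsto (fun k => ∫ t in (0:ℝ)..T, ‖v k t - u t‖ ^ 2) atTop (𝓝 0))) →
    (∫ t in (0:ℝ)..T, (‖y' t - xb' t‖ ^ 2 + ‖u t - ub t‖ ^ 2)) < ε →
    φ (xb T) ≤ φ (y T)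

section PmkBasics
variable {E F : Type*} [NormedAddCommGroup E] [NormedAddCommGroup F]
theorem pmk_sub (a c : E) (b d : F) : pmk a b - pmk c d = pmk (a - c) (b - d) := rfl
theorem pmk_add (a c : E) (b d : F) : pmk a b + pmk c d = pmk (a + c) (b + d) := rfl
theorem pmk_smul [NormedSpace ℝ E] [NormedSpace ℝ F] (t : ℝ) (a : E) (b : F) :
    t • pmk a b = pmk (t • a) (t • b) := rfl
theorem pmk_eta (q : WithLp 2 (E × F)) : pmk (pfst q) (psnd q) = q := rfl
@[simp] theorem pfst_pmk (a : E) (b : F) : pfst (pmk a b) = a := rfl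
@[simp] theorem psnd_pmk (a : E) (b : F) : psnd (pmk a b) = b := rfl
theorem pmk_norm_sq (a : E) (b : F) : ‖pmk a b‖ ^ 2 = ‖a‖ ^ 2 + ‖b‖ ^ 2 := by
  rw [WithLp.prod_norm_sq_eq_of_L2]; rfl
theorem pmk_norm_le (a : E) (b : F) : ‖pmk a b‖ ≤ ‖a‖ + ‖b‖ := by
  have h := pmk_norm_sq a b
  nlinarith [norm_nonneg a, norm_nonneg b, norm_nonneg (pmk a b)]
theorem norm_le_pmk_left (a : E) (b : F) : ‖a‖ ≤ ‖pmk a b‖ := by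
  have h := pmk_norm_sq a b
  nlinarith [norm_nonneg a, norm_nonneg b, norm_nonneg (pmk a b)]
theorem norm_le_pmk_right (a : E) (b : F) : ‖b‖ ≤ ‖pmk a b‖ := by
  have h := pmk_norm_sq a b
  nlinarith [norm_nonneg a, norm_nonneg b, norm_nonneg (pmk a b)]
theorem continuous_pmk : Continuous (fun q : E × F => pmk q.1 q.2) := by
  have := WithLp.prod_continuous_toLp 2 E F
  exact this
theorem continuous_pfst : Continuous (fun q : WithLp 2 (E × F) => pfst q) := by
  have := WithLp.prod_continuous_ofLp 2 E F
  exact this.fst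
theorem continuous_psnd : Continuous (fun q : WithLp 2 (E × F) => psnd q) := by
  have := WithLp.prod_continuous_ofLp 2 E F
  exact this.snd
end PmkBasics

theorem pmk_inner {E F : Type*} [NormedAddCommGroup E] [NormedAddCommGroup F]
    [InnerProductSpace ℝ E] [InnerProductSpace ℝ F] (a c : E) (b d : F) :
    ⟪pmk a b, pmk c d⟫ = ⟪a, c⟫ + ⟪b, d⟫ := by
  rw [WithLp.prod_inner_apply]; rfl

theorem mem_limNormal_iff {E : Type*} [NormedAddCommGroup E] [NormedSpace ℝ E]
    (Ω : Set E) (z v : E) :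
    v ∈ limNormal Ω z ↔ ∀ ε > (0:ℝ), ∃ (z' y : E) (t : ℝ), ‖z' - z‖ < ε ∧
      ‖t • (z' - y) - v‖ < ε ∧ 0 ≤ t ∧ y ∈ Ω ∧ ‖z' - y‖ = Metric.infDist z' Ω := by
  constructor
  · rintro ⟨zk, vk, tk, yk, h1, h2, h3, h4, h5, h6⟩ ε hε
    have a1 := (Metric.tendsto_nhds.1 h1 ε hε).and (Metric.tendsto_nhds.1 h2 ε hε)
    obtain ⟨k, hk1, hk2⟩ := a1.exists
    refine ⟨zk k, yk k, tk k, ?_, ?_, h3 k, h4 k, h5 k⟩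
    · rwa [← dist_eq_norm]
    · rw [← h6 k, ← dist_eq_norm]; exact hk2
  · intro h
    choose zk yk tk h1 h2 h3 h4 h5 using fun k : ℕ => h (1 / ((k:ℝ) + 1)) (by positivity)
    refine ⟨zk, fun k => tk k • (zk k - yk k), tk, yk, ?_, ?_, h3, h4, h5, fun k => rfl⟩
    · rw [tendsto_iff_norm_sub_tendsto_zero]
      exact squeeze_zero (fun _ => norm_nonneg _) (fun k => (h1 k).le)
        tendsto_one_div_add_atTop_nhds_zero_nat
    · rw [tendsto_iff_norm_sub_tendsto_zero]
      exact squeeze_zero (fun _ => norm_nonneg _) (fun k => (h2 k).le)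
        tendsto_one_div_add_atTop_nhds_zero_nat

theorem limNormal_closed {E : Type*} [NormedAddCommGroup E] [NormedSpace ℝ E]
    (Ω : Set E) (z v : E)
    (h : ∀ ε > (0:ℝ), ∃ z' v' : E, ‖z' - z‖ < ε ∧ ‖v' - v‖ < ε ∧ v' ∈ limNormal Ω z') :
    v ∈ limNormal Ω z := by
  rw [mem_limNormal_iff]
  intro ε hε
  obtain ⟨z', v', h1, h2, h3⟩ := h (ε / 2) (by positivity)
  rw [mem_limNormal_iff] at h3
  obtain ⟨z'', y, t, a1, a2, a3, a4, a5⟩ := h3 (ε / 2) (by positivity)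
  refine ⟨z'', y, t, ?_, ?_, a3, a4, a5⟩
  · have : z'' - z = (z'' - z') + (z' - z) := by abel
    rw [this]; linarith [norm_add_le (z'' - z') (z' - z)]
  · have : t • (z'' - y) - v = (t • (z'' - y) - v') + (v' - v) := by abel
    rw [this]; linarith [norm_add_le (t • (z'' - y) - v') (v' - v)]

/-- Proximal subgradients. -/
def ProxSub {E : Type*} [NormedAddCommGroup E] [InnerProductSpace ℝ E]
    (f : E → ℝ) (z v : E) : Prop :=
  ∃ C : ℝ, 0 ≤ C ∧ ∀ᶠ w in 𝓝 z, f z + ⟪v, w - z⟫ - C * ‖w - z‖ ^ 2 ≤ f w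

section NS
variable {E : Type*} [NormedAddCommGroup E] [InnerProductSpace ℝ E]

theorem ProxSub.mem_limSubdiff {f : E → ℝ} {z v : E} (h : ProxSub f z v) :
    v ∈ limSubdiff f z := by
  obtain ⟨C, hC, h⟩ := h
  obtain ⟨r, hr, hB⟩ := Metric.eventually_nhds_iff.1 h
  show pmk v (-1 : ℝ) ∈ limNormal _ _
  rw [mem_limNormal_iff]
  intro ε hε
  set m : ℝ := ‖pmk v (-1:ℝ)‖ with hm
  have hm0 : 0 ≤ m := norm_nonneg _
  -- choose tau
  obtain ⟨τ, hτ0, hτ1, hτ2, hτ3⟩ : ∃ τ : ℝ, 0 < τ ∧ τ * m < ε ∧ 2 * τ * m < r ∧ 2 * τ * C ≤ 1 := by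
    refine ⟨min (ε / (2 * (m + 1))) (min (r / (4 * (m + 1))) (1 / (2 * (C + 1)))),
      by positivity, ?_, ?_, ?_⟩
    · have h1 : min (ε / (2 * (m + 1))) (min (r / (4 * (m + 1))) (1 / (2 * (C + 1)))) ≤
        ε / (2 * (m + 1)) := min_le_left _ _
      calc _ ≤ ε / (2 * (m + 1)) * m := by gcongr
        _ < ε := by
          rw [div_mul_eq_mul_div, div_lt_iff₀ (by positivity)]; nlinarith
    · have h1 : min (ε / (2 * (m + 1))) (min (r / (4 * (m + 1))) (1 / (2 * (C + 1)))) ≤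
        r / (4 * (m + 1)) := (min_le_right _ _).trans (min_le_left _ _)
      calc _ ≤ 2 * (r / (4 * (m + 1))) * m := by gcongr
        _ < r := by
          rw [mul_div_assoc', div_mul_eq_mul_div, div_lt_iff₀ (by positivity)]; nlinarith
    · have h1 : min (ε / (2 * (m + 1))) (min (r / (4 * (m + 1))) (1 / (2 * (C + 1)))) ≤
        1 / (2 * (C + 1)) := (min_le_right _ _).trans (min_le_right _ _)
      calc _ ≤ 2 * (1 / (2 * (C + 1))) * C := by gcongr
        _ ≤ 1 := by
          rw [mul_div_assoc', div_mul_eq_mul_div, div_le_iff₀ (by positivity)]; nlinarith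
  refine ⟨pmk z (f z) + τ • pmk v (-1:ℝ), pmk z (f z), τ⁻¹, ?_, ?_, by positivity, ?_, ?_⟩
  · rw [add_sub_cancel_left, norm_smul, Real.norm_eq_abs, abs_of_pos hτ0]; exact hτ1
  · rw [add_sub_cancel_left, smul_smul, inv_mul_cancel₀ hτ0.ne']; simpa using hε
  · simp
  · rw [add_sub_cancel_left, norm_smul, Real.norm_eq_abs, abs_of_pos hτ0]
    apply le_antisymm
    · apply (Metric.le_infDist ⟨pmk z (f z), by simp⟩).2
      intro y hy
      obtain ⟨w, a, rfl⟩ : ∃ w a, y = pmk w a := ⟨pfst y, psnd y, rfl⟩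
      replace hy : f w ≤ a := hy
      rw [pmk_smul, pmk_add, dist_eq_norm, pmk_sub]
      by_contra! hlt
      have hsq := pmk_norm_sq (z + τ • v - w) (f z + τ • (-1:ℝ) - a)
      have hmsq : m ^ 2 = ‖v‖ ^ 2 + 1 := by rw [hm, pmk_norm_sq]; simp
      have hw : ‖w - z‖ < r := by
        have h1 := norm_le_pmk_left (z + τ • v - w) (f z + τ • (-1:ℝ) - a)
        have h2 : ‖v‖ ≤ m := norm_le_pmk_left v (-1:ℝ)
        have : w - z = τ • v - (z + τ • v - w) := by abel
        rw [this]
        have h3 := norm_sub_le (τ • v) (z + τ • v - w)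
        rw [norm_smul, Real.norm_eq_abs, abs_of_pos hτ0] at h3
        nlinarith
      have hf := hB (by rw [dist_eq_norm]; exact hw)
      have e1 : ‖z + τ • v - w‖ ^ 2 = ‖w - z‖ ^ 2 - 2 * τ * ⟪v, w - z⟫ + τ ^ 2 * ‖v‖ ^ 2 := by
        have : z + τ • v - w = τ • v - (w - z) := by abel
        rw [this, norm_sub_sq_real, norm_smul, inner_smul_left]
        simp [abs_of_pos hτ0]; ring
      have e2 : ‖f z + τ • (-1:ℝ) - a‖ ^ 2 = (a - f z) ^ 2 + 2 * τ * (a - f z) + τ ^ 2 := by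
        rw [Real.norm_eq_abs, sq_abs, smul_eq_mul]; ring
      have hlt2 : ‖pmk (z + τ • v - w) (f z + τ • (-1:ℝ) - a)‖ ^ 2 < (τ * m) ^ 2 := by
        apply pow_lt_pow_left₀ hlt (norm_nonneg _) (by norm_num)
      rw [hsq, e1, e2, mul_pow, hmsq] at hlt2
      have k1 : τ * (f w - f z) ≤ τ * (a - f z) := by gcongr
      have k2 : τ * (⟪v, w - z⟫ - C * ‖w - z‖ ^ 2) ≤ τ * (f w - f z) := by
        apply mul_le_mul_of_nonneg_left _ hτ0.le; linarith
      have k3 : 2 * τ * C * ‖w - z‖ ^ 2 ≤ 1 * ‖w - z‖ ^ 2 := by gcongr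
      nlinarith [sq_nonneg (a - f z)]
    · have := Metric.infDist_le_dist_of_mem (x := pmk z (f z) + τ • pmk v (-1:ℝ))
        (show pmk z (f z) ∈ {q : WithLp 2 (E × ℝ) | f (pfst q) ≤ psnd q} by simp)
      rw [dist_eq_norm, add_sub_cancel_left, norm_smul, Real.norm_eq_abs, abs_of_pos hτ0] at this
      exact this

theorem limSubdiff_closed {f : E → ℝ} {z v : E} (hf : ContinuousAt f z)
    (h : ∀ ε > (0:ℝ), ∃ z' v' : E, ‖z' - z‖ < ε ∧ ‖v' - v‖ < ε ∧ v' ∈ limSubdiff f z') :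
    v ∈ limSubdiff f z := by
  apply limNormal_closed
  intro ε hε
  obtain ⟨δ, hδ, hc⟩ := Metric.continuousAt_iff.1 hf (ε / 2) (by positivity)
  obtain ⟨z', v', h1, h2, h3⟩ := h (min δ (ε / 2)) (by positivity)
  refine ⟨pmk z' (f z'), pmk v' (-1), ?_, ?_, h3⟩
  · rw [pmk_sub]
    have a1 := hc (show dist z' z < δ by rw [dist_eq_norm]; exact h1.trans_le (min_le_left _ _))
    rw [dist_eq_norm] at a1
    have := pmk_norm_le (z' - z) (f z' - f z)
    have := h1.trans_le (min_le_right _ _)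
    linarith
  · rw [pmk_sub]
    have := pmk_norm_le (v' - v) ((-1:ℝ) - (-1))
    have := h2.trans_le (min_le_right _ _)
    simp at *
    linarith

/-- bound on proximal subgradients of a locally Lipschitz function -/
theorem ProxSub.norm_le {f : E → ℝ} {z v : E} {K : ℝ} (hK : 0 ≤ K) (h : ProxSub f z v)
    (hf : ∀ᶠ w in 𝓝 z, f w - f z ≤ K * ‖w - z‖) : ‖v‖ ≤ K := by
  obtain ⟨C, hC, h⟩ := h
  by_contra! hlt
  have hv : 0 < ‖v‖ := hK.trans_lt hlt
  obtain ⟨r, hr, hB⟩ := Metric.eventually_nhds_iff.1 (h.and hf)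
  -- w = z + τ v
  have key : ∀ τ : ℝ, 0 < τ → τ * ‖v‖ < r → ‖v‖ ≤ K + C * (τ * ‖v‖) := by
    intro τ h0 h1
    have := hB (y := z + τ • v) (by
      rw [dist_eq_norm, add_sub_cancel_left, norm_smul, Real.norm_eq_abs, abs_of_pos h0]; exact h1)
    rw [add_sub_cancel_left, norm_smul, Real.norm_eq_abs, abs_of_pos h0, inner_smul_right,
      real_inner_self_eq_norm_sq] at this
    have h2 : τ * ‖v‖ * ‖v‖ ≤ (τ * ‖v‖) * (K + C * (τ * ‖v‖)) := by nlinarith [this.1, this.2]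
    exact le_of_mul_le_mul_left h2 (by positivity)
  have hlim : Tendsto (fun τ : ℝ => K + C * (τ * ‖v‖)) (𝓝[>] 0) (𝓝 (K + C * (0 * ‖v‖))) := by
    apply Tendsto.mono_left _ nhdsWithin_le_nhds
    apply Continuous.tendsto; fun_prop
  have hev : ∀ᶠ τ in 𝓝[>] (0:ℝ), ‖v‖ ≤ K + C * (τ * ‖v‖) := by
    have h1 : ∀ᶠ τ in 𝓝[>] (0:ℝ), τ * ‖v‖ < r := by
      have : Tendsto (fun τ : ℝ => τ * ‖v‖) (𝓝[>] 0) (𝓝 (0 * ‖v‖)) := by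
        apply Tendsto.mono_left _ nhdsWithin_le_nhds
        apply Continuous.tendsto; fun_prop
      rw [zero_mul] at this
      exact this.eventually (gt_mem_nhds hr)
    filter_upwards [h1, self_mem_nhdsWithin] with τ a b using key τ b a
  have := ge_of_tendsto hlim hev
  simp at this
  linarith
end NS

theorem ProxSub.fuzzy {E : Type*} [NormedAddCommGroup E] [InnerProductSpace ℝ E]
    [FiniteDimensional ℝ E] {f' f : E → ℝ} {z v : E} {κ : ℝ} (hκ : 0 ≤ κ)
    (h : ProxSub f' z v) (hf : ∀ᶠ w in 𝓝 z, ContinuousAt f w)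
    (hd : ∀ᶠ w in 𝓝 z, |(f w - f' w) - (f z - f' z)| ≤ κ * ‖w - z‖)
    (ε : ℝ) (hε : 0 < ε) :
    ∃ w v'', ‖w - z‖ < ε ∧ ‖v'' - v‖ ≤ κ + ε ∧ ProxSub f w v'' := by
  obtain ⟨C, hC, h⟩ := h
  obtain ⟨r, hr, hB⟩ := Metric.eventually_nhds_iff.1 ((h.and hf).and hd)
  set r' : ℝ := min (r / 2) ε with hr'
  have hr'0 : 0 < r' := by positivity
  -- choose a
  obtain ⟨a, ha0, ha1, ha2⟩ : ∃ a : ℝ, 0 < a ∧ κ * a < r' ^ 2 ∧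
      2 * (C + 1) * √(κ * a) ≤ ε := by
    have t1 : Tendsto (fun a : ℝ => κ * a) (𝓝[>] 0) (𝓝 (κ * 0)) :=
      ((continuous_const.mul continuous_id).tendsto 0).mono_left nhdsWithin_le_nhds
    have t2 : Tendsto (fun a : ℝ => 2 * (C + 1) * √(κ * a)) (𝓝[>] 0) (𝓝 (2 * (C + 1) * √(κ * 0))) :=
      Tendsto.mono_left (Continuous.tendsto (by fun_prop) 0) nhdsWithin_le_nhds
    simp only [mul_zero, Real.sqrt_zero] at t1 t2
    have e1 := t1.eventually (gt_mem_nhds (show (0:ℝ) < r' ^ 2 by positivity))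
    have e2 := t2.eventually (gt_mem_nhds hε)
    obtain ⟨a, ⟨h1, h2⟩, h3⟩ := ((e1.and e2).and self_mem_nhdsWithin).exists
    exact ⟨a, h3, h1, h2.le⟩
  set S : E → ℝ := fun w => (C + 1) * ‖w - z‖ ^ 2 + κ * √(‖w - z‖ ^ 2 + a ^ 2) with hS
  have hcont : ContinuousOn (fun w => f w - ⟪v, w - z⟫ + S w) (Metric.closedBall z r') := by
    have h1 : ContinuousOn f (Metric.closedBall z r') := by
      intro w hw
      refine ((hB (y := w) ?_).1.2).continuousWithinAt
      have : r' ≤ r / 2 := min_le_left _ _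
      have := Metric.mem_closedBall.1 hw
      linarith
    have h2 : Continuous fun w => - ⟪v, w - z⟫ + S w := by simp only [hS]; fun_prop
    have := h1.add h2.continuousOn
    refine this.congr fun w _ => ?_
    simp only [Pi.add_apply]; ring
  obtain ⟨w, hw, hmin⟩ := (isCompact_closedBall z r').exists_isMinOn
    ⟨z, by simp [hr'0.le]⟩ hcont
  have hz := hmin (show z ∈ Metric.closedBall z r' by simp [hr'0.le])
  simp only [mem_ofPred_eq, hS, sub_self, norm_zero, inner_zero_right] at hz
  have hza : √((0:ℝ) ^ 2 + a ^ 2) = a := by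
    rw [zero_pow (by norm_num), zero_add, Real.sqrt_sq ha0.le]
  rw [hza] at hz
  have hwr : dist w z < r := by
    have : r' ≤ r / 2 := min_le_left _ _
    have := Metric.mem_closedBall.1 hw
    linarith
  obtain ⟨⟨b1, -⟩, b2⟩ := hB hwr
  have hsq : ‖w - z‖ ≤ √(‖w - z‖ ^ 2 + a ^ 2) := Real.le_sqrt_of_sq_le (by nlinarith)
  have hwz : ‖w - z‖ ^ 2 ≤ κ * a := by
    have := (abs_le.1 b2).1
    have : κ * ‖w - z‖ ≤ κ * √(‖w - z‖ ^ 2 + a ^ 2) := by gcongr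
    nlinarith
  have hwlt : ‖w - z‖ < r' := by
    by_contra! hcon
    nlinarith
  set B : ℝ := ‖w - z‖ ^ 2 + a ^ 2 with hBdef
  have hB0 : 0 < √B := Real.sqrt_pos.2 (by positivity)
  refine ⟨w, v - (2 * (C + 1)) • (w - z) - (κ / √B) • (w - z), hwlt.trans_le (min_le_right _ _), ?_,
    (C + 1) + κ / (2 * √B), by positivity, ?_⟩
  · have e : v - (2 * (C + 1)) • (w - z) - (κ / √B) • (w - z) - v =
      - ((2 * (C + 1) + κ / √B) • (w - z)) := by rw [add_smul]; abel
    rw [e, norm_neg, norm_smul, Real.norm_eq_abs, abs_of_nonneg (by positivity), add_mul]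
    have h1 : κ / √B * ‖w - z‖ ≤ κ := by
      rw [div_mul_eq_mul_div, div_le_iff₀ hB0]; gcongr
    have h2 : ‖w - z‖ ≤ √(κ * a) := Real.le_sqrt_of_sq_le hwz
    have h3 : 2 * (C + 1) * ‖w - z‖ ≤ 2 * (C + 1) * √(κ * a) := by gcongr
    linarith
  · have hnear : ∀ᶠ y in 𝓝 w, y ∈ Metric.closedBall z r' := by
      have : Metric.ball z r' ∈ 𝓝 w := Metric.isOpen_ball.mem_nhds (by
        rw [Metric.mem_ball, dist_eq_norm]; exact hwlt)
      filter_upwards [this] with y hy using Metric.ball_subset_closedBall hy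
    filter_upwards [hnear] with y hy
    have hm := hmin hy
    simp only [mem_ofPred_eq, hS] at hm
    have hexp : ‖y - z‖ ^ 2 = ‖w - z‖ ^ 2 + 2 * ⟪w - z, y - w⟫ + ‖y - w‖ ^ 2 := by
      have : y - z = (w - z) + (y - w) := by abel
      rw [this, norm_add_sq_real]
    have hsqrt : √(‖y - z‖ ^ 2 + a ^ 2) ≤ √B + (2 * ⟪w - z, y - w⟫ + ‖y - w‖ ^ 2) / (2 * √B) := by
      have hy0 : 0 ≤ ‖y - z‖ ^ 2 + a ^ 2 := by positivity
      have k : √(‖y - z‖ ^ 2 + a ^ 2) * (2 * √B) ≤ 2 * √B * √B + (2 * ⟪w - z, y - w⟫ + ‖y - w‖ ^ 2) := by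
        have e1 := Real.sq_sqrt hy0
        have e2 := Real.sq_sqrt (show 0 ≤ B by positivity)
        nlinarith [sq_nonneg (√(‖y - z‖ ^ 2 + a ^ 2) - √B)]
      have : √B + (2 * ⟪w - z, y - w⟫ + ‖y - w‖ ^ 2) / (2 * √B) =
        (2 * √B * √B + (2 * ⟪w - z, y - w⟫ + ‖y - w‖ ^ 2)) / (2 * √B) := by
        field_simp
      rw [this, le_div_iff₀ (by positivity)]; exact k
    have hk := mul_le_mul_of_nonneg_left hsqrt hκ
    have e3 : κ * (√B + (2 * ⟪w - z, y - w⟫ + ‖y - w‖ ^ 2) / (2 * √B)) =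
      κ * √B + κ / √B * ⟪w - z, y - w⟫ + κ / (2 * √B) * ‖y - w‖ ^ 2 := by
      field_simp
      try ring
    rw [e3] at hk
    have hv : ⟪v, y - z⟫ = ⟪v, w - z⟫ + ⟪v, y - w⟫ := by
      rw [← inner_add_right]; congr 1; abel
    rw [inner_sub_left, inner_sub_left, inner_smul_left, inner_smul_left]
    simp only [conj_trivial]
    rw [hexp] at hk hm
    rw [hv] at hm
    nlinarith

/-- nonemptiness of the limiting subdifferential with approximate prox subgradients -/
theorem limSubdiff_nonempty {E : Type*} [NormedAddCommGroup E] [InnerProductSpace ℝ E]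
    [FiniteDimensional ℝ E] {f : E → ℝ} (hf : LocallyLipschitz f) (z : E) :
    (limSubdiff f z).Nonempty := by
  obtain ⟨K, t, ht, hK⟩ := hf z
  obtain ⟨r, hr, hrt⟩ := Metric.mem_nhds_iff.1 ht
  have hz0 : ProxSub (fun _ : E => (0:ℝ)) z 0 := ⟨0, le_rfl, by simp⟩
  have hKt : ∀ w ∈ Metric.ball z r, ∀ᶠ y in 𝓝 w, f y - f w ≤ K * ‖y - w‖ := by
    intro w hw
    filter_upwards [Metric.isOpen_ball.mem_nhds hw] with y hy
    have := hK.dist_le_mul y (hrt hy) w (hrt hw)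
    rw [Real.dist_eq, dist_eq_norm] at this
    exact (le_abs_self _).trans this
  have key : ∀ k : ℕ, ∃ w v : E, ‖w - z‖ < 1 / ((k:ℝ) + 1) ∧ ‖w - z‖ < r ∧ ProxSub f w v := by
    intro k
    obtain ⟨w, v, h1, h2, h3⟩ := ProxSub.fuzzy (f := f) K.2 hz0
      (Eventually.of_forall fun w => hf.continuous.continuousAt)
      (by
        filter_upwards [Metric.isOpen_ball.mem_nhds (Metric.mem_ball_self hr)] with y hy
        have := hK.dist_le_mul y (hrt hy) z (hrt (Metric.mem_ball_self hr))
        rw [Real.dist_eq, dist_eq_norm] at this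
        simpa using this) (min (1 / ((k:ℝ) + 1)) r) (by positivity)
    exact ⟨w, v, h1.trans_le (min_le_left _ _), h1.trans_le (min_le_right _ _), h3⟩
  choose w v h1 h2 h3 using key
  have hb : ∀ k, v k ∈ Metric.closedBall (0:E) K := by
    intro k
    rw [mem_closedBall_zero_iff]
    exact (h3 k).norm_le K.2 (hKt _ (by rw [Metric.mem_ball, dist_eq_norm]; exact h2 k))
  obtain ⟨v0, -, ns, hns, hlim⟩ := (isCompact_closedBall (0:E) K).tendsto_subseq hb
  refine ⟨v0, limSubdiff_closed hf.continuous.continuousAt ?_⟩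
  intro ε hε
  have e1 := Metric.tendsto_nhds.1 hlim ε hε
  have e2 := (tendsto_one_div_add_atTop_nhds_zero_nat (𝕜 := ℝ)).comp hns.tendsto_atTop
  obtain ⟨k, hk1, hk2⟩ := (e1.and (e2.eventually (gt_mem_nhds hε))).exists
  refine ⟨w (ns k), v (ns k), (h1 _).trans hk2, ?_, (h3 _).mem_limSubdiff⟩
  rwa [← dist_eq_norm]

/-- upper semicontinuity of subgradients of `⟨q, g⟩`. -/
theorem subdiff_usc {E F : Type*} [NormedAddCommGroup E] [InnerProductSpace ℝ E]
    [FiniteDimensional ℝ E] [NormedAddCommGroup F] [InnerProductSpace ℝ F] {g : E → F}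
    {K r : ℝ} (hK : 0 ≤ K) (hr : 0 < r) (zb : E)
    (hg : ∀ z ∈ Metric.ball zb r, ∀ w ∈ Metric.ball zb r, ‖g z - g w‖ ≤ K * ‖z - w‖)
    (q : F) (ε : ℝ) (hε : 0 < ε) :
    ∃ δ > 0, ∀ (q' : F) (z v : E), ‖q' - q‖ < δ → ‖z - zb‖ < δ →
      ProxSub (fun w => ⟪q', g w⟫) z v →
      ∃ v0 ∈ limSubdiff (fun w => ⟪q, g w⟫) zb, ‖v - v0‖ < ε := by
  by_contra! hcon
  have hcon' : ∀ k : ℕ, ∃ (q' : F) (z v : E), ‖q' - q‖ < 1 / ((k:ℝ) + 1) ∧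
      ‖z - zb‖ < min (1 / ((k:ℝ) + 1)) r ∧ ProxSub (fun w => ⟪q', g w⟫) z v ∧
      ∀ v0 ∈ limSubdiff (fun w => ⟪q, g w⟫) zb, ε ≤ ‖v - v0‖ := by
    intro k
    obtain ⟨q', z, v, h1, h2, h3, h4⟩ := hcon (min (1 / ((k:ℝ) + 1)) r) (by positivity)
    exact ⟨q', z, v, h1.trans_le (min_le_left _ _), h2, h3, h4⟩
  choose qk zk vk h1 h2 h3 h4 using hcon'
  have hcg : ∀ w ∈ Metric.ball zb r, ContinuousAt g w := by
    intro w hw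
    have : ContinuousOn g (Metric.ball zb r) := by
      have : LipschitzOnWith ⟨K, hK⟩ g (Metric.ball zb r) :=
        LipschitzOnWith.of_dist_le_mul fun x hx y hy => by
          rw [dist_eq_norm, dist_eq_norm]; exact hg x hx y hy
      exact this.continuousOn
    exact this.continuousAt (Metric.isOpen_ball.mem_nhds hw)
  have hzk : ∀ k, zk k ∈ Metric.ball zb r := fun k => by
    rw [Metric.mem_ball, dist_eq_norm]; exact (h2 k).trans_le (min_le_right _ _)
  have hb : ∀ k, vk k ∈ Metric.closedBall (0:E) ((‖q‖ + 1) * K) := by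
    intro k
    rw [mem_closedBall_zero_iff]
    refine (h3 k).norm_le (by positivity) ?_
    filter_upwards [Metric.isOpen_ball.mem_nhds (hzk k)] with y hy
    rw [← inner_sub_right]
    have hq : ‖qk k‖ ≤ ‖q‖ + 1 := by
      have := (h1 k).le.trans (by
        rw [div_le_one (by positivity)]; linarith [k.cast_nonneg (α := ℝ)] : 1 / ((k:ℝ) + 1) ≤ 1)
      have h := norm_le_insert' (qk k) q
      linarith
    calc _ ≤ ‖qk k‖ * ‖g y - g (zk k)‖ := real_inner_le_norm _ _
      _ ≤ (‖q‖ + 1) * (K * ‖y - zk k‖) := by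
        gcongr
        exact hg _ hy _ (hzk k)
      _ = _ := by ring
  obtain ⟨v0, -, ns, hns, hlim⟩ := (isCompact_closedBall (0:E) ((‖q‖ + 1) * K)).tendsto_subseq hb
  have hv0 : v0 ∈ limSubdiff (fun w => ⟪q, g w⟫) zb := by
    refine limSubdiff_closed (continuousAt_const.inner (hcg zb (Metric.mem_ball_self hr))) ?_
    intro e he
    have e1 := Metric.tendsto_nhds.1 hlim (e / 4) (by positivity)
    have e2 := (tendsto_one_div_add_atTop_nhds_zero_nat (𝕜 := ℝ)).comp hns.tendsto_atTop
    have e3 := e2.mul_const (K + 1)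
    rw [zero_mul] at e3
    obtain ⟨k, hk1, hk2⟩ := (e1.and (e3.eventually (gt_mem_nhds (show (0:ℝ) < e / 4 by positivity)))).exists
    simp only [Function.comp] at hk1 hk2
    set m := ns k
    obtain ⟨w, v'', a1, a2, a3⟩ := ProxSub.fuzzy (f := fun w => ⟪q, g w⟫) (κ := ‖q - qk m‖ * K)
      (by positivity) (h3 m) (by
        filter_upwards [Metric.isOpen_ball.mem_nhds (hzk m)] with y hy
        exact continuousAt_const.inner (hcg y hy)) (by
        filter_upwards [Metric.isOpen_ball.mem_nhds (hzk m)] with y hy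
        have : (⟪q, g y⟫ - ⟪qk m, g y⟫) - (⟪q, g (zk m)⟫ - ⟪qk m, g (zk m)⟫) =
          ⟪q - qk m, g y - g (zk m)⟫ := by
          simp only [inner_sub_left, inner_sub_right]
        rw [this, mul_assoc]
        refine (abs_real_inner_le_norm _ _).trans ?_
        gcongr
        exact hg _ hy _ (hzk m)) (e / 4) (by positivity)
    refine ⟨w, v'', ?_, ?_, a3.mem_limSubdiff⟩
    · have : ‖zk m - zb‖ < e / 4 := by
        have := (h2 m).trans_le (min_le_left _ _)
        have : 1 / ((m:ℝ) + 1) ≤ 1 / ((m:ℝ) + 1) * (K + 1) :=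
          le_mul_of_one_le_right (by positivity) (by linarith)
        linarith
      have e : w - zb = (w - zk m) + (zk m - zb) := by abel
      rw [e]; linarith [norm_add_le (w - zk m) (zk m - zb)]
    · have hq : ‖q - qk m‖ * K ≤ 1 / ((m:ℝ) + 1) * (K + 1) := by
        rw [norm_sub_rev]
        have := (h1 m).le
        gcongr
        linarith
      have e : v'' - v0 = (v'' - vk m) + (vk m - v0) := by abel
      rw [dist_eq_norm] at hk1
      rw [e]; linarith [norm_add_le (v'' - vk m) (vk m - v0)]
  obtain ⟨k, hk⟩ := (Metric.tendsto_nhds.1 hlim ε hε).exists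
  rw [dist_eq_norm] at hk
  exact absurd hk (not_lt.2 (h4 _ _ hv0))

theorem limNormal_usc {E : Type*} [NormedAddCommGroup E] [NormedSpace ℝ E]
    [FiniteDimensional ℝ E] (U : Set E) (ub : E) (R ε : ℝ) (hε : 0 < ε) :
    ∃ δ > 0, ∀ (u v : E), ‖u - ub‖ < δ → v ∈ limNormal U u → ‖v‖ ≤ R →
      ∃ v0 ∈ limNormal U ub, ‖v0‖ ≤ R ∧ ‖v - v0‖ < ε := by
  by_contra! hcon
  choose uk vk h1 h2 h3 h4 using fun k : ℕ => hcon (1 / ((k:ℝ) + 1)) (by positivity)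
  have hb : ∀ k, vk k ∈ Metric.closedBall (0:E) R := fun k => by
    rw [mem_closedBall_zero_iff]; exact h3 k
  have : ProperSpace E := FiniteDimensional.proper_real E
  obtain ⟨v0, hv0, ns, hns, hlim⟩ := (isCompact_closedBall (0:E) R).tendsto_subseq hb
  have hm : v0 ∈ limNormal U ub := by
    refine limNormal_closed U ub v0 ?_
    intro e he
    have e1 := Metric.tendsto_nhds.1 hlim e he
    have e2 := (tendsto_one_div_add_atTop_nhds_zero_nat (𝕜 := ℝ)).comp hns.tendsto_atTop
    obtain ⟨k, hk1, hk2⟩ := (e1.and (e2.eventually (gt_mem_nhds he))).exists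
    refine ⟨uk (ns k), vk (ns k), (h1 _).trans hk2, ?_, h2 _⟩
    rwa [← dist_eq_norm]
  obtain ⟨k, hk⟩ := (Metric.tendsto_nhds.1 hlim ε hε).exists
  rw [dist_eq_norm] at hk
  exact absurd hk (not_lt.2 (h4 _ _ hm (by simpa using hv0)))

/-- projection normals are limiting normals -/
theorem mem_limNormal_of_proj {E : Type*} [NormedAddCommGroup E] [InnerProductSpace ℝ E]
    {U : Set E} {a u : E} (hu : u ∈ U) (hmin : ∀ w ∈ U, ‖a - u‖ ≤ ‖a - w‖) {t : ℝ} (ht : 0 ≤ t) :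
    t • (a - u) ∈ limNormal U u := by
  rw [mem_limNormal_iff]
  intro ε hε
  by_cases h0 : a - u = 0
  · refine ⟨u, u, 0, by simpa using hε, by simp [h0, hε], le_rfl, hu, ?_⟩
    rw [Metric.infDist_zero_of_mem hu]; simp
  have hn : 0 < ‖a - u‖ := norm_pos_iff.2 h0
  set τ : ℝ := min 1 (ε / (2 * ‖a - u‖)) with hτ
  have hτ0 : 0 < τ := by positivity
  have hτ1 : τ ≤ 1 := min_le_left _ _
  refine ⟨u + τ • (a - u), u, t / τ, ?_, ?_, by positivity, hu, ?_⟩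
  · rw [add_sub_cancel_left, norm_smul, Real.norm_eq_abs, abs_of_pos hτ0]
    calc _ ≤ ε / (2 * ‖a - u‖) * ‖a - u‖ := by gcongr; exact min_le_right _ _
      _ < ε := by field_simp; linarith
  · rw [add_sub_cancel_left, smul_smul, div_mul_cancel₀ _ hτ0.ne']; simpa using hε
  · rw [add_sub_cancel_left]
    apply le_antisymm
    · refine (Metric.le_infDist ⟨u, hu⟩).2 fun w hw => ?_
      rw [dist_eq_norm]
      have h1 := hmin w hw
      have h2 : a - w = (1 - τ) • (a - u) + (u + τ • (a - u) - w) := by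
        rw [sub_smul, one_smul]; abel
      have h3 := norm_add_le ((1 - τ) • (a - u)) (u + τ • (a - u) - w)
      rw [← h2, norm_smul, Real.norm_eq_abs, abs_of_nonneg (by linarith)] at h3
      rw [norm_smul, Real.norm_eq_abs, abs_of_pos hτ0]
      linarith
    · have := Metric.infDist_le_dist_of_mem (x := u + τ • (a - u)) hu
      rwa [dist_eq_norm, add_sub_cancel_left] at this

theorem zero_mem_limNormal {E : Type*} [NormedAddCommGroup E] [InnerProductSpace ℝ E]
    {U : Set E} {u : E} (hu : u ∈ U) : (0:E) ∈ limNormal U u := by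
  simpa using mem_limNormal_of_proj (a := u) (t := 0) hu (by simp) le_rfl

/-- For convex `U`, limiting normals are convex normals. -/
theorem limNormal_convex {E : Type*} [NormedAddCommGroup E] [InnerProductSpace ℝ E]
    {U : Set E} (hU : Convex ℝ U) {u v : E} (hu : u ∈ U) (hv : v ∈ limNormal U u) :
    ∀ w ∈ U, ⟪v, w - u⟫ ≤ 0 := by
  obtain ⟨zk, vk, tk, yk, h1, h2, h3, h4, h5, h6⟩ := hv
  intro w hw
  have hy : Tendsto yk atTop (𝓝 u) := by
    have h7 : Tendsto (fun k => Metric.infDist (zk k) U) atTop (𝓝 (Metric.infDist u U)) :=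
      ((Metric.continuous_infDist_pt U).tendsto u).comp h1
    rw [Metric.infDist_zero_of_mem hu] at h7
    have h8 : Tendsto (fun k => zk k - yk k) atTop (𝓝 0) :=
      tendsto_zero_iff_norm_tendsto_zero.2 (by simpa only [h5] using h7)
    have := h1.sub h8
    simpa using this
  have hin : ∀ k, ⟪vk k, w - yk k⟫ ≤ 0 := by
    intro k
    have := (norm_eq_iInf_iff_real_inner_le_zero hU (h4 k) (u := zk k)).1 (by
      rw [h5 k, Metric.infDist_eq_iInf]; simp only [dist_eq_norm]) w hw
    rw [h6 k, inner_smul_left]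
    exact mul_nonpos_of_nonneg_of_nonpos (h3 k) this
  exact le_of_tendsto' (h2.inner (tendsto_const_nhds.sub hy)) hin

/-- averages lemma -/
theorem avg_near {E ι : Type*} [DecidableEq ι] [NormedAddCommGroup E] [NormedSpace ℝ E] {K : Set E}
    (hK : Convex ℝ K) {k0 : E} (hk0 : k0 ∈ K) {F G : Finset ι} (hG : G ⊆ F) (hF : F.Nonempty)
    (ω : ι → E) {ε B : ℝ} (hε : 0 ≤ ε) (hB : 0 ≤ B)
    (hgood : ∀ i ∈ G, ∃ v ∈ K, ‖ω i - v‖ ≤ ε) (hbad : ∀ i ∈ F, ‖ω i‖ ≤ B)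
    (hcard : ((F \ G).card : ℝ) ≤ ε * F.card) :
    ∃ v ∈ K, ‖((F.card : ℝ)⁻¹ • ∑ i ∈ F, ω i) - v‖ ≤ ε * (1 + B + ‖k0‖) := by
  choose! v hv1 hv2 using hgood
  set κ : ι → E := fun i => if i ∈ G then v i else k0
  have hc : (0:ℝ) < F.card := by exact_mod_cast hF.card_pos
  refine ⟨∑ i ∈ F, (F.card : ℝ)⁻¹ • κ i, ?_, ?_⟩
  · refine hK.sum_mem (fun _ _ => by positivity) (by
      rw [Finset.sum_const, nsmul_eq_mul, mul_inv_cancel₀ hc.ne']) ?_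
    intro i _
    simp only [κ]; split_ifs with h
    · exact hv1 i h
    · exact hk0
  · rw [← Finset.smul_sum, ← smul_sub, ← Finset.sum_sub_distrib, norm_smul, norm_inv,
      Real.norm_eq_abs, abs_of_pos hc, inv_mul_le_iff₀ hc]
    refine (norm_sum_le _ _).trans ?_
    rw [← Finset.sum_sdiff hG]
    have a1 : ∑ i ∈ F \ G, ‖ω i - κ i‖ ≤ ε * F.card * (B + ‖k0‖) := by
      calc _ ≤ ∑ i ∈ F \ G, (B + ‖k0‖) := by
            refine Finset.sum_le_sum fun i hi => ?_
            rw [Finset.mem_sdiff] at hi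
            simp only [κ, if_neg hi.2]
            exact (norm_sub_le _ _).trans (by gcongr; exact hbad i hi.1)
        _ = ((F \ G).card : ℝ) * (B + ‖k0‖) := by rw [Finset.sum_const, nsmul_eq_mul]
        _ ≤ _ := by gcongr
    have a2 : ∑ i ∈ G, ‖ω i - κ i‖ ≤ F.card * ε := by
      calc _ ≤ ∑ i ∈ G, ε := by
            refine Finset.sum_le_sum fun i hi => ?_
            simp only [κ, if_pos hi]
            exact hv2 i hi
        _ = (G.card : ℝ) * ε := by rw [Finset.sum_const, nsmul_eq_mul]
        _ ≤ _ := by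
          gcongr
    linarith

/-- representation of polyhedral normals under PLICQ -/
theorem normal_rep {n s : ℕ} (xs : Fin s → Euc n) (c : Fin s → ℝ) {C : Set (Euc n)}
    (hC : C = {x | ∀ j, ⟪xs j, x⟫ ≤ c j}) {y ξ : Euc n} (hP : PLICQ xs c y)
    (hξ : ξ ∈ convNormal C y) :
    ∃ α : Fin s → ℝ, (∀ j, 0 ≤ α j) ∧ (∀ j, ⟪xs j, y⟫ ≠ c j → α j = 0) ∧
      ∑ j, α j • xs j = ξ := by
  set A : Set (Fin s → ℝ) := {α | (∀ j, 0 ≤ α j) ∧ (∀ j, ⟪xs j, y⟫ ≠ c j → α j = 0)} with hA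
  have hAc : IsClosed A := by
    have : A = (⋂ j, {α : Fin s → ℝ | 0 ≤ α j}) ∩
        ⋂ j, ⋂ (_ : ⟪xs j, y⟫ ≠ c j), {α : Fin s → ℝ | α j = 0} := by
      ext α; simp [hA]
    rw [this]
    refine IsClosed.inter (isClosed_iInter fun j => isClosed_le continuous_const (continuous_apply j))
      (isClosed_iInter fun j => isClosed_iInter fun _ =>
        isClosed_eq (continuous_apply j) continuous_const)
  have hcomp : ∀ R : ℝ, IsCompact (A ∩ {α | ∑ j, α j ≤ R}) := by
    intro R
    refine (isCompact_Icc (a := (0 : Fin s → ℝ)) (b := fun _ => R)).of_isClosed_subset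
      (hAc.inter (isClosed_le (by fun_prop) continuous_const)) ?_
    rintro α ⟨h1, h2⟩
    refine ⟨fun j => h1.1 j, fun j => le_trans ?_ h2⟩
    exact Finset.single_le_sum (f := α) (fun i _ => h1.1 i) (Finset.mem_univ j)
  obtain ⟨m, hm0, hm⟩ : ∃ m, 0 < m ∧ ∀ α ∈ A ∩ {α | ∑ j, α j = 1}, m ≤ ‖∑ j, α j • xs j‖ := by
    have hc1 : IsCompact (A ∩ {α : Fin s → ℝ | ∑ j, α j = 1}) := by
      refine (hcomp 1).of_isClosed_subset
        (hAc.inter (isClosed_eq (by fun_prop) continuous_const)) ?_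
      rintro α ⟨h1, h2⟩
      exact ⟨h1, le_of_eq h2⟩
    refine hc1.exists_forall_le' (f := fun α : Fin s → ℝ => ‖∑ j, α j • xs j‖) (by fun_prop) ?_
    rintro α ⟨h1, h2⟩
    rw [norm_pos_iff]
    intro h0
    have := hP α h1.1 h1.2 h0
    rw [mem_ofPred_eq] at h2
    simp [this] at h2
  have hm' : ∀ α ∈ A, m * ∑ j, α j ≤ ‖∑ j, α j • xs j‖ := by
    intro α hα
    have hs : 0 ≤ ∑ j, α j := Finset.sum_nonneg fun j _ => hα.1 j
    rcases hs.eq_or_lt with h0 | h0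
    · rw [← h0]; simp
    · have := hm (fun j => (∑ j, α j)⁻¹ * α j) ⟨⟨fun j => mul_nonneg (by positivity) (hα.1 j),
        fun j hj => by simp [hα.2 j hj]⟩, by
          rw [mem_ofPred_eq, ← Finset.mul_sum, inv_mul_cancel₀ h0.ne']⟩
      simp only [mul_smul] at this
      rw [← Finset.smul_sum, norm_smul, norm_inv, Real.norm_eq_abs, abs_of_pos h0,
        ← div_eq_inv_mul, le_div_iff₀ h0] at this
      exact this
  have h0A : (0 : Fin s → ℝ) ∈ A := ⟨fun _ => le_rfl, fun _ _ => rfl⟩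
  obtain ⟨α, ⟨hα, -⟩, hαmin⟩ := (hcomp (2 * ‖ξ‖ / m)).exists_isMinOn
    ⟨0, h0A, by simp; positivity⟩
    (f := fun α : Fin s → ℝ => ‖ξ - ∑ j, α j • xs j‖) (by fun_prop)
  have hmin : ∀ α' ∈ A, ‖ξ - ∑ j, α j • xs j‖ ≤ ‖ξ - ∑ j, α' j • xs j‖ := by
    intro α' hα'
    by_cases hle : ∑ j, α' j ≤ 2 * ‖ξ‖ / m
    · exact hαmin ⟨hα', hle⟩
    · push Not at hle
      rw [div_lt_iff₀ hm0] at hle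
      have h1 := hm' α' hα'
      have h2 : ‖ξ - ∑ j, α j • xs j‖ ≤ ‖ξ‖ := by
        have := hαmin (show (0 : Fin s → ℝ) ∈ _ from ⟨h0A, by simp; positivity⟩)
        simpa using this
      have h3 := norm_sub_norm_le (∑ j, α' j • xs j) ξ
      rw [norm_sub_rev] at h3
      linarith
  set P := ∑ j, α j • xs j with hPdef
  set w := ξ - P with hw
  have var : ∀ v : Euc n, (∃ τ0 > 0, ∀ τ : ℝ, 0 < τ → τ < τ0 → ‖w‖ ≤ ‖w - τ • v‖) → ⟪w, v⟫ ≤ 0 := by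
    rintro v ⟨τ0, h0, h⟩
    by_contra! hcon
    have h1 : ∀ τ : ℝ, 0 < τ → τ < τ0 → 2 * ⟪w, v⟫ ≤ τ * ‖v‖ ^ 2 := by
      intro τ a b
      have := h τ a b
      have h2 : ‖w‖ ^ 2 ≤ ‖w - τ • v‖ ^ 2 := by gcongr
      rw [norm_sub_sq_real w, inner_smul_right, norm_smul, Real.norm_eq_abs, abs_of_pos a] at h2
      have : τ * (2 * ⟪w, v⟫) ≤ τ * (τ * ‖v‖ ^ 2) := by nlinarith
      exact le_of_mul_le_mul_left this a
    set τ := min (τ0 / 2) (⟪w, v⟫ / (‖v‖ ^ 2 + 1))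
    have hτ : 0 < τ := by positivity
    have := h1 τ hτ ((min_le_left _ _).trans_lt (by linarith))
    have h3 : τ * ‖v‖ ^ 2 ≤ ⟪w, v⟫ / (‖v‖ ^ 2 + 1) * ‖v‖ ^ 2 := by
      gcongr; exact min_le_right _ _
    rw [div_mul_eq_mul_div] at h3
    have h4 : ⟪w, v⟫ * ‖v‖ ^ 2 / (‖v‖ ^ 2 + 1) ≤ ⟪w, v⟫ := by
      rw [div_le_iff₀ (by positivity)]; nlinarith
    linarith
  have v1 : ∀ j, ⟪xs j, y⟫ = c j → ⟪w, xs j⟫ ≤ 0 := by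
    intro j hj
    refine var _ ⟨1, one_pos, fun τ h0 _ => ?_⟩
    have := hmin (α + Pi.single j τ) ⟨fun i => add_nonneg (hα.1 i) (by
      by_cases hij : i = j
      · subst hij; simp [h0.le]
      · simp [hij]), fun i hi => by
        have : i ≠ j := by rintro rfl; exact hi hj
        simp [hα.2 i hi, this]⟩
    simp only [Pi.add_apply, add_smul, Finset.sum_add_distrib] at this
    have e : ∑ i, (Pi.single j τ : Fin s → ℝ) i • xs i = τ • xs j := by
      rw [Finset.sum_eq_single j] <;> simp +contextual
    rw [e, ← hPdef, ← sub_sub] at this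
    exact this
  have v2 : ⟪w, -P⟫ ≤ 0 := by
    refine var _ ⟨1, one_pos, fun τ h0 h1 => ?_⟩
    have := hmin ((1 - τ) • α) ⟨fun i => mul_nonneg (by linarith) (hα.1 i), fun i hi => by
        simp [hα.2 i hi]⟩
    simp only [Pi.smul_apply, smul_eq_mul, mul_smul] at this
    rw [← Finset.smul_sum, ← hPdef] at this
    have e : ξ - (1 - τ) • P = w - τ • -P := by
      rw [hw, sub_smul, one_smul, smul_neg]; abel
    rwa [e] at this
  have hyC : ∀ j, ⟪xs j, y⟫ ≤ c j := by have := hξ.1; rw [hC] at this; exact this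
  -- y + τ w ∈ C
  obtain ⟨τ, hτ0, hτ⟩ : ∃ τ > (0:ℝ), y + τ • w ∈ C := by
    have : ∀ᶠ τ in 𝓝[>] (0:ℝ), ∀ j, ⟪xs j, y + τ • w⟫ ≤ c j := by
      rw [eventually_all]
      intro j
      by_cases hj : ⟪xs j, y⟫ = c j
      · filter_upwards [self_mem_nhdsWithin] with τ hτ
        rw [inner_add_right, inner_smul_right, hj, real_inner_comm]
        have := mul_nonpos_of_nonneg_of_nonpos (le_of_lt (show 0 < τ from hτ)) (v1 j hj)
        linarith
      · have hlt := lt_of_le_of_ne (hyC j) hj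
        have : Tendsto (fun τ : ℝ => ⟪xs j, y + τ • w⟫) (𝓝[>] 0) (𝓝 ⟪xs j, y + (0:ℝ) • w⟫) :=
          Tendsto.mono_left (Continuous.tendsto (by fun_prop) 0) nhdsWithin_le_nhds
        rw [zero_smul, add_zero] at this
        filter_upwards [this.eventually (gt_mem_nhds hlt)] with τ hτ using hτ.le
    obtain ⟨τ, h1, h2⟩ := (this.and self_mem_nhdsWithin).exists
    exact ⟨τ, h2, by rw [hC]; exact h1⟩
  have hf := hξ.2 _ hτ
  rw [add_sub_cancel_left, inner_smul_right] at hf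
  have hf' : ⟪ξ, w⟫ ≤ 0 := by
    by_contra! h
    have := mul_pos hτ0 h
    linarith
  have : ξ = w + P := by rw [hw]; abel
  rw [this, inner_add_left, real_inner_self_eq_norm_sq, real_inner_comm] at hf'
  rw [inner_neg_right] at v2
  have hw0 : ‖w‖ ^ 2 ≤ 0 := by linarith
  have hw1 : w = 0 := by
    have : ‖w‖ = 0 := by nlinarith [norm_nonneg w]
    exact norm_eq_zero.1 this
  exact ⟨α, hα.1, hα.2, by rw [this, hw1, zero_add]⟩

/-- conic Caratheodory -/
theorem conic_caratheodory {E : Type*} [AddCommGroup E] [Module ℝ E] {s : ℕ} (xs : Fin s → E) :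
    ∀ (m : ℕ) (α : Fin s → ℝ), (∀ j, 0 ≤ α j) → (Finset.univ.filter fun j => α j ≠ 0).card ≤ m →
    ∃ (J : Finset (Fin s)) (α' : Fin s → ℝ), (∀ j, 0 ≤ α' j) ∧ (∀ j ∈ J, α j ≠ 0) ∧
      (∀ j ∉ J, α' j = 0) ∧ (LinearIndependent ℝ fun j : J => xs j) ∧
      ∑ j, α' j • xs j = ∑ j, α j • xs j := by
  intro m
  induction m with
  | zero =>
    intro α h0 hc
    have : ∀ j, α j = 0 := by
      intro j
      by_contra hj
      have : j ∈ Finset.univ.filter fun j => α j ≠ 0 := by simp [hj]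
      rw [Finset.card_eq_zero.1 (Nat.le_zero.1 hc)] at this
      simp at this
    refine ⟨∅, α, h0, by simp, fun j _ => this j, linearIndependent_empty_type, rfl⟩
  | succ m ih =>
    intro α h0 hc
    set J := Finset.univ.filter fun j => α j ≠ 0 with hJ
    by_cases hli : LinearIndependent ℝ fun j : J => xs j
    · exact ⟨J, α, h0, fun j hj => by simpa [hJ] using hj, fun j hj => by simpa [hJ] using hj, hli, rfl⟩
    · rw [Fintype.not_linearIndependent_iff] at hli
      obtain ⟨β0, hβ0, ⟨j0, hj0⟩, hne⟩ := hli
      -- extend by zero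
      obtain ⟨β, hβ1, hβ2, j1, hj1⟩ : ∃ β : Fin s → ℝ, (∀ j ∉ J, β j = 0) ∧ ∑ j, β j • xs j = 0 ∧
          ∃ j, 0 < β j := by
        set b : Fin s → ℝ := fun j => if h : j ∈ J then β0 ⟨j, h⟩ else 0 with hb
        have hb1 : ∀ j ∉ J, b j = 0 := fun j hj => by simp [hb, hj]
        have hb2 : ∑ j, b j • xs j = 0 := by
          rw [← hβ0, ← Finset.sum_subset (Finset.subset_univ J)
            (fun j _ hj => by rw [hb1 j hj, zero_smul]), ← Finset.sum_coe_sort J]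
          refine Finset.sum_congr rfl fun j _ => by simp [hb]
        have hb3 : b j0 ≠ 0 := by simp [hb, hj0, hne]
        rcases hb3.lt_or_gt with h | h
        · exact ⟨-b, fun j hj => by simp [hb1 j hj], by simp [hb2], j0, by simpa using h⟩
        · exact ⟨b, hb1, hb2, j0, h⟩
      set S := Finset.univ.filter fun j => 0 < β j with hS
      obtain ⟨jm, hjm, hmin⟩ := S.exists_min_image (fun j => α j / β j) ⟨j1, by simp [hS, hj1]⟩
      have hjm' : 0 < β jm := by simpa [hS] using hjm
      set τ := α jm / β jm with hτ
      have hτ0 : 0 ≤ τ := div_nonneg (h0 _) hjm'.le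
      set α2 : Fin s → ℝ := fun j => α j - τ * β j with hα2
      have h2 : ∀ j, 0 ≤ α2 j := by
        intro j
        simp only [hα2]
        rcases le_or_gt (β j) 0 with h | h
        · nlinarith [h0 j, mul_nonneg hτ0 (neg_nonneg.2 h)]
        · have := hmin j (by simp [hS, h])
          rw [le_div_iff₀ h] at this
          linarith
      have hsub : ∀ j, α2 j ≠ 0 → α j ≠ 0 := by
        intro j hj h
        apply hj
        have : j ∉ J := by simp [hJ, h]
        simp [hα2, h, hβ1 j this]
      have hz : α2 jm = 0 := by simp only [hα2, hτ]; field_simp; ring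
      have hcard : (Finset.univ.filter fun j => α2 j ≠ 0).card ≤ m := by
        have : (Finset.univ.filter fun j => α2 j ≠ 0) ⊂ J := by
          rw [Finset.ssubset_iff_of_subset (fun j hj => by
            simp only [Finset.mem_filter, Finset.mem_univ, true_and, hJ] at hj ⊢
            exact hsub j hj)]
          refine ⟨jm, ?_, by simp [hz]⟩
          by_contra h
          have := hβ1 jm h
          linarith
        have := Finset.card_lt_card this
        omega
      obtain ⟨J', α', a1, a2, a3, a4, a5⟩ := ih α2 h2 hcard
      refine ⟨J', α', a1, fun j hj => hsub j (a2 j hj), a3, a4, a5.trans ?_⟩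
      simp only [hα2, sub_smul, mul_smul, Finset.sum_sub_distrib]
      rw [← Finset.smul_sum, hβ2, smul_zero, sub_zero]

/-- coordinates for a linearly independent family -/
theorem exists_coords {E ι : Type*} [Fintype ι] [NormedAddCommGroup E] [InnerProductSpace ℝ E]
    [FiniteDimensional ℝ E] {v : ι → E} (hv : LinearIndependent ℝ v) :
    ∃ f : E →L[ℝ] (ι → ℝ), ∀ α : ι → ℝ, f (∑ j, α j • v j) = α := by
  have hinj : LinearMap.ker (Fintype.linearCombination ℝ v) = ⊥ := by
    rw [LinearMap.ker_eq_bot]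
    exact hv.fintypeLinearCombination_injective
  obtain ⟨f, hf⟩ := LinearMap.exists_leftInverse_of_injective _ hinj
  refine ⟨LinearMap.toContinuousLinearMap f, fun α => ?_⟩
  have := LinearMap.congr_fun hf α
  simpa [Fintype.linearCombination_apply] using this

/-- measurable selection of multipliers -/
theorem eta_select {n s : ℕ} (xs : Fin s → Euc n) (a : ℝ → Euc n) (ha : Measurable a)
    (S : Fin s → Set ℝ) (hS : ∀ j, MeasurableSet (S j)) :
    ∃ (η : Fin s → ℝ → ℝ) (B : ℝ), (∀ j, Measurable (η j)) ∧ (∀ j t, 0 ≤ η j t) ∧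
      (∀ j t, η j t ≤ B * ‖a t‖) ∧
      ∀ t, (∃ α : Fin s → ℝ, (∀ j, 0 ≤ α j) ∧ (∀ j, t ∉ S j → α j = 0) ∧
          ∑ j, α j • xs j = a t) →
        (∀ j, t ∉ S j → η j t = 0) ∧ ∑ j, η j t • xs j = a t := by
  classical
  have hA : ∀ J : Finset (Fin s), ∃ f : Euc n →L[ℝ] (Fin s → ℝ),
      (LinearIndependent ℝ fun j : J => xs j) →
      ∀ α : Fin s → ℝ, (∀ j ∉ J, α j = 0) → f (∑ j, α j • xs j) = α := by
    intro J
    by_cases h : LinearIndependent ℝ fun j : J => xs j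
    · obtain ⟨f, hf⟩ := exists_coords h
      let e : (J → ℝ) →L[ℝ] (Fin s → ℝ) := LinearMap.toContinuousLinearMap
        { toFun := fun b j => if hj : j ∈ J then b ⟨j, hj⟩ else 0
          map_add' := by intro x y; ext j; by_cases hj : j ∈ J <;> simp [hj]
          map_smul' := by intro r x; ext j; by_cases hj : j ∈ J <;> simp [hj] }
      refine ⟨e.comp f, fun _ α hα => ?_⟩
      have h1 : ∑ j, α j • xs j = ∑ j : J, (fun i : J => α i) j • xs j := by
        rw [← Finset.sum_subset (Finset.subset_univ J)
            (fun j _ hj => by rw [hα j hj, zero_smul]), ← Finset.sum_coe_sort J]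
      rw [h1, ContinuousLinearMap.comp_apply, hf]
      ext j
      by_cases hj : j ∈ J
      · simp [e, hj]
      · simp [e, hj, hα j hj]
    · exact ⟨0, fun h' => absurd h' h⟩
  choose f hf using hA
  set G : Finset (Fin s) → Set ℝ := fun J => {t | (∀ j, 0 ≤ f J (a t) j) ∧
      (∀ j, t ∉ S j → f J (a t) j = 0) ∧ ∑ j, f J (a t) j • xs j = a t} with hG
  have hfm : ∀ J j, Measurable fun t => f J (a t) j := by
    intro J j
    exact (measurable_pi_apply j).comp ((f J).continuous.measurable.comp ha)
  have hGm : ∀ J, MeasurableSet (G J) := by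
    intro J
    have : G J = (⋂ j, {t | 0 ≤ f J (a t) j}) ∩ ((⋂ j, (S j ∪ {t | f J (a t) j = 0})) ∩
        {t | ∑ j, f J (a t) j • xs j = a t}) := by
      ext t
      simp only [hG, mem_ofPred_eq, mem_inter_iff, mem_iInter, mem_union, or_iff_not_imp_left]
    rw [this]
    refine (MeasurableSet.iInter fun j => measurableSet_le measurable_const (hfm J j)).inter
      ((MeasurableSet.iInter fun j => (hS j).union (measurableSet_eq_fun (hfm J j) measurable_const)).inter
        (measurableSet_eq_fun ?_ ha))
    exact Finset.measurable_sum _ fun j _ => (hfm J j).smul_const _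
  have key : ∀ l : List (Finset (Fin s)), ∃ (η : Fin s → ℝ → ℝ) (B : ℝ), 0 ≤ B ∧
      (∀ j, Measurable (η j)) ∧ (∀ j t, 0 ≤ η j t) ∧ (∀ j t, η j t ≤ B * ‖a t‖) ∧
      ∀ t, (∃ J ∈ l, t ∈ G J) → (∀ j, t ∉ S j → η j t = 0) ∧ ∑ j, η j t • xs j = a t := by
    intro l
    induction l with
    | nil => exact ⟨fun _ _ => 0, 0, le_rfl, fun _ => measurable_const, fun _ _ => le_rfl,
        fun j t => by simp, by simp⟩
    | cons J l ih =>
      obtain ⟨η, B, hB, h1, h2, h3, h4⟩ := ih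
      refine ⟨fun j t => if t ∈ G J then f J (a t) j else η j t, max B ‖f J‖,
        hB.trans (le_max_left _ _), fun j => Measurable.ite (hGm J) (hfm J j) (h1 j), ?_, ?_, ?_⟩
      · intro j t
        by_cases h : t ∈ G J
        · simp only [if_pos h]; exact h.1 j
        · simp only [if_neg h]; exact h2 j t
      · intro j t
        by_cases h : t ∈ G J
        · simp only [if_pos h]
          calc f J (a t) j ≤ ‖f J (a t) j‖ := le_abs_self _
            _ ≤ ‖f J (a t)‖ := norm_le_pi_norm _ j
            _ ≤ ‖f J‖ * ‖a t‖ := (f J).le_opNorm _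
            _ ≤ _ := by gcongr; exact le_max_right _ _
        · simp only [if_neg h]
          exact (h3 j t).trans (by gcongr; exact le_max_left _ _)
      · intro t ht
        by_cases h : t ∈ G J
        · simp only [if_pos h]; exact ⟨h.2.1, h.2.2⟩
        · simp only [if_neg h]
          apply h4
          obtain ⟨J', hJ', hJt⟩ := ht
          rcases List.mem_cons.1 hJ' with rfl | h'
          · exact absurd hJt h
          · exact ⟨J', h', hJt⟩
  obtain ⟨η, B, -, h1, h2, h3, h4⟩ := key Finset.univ.toList
  refine ⟨η, B, h1, h2, h3, ?_⟩
  rintro t ⟨α, a1, a2, a3⟩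
  apply h4
  obtain ⟨J, α', b1, b2, b3, b4, b5⟩ := conic_caratheodory xs _ α a1 le_rfl
  have hfe := hf J b4 α' b3
  rw [b5, a3] at hfe
  refine ⟨J, by simp, ?_, ?_, ?_⟩
  · intro j; rw [hfe]; exact b1 j
  · intro j hj; rw [hfe]
    by_cases hjJ : j ∈ J
    · exact absurd (a2 j hj) (b2 j hjJ)
    · exact b3 j hjJ
  · rw [hfe, b5, a3]

/-- projection on the orthogonal complement of the span of a subfamily -/
def perp {n s : ℕ} (xs : Fin s → Euc n) (S : Finset (Fin s)) : Euc n →L[ℝ] Euc n :=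
  (Submodule.span ℝ (xs '' (S : Set (Fin s))))ᗮ.starProjection

theorem perp_inner {n s : ℕ} (xs : Fin s → Euc n) (S : Finset (Fin s)) (v w : Euc n) :
    ⟪perp xs S v, perp xs S w⟫ = ⟪perp xs S v, w⟫ := by
  unfold perp
  rw [← Submodule.inner_starProjection_left_eq_right]
  congr 1
  exact Submodule.starProjection_eq_self_iff.2 (Submodule.starProjection_apply_mem _ _)

theorem perp_inner' {n s : ℕ} (xs : Fin s → Euc n) (S : Finset (Fin s)) (v w : Euc n) :
    ⟪perp xs S v, w⟫ = ⟪v, perp xs S w⟫ :=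
  Submodule.inner_starProjection_left_eq_right _ _ _

theorem perp_orth {n s : ℕ} (xs : Fin s → Euc n) (S : Finset (Fin s)) (v : Euc n) {j : Fin s}
    (hj : j ∈ S) : ⟪xs j, perp xs S v⟫ = 0 := by
  have : perp xs S v ∈ (Submodule.span ℝ (xs '' (S : Set (Fin s))))ᗮ :=
    Submodule.starProjection_apply_mem _ _
  exact this _ (Submodule.subset_span ⟨j, hj, rfl⟩)

theorem perp_zero {n s : ℕ} (xs : Fin s → Euc n) (S : Finset (Fin s)) {j : Fin s}
    (hj : j ∈ S) : perp xs S (xs j) = 0 := by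
  rw [← inner_self_eq_zero (𝕜 := ℝ), perp_inner, real_inner_comm, perp_orth xs S _ hj]

theorem perp_empty {n s : ℕ} (xs : Fin s → Euc n) (v : Euc n) : perp xs ∅ v = v := by
  unfold perp
  exact Submodule.starProjection_eq_self_iff.2 (by simp)

theorem perp_ne {n s : ℕ} (xs : Fin s → Euc n) (hx : LinearIndependent ℝ xs)
    (S : Finset (Fin s)) {j : Fin s} (hj : j ∉ S) : perp xs S (xs j) ≠ 0 := by
  intro h
  have h2 := (Submodule.starProjection_apply_eq_zero_iff _).1 h
  rw [Submodule.orthogonal_orthogonal] at h2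
  exact hx.notMem_span_image (s := (S : Set (Fin s))) (by simpa using hj) h2

theorem perp_norm_sub {n s : ℕ} (xs : Fin s → Euc n) (S : Finset (Fin s)) (v : Euc n) :
    ‖v - perp xs S v‖ ^ 2 = ‖v‖ ^ 2 - ‖perp xs S v‖ ^ 2 := by
  rw [norm_sub_sq_real, real_inner_comm, ← perp_inner, real_inner_self_eq_norm_sq]; ring

theorem perp_mem_le {n s : ℕ} (xs : Fin s → Euc n) (S : Finset (Fin s)) (v w : Euc n)
    (hw : ∀ j ∈ S, ⟪xs j, w⟫ = 0) (hv : ⟪v, w⟫ = ‖w‖ ^ 2) : ‖w‖ ^ 2 ≤ ‖perp xs S v‖ ^ 2 := by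
  have h1 : perp xs S w = w := by
    unfold perp
    refine Submodule.starProjection_eq_self_iff.2 ?_
    rw [Submodule.mem_orthogonal]
    intro u hu
    induction hu using Submodule.span_induction with
    | mem x hx => obtain ⟨j, hj, rfl⟩ := hx; exact hw j hj
    | zero => simp
    | add x y _ _ h1 h2 => rw [inner_add_left, h1, h2, add_zero]
    | smul a x _ h => rw [inner_smul_left, h]; simp
  have h2 : ‖w‖ ^ 2 ≤ ‖perp xs S v‖ * ‖w‖ := by
    rw [← hv]; nth_rewrite 1 [← h1]; rw [← perp_inner']; exact real_inner_le_norm _ _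
  by_cases h : ‖w‖ = 0
  · rw [h]; have := sq_nonneg ‖perp xs S v‖; simpa using this
  · have : 0 < ‖w‖ := lt_of_le_of_ne (norm_nonneg _) (Ne.symm h)
    have : ‖w‖ ≤ ‖perp xs S v‖ := by nlinarith
    gcongr

theorem lyap_key {n s : ℕ} (xs : Fin s → Euc n) {X d κ : ℝ} (κf : ℕ → ℝ)
    (hX : ∀ j, ‖xs j‖ ≤ X) (hX0 : 0 ≤ X) (hd : ∀ S : Finset (Fin s), ∀ j ∉ S, d ≤ ‖perp xs S (xs j)‖)
    (hd0 : 0 < d) (hκ : 0 < κ) (hκ0 : κf 0 = 0) (hκn : ∀ m, 0 ≤ κf m) 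
    (hstep : ∀ m, 2 * X ^ 2 * κf m + 2 * κ ≤ d ^ 2 * (κf (m+1) - κf m))
    (v : Euc n) (hv : ∀ S, ‖perp xs S v‖ ^ 2 ≤ 1 - κf S.card) (j : Fin s)
    (hout : ∀ τ > (0:ℝ), ∃ S, 1 - κf S.card < ‖perp xs S (v + τ • xs j)‖ ^ 2) :
    √κ ≤ ⟪v, xs j⟫ := by
  -- pigeonhole
  have hS : ∃ S : Finset (Fin s), ∃ᶠ τ in 𝓝[>] (0:ℝ), 1 - κf S.card < ‖perp xs S (v + τ • xs j)‖ ^ 2 := by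
    by_contra hcon
    push Not at hcon
    have h1 : ∀ᶠ τ in 𝓝[>] (0:ℝ), ∀ S : Finset (Fin s), ‖perp xs S (v + τ • xs j)‖ ^ 2 ≤ 1 - κf S.card := by
      rw [eventually_all]
      intro S; simpa using hcon S
    obtain ⟨τ, hτ, hτ0⟩ := (h1.and self_mem_nhdsWithin).exists
    obtain ⟨S, hS⟩ := hout τ hτ0
    exact absurd (hτ S) (not_le.2 hS)
  obtain ⟨S, hS⟩ := hS
  set m := S.card
  set a := ⟪perp xs S v, xs j⟫ with ha
  set nn := perp xs S (xs j) with hnn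
  have hexp : ∀ τ : ℝ, ‖perp xs S (v + τ • xs j)‖ ^ 2 = ‖perp xs S v‖ ^ 2 + 2 * τ * a + τ ^ 2 * ‖nn‖ ^ 2 := by
    intro τ
    rw [map_add, map_smul, norm_add_sq_real, inner_smul_right, perp_inner, norm_smul, mul_pow]
    simp [ha, hnn]; ring
  have hfr : ∃ᶠ τ in 𝓝[>] (0:ℝ), 0 < τ ∧ 1 - κf m < ‖perp xs S v‖ ^ 2 + 2 * τ * a + τ ^ 2 * ‖nn‖ ^ 2 := by
    refine (hS.and_eventually self_mem_nhdsWithin).mono ?_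
    rintro τ ⟨h1, h2⟩
    refine ⟨h2, ?_⟩; rw [← hexp]; exact h1
  have ha0 : 0 ≤ a := by
    by_contra hneg
    push Not at hneg
    have : ∀ᶠ τ in 𝓝[>] (0:ℝ), 2 * a + τ * ‖nn‖ ^ 2 < 0 := by
      have : Tendsto (fun τ : ℝ => 2 * a + τ * ‖nn‖ ^ 2) (𝓝[>] 0) (𝓝 (2 * a + 0 * ‖nn‖ ^ 2)) :=
        (Continuous.tendsto (by fun_prop) 0).mono_left nhdsWithin_le_nhds
      exact this.eventually_lt_const (by simp; linarith)
    obtain ⟨τ, ⟨h0, h1⟩, h2⟩ := (hfr.and_eventually this).exists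
    have := hv S
    nlinarith [mul_pos_of_neg_of_neg h2 (neg_lt_zero.2 h0)]
  have heq : 1 - κf m ≤ ‖perp xs S v‖ ^ 2 := by
    by_contra hneg
    push Not at hneg
    have : ∀ᶠ τ in 𝓝[>] (0:ℝ), ‖perp xs S v‖ ^ 2 + 2 * τ * a + τ ^ 2 * ‖nn‖ ^ 2 < 1 - κf m := by
      have : Tendsto (fun τ : ℝ => ‖perp xs S v‖ ^ 2 + 2 * τ * a + τ ^ 2 * ‖nn‖ ^ 2) (𝓝[>] 0)
          (𝓝 (‖perp xs S v‖ ^ 2 + 2 * 0 * a + 0 ^ 2 * ‖nn‖ ^ 2)) :=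
        (Continuous.tendsto (by fun_prop) 0).mono_left nhdsWithin_le_nhds
      exact this.eventually_lt_const (by simp; linarith)
    obtain ⟨τ, ⟨h0, h1⟩, h2⟩ := (hfr.and_eventually this).exists
    linarith
  have hjS : j ∉ S := by
    intro hj
    have h0 : nn = 0 := perp_zero xs S hj
    have h1 : a = 0 := by rw [ha, perp_inner', ← hnn, h0, inner_zero_right]
    obtain ⟨τ, h2, h3⟩ := hfr.exists
    rw [h0, h1] at h3
    have := hv S
    simp at h3; linarith
  have hn := hd S j hjS
  rw [← hnn] at hn
  have hn0 : 0 < ‖nn‖ := lt_of_lt_of_le hd0 hn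
  have hnp : 0 < ‖nn‖ ^ 2 := by positivity
  have ha2 : a = ⟪v, nn⟫ := by rw [ha, perp_inner']
  have ha3 : ⟪perp xs S v, nn⟫ = a := by rw [hnn, perp_inner]
  have hnj : ⟪xs j, nn⟫ = ‖nn‖ ^ 2 := by
    rw [real_inner_comm, ← real_inner_self_eq_norm_sq, hnn, perp_inner]
  set w := perp xs S v - (a / ‖nn‖ ^ 2) • nn with hw
  have hww : ‖w‖ ^ 2 = ‖perp xs S v‖ ^ 2 - a ^ 2 / ‖nn‖ ^ 2 := by
    rw [hw, norm_sub_sq_real, inner_smul_right, ha3, norm_smul, mul_pow]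
    rw [Real.norm_eq_abs, sq_abs]; field_simp; ring
  have hvw : ⟪v, w⟫ = ‖w‖ ^ 2 := by
    rw [hww, hw, inner_sub_right, inner_smul_right, ← ha2, ← perp_inner', ← perp_inner, perp_inner',
      ← perp_inner', perp_inner, ← perp_inner, real_inner_self_eq_norm_sq]
    field_simp
  have hT := perp_mem_le xs (insert j S) v w (by
    intro i hi
    rw [Finset.mem_insert] at hi
    rw [hw, inner_sub_right, inner_smul_right]
    rcases hi with rfl | hi
    · rw [hnj, real_inner_comm, ← ha, div_mul_cancel₀ _ hnp.ne', sub_self]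
    · rw [hnn, perp_orth xs S _ hi, perp_orth xs S _ hi]; simp) hvw
  have hT2 := hv (insert j S)
  rw [Finset.card_insert_of_notMem hjS] at hT2
  have h1 : κf (m+1) - κf m ≤ a ^ 2 / ‖nn‖ ^ 2 := by
    change _ ≤ 1 - κf (m+1) at hT2
    linarith
  have hst := hstep m
  have hdn : d ^ 2 ≤ ‖nn‖ ^ 2 := by gcongr
  have hk' : 0 ≤ κf (m+1) - κf m := by
    have : 0 ≤ d ^ 2 * (κf (m+1) - κf m) := by have := hκn m; refine le_trans ?_ hst; positivity
    exact nonneg_of_mul_nonneg_right this (by positivity)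
  have h2 : 2 * X ^ 2 * κf m + 2 * κ ≤ a ^ 2 := by
    rw [le_div_iff₀ hnp] at h1
    nlinarith
  have h3 : ‖v - perp xs S v‖ ^ 2 ≤ κf m := by
    rw [perp_norm_sub]
    have := hv ∅
    rw [perp_empty] at this
    simp [hκ0] at this
    have h4 : ‖v‖ ^ 2 ≤ 1 := by nlinarith [norm_nonneg v]
    linarith
  have h4 : X * √(κf m) + √κ ≤ a := by
    apply le_of_sq_le_sq _ ha0 |> fun h => h
    nlinarith [Real.sq_sqrt (hκn m), Real.sq_sqrt hκ.le, sq_nonneg (X * √(κf m) - √κ)]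
  have h5 : ‖v - perp xs S v‖ ≤ √(κf m) := Real.le_sqrt_of_sq_le h3
  have h6 : -(√(κf m) * X) ≤ ⟪v - perp xs S v, xs j⟫ := by
    have := abs_real_inner_le_norm (v - perp xs S v) (xs j)
    have h7 : ‖v - perp xs S v‖ * ‖xs j‖ ≤ √(κf m) * X := by
      gcongr; exact hX j
    linarith [neg_abs_le ⟪v - perp xs S v, xs j⟫]
  rw [inner_sub_left] at h6
  linarith

theorem lyapunov {n s : ℕ} (xs : Fin s → Euc n) (hx : LinearIndependent ℝ xs) :
    ∃ (Φ : Euc n → ℝ) (c ρ : ℝ), 0 < c ∧ 0 < ρ ∧ (∀ q, ρ * ‖q‖ ≤ Φ q) ∧ (∀ q, Φ q ≤ ‖q‖) ∧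
      (∀ q r, Φ (q + r) ≤ Φ q + ‖r‖) ∧
      (∀ q (α : Fin s → ℝ), (∀ j, 0 ≤ α j) →
        Φ q + c * ∑ j, α j * |⟪xs j, q⟫| ≤ Φ (q + ∑ j, (α j * ⟪xs j, q⟫) • xs j)) := by
  obtain ⟨d, hd, hd0⟩ : ∃ d : ℝ, (∀ S : Finset (Fin s), ∀ j ∉ S, d ≤ ‖perp xs S (xs j)‖) ∧ 0 < d := by
    have h1 : ∀ᶠ d in 𝓝[>] (0:ℝ), ∀ S : Finset (Fin s), ∀ j, j ∉ S → d ≤ ‖perp xs S (xs j)‖ := by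
      rw [eventually_all]; intro S; rw [eventually_all]; intro j
      by_cases hj : j ∈ S
      · simp [hj]
      · have : 0 < ‖perp xs S (xs j)‖ := norm_pos_iff.2 (perp_ne xs hx S hj)
        filter_upwards [Ioo_mem_nhdsGT this] with d hd _ using hd.2.le
    obtain ⟨d, h2, h3⟩ := (h1.and self_mem_nhdsWithin).exists
    exact ⟨d, h2, h3⟩
  set X : ℝ := ∑ j, ‖xs j‖ with hXd
  have hX : ∀ j, ‖xs j‖ ≤ X := fun j => Finset.single_le_sum (f := fun j => ‖xs j‖)
    (fun i _ => norm_nonneg _) (Finset.mem_univ j)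
  have hX0 : 0 ≤ X := Finset.sum_nonneg fun i _ => norm_nonneg _
  set K : ℝ := 1 + (2 * X ^ 2 + 2) / d ^ 2 with hK
  have hK1 : 1 ≤ K := by rw [hK]; have : 0 ≤ (2 * X ^ 2 + 2) / d ^ 2 := by positivity
                         linarith
  have hKd : d ^ 2 * (K - 1) = 2 * X ^ 2 + 2 := by rw [hK]; field_simp; ring
  have hKs : 0 < K ^ s := by positivity
  set κ : ℝ := 1 / (2 * K ^ s) with hκd
  have hκ : 0 < κ := by positivity
  set κf : ℕ → ℝ := fun m => if m = 0 then 0 else K ^ m * κ with hκf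
  have hκn : ∀ m, 0 ≤ κf m := by
    intro m; simp only [hκf]; split_ifs <;> positivity
  have hstep : ∀ m, 2 * X ^ 2 * κf m + 2 * κ ≤ d ^ 2 * (κf (m+1) - κf m) := by
    intro m
    rcases Nat.eq_zero_or_pos m with rfl | hm
    · simp [hκf]
      have : 2 ≤ d ^ 2 * K := by nlinarith [sq_nonneg X, sq_nonneg d]
      nlinarith
    · have hm' : m ≠ 0 := by omega
      simp only [hκf, hm', if_false, Nat.add_eq_zero_iff, one_ne_zero, and_false, pow_succ K]
      have h1 : (1:ℝ) ≤ K ^ m := one_le_pow₀ hK1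
      have h2 : d ^ 2 * (K ^ m * K * κ - K ^ m * κ) = (d ^ 2 * (K - 1)) * (K ^ m * κ) := by ring
      rw [h2, hKd]
      nlinarith
  have hhalf : ∀ S : Finset (Fin s), κf S.card ≤ 1 / 2 := by
    intro S
    simp only [hκf]
    split_ifs
    · norm_num
    · have : K ^ S.card ≤ K ^ s := pow_le_pow_right₀ hK1 (by simpa using S.card_le_univ)
      calc K ^ S.card * κ ≤ K ^ s * κ := by gcongr
        _ = 1 / 2 := by rw [hκd]; field_simp
  set V : Set (Euc n) := {v | ∀ S, ‖perp xs S v‖ ^ 2 ≤ 1 - κf S.card} with hV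
  have hVn : ∀ v ∈ V, ‖v‖ ≤ 1 := by
    intro v hv
    have := hv ∅
    rw [perp_empty] at this
    simp [hκf] at this
    exact this
  have hVc : IsCompact V := by
    apply Metric.isCompact_of_isClosed_isBounded
    · have : V = ⋂ S, {v | ‖perp xs S v‖ ^ 2 ≤ 1 - κf S.card} := by ext v; simp [hV]
      rw [this]
      exact isClosed_iInter fun S => isClosed_le (by fun_prop) continuous_const
    · exact isBounded_iff_forall_norm_le.2 ⟨1, hVn⟩
  have hVneg : ∀ v ∈ V, -v ∈ V := by
    intro v hv S; rw [map_neg, norm_neg]; exact hv S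
  have hVball : ∀ v : Euc n, ‖v‖ ≤ 1 / 2 → v ∈ V := by
    intro v hv S
    have h1 : ‖perp xs S v‖ ≤ 1 / 2 := (Submodule.norm_starProjection_apply_le _ _).trans hv
    have := hhalf S
    nlinarith [norm_nonneg (perp xs S v)]
  have hmax : ∀ q : Euc n, ∃ v ∈ V, ∀ w ∈ V, ⟪w, q⟫ ≤ ⟪v, q⟫ := by
    intro q
    obtain ⟨v, hv, h⟩ := hVc.exists_isMaxOn ⟨0, hVball 0 (by simp)⟩ (f := fun w => ⟪w, q⟫) (by fun_prop)
    exact ⟨v, hv, fun w hw => h hw⟩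
  choose m hmV hm using hmax
  refine ⟨fun q => ⟪m q, q⟫, √κ, 1 / 2, Real.sqrt_pos.2 hκ, by norm_num, ?_, ?_, ?_, ?_⟩
  · intro q
    by_cases hq : q = 0
    · simp [hq]
    have hq' : 0 < ‖q‖ := norm_pos_iff.2 hq
    have := hm q ((1 / (2 * ‖q‖)) • q) (hVball _ (by
      rw [norm_smul, Real.norm_of_nonneg (by positivity)]
      apply le_of_eq; field_simp))
    refine le_trans (le_of_eq ?_) this
    rw [inner_smul_left, real_inner_self_eq_norm_sq]
    simp; field_simp
  · intro q
    have := real_inner_le_norm (m q) q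
    have h1 := hVn _ (hmV q)
    have h2 := norm_nonneg q
    show ⟪m q, q⟫ ≤ _
    nlinarith
  · intro q r
    show ⟪m (q + r), q + r⟫ ≤ ⟪m q, q⟫ + ‖r‖
    rw [inner_add_right]
    have h0 := hm q _ (hmV (q + r))
    have := real_inner_le_norm (m (q + r)) r
    have h1 := hVn _ (hmV (q + r))
    have h2 := norm_nonneg r
    nlinarith
  · intro q α hα
    refine le_trans ?_ (hm (q + ∑ j, (α j * ⟪xs j, q⟫) • xs j) _ (hmV q))
    rw [inner_add_right, inner_sum, Finset.mul_sum]
    gcongr with j _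
    rw [inner_smul_right]
    have key : √κ * |⟪xs j, q⟫| ≤ ⟪xs j, q⟫ * ⟪m q, xs j⟫ := by
      rcases lt_trichotomy ⟪xs j, q⟫ 0 with h | h | h
      · have := lyap_key xs κf hX hX0 hd hd0 hκ (by simp [hκf]) hκn hstep (-m q) (hVneg _ (hmV q)) j (by
          intro τ hτ
          by_contra hcon
          push Not at hcon
          have h1 := hm q _ (hVneg _ hcon)
          rw [inner_neg_left, inner_add_left, inner_neg_left, inner_smul_left] at h1
          simp at h1
          nlinarith)
        rw [inner_neg_left] at this
        rw [abs_of_neg h]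
        nlinarith
      · rw [h]; simp
      · have := lyap_key xs κf hX hX0 hd hd0 hκ (by simp [hκf]) hκn hstep (m q) (hmV q) j (by
          intro τ hτ
          by_contra hcon
          push Not at hcon
          have h1 := hm q _ hcon
          rw [inner_add_left, inner_smul_left] at h1
          simp at h1
          nlinarith)
        rw [abs_of_pos h]
        nlinarith
    calc √κ * (α j * |⟪xs j, q⟫|) = α j * (√κ * |⟪xs j, q⟫|) := by ring
      _ ≤ α j * (⟪xs j, q⟫ * ⟪m q, xs j⟫) := by gcongr; exact hα j
      _ = _ := by ring

/-- positive part of the constraint residual -/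
def rp {n s : ℕ} (xs : Fin s → Euc n) (c : Fin s → ℝ) (j : Fin s) (x : Euc n) : ℝ :=
  max (⟪xs j, x⟫ - c j) 0

/-- penalty gradient -/
def pz {n s : ℕ} (xs : Fin s → Euc n) (c : Fin s → ℝ) (x : Euc n) : Euc n :=
  ∑ j, (rp xs c j x ^ 2) • xs j

/-- penalty potential -/
def pW {n s : ℕ} (xs : Fin s → Euc n) (c : Fin s → ℝ) (x : Euc n) : ℝ :=
  ∑ j, rp xs c j x ^ 3 / 3

theorem rp_nonneg {n s : ℕ} (xs : Fin s → Euc n) (c : Fin s → ℝ) (j : Fin s) (x : Euc n) :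
    0 ≤ rp xs c j x := le_max_right _ _

theorem continuous_rp {n s : ℕ} (xs : Fin s → Euc n) (c : Fin s → ℝ) (j : Fin s) :
    Continuous (rp xs c j) := by unfold rp; fun_prop

theorem continuous_pz {n s : ℕ} (xs : Fin s → Euc n) (c : Fin s → ℝ) :
    Continuous (pz xs c) := by
  unfold pz
  exact continuous_finsetSum _ fun j _ => ((continuous_rp xs c j).pow 2).smul continuous_const

theorem continuous_pW {n s : ℕ} (xs : Fin s → Euc n) (c : Fin s → ℝ) :
    Continuous (pW xs c) := by
  unfold pW
  exact continuous_finsetSum _ fun j _ => ((continuous_rp xs c j).pow 3).div_const _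

theorem cube_convex (a b : ℝ) :
    max a 0 ^ 3 / 3 + max a 0 ^ 2 * b ≤ max (a + b) 0 ^ 3 / 3 := by
  rcases le_total a 0 with ha | ha
  · rw [max_eq_right ha]
    have : 0 ≤ max (a + b) 0 := le_max_right _ _
    simp; positivity
  · rw [max_eq_left ha]
    rcases le_total (a + b) 0 with hb | hb
    · rw [max_eq_right hb]
      nlinarith [mul_nonneg (sq_nonneg a) (by linarith : 0 ≤ -(a+b)), pow_nonneg ha 3]
    · rw [max_eq_left hb]
      nlinarith [mul_nonneg (sq_nonneg b) ha, mul_nonneg (sq_nonneg b) hb]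

theorem sq_expand (a b : ℝ) : |max (a + b) 0 ^ 2 - max a 0 ^ 2 - 2 * max a 0 * b| ≤ b ^ 2 := by
  rw [abs_le]
  rcases le_total a 0 with ha | ha <;> rcases le_total (a + b) 0 with hb | hb
  · rw [max_eq_right ha, max_eq_right hb]; constructor <;> nlinarith
  · rw [max_eq_right ha, max_eq_left hb]; constructor <;> nlinarith
  · rw [max_eq_left ha, max_eq_right hb]; constructor <;> nlinarith
  · rw [max_eq_left ha, max_eq_left hb]; constructor <;> nlinarith

theorem pW_nonneg {n s : ℕ} (xs : Fin s → Euc n) (c : Fin s → ℝ) (x : Euc n) :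
    0 ≤ pW xs c x := Finset.sum_nonneg fun j _ => by have := rp_nonneg xs c j x; positivity

theorem pW_convex {n s : ℕ} (xs : Fin s → Euc n) (c : Fin s → ℝ) (x v : Euc n) :
    pW xs c x + ⟪pz xs c x, v⟫ ≤ pW xs c (x + v) := by
  unfold pW pz
  rw [sum_inner, ← Finset.sum_add_distrib]
  gcongr with j _
  rw [inner_smul_left]
  have := cube_convex (⟪xs j, x⟫ - c j) ⟪xs j, v⟫
  unfold rp
  rw [inner_add_right, add_sub_right_comm]
  exact this

theorem pW_zero {n s : ℕ} (xs : Fin s → Euc n) (c : Fin s → ℝ) {x : Euc n}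
    (hx : ∀ j, ⟪xs j, x⟫ ≤ c j) : pW xs c x = 0 := by
  unfold pW rp
  refine Finset.sum_eq_zero fun j _ => ?_
  rw [max_eq_right (by linarith [hx j])]; simp

theorem pz_inner_le {n s : ℕ} (xs : Fin s → Euc n) (c : Fin s → ℝ) (x : Euc n) {z : Euc n}
    (hz : ∀ j, ⟪xs j, z⟫ ≤ c j) : ⟪pz xs c x, z - x⟫ ≤ 0 := by
  have := pW_convex xs c x (z - x)
  rw [add_sub_cancel, pW_zero xs c hz] at this
  linarith [pW_nonneg xs c x]

theorem rp_le_of_pW {n s : ℕ} (xs : Fin s → Euc n) (c : Fin s → ℝ) (x : Euc n) (j : Fin s) :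
    rp xs c j x ^ 3 ≤ 3 * pW xs c x := by
  have : rp xs c j x ^ 3 / 3 ≤ pW xs c x := by
    unfold pW
    exact Finset.single_le_sum (f := fun j => rp xs c j x ^ 3 / 3)
      (fun i _ => by have := rp_nonneg xs c i x; positivity) (Finset.mem_univ j)
  linarith

/-- second order expansion of `⟨q, pz⟩` -/
theorem pz_expand {n s : ℕ} (xs : Fin s → Euc n) (c : Fin s → ℝ) : ∃ K : ℝ, 0 ≤ K ∧
    ∀ x v, ‖pz xs c (x + v) - pz xs c x - ∑ j, (2 * rp xs c j x * ⟪xs j, v⟫) • xs j‖ ≤ K * ‖v‖ ^ 2 := by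
  refine ⟨∑ j, ‖xs j‖ ^ 3, Finset.sum_nonneg fun j _ => by positivity, fun x v => ?_⟩
  unfold pz
  rw [← Finset.sum_sub_distrib, ← Finset.sum_sub_distrib, Finset.sum_mul]
  refine norm_sum_le_of_le _ fun j _ => ?_
  rw [← sub_smul, ← sub_smul, norm_smul, Real.norm_eq_abs]
  have h1 := sq_expand (⟪xs j, x⟫ - c j) ⟪xs j, v⟫
  rw [← add_sub_right_comm, ← inner_add_right] at h1
  have h2 : ⟪xs j, v⟫ ^ 2 ≤ ‖xs j‖ ^ 2 * ‖v‖ ^ 2 := by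
    rw [← sq_abs, ← mul_pow]; gcongr; exact abs_real_inner_le_norm _ _
  calc _ ≤ (‖xs j‖ ^ 2 * ‖v‖ ^ 2) * ‖xs j‖ := by
        gcongr; exact h1.trans h2
    _ = _ := by ring

/-- resolvent of the penalty -/
theorem pen_resolvent {n s : ℕ} (xs : Fin s → Euc n) (c : Fin s → ℝ) {κ : ℝ} (hκ : 0 ≤ κ)
    (b : Euc n) : ∃ x, x + κ • pz xs c x = b := by
  set F : Euc n → ℝ := fun x => ‖x - b‖ ^ 2 / 2 + κ * pW xs c x with hF
  have hFc : Continuous F := by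
    have := continuous_pW xs c
    rw [hF]; fun_prop
  obtain ⟨x, hx⟩ := hFc.exists_forall_le (by
    refine tendsto_atTop_mono (f := fun x => ‖x - b‖ ^ 2 / 2) (fun x => ?_) ?_
    · have := pW_nonneg xs c x
      simp only [hF]; have := mul_nonneg hκ this; linarith
    · apply Tendsto.atTop_div_const (by norm_num)
      apply (tendsto_pow_atTop (by norm_num)).comp
      have := tendsto_dist_right_cocompact_atTop (α := Euc n) b
      simpa [dist_eq_norm] using this)
  refine ⟨x, ?_⟩
  have key : ∀ v, 0 ≤ ⟪x - b + κ • pz xs c x, v⟫ := by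
    intro v
    have h1 : ∀ τ > (0:ℝ), 0 ≤ ⟪x - b, v⟫ + τ * (‖v‖ ^ 2 / 2) + κ * ⟪pz xs c (x + τ • v), v⟫ := by
      intro τ hτ
      have h2 := hx (x + τ • v)
      have h3 := pW_convex xs c (x + τ • v) (-(τ • v))
      rw [add_neg_cancel_right, inner_neg_right, inner_smul_right] at h3
      simp only [hF] at h2
      rw [add_sub_right_comm, norm_add_sq_real, inner_smul_right, norm_smul, mul_pow, Real.norm_eq_abs, sq_abs] at h2
      have h4 := mul_le_mul_of_nonneg_left h3 hκ
      have h5 : 0 ≤ τ * (⟪x - b, v⟫ + τ * (‖v‖ ^ 2 / 2) + κ * ⟪pz xs c (x + τ • v), v⟫) := by nlinarith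
      exact nonneg_of_mul_nonneg_right h5 hτ
    have hc : Tendsto (fun τ : ℝ => ⟪x - b, v⟫ + τ * (‖v‖ ^ 2 / 2) + κ * ⟪pz xs c (x + τ • v), v⟫)
        (𝓝[>] 0) (𝓝 (⟪x - b, v⟫ + 0 * (‖v‖ ^ 2 / 2) + κ * ⟪pz xs c (x + (0:ℝ) • v), v⟫)) := by
      refine (Continuous.tendsto ?_ 0).mono_left nhdsWithin_le_nhds
      have := continuous_pz xs c
      fun_prop
    have h6 := ge_of_tendsto hc (by filter_upwards [self_mem_nhdsWithin] with τ hτ using h1 τ hτ)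
    rw [inner_add_left, inner_smul_left]
    simpa using h6
  have h0 := key (-(x - b + κ • pz xs c x))
  rw [inner_neg_right, real_inner_self_eq_norm_sq] at h0
  have : ‖x - b + κ • pz xs c x‖ = 0 := by nlinarith [norm_nonneg (x - b + κ • pz xs c x)]
  rw [norm_eq_zero] at this
  rw [← sub_eq_zero, ← this]; abel

theorem lip_deriv_ii {n : ℕ} {y : ℝ → Euc n} {K : NNReal} (hy : LipschitzWith K y) (a b : ℝ) :
    IntervalIntegrable (deriv y) volume a b := by
  rw [intervalIntegrable_iff]
  refine Measure.integrableOn_of_bounded (M := K) (by simp) 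
    (measurable_deriv y).aestronglyMeasurable ?_
  exact ae_of_all _ fun t => norm_deriv_le_of_lipschitz hy

theorem lip_ftc {n : ℕ} {y : ℝ → Euc n} {K : NNReal} (hy : LipschitzWith K y) (a b : ℝ) :
    y b - y a = ∫ t in a..b, deriv y t := by
  have hi := lip_deriv_ii hy a b
  have hlip : LipschitzWith K (fun t => ∫ τ in a..t, deriv y τ) := by
    refine LipschitzWith.of_dist_le_mul fun t r => ?_
    rw [dist_eq_norm, intervalIntegral.integral_interval_sub_left (lip_deriv_ii hy _ _)
      (lip_deriv_ii hy _ _), Real.dist_eq]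
    exact intervalIntegral.norm_integral_le_of_norm_le_const fun t _ => norm_deriv_le_of_lipschitz hy
  have h1 : AbsolutelyContinuousOnInterval (fun t => ∫ τ in a..t, deriv y τ) a b :=
    LipschitzOnWith.absolutelyContinuousOnInterval (K := K) hlip.lipschitzOnWith
  have h2 : AbsolutelyContinuousOnInterval y a b :=
    LipschitzOnWith.absolutelyContinuousOnInterval (K := K) hy.lipschitzOnWith
  obtain ⟨C, hC⟩ := (h2.sub h1).const_of_ae_hasDerivAt_zero (by
    filter_upwards [hi.ae_hasDerivAt_integral, hy.ae_differentiableAt_real] with t h3 h4 ht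
    have := h4.hasDerivAt.sub (h3 ht a (by simp))
    simpa using this)
  have e1 := hC a (by simp)
  have e2 := hC b (by simp)
  simp at e1 e2
  rw [e1, ← e2]; abel

theorem feas_cont {n : ℕ} {T : ℝ} (hT : 0 < T) {x0 : Euc n} {y y' : ℝ → Euc n}
    (hy : ∀ t ∈ Set.Icc 0 T, y t = x0 + ∫ s in (0:ℝ)..t, y' s) (hi : IntegrableOn y' (Icc 0 T)) :
    ContinuousOn y (Icc 0 T) := by
  have h1 : ContinuousOn (fun t => x0 + ∫ s in (0:ℝ)..t, y' s) (Icc 0 T) := by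
    refine continuousOn_const.add ?_
    have := intervalIntegral.continuousOn_primitive_interval (f := y') (a := 0) (b := T) (μ := volume)
      (by rwa [uIcc_of_le hT.le])
    rwa [uIcc_of_le hT.le] at this
  exact h1.congr hy

theorem feas_deriv {n : ℕ} {T : ℝ} (hT : 0 < T) {x0 : Euc n} {y y' : ℝ → Euc n}
    (hy : ∀ t ∈ Set.Icc 0 T, y t = x0 + ∫ s in (0:ℝ)..t, y' s) (hi : IntegrableOn y' (Icc 0 T)) :
    ∀ᵐ t, t ∈ Icc 0 T → t ∈ Ioo 0 T ∧ HasDerivAt y (y' t) t := by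
  have hii : IntervalIntegrable y' volume 0 T := by
    rw [intervalIntegrable_iff_integrableOn_Icc_of_le hT.le]; exact hi
  have h₁ : ∀ᵐ x : ℝ, x ≠ 0 := by simp [ae_iff, measure_singleton]
  have h₂ : ∀ᵐ x : ℝ, x ≠ T := by simp [ae_iff, measure_singleton]
  filter_upwards [hii.ae_hasDerivAt_integral, h₁, h₂] with t h3 h0 hTT ht
  have hto : t ∈ Ioo 0 T := ⟨lt_of_le_of_ne ht.1 (Ne.symm h0), lt_of_le_of_ne ht.2 hTT⟩
  refine ⟨hto, ?_⟩
  rw [uIcc_of_le hT.le] at h3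
  have := (h3 ht 0 ⟨le_rfl, hT.le⟩).const_add x0
  refine this.congr_of_eventuallyEq ?_
  filter_upwards [Ioo_mem_nhds hto.1 hto.2] with τ hτ using hy τ ⟨hτ.1.le, hτ.2.le⟩

theorem feas_sub {n : ℕ} {T : ℝ} (hT : 0 < T) {x0 : Euc n} {y y' : ℝ → Euc n}
    (hy : ∀ t ∈ Set.Icc 0 T, y t = x0 + ∫ s in (0:ℝ)..t, y' s) (hi : IntegrableOn y' (Icc 0 T))
    {a b : ℝ} (ha : a ∈ Icc 0 T) (hb : b ∈ Icc 0 T) : y b - y a = ∫ s in a..b, y' s := by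
  have hii : ∀ t ∈ Icc 0 T, IntervalIntegrable y' volume 0 t := by
    intro t ht
    rw [intervalIntegrable_iff_integrableOn_Icc_of_le ht.1]; exact hi.mono_set (Icc_subset_Icc le_rfl ht.2)
  rw [hy a ha, hy b hb, add_sub_add_left_eq_sub]
  exact intervalIntegral.integral_interval_sub_left (hii b hb) (hii a ha)

theorem ae_dense {T : ℝ} (hT : 0 < T) {P : ℝ → Prop} (h : ∀ᵐ t, t ∈ Icc 0 T → P t) {t : ℝ}
    (ht : t ∈ Icc 0 T) : t ∈ closure {τ | τ ∈ Icc 0 T ∧ P τ} := by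
  rw [Metric.mem_closure_iff]
  intro ε hε
  obtain ⟨τ, h1, h2, h3⟩ : ∃ τ, τ ∈ Icc 0 T ∧ |τ - t| < ε ∧ P τ := by
    by_contra hcon
    push Not at hcon
    have hne : (Ioo 0 T ∩ Ioo (t - ε) (t + ε)).Nonempty := by
      rw [Ioo_inter_Ioo, nonempty_Ioo]
      simp only [max_lt_iff, lt_min_iff]
      constructor <;> constructor <;> linarith [ht.1, ht.2]
    have hpos := (isOpen_Ioo.inter isOpen_Ioo).measure_pos volume hne
    have h0 : volume (Ioo 0 T ∩ Ioo (t - ε) (t + ε)) = 0 := by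
      refine measure_mono_null ?_ h
      rintro τ ⟨h1, h2⟩
      simp only [mem_compl_iff, mem_ofPred_eq]
      intro hP
      have h4 : τ ∈ Icc 0 T := ⟨h1.1.le, h1.2.le⟩
      exact hcon τ h4 (by rw [abs_lt]; constructor <;> linarith [h2.1, h2.2]) (hP h4)
    exact absurd h0 hpos.ne'
  exact ⟨τ, ⟨h1, h3⟩, by rw [Real.dist_eq, abs_sub_comm]; exact h2⟩

theorem feas_memC {n d : ℕ} {T : ℝ} (hT : 0 < T) {x0 : Euc n} {C : Set (Euc n)} (hCc : IsClosed C)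
    {U : Set (Euc d)} {g : WithLp 2 (Euc n × Euc d) → Euc n} {y y' : ℝ → Euc n} {u : ℝ → Euc d}
    (hf : FeasibleP T x0 C U g y y' u) : ∀ t ∈ Icc 0 T, y t ∈ C := by
  obtain ⟨_, hy, hi, _, _, _, hinc⟩ := hf
  intro t ht
  have h1 := ae_dense hT hinc ht
  have h2 := feas_cont hT hy hi
  have h3 : MapsTo y {τ | τ ∈ Icc 0 T ∧ ∃ v ∈ convNormal C (y τ), -y' τ = v + g (pmk (y τ) (u τ))} C := by
    rintro τ ⟨_, v, hv, _⟩; exact hv.1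
  have h4 := ((h2 t ht).mono (fun τ hτ => hτ.1)).mem_closure h1 h3
  rwa [hCc.closure_eq] at h4

/-- energy identity -/
theorem feas_energy {n d : ℕ} {T : ℝ} (hT : 0 < T) {x0 : Euc n} {C : Set (Euc n)} (hCc : IsClosed C)
    {U : Set (Euc d)} {g : WithLp 2 (Euc n × Euc d) → Euc n} {y y' : ℝ → Euc n} {u : ℝ → Euc d}
    (hf : FeasibleP T x0 C U g y y' u) : ∀ᵐ t, t ∈ Icc 0 T →
      (-y' t - g (pmk (y t) (u t))) ∈ convNormal C (y t) ∧
      ⟪-y' t - g (pmk (y t) (u t)), y' t⟫ = 0 ∧ ‖y' t‖ ≤ ‖g (pmk (y t) (u t))‖ := by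
  have hC := feas_memC hT hCc hf
  obtain ⟨_, hy, hi, _, _, _, hinc⟩ := hf
  filter_upwards [feas_deriv hT hy hi, hinc] with t h1 h2 ht
  obtain ⟨hto, hd⟩ := h1 ht
  obtain ⟨v, hv, hv2⟩ := h2 ht
  have e1 : v = -y' t - g (pmk (y t) (u t)) := by rw [hv2]; abel
  rw [← e1]
  have h0 : ⟪v, y' t⟫ = 0 := by
    have hd2 : HasDerivAt (fun τ => ⟪v, y τ⟫) ⟪v, y' t⟫ t := by
      simpa using (hasDerivAt_const t v).inner ℝ hd
    refine IsLocalMax.hasDerivAt_eq_zero ?_ hd2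
    filter_upwards [Ioo_mem_nhds hto.1 hto.2] with τ hτ
    have := hv.2 (y τ) (hC τ ⟨hτ.1.le, hτ.2.le⟩)
    rw [inner_sub_right] at this; linarith
  refine ⟨hv, h0, ?_⟩
  have h3 : ‖y' t‖ ^ 2 ≤ ‖g (pmk (y t) (u t))‖ * ‖y' t‖ := by
    have h4 : ⟪y' t, y' t⟫ = - ⟪g (pmk (y t) (u t)), y' t⟫ := by
      rw [e1, inner_sub_left, inner_neg_left] at h0; linarith
    rw [← real_inner_self_eq_norm_sq, h4]
    have := abs_real_inner_le_norm (g (pmk (y t) (u t))) (y' t)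
    linarith [neg_abs_le ⟪g (pmk (y t) (u t)), y' t⟫]
  by_cases h : ‖y' t‖ = 0
  · rw [h]; positivity
  · have : 0 < ‖y' t‖ := lt_of_le_of_ne (norm_nonneg _) (Ne.symm h)
    nlinarith

/-- regular trajectory: Lipschitz, bounded normal part -/
def NiceTraj {n d : ℕ} (T : ℝ) (C : Set (Euc n)) (g : WithLp 2 (Euc n × Euc d) → Euc n)
    (L B : ℝ) (y ξ : ℝ → Euc n) (u : ℝ → Euc d) : Prop :=
  (∀ t ∈ Icc 0 T, y t ∈ C) ∧
  (∀ a ∈ Icc 0 T, ∀ b ∈ Icc 0 T, ‖y b - y a‖ ≤ L * |b - a|) ∧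
  (∀ᵐ t, t ∈ Icc 0 T → ξ t ∈ convNormal C (y t) ∧ ‖ξ t‖ ≤ B) ∧
  IntegrableOn ξ (Icc 0 T) ∧ IntegrableOn (fun t => g (pmk (y t) (u t))) (Icc 0 T) ∧
  (∀ a ∈ Icc 0 T, ∀ b ∈ Icc 0 T, y b - y a = - ∫ t in a..b, (ξ t + g (pmk (y t) (u t))))

theorem gcomp_meas {n d : ℕ} {T : ℝ} {g : WithLp 2 (Euc n × Euc d) → Euc n} (hg : Continuous g)
    {y : ℝ → Euc n} {u : ℝ → Euc d} (hy : ContinuousOn y (Icc 0 T))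
    (hu : AEStronglyMeasurable u (volume.restrict (Icc 0 T))) :
    AEStronglyMeasurable (fun t => g (pmk (y t) (u t))) (volume.restrict (Icc 0 T)) := by
  have h1 := hy.aestronglyMeasurable (μ := volume) measurableSet_Icc
  have h2 : Continuous (fun p : Euc n × Euc d => g (pmk p.1 p.2)) := by
    refine hg.comp ?_
    exact WithLp.prod_continuous_toLp 2 _ _
  exact h2.comp_aestronglyMeasurable (h1.prodMk hu)

theorem feas_nice {n d : ℕ} {T : ℝ} (hT : 0 < T) {x0 : Euc n} {C : Set (Euc n)} (hCc : IsClosed C)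
    {U : Set (Euc d)} {g : WithLp 2 (Euc n × Euc d) → Euc n} (hg : Continuous g)
    {y y' : ℝ → Euc n} {u : ℝ → Euc d}
    (hf : FeasibleP T x0 C U g y y' u) {G : ℝ} 
    (hG : ∀ t ∈ Icc 0 T, ∀ w ∈ U, ‖g (pmk (y t) w)‖ ≤ G) :
    NiceTraj T C g G (2 * G) y (fun t => -y' t - g (pmk (y t) (u t))) u := by
  have hC := feas_memC hT hCc hf
  have hE := feas_energy hT hCc hf
  obtain ⟨_, hy, hi, _, hum, huU, hinc⟩ := hf
  have hgi : IntegrableOn (fun t => g (pmk (y t) (u t))) (Icc 0 T) := by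
    refine Integrable.of_bound (gcomp_meas hg (feas_cont hT hy hi) hum) G ?_
    rw [ae_restrict_iff' measurableSet_Icc]
    filter_upwards [huU] with t h1 ht using hG t ht _ (h1 ht)
  have hyG : ∀ᵐ t, t ∈ Icc 0 T → ‖y' t‖ ≤ G := by
    filter_upwards [hE, huU] with t h1 h2 ht
    exact (h1 ht).2.2.trans (hG t ht _ (h2 ht))
  refine ⟨hC, ?_, ?_, hi.neg.sub hgi, hgi, ?_⟩
  · intro a ha b hb
    rw [feas_sub hT hy hi ha hb]
    refine intervalIntegral.norm_integral_le_of_norm_le_const_ae ?_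
    filter_upwards [hyG] with t h1 ht
    refine h1 ?_
    exact (uIcc_subset_Icc ha hb) (uIoc_subset_uIcc ht)
  · filter_upwards [hE, huU, hyG] with t h1 h2 h3 ht
    refine ⟨(h1 ht).1, ?_⟩
    calc _ ≤ ‖-y' t‖ + ‖g (pmk (y t) (u t))‖ := norm_sub_le _ _
      _ ≤ G + G := by rw [norm_neg]; exact add_le_add (h3 ht) (hG t ht _ (h2 ht))
      _ = 2 * G := by ring
  · intro a ha b hb
    rw [feas_sub hT hy hi ha hb, ← intervalIntegral.integral_neg]
    congr 1; ext1 t; simp only [sub_add_cancel, neg_neg]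

/-- grid points -/
def gp (T : ℝ) (N i : ℕ) : ℝ := i * (T / N)

theorem gp_zero (T : ℝ) (N : ℕ) : gp T N 0 = 0 := by simp [gp]
theorem gp_last (T : ℝ) {N : ℕ} (hN : 0 < N) : gp T N N = T := by
  have : (N : ℝ) ≠ 0 := by positivity
  unfold gp; field_simp
theorem gp_succ (T : ℝ) (N i : ℕ) : gp T N (i + 1) = gp T N i + T / N := by
  unfold gp; push_cast; ring
theorem gp_mem {T : ℝ} (hT : 0 < T) {N i : ℕ} (hN : 0 < N) (hi : i ≤ N) : gp T N i ∈ Icc 0 T := by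
  have hN' : (0 : ℝ) < N := by positivity
  constructor
  · unfold gp; positivity
  · calc gp T N i ≤ gp T N N := by unfold gp; gcongr
      _ = T := gp_last T hN
theorem gp_le {T : ℝ} (hT : 0 < T) {N i : ℕ} : gp T N i ≤ gp T N (i + 1) := by
  rw [gp_succ]; have : 0 ≤ T / N := by positivity
  linarith

theorem grid_sum {T : ℝ} (hT : 0 < T) {N : ℕ} (hN : 0 < N) {f : ℝ → ℝ}
    (hf : IntegrableOn f (Icc 0 T)) :
    ∫ t in (0:ℝ)..T, f t = ∑ i ∈ Finset.range N, ∫ t in (gp T N i)..(gp T N (i + 1)), f t := by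
  rw [intervalIntegral.sum_integral_adjacent_intervals, gp_zero, gp_last T hN]
  intro k hk
  rw [intervalIntegrable_iff_integrableOn_Icc_of_le (gp_le hT)]
  exact hf.mono_set (Icc_subset_Icc (gp_mem hT hN hk.le).1 (gp_mem hT hN hk).2)

theorem weak_small {n : ℕ} {T : ℝ} (hT : 0 < T) {f : ℝ → Euc n} (hf : IntegrableOn f (Icc 0 T))
    {G : ℝ} (hG : 0 ≤ G) {ε : ℝ} (hε : 0 < ε) : ∃ δ > (0:ℝ), ∀ w w' : ℝ → Euc n,
      IntegrableOn w' (Icc 0 T) →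
      (∀ a ∈ Icc 0 T, ∀ b ∈ Icc 0 T, w b - w a = ∫ t in a..b, w' t) →
      (∀ᵐ t, t ∈ Icc 0 T → ‖w' t‖ ≤ G) → (∀ t ∈ Icc 0 T, ‖w t‖ ≤ δ) →
      ∫ t in (0:ℝ)..T, ⟪w' t, f t⟫ ≤ ε := by
  set ε' := ε / (3 * (G + 1)) with hε'
  have hε'0 : 0 < ε' := by positivity
  have hf1 : Integrable (indicator (Icc 0 T) f) := hf.integrable_indicator measurableSet_Icc
  obtain ⟨F, hFs, hFint, hFc, hFi⟩ := hf1.exists_hasCompactSupport_integral_sub_le hε'0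
  obtain ⟨M, hM⟩ := hFs.exists_bound_of_continuous hFc
  have hM0 : 0 ≤ M := (norm_nonneg _).trans (hM 0)
  set ε2 := ε / (3 * (G + 1) * T) with hε2
  have hε20 : 0 < ε2 := by positivity
  obtain ⟨δ1, hδ1, hu⟩ := Metric.uniformContinuous_iff.1 (hFs.uniformContinuous_of_continuous hFc) ε2 hε20
  obtain ⟨N, hN0, hN⟩ : ∃ N : ℕ, 0 < N ∧ T / N < δ1 := by
    obtain ⟨N, hN⟩ := exists_nat_gt (T / δ1)
    have hN0 : (0:ℝ) < N := lt_trans (by positivity) hN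
    refine ⟨N, by exact_mod_cast hN0, ?_⟩
    rw [div_lt_iff₀ hδ1] at hN
    rw [div_lt_iff₀ hN0]; linarith
  have hN' : (0:ℝ) < N := by positivity
  refine ⟨ε / (3 * (2 * N * (M + 1))), by positivity, fun w w' hw' hw hb hwd => ?_⟩
  set δ := ε / (3 * (2 * N * (M + 1))) with hδ
  have hδ0 : 0 < δ := by positivity
  have hbr : ∀ᵐ t ∂(volume.restrict (Icc 0 T)), ‖w' t‖ ≤ G := by
    rw [ae_restrict_iff' measurableSet_Icc]; exact hb
  have hFi' : IntegrableOn F (Icc 0 T) := hFi.integrableOn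
  have hin : ∀ {H : ℝ → Euc n}, IntegrableOn H (Icc 0 T) → IntegrableOn (fun t => ⟪w' t, H t⟫) (Icc 0 T) := by
    intro H hH
    refine Integrable.mono' (hH.norm.const_mul G) (hw'.aestronglyMeasurable.inner hH.aestronglyMeasurable) ?_
    filter_upwards [hbr] with t ht
    rw [Real.norm_eq_abs]
    refine (abs_real_inner_le_norm _ _).trans ?_
    gcongr
  have hsplit : ∫ t in (0:ℝ)..T, ⟪w' t, f t⟫ = (∫ t in (0:ℝ)..T, ⟪w' t, f t - F t⟫) + ∫ t in (0:ℝ)..T, ⟪w' t, F t⟫ := by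
    rw [← intervalIntegral.integral_add]
    · congr 1; ext1 t; rw [inner_sub_right]; ring
    · rw [intervalIntegrable_iff_integrableOn_Icc_of_le hT.le]; exact hin (hf.sub hFi')
    · rw [intervalIntegrable_iff_integrableOn_Icc_of_le hT.le]; exact hin hFi'
  have h1 : ∫ t in (0:ℝ)..T, ⟪w' t, f t - F t⟫ ≤ G * ε' := by
    calc ∫ t in (0:ℝ)..T, ⟪w' t, f t - F t⟫ = ∫ t in Icc 0 T, ⟪w' t, f t - F t⟫ := by
          rw [intervalIntegral.integral_of_le hT.le, integral_Icc_eq_integral_Ioc]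
      _ ≤ ∫ t in Icc 0 T, G * ‖f t - F t‖ := by
          refine integral_mono_ae (hin (hf.sub hFi')) ((hf.sub hFi').norm.const_mul G) ?_
          filter_upwards [hbr] with t ht
          refine (real_inner_le_norm _ _).trans ?_
          gcongr
      _ = G * ∫ t in Icc 0 T, ‖f t - F t‖ := by rw [integral_const_mul]
      _ = G * ∫ t in Icc 0 T, ‖indicator (Icc 0 T) f t - F t‖ := by
          congr 1
          refine setIntegral_congr_fun measurableSet_Icc fun t ht => ?_
          simp only [indicator_of_mem ht]
      _ ≤ G * ∫ t, ‖indicator (Icc 0 T) f t - F t‖ := by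
          refine mul_le_mul_of_nonneg_left ?_ hG
          exact setIntegral_le_integral (hf1.sub hFi).norm (ae_of_all _ fun t => norm_nonneg _)
      _ ≤ G * ε' := by gcongr
  have h2 : ∫ t in (0:ℝ)..T, ⟪w' t, F t⟫ ≤ ∑ i ∈ Finset.range N, (G * ε2 * (T / N) + 2 * δ * M) := by
    rw [grid_sum hT hN0 (hin hFi')]
    refine Finset.sum_le_sum fun i hi => ?_
    have hi' := Finset.mem_range.1 hi
    have ma := gp_mem hT hN0 hi'.le
    have mb := gp_mem hT hN0 (show i + 1 ≤ N from hi')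
    set a := gp T N i with ha
    set b := gp T N (i + 1) with hb'
    have hab : a ≤ b := gp_le hT
    have hsub : Icc a b ⊆ Icc 0 T := Icc_subset_Icc ma.1 mb.2
    have hii : IntervalIntegrable w' volume a b := by
      rw [intervalIntegrable_iff_integrableOn_Icc_of_le hab]; exact hw'.mono_set hsub
    have e1 : ∫ t in a..b, ⟪w' t, F t⟫ = (∫ t in a..b, ⟪w' t, F t - F a⟫) + ⟪w b - w a, F a⟫ := by
      have e2 : ⟪w b - w a, F a⟫ = ∫ t in a..b, ⟪w' t, F a⟫ := by
        have := (innerSL ℝ (F a)).intervalIntegral_comp_comm hii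
        simp only [innerSL_apply_apply] at this
        rw [hw a ma b mb, real_inner_comm, ← this]
        congr 1; ext1 t; rw [real_inner_comm]
      rw [e2, ← intervalIntegral.integral_add]
      · congr 1; ext1 t; rw [inner_sub_right]; ring
      · rw [intervalIntegrable_iff_integrableOn_Icc_of_le hab]
        refine (hin (hFi'.sub (integrableOn_const (by simp) (by simp)))).mono_set hsub
      · rw [intervalIntegrable_iff_integrableOn_Icc_of_le hab]
        exact (hin (integrableOn_const (by simp) (by simp))).mono_set hsub
    rw [e1]
    refine add_le_add ?_ ?_
    · refine (le_abs_self _).trans ?_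
      rw [← Real.norm_eq_abs]
      have hh : b - a = T / N := by rw [hb', gp_succ, ← ha]; ring
      have := intervalIntegral.norm_integral_le_of_norm_le_const_ae (a := a) (b := b) (C := G * ε2)
        (f := fun t => ⟪w' t, F t - F a⟫) (by
          filter_upwards [hb] with t ht hm
          rw [uIoc_of_le hab] at hm
          rw [Real.norm_eq_abs]
          refine (abs_real_inner_le_norm _ _).trans ?_
          gcongr
          · exact ht (hsub ⟨hm.1.le, hm.2⟩)
          · have := hu (a := t) (b := a) (by
              rw [Real.dist_eq, abs_of_nonneg (by linarith [hm.1])]; linarith [hm.2])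
            rw [dist_eq_norm] at this; exact this.le)
      rwa [hh, abs_of_pos (by positivity)] at this
    · refine (real_inner_le_norm _ _).trans ?_
      have h3 : ‖w b - w a‖ ≤ 2 * δ := (norm_sub_le _ _).trans (by linarith [hwd a ma, hwd b mb])
      gcongr
      exact hM a
  rw [Finset.sum_const, Finset.card_range, nsmul_eq_mul] at h2
  have h3 : (N:ℝ) * (G * ε2 * (T / N) + 2 * δ * M) = G / (G + 1) * (ε / 3) + M / (M + 1) * (ε / 3) := by
    rw [hε2, hδ]; field_simp
  have h4 : G * ε' = G / (G + 1) * (ε / 3) := by rw [hε']; field_simp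
  have h5 : G / (G + 1) ≤ 1 := by rw [div_le_one (by positivity)]; linarith
  have h6 : M / (M + 1) ≤ 1 := by rw [div_le_one (by positivity)]; linarith
  rw [hsplit]
  nlinarith

theorem int_norm_le {d : ℕ} {T : ℝ} (hT : 0 < T) {w : ℝ → Euc d} (hw : IntegrableOn w (Icc 0 T))
    (hw2 : IntegrableOn (fun t => ‖w t‖ ^ 2) (Icc 0 T)) {θ : ℝ} (hθ : 0 < θ)
    (h : ∫ t in (0:ℝ)..T, ‖w t‖ ^ 2 ≤ θ ^ 2) : ∫ t in (0:ℝ)..T, ‖w t‖ ≤ θ * (T + 1) := by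
  have hii : ∀ {f : ℝ → ℝ}, IntegrableOn f (Icc 0 T) → IntervalIntegrable f volume 0 T := by
    intro f hf; rw [intervalIntegrable_iff_integrableOn_Icc_of_le hT.le]; exact hf
  have h1 : ∫ t in (0:ℝ)..T, ‖w t‖ ≤ ∫ t in (0:ℝ)..T, (θ + (1 / θ) * ‖w t‖ ^ 2) := by
    refine intervalIntegral.integral_mono hT.le (hii hw.norm) (hii ?_) fun t => ?_
    · exact (integrableOn_const (by simp) (by simp)).add (hw2.const_mul _)
    · show ‖w t‖ ≤ θ + (1 / θ) * ‖w t‖ ^ 2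
      have e : θ + (1 / θ) * ‖w t‖ ^ 2 - ‖w t‖ = (θ ^ 2 + ‖w t‖ ^ 2 - θ * ‖w t‖) / θ := by field_simp
      have : 0 ≤ (θ ^ 2 + ‖w t‖ ^ 2 - θ * ‖w t‖) / θ := by
        apply div_nonneg _ hθ.le
        nlinarith [sq_nonneg (θ - ‖w t‖), norm_nonneg (w t), mul_nonneg hθ.le (norm_nonneg (w t))]
      linarith
  rw [intervalIntegral.integral_add (hii (integrableOn_const (by simp) (by simp))) (hii (hw2.const_mul _)),
    intervalIntegral.integral_const, intervalIntegral.integral_const_mul] at h1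
  have h2 : (1 / θ) * ∫ t in (0:ℝ)..T, ‖w t‖ ^ 2 ≤ θ := by
    calc _ ≤ (1 / θ) * θ ^ 2 := by gcongr
      _ = θ := by field_simp
  simp at h1 h2
  nlinarith

/-- working form of the local Lipschitz property -/
def GLip {n d : ℕ} (g : WithLp 2 (Euc n × Euc d) → Euc n) : Prop :=
  ∀ R : ℝ, ∃ K : ℝ, 0 ≤ K ∧ ∀ x x' u u', ‖x‖ ≤ R → ‖x'‖ ≤ R → ‖u‖ ≤ R → ‖u'‖ ≤ R →
    ‖g (pmk x u) - g (pmk x' u')‖ ≤ K * (‖x - x'‖ + ‖u - u'‖)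

/-- reduced local minimality -/
def LocMin {n d : ℕ} (T : ℝ) (x0 : Euc n) (C : Set (Euc n)) (U : Set (Euc d))
    (g : WithLp 2 (Euc n × Euc d) → Euc n) (φ : Euc n → ℝ) (xb : ℝ → Euc n) (ub : ℝ → Euc d) : Prop :=
  ∃ δ > (0:ℝ), ∀ y y' u, FeasibleP T x0 C U g y y' u → PiecewiseConstOn u T →
    (∀ t ∈ Icc 0 T, ‖y t - xb t‖ ≤ δ) → ∫ t in (0:ℝ)..T, ‖u t - ub t‖ ^ 2 ≤ δ → φ (xb T) ≤ φ (y T)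

theorem ctrl_int {d : ℕ} {T : ℝ} {u : ℝ → Euc d} {R : ℝ}
    (hum : AEStronglyMeasurable u (volume.restrict (Icc 0 T)))
    (hb : ∀ᵐ t, t ∈ Icc 0 T → ‖u t‖ ≤ R) :
    IntegrableOn u (Icc 0 T) ∧ IntegrableOn (fun t => ‖u t‖ ^ 2) (Icc 0 T) := by
  have hb' : ∀ᵐ t ∂(volume.restrict (Icc 0 T)), ‖u t‖ ≤ R := by
    rw [ae_restrict_iff' measurableSet_Icc]; exact hb
  refine ⟨Integrable.of_bound hum R hb', Integrable.of_bound (hum.norm.pow 2) (R ^ 2) ?_⟩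
  filter_upwards [hb'] with t ht
  rw [Real.norm_of_nonneg (by positivity)]; gcongr

theorem loc_min {n d : ℕ} {T : ℝ} (hT : 0 < T) {x0 : Euc n} {C : Set (Euc n)} (hCc : IsClosed C)
    {U : Set (Euc d)} {g : WithLp 2 (Euc n × Euc d) → Euc n} (hgc : Continuous g) (hgL : GLip g)
    {φ : Euc n → ℝ} (hUc : IsCompact U)
    {β : ℝ} (hβ : 0 < β) (hgrow : ∀ (x : Euc n), ∀ u ∈ U, ‖g (pmk x u)‖ ≤ β * (1 + ‖x‖))
    {xb xb' : ℝ → Euc n} {ub : ℝ → Euc d}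
    (hfeas : FeasibleP T x0 C U g xb xb' ub) {ε : ℝ} (hε : 0 < ε)
    (hrelax : RelaxedLocalMin T x0 C U g φ xb xb' ub ε) : LocMin T x0 C U g φ xb ub := by
  have hfeas0 := hfeas
  have hE := feas_energy hT hCc hfeas
  obtain ⟨_, hy, hi, _, hum, huU, hinc⟩ := hfeas0
  obtain ⟨RU, hRU⟩ := isBounded_iff_forall_norm_le.1 hUc.isBounded
  obtain ⟨Rx, hRx⟩ := isCompact_Icc.exists_bound_of_continuousOn (feas_cont hT hy hi)
  have hRx0 : 0 ≤ Rx := (norm_nonneg _).trans (hRx 0 ⟨le_rfl, hT.le⟩)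
  set R := max (Rx + 1) RU with hR
  obtain ⟨K, hK0, hK⟩ := hgL R
  set G := β * (1 + (Rx + 1)) with hGd
  have hG0 : 0 < G := by positivity
  have hGb : ∀ x, ‖x‖ ≤ Rx + 1 → ∀ w ∈ U, ‖g (pmk x w)‖ ≤ G := by
    intro x hx w hw
    refine (hgrow x w hw).trans ?_; rw [hGd]; gcongr
  have hniceb := feas_nice hT hCc hgc hfeas (G := G) (fun t ht w hw => hGb _ ((hRx t ht).trans (by linarith)) w hw)
  set f : ℝ → Euc n := fun t => (-xb' t - g (pmk (xb t) (ub t))) - xb' t with hf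
  have hfi : IntegrableOn f (Icc 0 T) := hniceb.2.2.2.1.sub hi
  obtain ⟨δ1, hδ1, hweak⟩ := weak_small hT hfi (G := 2 * G) (by positivity) (ε := ε / 4) (by positivity)
  -- choose θ
  obtain ⟨θ, hθ0, hθ1, hθδ, hθK, hθε⟩ : ∃ θ : ℝ, 0 < θ ∧ θ ≤ 1 ∧ θ ≤ δ1 ∧ G * K * (θ * T + θ * (T + 1)) ≤ ε / 4 ∧ θ ^ 2 ≤ ε / 4 := by
    have h1 : ∀ᶠ θ in 𝓝[>] (0:ℝ), G * K * (θ * T + θ * (T + 1)) ≤ ε / 4 := by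
      have : Tendsto (fun θ : ℝ => G * K * (θ * T + θ * (T + 1))) (𝓝[>] 0) (𝓝 (G * K * (0 * T + 0 * (T + 1)))) :=
        (Continuous.tendsto (by fun_prop) 0).mono_left nhdsWithin_le_nhds
      exact (this.eventually_lt_const (by simp; positivity)).mono fun _ h => h.le
    have h2 : ∀ᶠ θ in 𝓝[>] (0:ℝ), θ ^ 2 ≤ ε / 4 := by
      have : Tendsto (fun θ : ℝ => θ ^ 2) (𝓝[>] 0) (𝓝 (0 ^ 2)) :=
        (Continuous.tendsto (by fun_prop) 0).mono_left nhdsWithin_le_nhds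
      exact (this.eventually_lt_const (by simp; positivity)).mono fun _ h => h.le
    obtain ⟨θ, ⟨⟨ha, hb⟩, hc⟩, hd⟩ := (((h1.and h2).and (Ioo_mem_nhdsGT (show (0:ℝ) < 1 by norm_num))).and (Ioo_mem_nhdsGT hδ1)).exists
    exact ⟨θ, hc.1, hc.2.le, hd.2.le, ha, hb⟩
  refine ⟨min θ (θ ^ 2), by positivity, fun y y' u hfy hpc hyd hud => ?_⟩
  have hyd' : ∀ t ∈ Icc 0 T, ‖y t - xb t‖ ≤ θ := fun t ht => (hyd t ht).trans (min_le_left _ _)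
  have hud' := hud.trans (min_le_right _ _)
  have hEy := feas_energy hT hCc hfy
  obtain ⟨hyy0, hyy, hyi, hyi2, hyum, hyuU, hyinc⟩ := id hfy
  have hyb : ∀ t ∈ Icc 0 T, ‖y t‖ ≤ Rx + 1 := by
    intro t ht
    have := norm_add_le (y t - xb t) (xb t)
    rw [sub_add_cancel] at this
    linarith [hyd' t ht, hRx t ht]
  have hwm : AEStronglyMeasurable (fun t => u t - ub t) (volume.restrict (Icc 0 T)) := hyum.sub hum
  obtain ⟨hwi, hwi2⟩ := ctrl_int (R := RU + RU) hwm (by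
    filter_upwards [huU, hyuU] with t h1 h2 ht
    exact (norm_sub_le _ _).trans (add_le_add (hRU _ (h2 ht)) (hRU _ (h1 ht))))
  have hun := int_norm_le hT hwi hwi2 hθ0 hud'
  -- derivative bound
  have hDb : ∀ᵐ t, t ∈ Icc 0 T → ‖y' t‖ ≤ G ∧ ‖xb' t‖ ≤ G := by
    filter_upwards [hE, hEy, huU, hyuU] with t h1 h2 h3 h4 ht
    exact ⟨(h2 ht).2.2.trans (hGb _ (hyb t ht) _ (h4 ht)), (h1 ht).2.2.trans (hGb _ ((hRx t ht).trans (by linarith)) _ (h3 ht))⟩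
  have hDi : IntegrableOn (fun t => y' t - xb' t) (Icc 0 T) := hyi.sub hi
  obtain ⟨-, hDi2⟩ := ctrl_int (R := G + G) hDi.aestronglyMeasurable (by
    filter_upwards [hDb] with t h1 ht
    exact (norm_sub_le _ _).trans (add_le_add (h1 ht).1 (h1 ht).2))
  have hDf : IntegrableOn (fun t => ⟪y' t - xb' t, f t⟫) (Icc 0 T) := by
    refine Integrable.mono' (hfi.norm.const_mul (2 * G)) (hDi.aestronglyMeasurable.inner hfi.aestronglyMeasurable) ?_
    have : ∀ᵐ t ∂(volume.restrict (Icc 0 T)), ‖y' t‖ ≤ G ∧ ‖xb' t‖ ≤ G := by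
      rw [ae_restrict_iff' measurableSet_Icc]; exact hDb
    filter_upwards [this] with t ht
    rw [Real.norm_eq_abs]
    refine (abs_real_inner_le_norm _ _).trans ?_
    gcongr
    exact (norm_sub_le _ _).trans (by linarith [ht.1, ht.2])
  have hpt : ∀ᵐ t, t ∈ Icc 0 T → ‖y' t - xb' t‖ ^ 2 ≤ G * K * (θ + ‖u t - ub t‖) + ⟪y' t - xb' t, f t⟫ := by
    filter_upwards [hE, hEy, huU, hyuU, hDb] with t h1 h2 h3 h4 h5 ht
    obtain ⟨-, e1, -⟩ := h1 ht
    obtain ⟨-, e2, -⟩ := h2 ht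
    have hk := hK (y t) (xb t) (u t) (ub t) ((hyb t ht).trans (le_max_left _ _))
      ((hRx t ht).trans (le_trans (by linarith) (le_max_left _ _))) ((hRU _ (h4 ht)).trans (le_max_right _ _))
      ((hRU _ (h3 ht)).trans (le_max_right _ _))
    set a := y' t
    set b := xb' t
    set g1 := g (pmk (y t) (u t))
    set g2 := g (pmk (xb t) (ub t))
    have e3 : ‖a - b‖ ^ 2 = - ⟪g1 - g2, a⟫ + ⟪a - b, (-b - g2) - b⟫ := by
      rw [← real_inner_self_eq_norm_sq]
      simp only [inner_sub_left, inner_sub_right, inner_neg_left, inner_neg_right] at e1 e2 ⊢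
      have c1 := real_inner_comm a b
      have c2 := real_inner_comm a g2
      have c3 := real_inner_comm b g2
      linarith
    rw [e3]
    have e4 : - ⟪g1 - g2, a⟫ ≤ G * K * (θ + ‖u t - ub t‖) := by
      have := abs_real_inner_le_norm (g1 - g2) a
      calc - ⟪g1 - g2, a⟫ ≤ ‖g1 - g2‖ * ‖a‖ := by linarith [neg_abs_le ⟪g1 - g2, a⟫]
        _ ≤ (K * (θ + ‖u t - ub t‖)) * G := by
            gcongr
            · exact hk.trans (by gcongr; exact hyd' t ht)
            · exact (h5 ht).1
        _ = _ := by ring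
    linarith
  have hii : ∀ {f : ℝ → ℝ}, IntegrableOn f (Icc 0 T) → IntervalIntegrable f volume 0 T := by
    intro f hf; rw [intervalIntegrable_iff_integrableOn_Icc_of_le hT.le]; exact hf
  have hwn : IntegrableOn (fun t => ‖u t - ub t‖) (Icc 0 T) := hwi.norm
  have hci : IntegrableOn (fun _ : ℝ => θ) (Icc 0 T) := integrableOn_const (by simp) (by simp)
  have hcw : IntegrableOn (fun t => θ + ‖u t - ub t‖) (Icc 0 T) := hci.add hwn
  have hcw2 : IntegrableOn (fun t => G * K * (θ + ‖u t - ub t‖)) (Icc 0 T) := hcw.const_mul _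
  have hD2 : ∫ t in (0:ℝ)..T, ‖y' t - xb' t‖ ^ 2 ≤ ε / 4 + ε / 4 := by
    calc ∫ t in (0:ℝ)..T, ‖y' t - xb' t‖ ^ 2
        ≤ ∫ t in (0:ℝ)..T, (G * K * (θ + ‖u t - ub t‖) + ⟪y' t - xb' t, f t⟫) := by
          refine intervalIntegral.integral_mono_ae_restrict hT.le (hii hDi2) (hii ?_) ?_
          · exact ((hci.add hwn).const_mul _).add hDf
          · rw [EventuallyLE, ae_restrict_iff' measurableSet_Icc]; exact hpt
      _ = G * K * (θ * T + ∫ t in (0:ℝ)..T, ‖u t - ub t‖) + ∫ t in (0:ℝ)..T, ⟪y' t - xb' t, f t⟫ := by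
          rw [intervalIntegral.integral_add (hii hcw2) (hii hDf),
            intervalIntegral.integral_const_mul, intervalIntegral.integral_add (hii hci) (hii hwn)]
          simp [mul_comm]
      _ ≤ _ := by
          refine add_le_add ?_ ?_
          · refine le_trans ?_ hθK
            gcongr
          · refine hweak (fun t => y t - xb t) _ hDi ?_ ?_ (fun t ht => (hyd' t ht).trans hθδ)
            · intro a ha b hb
              have h1 := feas_sub hT hyy hyi ha hb
              have h2 := feas_sub hT hy hi ha hb
              have hsub : uIoc a b ⊆ Icc 0 T := uIoc_subset_uIcc.trans (uIcc_subset_Icc ha hb)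
              rw [intervalIntegral.integral_sub (intervalIntegrable_iff.2 (hyi.mono_set hsub)) (intervalIntegrable_iff.2 (hi.mono_set hsub)), ← h1, ← h2]
              abel
            · filter_upwards [hDb] with t h1 ht
              exact (norm_sub_le _ _).trans (by linarith [(h1 ht).1, (h1 ht).2])
  refine hrelax y y' u hyum ?_ hyy0 hyy hyi hyi2 ?_ ⟨fun _ => y, fun _ => y', fun _ => u, fun _ => ⟨hfy, hpc⟩, by simp,
    fun _ => u, fun k => ⟨1, fun _ => 1, by simp, by simp, by simp⟩, by simp⟩ ?_
  · filter_upwards [hyuU] with t h1 ht using subset_convexHull ℝ _ (h1 ht)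
  · filter_upwards [hyuU, hyinc] with t h1 h2 ht
    obtain ⟨v, hv, e⟩ := h2 ht
    exact ⟨v, hv, _, subset_convexHull ℝ _ ⟨u t, h1 ht, rfl⟩, e⟩
  · rw [intervalIntegral.integral_add (hii hDi2) (hii hwi2)]
    linarith

/-- grid index of a time -/
def gidx (T : ℝ) (m : ℕ) (t : ℝ) : ℕ := ⌊t * m / T⌋₊

theorem gidx_le {T : ℝ} (hT : 0 < T) (m : ℕ) {t : ℝ} (ht : t ≤ T) : gidx T m t ≤ m := by
  unfold gidx
  apply Nat.floor_le_of_le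
  rw [div_le_iff₀ hT]
  have : (0:ℝ) ≤ m := by positivity
  nlinarith

theorem gp_gidx_le {T : ℝ} (hT : 0 < T) {m : ℕ} (hm : 0 < m) {t : ℝ} (ht : 0 ≤ t) :
    gp T m (gidx T m t) ≤ t := by
  have hm' : (0:ℝ) < m := by positivity
  have := Nat.floor_le (show 0 ≤ t * m / T by positivity)
  unfold gp gidx
  calc (⌊t * m / T⌋₊ : ℝ) * (T / m) ≤ (t * m / T) * (T / m) := by gcongr
    _ = t := by field_simp

theorem lt_gp_gidx {T : ℝ} (hT : 0 < T) {m : ℕ} (hm : 0 < m) (t : ℝ) :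
    t < gp T m (gidx T m t) + T / m := by
  have hm' : (0:ℝ) < m := by positivity
  have := Nat.lt_floor_add_one (t * m / T)
  unfold gp gidx
  calc t = (t * m / T) * (T / m) := by field_simp
    _ < (⌊t * m / T⌋₊ + 1) * (T / m) := by gcongr
    _ = _ := by ring

theorem gidx_gp {T : ℝ} (hT : 0 < T) {m : ℕ} (hm : 0 < m) (i : ℕ) : gidx T m (gp T m i) = i := by
  have hm' : (0:ℝ) < m := by positivity
  unfold gidx gp
  have : (i:ℝ) * (T / m) * m / T = i := by field_simp
  rw [this, Nat.floor_natCast]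

theorem gidx_mono {T : ℝ} (hT : 0 < T) (m : ℕ) {s t : ℝ} (h : s ≤ t) : gidx T m s ≤ gidx T m t := by
  unfold gidx
  apply Nat.floor_mono
  have : (0:ℝ) ≤ m := by positivity
  gcongr

theorem gidx_eq {T : ℝ} (hT : 0 < T) {m : ℕ} (hm : 0 < m) {i : ℕ} {t : ℝ}
    (ht : t ∈ Ico (gp T m i) (gp T m (i + 1))) : gidx T m t = i := by
  have hm' : (0:ℝ) < m := by positivity
  unfold gidx
  rw [Nat.floor_eq_iff (by have := ht.1; have h0 : 0 ≤ gp T m i := by unfold gp; positivity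
                           have : 0 ≤ t := by linarith
                           positivity)]
  have h1 := ht.1; have h2 := ht.2
  unfold gp at h1 h2
  constructor
  · rw [le_div_iff₀ hT]
    calc (i:ℝ) * T = (i * (T / m)) * m := by field_simp
      _ ≤ _ := by gcongr
  · rw [div_lt_iff₀ hT]
    calc t * m < (((i + 1 : ℕ) : ℝ) * (T / m)) * m := by gcongr
      _ = _ := by push_cast; field_simp

theorem chain_le {E : Type*} [SeminormedAddCommGroup E] {Y : ℕ → E} {D : ℝ} {m : ℕ}
    (h : ∀ i < m, ‖Y (i + 1) - Y i‖ ≤ D) {a : ℕ} (b : ℕ) (hab : a ≤ b) (hb : b ≤ m) :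
    ‖Y b - Y a‖ ≤ D * ((b : ℝ) - a) := by
  induction b, hab using Nat.le_induction with
  | base => simp
  | succ k hk ih =>
    have h1 := ih (by omega)
    have h2 := h k (by omega)
    calc ‖Y (k + 1) - Y a‖ = ‖(Y (k + 1) - Y k) + (Y k - Y a)‖ := by abel_nf
      _ ≤ D + D * ((k:ℝ) - a) := (norm_add_le _ _).trans (add_le_add h2 h1)
      _ = _ := by push_cast; ring

theorem ultra_lip {E : Type*} [NormedAddCommGroup E] [ProperSpace E] {T : ℝ} (hT : 0 < T)
    (𝒰 : Ultrafilter ℕ) (h𝒰 : (𝒰 : Filter ℕ) ≤ atTop)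
    {Y : ℕ → ℕ → E} {L R : ℝ} (hL : 0 ≤ L)
    (hR : ∀ᶠ m in (𝒰 : Filter ℕ), ∀ i ≤ m, ‖Y m i‖ ≤ R)
    (hY : ∀ᶠ m in (𝒰 : Filter ℕ), ∀ i < m, ‖Y m (i + 1) - Y m i‖ ≤ L * (T / m)) :
    ∃ y : ℝ → E, LipschitzWith L.toNNReal y ∧ (∀ t, ‖y t‖ ≤ R) ∧
      (∀ ε > (0:ℝ), ∀ᶠ m in (𝒰 : Filter ℕ), ∀ i ≤ m, ‖Y m i - y (gp T m i)‖ ≤ ε) := by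
  have hpos : ∀ᶠ m in (𝒰 : Filter ℕ), 0 < m := h𝒰 (eventually_gt_atTop 0)
  have hsmall : Tendsto (fun m : ℕ => T / (m:ℝ)) 𝒰 (𝓝 0) :=
    (tendsto_const_div_atTop_nhds_zero_nat T).mono_left h𝒰
  have hex : ∀ t : ℝ, ∃ y : E, ‖y‖ ≤ R ∧ (t ≤ T → Tendsto (fun m => Y m (gidx T m t)) 𝒰 (𝓝 y)) := by
    intro t
    by_cases ht : t ≤ T
    · have : (Ultrafilter.map (fun m => Y m (gidx T m t)) 𝒰 : Filter E) ≤ 𝓟 (Metric.closedBall 0 R) := by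
        rw [le_principal_iff]
        change ∀ᶠ m in (𝒰 : Filter ℕ), _
        filter_upwards [hR] with m hm
        simpa using hm _ (gidx_le hT m ht)
      obtain ⟨y, hy, hl⟩ := (isCompact_closedBall (0:E) R).ultrafilter_le_nhds _ this
      exact ⟨y, by simpa using hy, fun _ => hl⟩
    · refine ⟨0, ?_, fun h => absurd h ht⟩
      obtain ⟨m, hm⟩ := hR.exists
      simpa using (norm_nonneg _).trans (hm 0 (by omega))
  choose y0 hy0 hy0t using hex
  have hF : ∀ᶠ m in (𝒰 : Filter ℕ), ∀ s ∈ Icc 0 T, ∀ t ∈ Icc 0 T,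
      ‖Y m (gidx T m s) - Y m (gidx T m t)‖ ≤ L * (|s - t| + T / m) := by
    filter_upwards [hY, hpos] with m hm hm0
    have key : ∀ s ∈ Icc 0 T, ∀ t ∈ Icc 0 T, s ≤ t →
        ‖Y m (gidx T m t) - Y m (gidx T m s)‖ ≤ L * (|s - t| + T / m) := by
      intro s hs t ht hst
      refine (chain_le hm _ (gidx_mono hT m hst) (gidx_le hT m ht.2)).trans ?_
      have h1 := gp_gidx_le hT hm0 ht.1
      have h2 := lt_gp_gidx hT hm0 s
      unfold gp at h1 h2
      rw [abs_sub_comm, abs_of_nonneg (by linarith), mul_assoc]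
      gcongr
      nlinarith
    intro s hs t ht
    rcases le_total s t with h | h
    · rw [norm_sub_rev]; exact key s hs t ht h
    · rw [abs_sub_comm]; exact key t ht s hs h
  have hlip0 : ∀ s ∈ Icc 0 T, ∀ t ∈ Icc 0 T, ‖y0 s - y0 t‖ ≤ L * |s - t| := by
    intro s hs t ht
    have h1 : Tendsto (fun m => ‖Y m (gidx T m s) - Y m (gidx T m t)‖) 𝒰 (𝓝 ‖y0 s - y0 t‖) :=
      ((hy0t s hs.2).sub (hy0t t ht.2)).norm
    have h2 : Tendsto (fun m : ℕ => L * (|s - t| + T / m)) 𝒰 (𝓝 (L * (|s - t| + 0))) :=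
      (hsmall.const_add _).const_mul _
    have := le_of_tendsto_of_tendsto h1 h2 (by filter_upwards [hF] with m hm using hm s hs t ht)
    simpa using this
  set y : ℝ → E := fun t => y0 (projIcc 0 T hT.le t) with hy
  refine ⟨y, ?_, fun t => hy0 _, ?_⟩
  · refine LipschitzWith.of_dist_le_mul fun s t => ?_
    rw [dist_eq_norm, Real.coe_toNNReal _ hL]
    refine (hlip0 _ (projIcc 0 T hT.le s).2 _ (projIcc 0 T hT.le t).2).trans ?_
    gcongr
    have := (LipschitzWith.projIcc hT.le).dist_le_mul s t
    rw [Subtype.dist_eq, NNReal.coe_one, one_mul] at this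
    exact this
  · intro ε hε
    have hL1 : 0 < 4 * (L + 1) := by positivity
    obtain ⟨S, hSs, hSf, hSc⟩ := (isCompact_Icc (a := (0:ℝ)) (b := T)).finite_cover_balls (e := ε / (4 * (L + 1))) (by positivity)
    have h1 : ∀ᶠ m in (𝒰 : Filter ℕ), ∀ t ∈ S, ‖Y m (gidx T m t) - y0 t‖ ≤ ε / 4 := by
      rw [eventually_all_finite hSf]
      intro t ht
      have := (tendsto_iff_norm_sub_tendsto_zero.1 (hy0t t (hSs ht).2)).eventually_lt_const (show 0 < ε / 4 by positivity)
      exact this.mono fun _ h => h.le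
    filter_upwards [h1, hF, hpos, hsmall.eventually_lt_const (show 0 < ε / (4 * (L + 1)) by positivity)] with m h1 hF hm0 hsm i hi
    have hti := gp_mem hT hm0 hi
    obtain ⟨t, htS, htt⟩ := mem_iUnion₂.1 (hSc hti)
    rw [Metric.mem_ball, Real.dist_eq] at htt
    have e1 := hF _ hti t (hSs htS)
    rw [gidx_gp hT hm0] at e1
    have e2 := h1 t htS
    have e3 := hlip0 t (hSs htS) _ hti
    have hyi : y (gp T m i) = y0 (gp T m i) := by rw [hy]; simp only; rw [projIcc_of_mem hT.le hti]
    rw [hyi]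
    have e4 : L * (ε / (4 * (L + 1))) ≤ ε / 4 := by
      rw [mul_div_assoc', div_le_div_iff₀ hL1 (by norm_num)]; nlinarith
    have e5 : L * (|gp T m i - t| + T / m) ≤ ε / 4 + ε / 4 := by
      calc _ ≤ L * (ε / (4 * (L + 1)) + ε / (4 * (L + 1))) := by gcongr
        _ ≤ _ := by linarith
    have e6 : L * |t - gp T m i| ≤ ε / 4 := by
      rw [abs_sub_comm]; exact le_trans (by gcongr) e4
    calc ‖Y m i - y0 (gp T m i)‖ = ‖(Y m i - Y m (gidx T m t)) + (Y m (gidx T m t) - y0 t) + (y0 t - y0 (gp T m i))‖ := by abel_nf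
      _ ≤ _ := norm_add₃_le
      _ ≤ ε := by linarith

theorem deriv_nonpos_right {f : ℝ → ℝ} {f' t T : ℝ} (hf : HasDerivAt f f' t) (h0 : f t = 0) (htT : t < T)
    (h : ∀ s ∈ Ioo t T, f s ≤ 0) : f' ≤ 0 := by
  have h1 : Tendsto (slope f t) (𝓝[>] t) (𝓝 f') := by
    have := hf.hasDerivWithinAt (s := Ioi t)
    rw [hasDerivWithinAt_iff_tendsto_slope' (by simp)] at this
    exact this
  refine le_of_tendsto h1 ?_
  filter_upwards [Ioo_mem_nhdsGT htT] with s hs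
  rw [slope_def_field, h0, sub_zero]
  exact div_nonpos_of_nonpos_of_nonneg (h s hs) (by linarith [hs.1])

theorem exists_traj {n d : ℕ} {T : ℝ} (hT : 0 < T) {x0 : Euc n} {C : Set (Euc n)} (hCc : IsClosed C)
    (hCconv : Convex ℝ C) (hx0 : x0 ∈ C)
    {U : Set (Euc d)} {g : WithLp 2 (Euc n × Euc d) → Euc n} (hgc : Continuous g) (hgL : GLip g)
    (hUc : IsCompact U)
    {β : ℝ} (hβ : 0 < β) (hgrow : ∀ (x : Euc n), ∀ u ∈ U, ‖g (pmk x u)‖ ≤ β * (1 + ‖x‖))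
    {u : ℝ → Euc d} (hum : Measurable u) (huU : ∀ t, u t ∈ U) :
    ∃ y y', FeasibleP T x0 C U g y y' u := by
  obtain ⟨RU, hRU⟩ := isBounded_iff_forall_norm_le.1 hUc.isBounded
  have hP : ∀ z : Euc n, ∃ v ∈ C, ∀ w ∈ C, ⟪z - v, w - v⟫ ≤ 0 := by
    intro z
    obtain ⟨v, hv, hv2⟩ := exists_norm_eq_iInf_of_complete_convex ⟨x0, hx0⟩ hCc.isComplete hCconv z
    exact ⟨v, hv, (norm_eq_iInf_iff_real_inner_le_zero hCconv hv).1 hv2⟩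
  choose P hPC hPi using hP
  set Gs : ℕ → ℕ → Euc n → Euc n := fun m i a => ∫ s in (gp T m i)..(gp T m (i + 1)), g (pmk a (u s)) with hGs
  set Y : ℕ → ℕ → Euc n := fun m i => Nat.rec x0 (fun i y => P (y - Gs m i y)) i with hYd
  have hY0 : ∀ m, Y m 0 = x0 := fun m => rfl
  have hYs : ∀ m i, Y m (i + 1) = P (Y m i - Gs m i (Y m i)) := fun m i => rfl
  have hYC : ∀ m i, Y m i ∈ C := by
    intro m i
    cases i with
    | zero => exact hx0
    | succ i => rw [hYs]; exact hPC _
  have hZi : ∀ m i, ∀ w ∈ C, ⟪Y m i - Gs m i (Y m i) - Y m (i + 1), w - Y m (i + 1)⟫ ≤ 0 := by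
    intro m i w hw; rw [hYs]; exact hPi _ w hw
  have hstep : ∀ m i, ‖Y m (i + 1) - Y m i‖ ≤ ‖Gs m i (Y m i)‖ := by
    intro m i
    have h1 := hZi m i _ (hYC m i)
    set G := Gs m i (Y m i)
    have h2 : ‖Y m i - Y m (i + 1)‖ ^ 2 ≤ ⟪G, Y m i - Y m (i + 1)⟫ := by
      rw [← real_inner_self_eq_norm_sq]
      have : Y m i - G - Y m (i + 1) = (Y m i - Y m (i + 1)) - G := by abel
      rw [this, inner_sub_left] at h1
      linarith
    have h3 := (real_inner_le_norm G (Y m i - Y m (i + 1)))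
    rw [norm_sub_rev]
    by_contra hcon
    push Not at hcon
    have : 0 < ‖Y m i - Y m (i + 1)‖ := (norm_nonneg _).trans_lt hcon
    nlinarith
  have hGb : ∀ m i a, ‖Gs m i a‖ ≤ T / m * (β * (1 + ‖a‖)) := by
    intro m i a
    have := intervalIntegral.norm_integral_le_of_norm_le_const (a := gp T m i) (b := gp T m (i + 1)) (f := fun s => g (pmk a (u s)))
      (C := β * (1 + ‖a‖)) (fun s _ => hgrow a _ (huU s))
    refine this.trans (le_of_eq ?_)
    rw [gp_succ, add_sub_cancel_left, abs_of_nonneg (by positivity)]; ring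
  set Rx := (1 + ‖x0‖) * Real.exp (β * T) with hRx
  have hYb : ∀ m i, i ≤ m → 1 + ‖Y m i‖ ≤ Rx := by
    intro m i him
    have h1 : ∀ i, 1 + ‖Y m i‖ ≤ (1 + ‖x0‖) * Real.exp (β * (i * (T / m))) := by
      intro i
      induction i with
      | zero => simp [hY0]
      | succ i ih =>
        have e1 := (hstep m i).trans (hGb m i _)
        have e2 : ‖Y m (i + 1)‖ ≤ ‖Y m (i + 1) - Y m i‖ + ‖Y m i‖ := by
          have := norm_add_le (Y m (i + 1) - Y m i) (Y m i)
          rwa [sub_add_cancel] at this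
        calc 1 + ‖Y m (i + 1)‖ ≤ (1 + ‖Y m i‖) * (β * (T / m) + 1) := by linarith
          _ ≤ ((1 + ‖x0‖) * Real.exp (β * (i * (T / m)))) * Real.exp (β * (T / m)) := by
              gcongr
              exact Real.add_one_le_exp _
          _ = _ := by rw [mul_assoc, ← Real.exp_add]; push_cast; ring_nf
    refine (h1 i).trans ?_
    rw [hRx]
    gcongr
    rcases Nat.eq_zero_or_pos m with rfl | hm
    · simp [hT.le]
    · exact (gp_mem hT hm him).2
  have hRx1 : 1 ≤ Rx := le_trans (by simp) (hYb 0 0 le_rfl)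
  set L := β * Rx with hL
  have hL0 : 0 < L := by positivity
  have hGL : ∀ m i, i ≤ m → ‖Gs m i (Y m i)‖ ≤ L * (T / m) := by
    intro m i hi
    refine (hGb m i _).trans ?_
    rw [mul_comm, hL]; gcongr; exact hYb m i hi
  have hYL : ∀ m, ∀ i < m, ‖Y m (i + 1) - Y m i‖ ≤ L * (T / m) := fun m i hi => (hstep m i).trans (hGL m i hi.le)
  set 𝒰 : Ultrafilter ℕ := Ultrafilter.of atTop
  have h𝒰 : (𝒰 : Filter ℕ) ≤ atTop := Ultrafilter.of_le _
  obtain ⟨y, hyL, hyb, hyc⟩ := ultra_lip hT 𝒰 h𝒰 (Y := Y) (L := L) (R := Rx) hL0.le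
    (Eventually.of_forall fun m i hi => by linarith [hYb m i hi]) (Eventually.of_forall hYL)
  have hpos : ∀ᶠ m in (𝒰 : Filter ℕ), 0 < m := h𝒰 (eventually_gt_atTop 0)
  have hsmall : Tendsto (fun m : ℕ => T / (m:ℝ)) 𝒰 (𝓝 0) :=
    (tendsto_const_div_atTop_nhds_zero_nat T).mono_left h𝒰
  have hgt : ∀ t ∈ Icc 0 T, Tendsto (fun m => gp T m (gidx T m t)) 𝒰 (𝓝 t) := by
    intro t ht
    have h1 : Tendsto (fun m : ℕ => t - T / (m:ℝ)) 𝒰 (𝓝 (t - 0)) := hsmall.const_sub t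
    rw [sub_zero] at h1
    refine tendsto_of_tendsto_of_tendsto_of_le_of_le' h1 tendsto_const_nhds ?_ ?_
    · filter_upwards [hpos] with m hm; linarith [lt_gp_gidx hT hm t]
    · filter_upwards [hpos] with m hm; exact gp_gidx_le hT hm ht.1
  have hYt : ∀ t ∈ Icc 0 T, Tendsto (fun m => Y m (gidx T m t)) 𝒰 (𝓝 (y t)) := by
    intro t ht
    have h1 : Tendsto (fun m => y (gp T m (gidx T m t))) 𝒰 (𝓝 (y t)) := (hyL.continuous.tendsto t).comp (hgt t ht)
    have h2 : Tendsto (fun m => Y m (gidx T m t) - y (gp T m (gidx T m t))) 𝒰 (𝓝 0) := by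
      rw [Metric.tendsto_nhds]
      intro ε hε
      filter_upwards [hyc (ε / 2) (by positivity)] with m hm
      rw [dist_zero_right]
      linarith [hm _ (gidx_le hT m ht.2)]
    simpa using h2.add h1
  have hyC : ∀ t ∈ Icc 0 T, y t ∈ C := fun t ht =>
    hCc.mem_of_tendsto (hYt t ht) (Eventually.of_forall fun m => hYC _ _)
  have hy0 : y 0 = x0 := by
    refine tendsto_nhds_unique (hYt 0 ⟨le_rfl, hT.le⟩) ?_
    simp [gidx, hY0]
  -- integrability
  have hgm : AEStronglyMeasurable (fun t => g (pmk (y t) (u t))) (volume.restrict (Icc 0 T)) :=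
    gcomp_meas hgc hyL.continuous.continuousOn hum.aestronglyMeasurable
  have hgi : IntegrableOn (fun t => g (pmk (y t) (u t))) (Icc 0 T) := by
    refine Integrable.of_bound hgm (β * (1 + Rx)) (Eventually.of_forall fun t => ?_)
    refine (hgrow _ _ (huU t)).trans ?_
    gcongr; exact hyb t
  have hgii : ∀ a ∈ Icc 0 T, ∀ b ∈ Icc 0 T, IntervalIntegrable (fun t => g (pmk (y t) (u t))) volume a b := by
    intro a ha b hb
    rw [intervalIntegrable_iff]
    exact hgi.mono_set (uIoc_subset_uIcc.trans (uIcc_subset_Icc ha hb))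
  have hgci : ∀ (v : Euc n) (a b : ℝ), IntervalIntegrable (fun t => g (pmk v (u t))) volume a b := by
    intro v a b
    rw [intervalIntegrable_iff]
    have hm : Measurable (fun t => g (pmk v (u t))) := by
      have hc : Continuous (fun w : Euc d => g (pmk v w)) := hgc.comp (continuous_pmk.comp (by fun_prop : Continuous fun w : Euc d => (v, w)))
      exact hc.measurable.comp hum
    exact Measure.integrableOn_of_bounded (M := β * (1 + ‖v‖)) (by simp) hm.aestronglyMeasurable (ae_of_all _ fun t => hgrow _ _ (huU t))
  obtain ⟨K, hK0, hK⟩ := hgL (max Rx RU)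
  set I : ℝ → Euc n := fun t => ∫ s in (0:ℝ)..t, g (pmk (y s) (u s)) with hI
  have hIs : ∀ a ∈ Icc 0 T, ∀ b ∈ Icc 0 T, ∫ s in a..b, g (pmk (y s) (u s)) = I b - I a := by
    intro a ha b hb
    rw [hI]
    exact (intervalIntegral.integral_interval_sub_left (hgii 0 ⟨le_rfl, hT.le⟩ b hb) (hgii 0 ⟨le_rfl, hT.le⟩ a ha)).symm
  have hIlip : ∀ a ∈ Icc 0 T, ∀ b ∈ Icc 0 T, ‖I b - I a‖ ≤ (β * (1 + Rx)) * |b - a| := by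
    intro a ha b hb
    rw [← hIs a ha b hb]
    refine intervalIntegral.norm_integral_le_of_norm_le_const fun t _ => ?_
    refine (hgrow _ _ (huU t)).trans ?_
    gcongr; exact hyb t
  -- main inequality
  have hmain : ∀ a ∈ Icc 0 T, ∀ b ∈ Icc 0 T, a ≤ b → ∀ z ∈ C,
      ⟪y a - y b - (I b - I a), z - y a⟫ ≤ 2 * L ^ 2 * (b - a) ^ 2 := by
    intro a ha b hb hab z hz
    set S : ℕ → Euc n := fun m => ∑ i ∈ Finset.Ico (gidx T m a) (gidx T m b), Gs m i (Y m i) with hS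
    have hIt : ∀ t ∈ Icc 0 T, Tendsto (fun m => I (gp T m (gidx T m t))) 𝒰 (𝓝 (I t)) := by
      intro t ht
      rw [tendsto_iff_norm_sub_tendsto_zero]
      have h1 : Tendsto (fun m => (β * (1 + Rx)) * |gp T m (gidx T m t) - t|) 𝒰 (𝓝 ((β * (1 + Rx)) * |t - t|)) :=
        (((hgt t ht).sub_const t).abs).const_mul _
      simp only [sub_self, abs_zero, mul_zero] at h1
      refine squeeze_zero' (Eventually.of_forall fun m => norm_nonneg _) ?_ h1
      filter_upwards [hpos] with m hm
      exact hIlip t ht _ (gp_mem hT hm (gidx_le hT m ht.2))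
    have hSI : Tendsto (fun m => S m - (I (gp T m (gidx T m b)) - I (gp T m (gidx T m a)))) 𝒰 (𝓝 0) := by
      rw [Metric.tendsto_nhds]
      intro ε hε
      set ε' := ε / (2 * (T * K + 1)) / (1 + L) with hε'
      have hε'0 : 0 < ε' := by positivity
      filter_upwards [hyc ε' hε'0, hpos, hsmall.eventually_lt_const hε'0] with m hm hm0 hms
      rw [dist_zero_right]
      have hm0' : (0:ℝ) < m := by positivity
      have hib := gidx_le hT m hb.2
      have e1 : ∀ i ∈ Finset.Ico (gidx T m a) (gidx T m b),
          ‖Gs m i (Y m i) - ∫ s in (gp T m i)..(gp T m (i + 1)), g (pmk (y s) (u s))‖ ≤ (K * (ε' * (1 + L))) * (T / m) := by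
        intro i hi
        rw [Finset.mem_Ico] at hi
        have hi1 := gp_mem hT hm0 (show i ≤ m by omega)
        have hi2 := gp_mem hT hm0 (show i + 1 ≤ m by omega)
        rw [hGs]; simp only
        rw [← intervalIntegral.integral_sub (hgci _ _ _) (hgii _ hi1 _ hi2)]
        have := intervalIntegral.norm_integral_le_of_norm_le_const (a := gp T m i) (b := gp T m (i + 1))
          (f := fun s => g (pmk (Y m i) (u s)) - g (pmk (y s) (u s))) (C := K * (ε' * (1 + L))) ?_
        · rwa [gp_succ, add_sub_cancel_left, abs_of_nonneg (by positivity), ← gp_succ] at this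
        · intro s hs
          rw [uIoc_of_le (gp_le hT)] at hs
          refine (hK _ _ _ _ (by have := hYb m i (by omega); exact le_trans (by linarith) (le_max_left _ _)) ((hyb s).trans (le_max_left _ _))
            ((hRU _ (huU s)).trans (le_max_right _ _)) ((hRU _ (huU s)).trans (le_max_right _ _))).trans ?_
          rw [sub_self, norm_zero, add_zero]
          gcongr
          have d1 := hm i (by omega)
          have d2 := hyL.dist_le_mul (gp T m i) s
          rw [dist_eq_norm, Real.dist_eq, Real.coe_toNNReal _ hL0.le, gp_succ] at *
          have d3 : |gp T m i - s| ≤ ε' := by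
            rw [abs_sub_comm, abs_of_nonneg (by linarith [hs.1])]; linarith [hs.2]
          calc ‖Y m i - y s‖ = ‖(Y m i - y (gp T m i)) + (y (gp T m i) - y s)‖ := by abel_nf
            _ ≤ ε' + L * ε' := (norm_add_le _ _).trans (add_le_add d1 (d2.trans (by gcongr)))
            _ = _ := by ring
      have e2 : I (gp T m (gidx T m b)) - I (gp T m (gidx T m a)) = ∑ i ∈ Finset.Ico (gidx T m a) (gidx T m b), ∫ s in (gp T m i)..(gp T m (i + 1)), g (pmk (y s) (u s)) := by
        rw [intervalIntegral.sum_integral_adjacent_intervals_Ico (gidx_mono hT m hab)]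
        · rw [hIs _ (gp_mem hT hm0 (gidx_le hT m ha.2)) _ (gp_mem hT hm0 hib)]
        · intro i hi
          rw [mem_Ico] at hi
          exact hgii _ (gp_mem hT hm0 (by omega)) _ (gp_mem hT hm0 (by omega))
      rw [e2, hS]; simp only
      rw [← Finset.sum_sub_distrib]
      calc _ ≤ ∑ i ∈ Finset.Ico (gidx T m a) (gidx T m b), (K * (ε' * (1 + L))) * (T / m) := norm_sum_le_of_le _ e1
        _ = ((gidx T m b - gidx T m a : ℕ) : ℝ) * ((K * (ε' * (1 + L))) * (T / m)) := by simp
        _ ≤ (m : ℝ) * ((K * (ε' * (1 + L))) * (T / m)) := by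
            gcongr; omega
        _ = T * K * (ε / (2 * (T * K + 1))) := by rw [hε']; field_simp
        _ < ε := by
            rw [mul_div_assoc', div_lt_iff₀ (by positivity)]
            nlinarith [mul_nonneg hT.le hK0]
    have hSt : Tendsto S 𝒰 (𝓝 (I b - I a)) := by
      have := hSI.add ((hIt b hb).sub (hIt a ha))
      simpa using this
    have hlim1 : Tendsto (fun m => ⟪Y m (gidx T m a) - Y m (gidx T m b) - S m, z - Y m (gidx T m a)⟫) 𝒰
        (𝓝 ⟪y a - y b - (I b - I a), z - y a⟫) :=
      (((hYt a ha).sub (hYt b hb)).sub hSt).inner ((hYt a ha).const_sub z)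
    have hlim2 : Tendsto (fun m : ℕ => 2 * L ^ 2 * (b - a + T / m) ^ 2) 𝒰 (𝓝 (2 * L ^ 2 * (b - a + 0) ^ 2)) :=
      ((hsmall.const_add _).pow 2).const_mul _
    rw [add_zero] at hlim2
    refine le_of_tendsto_of_tendsto hlim1 hlim2 ?_
    filter_upwards [hpos] with m hm0
    have hm0' : (0:ℝ) < m := by positivity
    have hib := gidx_le hT m hb.2
    have hiab := gidx_mono hT m hab
    set ia := gidx T m a
    set ib := gidx T m b
    have hgap : (T / m) * ((ib:ℝ) - ia) ≤ b - a + T / m := by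
      have h1 := gp_gidx_le hT hm0 hb.1
      have h2 := lt_gp_gidx hT hm0 a
      unfold gp at h1 h2
      nlinarith
    have hgap0 : (0:ℝ) ≤ (ib:ℝ) - ia := by
      have : (ia:ℝ) ≤ ib := by exact_mod_cast hiab
      linarith
    have e1 : Y m ia - Y m ib - S m = ∑ i ∈ Finset.Ico ia ib, (Y m i - Gs m i (Y m i) - Y m (i + 1)) := by
      have := Finset.sum_Ico_sub (fun i => Y m i) hiab
      rw [hS]; simp only
      rw [← neg_sub (Y m ib), ← this, ← Finset.sum_neg_distrib, ← Finset.sum_sub_distrib]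
      exact Finset.sum_congr rfl fun i _ => by abel
    rw [e1, sum_inner]
    calc _ ≤ ∑ i ∈ Finset.Ico ia ib, (2 * L * (T / m)) * (L * (T / m) * ((ib:ℝ) - ia)) := by
          refine Finset.sum_le_sum fun i hi => ?_
          rw [Finset.mem_Ico] at hi
          have f1 := hZi m i z hz
          have f2 : z - Y m ia = (z - Y m (i + 1)) + (Y m (i + 1) - Y m ia) := by abel
          rw [f2, inner_add_right]
          have f3 := real_inner_le_norm (Y m i - Gs m i (Y m i) - Y m (i + 1)) (Y m (i + 1) - Y m ia)
          have f4 := chain_le (hYL m) (a := ia) (i + 1) (by omega) (by omega)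
          have f5 : ‖Y m i - Gs m i (Y m i) - Y m (i + 1)‖ ≤ 2 * L * (T / m) := by
            have : Y m i - Gs m i (Y m i) - Y m (i + 1) = - (Y m (i + 1) - Y m i) - Gs m i (Y m i) := by abel
            rw [this]
            refine (norm_sub_le _ _).trans ?_
            rw [norm_neg]
            linarith [hYL m i (by omega), hGL m i (by omega)]
          have f6 : L * (T / m) * (((i + 1 : ℕ) : ℝ) - ia) ≤ L * (T / m) * ((ib:ℝ) - ia) := by
            gcongr; omega
          have f7 : ‖Y m i - Gs m i (Y m i) - Y m (i + 1)‖ * ‖Y m (i + 1) - Y m ia‖ ≤ (2 * L * (T / m)) * (L * (T / m) * ((ib:ℝ) - ia)) :=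
            mul_le_mul f5 (f4.trans f6) (norm_nonneg _) (by positivity)
          linarith
      _ = 2 * L ^ 2 * ((T / m) * ((ib:ℝ) - ia)) ^ 2 := by
          rw [Finset.sum_const, Nat.card_Ico, nsmul_eq_mul, Nat.cast_sub hiab]; ring
      _ ≤ _ := by gcongr
  have hdb : ∀ t, ‖deriv y t‖ ≤ L := by
    intro t
    have := norm_deriv_le_of_lipschitz (x₀ := t) hyL
    rwa [Real.coe_toNNReal _ hL0.le] at this
  have hdm : AEStronglyMeasurable (deriv y) (volume.restrict (Icc 0 T)) := (measurable_deriv y).aestronglyMeasurable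
  refine ⟨y, deriv y, hy0, ?_, Integrable.of_bound hdm L (Eventually.of_forall hdb),
    Integrable.of_bound (hdm.norm.pow 2) (L ^ 2) (Eventually.of_forall fun t => ?_), hum.aestronglyMeasurable,
    Eventually.of_forall fun t _ => huU t, ?_⟩
  · intro t ht
    have := lip_ftc hyL 0 t
    rw [← this, hy0]; abel
  · rw [Real.norm_of_nonneg (by positivity)]; gcongr; exact hdb t
  · have hne : ∀ᵐ t : ℝ, t ≠ T := by simp [ae_iff]
    filter_upwards [hyL.ae_differentiableAt_real, (hgii 0 ⟨le_rfl, hT.le⟩ T ⟨hT.le, le_rfl⟩).ae_hasDerivAt_integral, hne] with t h1 h2 h3 ht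
    have h2' := h2 (by rwa [uIcc_of_le hT.le]) 0 (by rw [uIcc_of_le hT.le]; exact ⟨le_rfl, hT.le⟩)
    refine ⟨-deriv y t - g (pmk (y t) (u t)), ⟨hyC t ht, fun z hz => ?_⟩, by abel⟩
    have hd : HasDerivAt (fun s => ⟪y t - y s - (I s - I t), z - y t⟫ - 2 * L ^ 2 * (s - t) ^ 2)
        (⟪-deriv y t - g (pmk (y t) (u t)), z - y t⟫ - 2 * L ^ 2 * (2 * (t - t))) t := by
      have d1 : HasDerivAt (fun s => y t - y s - (I s - I t)) (-deriv y t - g (pmk (y t) (u t))) t :=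
        (h1.hasDerivAt.const_sub (y t)).sub (h2'.sub_const (I t))
      have d2 : HasDerivAt (fun s => ⟪y t - y s - (I s - I t), z - y t⟫) ⟪-deriv y t - g (pmk (y t) (u t)), z - y t⟫ t := by
        simpa using d1.inner ℝ (hasDerivAt_const t (z - y t))
      have d3 : HasDerivAt (fun s : ℝ => 2 * L ^ 2 * (s - t) ^ 2) (2 * L ^ 2 * (2 * (t - t))) t := by
        simpa using (((hasDerivAt_id t).sub_const t).pow 2).const_mul (2 * L ^ 2)
      exact d2.sub d3
    have := deriv_nonpos_right hd (by simp) (lt_of_le_of_ne ht.2 h3) (fun s hs => by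
      have := hmain t ht s ⟨ht.1.trans hs.1.le, hs.2.le⟩ hs.1.le z hz
      linarith)
    simpa using this

theorem disc_gronwall {a δ : ℕ → ℝ} {x : ℝ} {N : ℕ} (hx0 : 0 ≤ x) (hx : x ≤ 1 / 2) (ha0 : a 0 = 0)
    (ha : ∀ i, 0 ≤ a i) (hδ : ∀ i, 0 ≤ δ i)
    (h : ∀ i < N, a (i + 1) * (1 - x) ≤ (1 + x) * a i + δ i) :
    ∀ i ≤ N, a i ≤ Real.exp (4 * (N * x)) * (2 * ∑ j ∈ Finset.range N, δ j) := by
  have h1 : ∀ i ≤ N, a i ≤ (1 + 4 * x) ^ i * (2 * ∑ j ∈ Finset.range i, δ j) := by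
    intro i
    induction i with
    | zero => intro _; simp [ha0]
    | succ i ih =>
      intro hi
      have e1 := ih (by omega)
      have e2 := h i (by omega)
      have e3 : a (i + 1) ≤ (1 + 4 * x) * a i + 2 * δ i := by
        have p1 : 0 ≤ x * (1 / 2 - x) * a i := mul_nonneg (mul_nonneg hx0 (by linarith)) (ha i)
        have p2 : 0 ≤ (1 / 2 - x) * δ i := mul_nonneg (by linarith) (hδ i)
        have p3 : (1 + x) * a i + δ i ≤ ((1 + 4 * x) * a i + 2 * δ i) * (1 - x) := by nlinarith
        have p4 : 0 < 1 - x := by linarith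
        exact le_of_mul_le_mul_right (e2.trans p3) p4
      have e4 : (1:ℝ) ≤ (1 + 4 * x) ^ (i + 1) := one_le_pow₀ (by linarith)
      rw [Finset.sum_range_succ]
      have e5 : (1 + 4 * x) * a i ≤ (1 + 4 * x) * ((1 + 4 * x) ^ i * (2 * ∑ j ∈ Finset.range i, δ j)) := by gcongr
      have e6 : 2 * δ i ≤ (1 + 4 * x) ^ (i + 1) * (2 * δ i) := le_mul_of_one_le_left (by linarith [hδ i]) e4
      calc a (i + 1) ≤ _ := e3
        _ ≤ _ := add_le_add e5 e6
        _ = _ := by ring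
  intro i hi
  refine (h1 i hi).trans ?_
  have hs : ∑ j ∈ Finset.range i, δ j ≤ ∑ j ∈ Finset.range N, δ j :=
    Finset.sum_le_sum_of_subset_of_nonneg (Finset.range_mono hi) fun j _ _ => hδ j
  have hs0 : 0 ≤ ∑ j ∈ Finset.range i, δ j := Finset.sum_nonneg fun j _ => hδ j
  have e : (1 + 4 * x) ^ i ≤ Real.exp (4 * (N * x)) := by
    calc (1 + 4 * x) ^ i ≤ (1 + 4 * x) ^ N := pow_le_pow_right₀ (by linarith) hi
      _ ≤ (Real.exp (4 * x)) ^ N := by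
          gcongr; rw [add_comm]; exact Real.add_one_le_exp _
      _ = _ := by rw [← Real.exp_nat_mul]; ring_nf
  gcongr

theorem lemmaE {n d : ℕ} {T : ℝ} (hT : 0 < T) {C : Set (Euc n)} 
    {g : WithLp 2 (Euc n × Euc d) → Euc n} {R K L B : ℝ} (hK0 : 0 ≤ K) (hB : 0 ≤ B) (hL : 0 ≤ L)
    (hK : ∀ x x' u u', ‖x‖ ≤ R → ‖x'‖ ≤ R → ‖u‖ ≤ R → ‖u'‖ ≤ R →
      ‖g (pmk x u) - g (pmk x' u')‖ ≤ K * (‖x - x'‖ + ‖u - u'‖))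
    {y ξ : ℝ → Euc n} {u : ℝ → Euc d} (hy : NiceTraj T C g L B y ξ u)
    (hum : AEStronglyMeasurable u (volume.restrict (Icc 0 T)))
    (hub : ∀ᵐ t, t ∈ Icc 0 T → ‖u t‖ ≤ R) (hyb : ∀ t ∈ Icc 0 T, ‖y t‖ ≤ R)
    {N : ℕ} (hN : 0 < N) {x ζ Rr : ℕ → Euc n} {v : ℕ → Euc d} {σ : ℝ} (hσ : 0 ≤ σ)
    (hx0 : x 0 = y 0)
    (hxR : ∀ i < N, ‖x i‖ ≤ R) (hvR : ∀ i < N, ‖v i‖ ≤ R)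
    (hRr : ∀ i < N, Rr i = x (i + 1) - x i + (T / N) • g (pmk (x i) (v i)) + (T / N) • ζ (i + 1))
    (hζ : ∀ i < N, ∀ z ∈ C, ⟪ζ (i + 1), z - x (i + 1)⟫ ≤ 0)
    (hz : ∀ i < N, ∃ z ∈ C, ‖x (i + 1) - z‖ ≤ σ)
    (hsm : (T / N) * (1 + 3 * K) ≤ 1 / 2) :
    ∀ i ≤ N, ‖x i - y (gp T N i)‖ ^ 2 ≤ Real.exp (4 * (T * (1 + 3 * K))) * (2 *
      (∑ j ∈ Finset.range N, ‖Rr j‖ ^ 2 / (T / N) +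
        K * ∑ j ∈ Finset.range N, (∫ t in (gp T N j)..(gp T N (j + 1)), ‖u t - v j‖ ^ 2) +
        T * (2 * B * (σ + L * (T / N)) + K * L ^ 2 * (T / N) ^ 2))) := by
  obtain ⟨hyC, hyL, hξ, hξi, hgi, hyint⟩ := hy
  have hN' : (0:ℝ) < N := by positivity
  set h := T / N with hh
  have hh0 : 0 < h := by positivity
  set A := 1 + 3 * K with hA
  set D : ℕ → ℝ := fun j => ∫ t in (gp T N j)..(gp T N (j + 1)), ‖u t - v j‖ ^ 2 with hD
  set δ : ℕ → ℝ := fun j => ‖Rr j‖ ^ 2 / h + K * D j + h * (2 * B * (σ + L * h) + K * L ^ 2 * h ^ 2) with hδ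
  have hD0 : ∀ j, 0 ≤ D j := fun j => intervalIntegral.integral_nonneg (gp_le hT) fun t _ => by positivity
  have hδ0 : ∀ j, 0 ≤ δ j := by
    intro j; have := hD0 j; rw [hδ]; positivity
  have hui : ∀ w : Euc d, IntegrableOn (fun t => ‖u t - w‖ ^ 2) (Icc 0 T) := by
    intro w
    refine (ctrl_int (R := R + ‖w‖) (hum.sub aestronglyMeasurable_const) ?_).2
    filter_upwards [hub] with t ht htm
    exact (norm_sub_le _ _).trans (by gcongr; exact ht htm)
  have key := disc_gronwall (a := fun i => ‖x i - y (gp T N i)‖ ^ 2) (δ := δ) (x := h * A) (N := N) (by positivity) hsm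
    (by simp [hx0, gp_zero]) (fun i => by positivity) hδ0 ?_
  · intro i hi
    refine (key i hi).trans (le_of_eq ?_)
    have e1 : ∑ j ∈ Finset.range N, δ j = ∑ j ∈ Finset.range N, ‖Rr j‖ ^ 2 / h + K * ∑ j ∈ Finset.range N, D j + T * (2 * B * (σ + L * h) + K * L ^ 2 * h ^ 2) := by
      rw [hδ, Finset.sum_add_distrib, Finset.sum_add_distrib, Finset.mul_sum]
      congr 1
      simp only [Finset.sum_const, Finset.card_range, nsmul_eq_mul]
      rw [← mul_assoc]; congr 1; rw [hh]; field_simp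
    have e2 : (N:ℝ) * (h * A) = T * A := by rw [hh]; field_simp
    rw [e1, e2]
  · intro i hi
    have ht1 := gp_mem hT hN hi.le
    have ht2 := gp_mem hT hN (show i + 1 ≤ N from hi)
    set e0 := x i - y (gp T N i) with he0
    set e := x (i + 1) - y (gp T N (i + 1)) with he
    have hsub : Icc (gp T N i) (gp T N (i + 1)) ⊆ Icc 0 T := Icc_subset_Icc ht1.1 ht2.2
    have ii : ∀ {f : ℝ → ℝ}, IntegrableOn f (Icc 0 T) → IntervalIntegrable f volume (gp T N i) (gp T N (i + 1)) := by
      intro f hf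
      rw [intervalIntegrable_iff_integrableOn_Icc_of_le (gp_le hT)]
      exact hf.mono_set hsub
    have hfi : IntegrableOn (fun t => ξ t + g (pmk (y t) (u t))) (Icc 0 T) := hξi.add hgi
    have hfii : IntervalIntegrable (fun t => ξ t + g (pmk (y t) (u t))) volume (gp T N i) (gp T N (i + 1)) := by
      rw [intervalIntegrable_iff_integrableOn_Icc_of_le (gp_le hT)]
      exact hfi.mono_set hsub
    set F := ∫ t in (gp T N i)..(gp T N (i + 1)), (ξ t + g (pmk (y t) (u t))) with hF
    have hdiff : e - e0 = Rr i - h • ζ (i + 1) + (F - h • g (pmk (x i) (v i))) := by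
      have := hyint _ ht1 _ ht2
      rw [hRr i hi, he, he0]
      have e3 : y (gp T N (i + 1)) = y (gp T N i) - F := by rw [sub_eq_iff_eq_add'.1 this, sub_eq_add_neg]
      rw [e3]; abel
    have hInt : ⟪F - h • g (pmk (x i) (v i)), e⟫ ≤ h * (B * (σ + L * h) + K / 2 * (‖e0‖ ^ 2 + 3 * ‖e‖ ^ 2 + L ^ 2 * h ^ 2)) + K / 2 * D i := by
      have e1 : ⟪F - h • g (pmk (x i) (v i)), e⟫ = ∫ t in (gp T N i)..(gp T N (i + 1)), ⟪e, ξ t + g (pmk (y t) (u t)) - g (pmk (x i) (v i))⟫ := by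
        have h1 := (innerSL ℝ e).intervalIntegral_comp_comm (hfii.sub (intervalIntegrable_const (c := g (pmk (x i) (v i)))))
        simp only [innerSL_apply_apply] at h1
        rw [h1, intervalIntegral.integral_sub hfii intervalIntegrable_const, real_inner_comm]
        rw [intervalIntegral.integral_const, show gp T N (i + 1) - gp T N i = h by rw [gp_succ, add_sub_cancel_left]]
      rw [e1]
      have e2 : ∫ t in (gp T N i)..(gp T N (i + 1)), ⟪e, ξ t + g (pmk (y t) (u t)) - g (pmk (x i) (v i))⟫ ≤
          ∫ t in (gp T N i)..(gp T N (i + 1)), ((B * (σ + L * h) + K / 2 * (‖e0‖ ^ 2 + 3 * ‖e‖ ^ 2 + L ^ 2 * h ^ 2)) + K / 2 * ‖u t - v i‖ ^ 2) := by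
        have hci : IntegrableOn (fun _ : ℝ => g (pmk (x i) (v i))) (Icc 0 T) := integrableOn_const (by simp) (by simp)
        have hci' : IntegrableOn (fun _ : ℝ => (B * (σ + L * h) + K / 2 * (‖e0‖ ^ 2 + 3 * ‖e‖ ^ 2 + L ^ 2 * h ^ 2))) (Icc 0 T) := integrableOn_const (by simp) (by simp)
        refine intervalIntegral.integral_mono_ae_restrict (gp_le hT) (ii ?_) (ii (hci'.add ((hui (v i)).const_mul _))) ?_
        · exact (innerSL ℝ e).integrable_comp (hfi.sub hci)
        · rw [EventuallyLE, ae_restrict_iff' measurableSet_Icc]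
          filter_upwards [hξ, hub] with t hξt hut ht
          obtain ⟨hξN, hξB⟩ := hξt (hsub ht)
          obtain ⟨z, hzC, hzσ⟩ := hz i hi
          have htt := hyL _ ht1 _ (hsub ht)
          have htt2 := hyL _ ht2 _ (hsub ht)
          rw [gp_succ] at ht
          have a1 : ‖y t - y (gp T N i)‖ ≤ L * h := htt.trans (by
            gcongr; rw [abs_of_nonneg (by linarith [ht.1])]; linarith [ht.2])
          have a2 : ‖y t - y (gp T N (i + 1))‖ ≤ L * h := htt2.trans (by
            gcongr; rw [gp_succ, abs_of_nonpos (by linarith [ht.2])]; linarith [ht.1])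
          rw [gp_succ] at hsub
          have b1 : ⟪e, ξ t⟫ ≤ B * (σ + L * h) := by
            rw [real_inner_comm]
            have : e = (z - y t) + ((x (i + 1) - z) + (y t - y (gp T N (i + 1)))) := by rw [he]; abel
            rw [this, inner_add_right]
            have c1 := hξN.2 z hzC
            have c2 := real_inner_le_norm (ξ t) ((x (i + 1) - z) + (y t - y (gp T N (i + 1))))
            have c3 : ‖(x (i + 1) - z) + (y t - y (gp T N (i + 1)))‖ ≤ σ + L * h := (norm_add_le _ _).trans (add_le_add hzσ a2)
            have c4 : ‖ξ t‖ * ‖(x (i + 1) - z) + (y t - y (gp T N (i + 1)))‖ ≤ B * (σ + L * h) := by gcongr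
            linarith
          have b2 : ⟪e, g (pmk (y t) (u t)) - g (pmk (x i) (v i))⟫ ≤ ‖e‖ * (K * ((‖e0‖ + L * h) + ‖u t - v i‖)) := by
            refine (real_inner_le_norm _ _).trans ?_
            gcongr
            refine (hK _ _ _ _ (hyb t (hsub ht)) (hxR i hi) (hut (hsub ht)) (hvR i hi)).trans ?_
            gcongr
            calc ‖y t - x i‖ = ‖(y t - y (gp T N i)) - e0‖ := by rw [he0]; abel_nf
              _ ≤ _ := (norm_sub_le _ _).trans (by linarith)
          have b3 : ‖e‖ * (K * ((‖e0‖ + L * h) + ‖u t - v i‖)) ≤ K / 2 * (‖e0‖ ^ 2 + 3 * ‖e‖ ^ 2 + L ^ 2 * h ^ 2) + K / 2 * ‖u t - v i‖ ^ 2 := by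
            nlinarith [mul_nonneg hK0 (sq_nonneg (‖e‖ - ‖e0‖)), mul_nonneg hK0 (sq_nonneg (‖e‖ - L * h)), mul_nonneg hK0 (sq_nonneg (‖e‖ - ‖u t - v i‖))]
          have : ξ t + g (pmk (y t) (u t)) - g (pmk (x i) (v i)) = ξ t + (g (pmk (y t) (u t)) - g (pmk (x i) (v i))) := by abel
          rw [this, inner_add_right]
          linarith
      refine e2.trans (le_of_eq ?_)
      have e3 : IntervalIntegrable (fun t => K / 2 * ‖u t - v i‖ ^ 2) volume (gp T N i) (gp T N (i + 1)) := ii ((hui (v i)).const_mul _)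
      rw [intervalIntegral.integral_add intervalIntegrable_const e3, intervalIntegral.integral_const_mul,
        intervalIntegral.integral_const, smul_eq_mul]
      have : gp T N (i + 1) - gp T N i = h := by rw [gp_succ, add_sub_cancel_left]
      rw [this]
    have hm : ‖e‖ ^ 2 - ‖e0‖ ^ 2 ≤ 2 * ⟪e - e0, e⟫ := by
      have e1 := real_inner_self_eq_norm_sq (e - e0)
      have e2 := sq_nonneg ‖e - e0‖
      rw [inner_sub_left, real_inner_self_eq_norm_sq]
      rw [norm_sub_sq_real] at e2
      rw [real_inner_comm]
      linarith
    rw [hdiff, inner_add_left, inner_sub_left] at hm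
    have hR1 : ⟪Rr i, e⟫ ≤ ‖Rr i‖ ^ 2 / (2 * h) + h * ‖e‖ ^ 2 / 2 := by
      refine (real_inner_le_norm _ _).trans ?_
      have : ‖Rr i‖ ^ 2 / (2 * h) + h * ‖e‖ ^ 2 / 2 - ‖Rr i‖ * ‖e‖ = (‖Rr i‖ - h * ‖e‖) ^ 2 / (2 * h) := by field_simp; ring
      have : 0 ≤ (‖Rr i‖ - h * ‖e‖) ^ 2 / (2 * h) := by positivity
      linarith
    have hZ1 : 0 ≤ ⟪h • ζ (i + 1), e⟫ := by
      have := hζ i hi _ (hyC _ ht2)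
      rw [real_inner_smul_left, he, ← neg_sub, inner_neg_right]
      nlinarith
    have hdd : ‖Rr i‖ ^ 2 / h = 2 * (‖Rr i‖ ^ 2 / (2 * h)) := by field_simp
    simp only [hδ]
    rw [hdd, hA]
    have q1 : 0 ≤ h * ‖e0‖ ^ 2 := by positivity
    have q2 : 0 ≤ h * K * ‖e0‖ ^ 2 := by positivity
    linarith

/-- multiplier coefficient -/
def bet {n s : ℕ} (xs : Fin s → Euc n) (c : Fin s → ℝ) (κ : ℝ) (x q : Euc n) (j : Fin s) : ℝ :=
  (κ * (2 * rp xs c j x)) * ⟪xs j, q⟫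

/-- discrete residual -/
def dR {n d s : ℕ} (xs : Fin s → Euc n) (c : Fin s → ℝ) (h κ : ℝ)
    (g : WithLp 2 (Euc n × Euc d) → Euc n) (x : ℕ → Euc n) (u : ℕ → Euc d) (i : ℕ) : Euc n :=
  x (i + 1) - x i + h • g (pmk (x i) (u i)) + κ • pz xs c (x (i + 1))

/-- stage cost -/
def dJ {n d s : ℕ} (xs : Fin s → Euc n) (c : Fin s → ℝ) (h κ M A : ℝ)
    (g : WithLp 2 (Euc n × Euc d) → Euc n) (ua : ℕ → Euc d)
    (x : ℕ → Euc n) (u w : ℕ → Euc d) (i : ℕ) : ℝ :=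
  M / h * ‖dR xs c h κ g x u i‖ ^ 2 + M * h * ‖u i - w i‖ ^ 2 + A * h * ‖w i - ua i‖ ^ 2

/-- total cost -/
def dTot {n d s : ℕ} (xs : Fin s → Euc n) (c : Fin s → ℝ) (h κ M A : ℝ)
    (g : WithLp 2 (Euc n × Euc d) → Euc n) (φ : Euc n → ℝ) (ua : ℕ → Euc d) (N : ℕ)
    (x : ℕ → Euc n) (u w : ℕ → Euc d) : ℝ :=
  φ (x N) + ∑ i ∈ Finset.range N, dJ xs c h κ M A g ua x u w i

theorem norm_sq_exp {E : Type*} [NormedAddCommGroup E] [InnerProductSpace ℝ E] (m : ℝ) (R D : E) :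
    m * ‖R + D‖ ^ 2 - m * ‖R‖ ^ 2 = ⟪(2 * m) • R, D⟫ + m * ‖D‖ ^ 2 := by
  rw [norm_add_sq_real, real_inner_smul_left]; ring

theorem pen_term {n s : ℕ} (xs : Fin s → Euc n) (c : Fin s → ℝ) {m κ : ℝ} (hm : 0 ≤ m) (hκ : 0 ≤ κ)
    (x R : Euc n) : ∃ C : ℝ, 0 ≤ C ∧ ∀ v : Euc n, ‖v‖ ≤ 1 →
      m * ‖R + (v + κ • (pz xs c (x + v) - pz xs c x))‖ ^ 2 - m * ‖R‖ ^ 2 ≤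
        ⟪(2 * m) • R + ∑ j, bet xs c κ x ((2 * m) • R) j • xs j, v⟫ + C * ‖v‖ ^ 2 := by
  obtain ⟨K, hK0, hK⟩ := pz_expand xs c
  set q := (2 * m) • R with hq
  set S := ∑ j, 2 * rp xs c j x * ‖xs j‖ ^ 2 with hS
  have hS0 : 0 ≤ S := Finset.sum_nonneg fun j _ => by have := rp_nonneg xs c j x; positivity
  refine ⟨‖q‖ * (κ * K) + m * (1 + κ * (S + K)) ^ 2, by positivity, fun v hv => ?_⟩
  rw [norm_sq_exp, ← hq]
  have hv2 : ‖v‖ ^ 2 ≤ ‖v‖ := by nlinarith [norm_nonneg v]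
  have hlin : ‖∑ j, (2 * rp xs c j x * ⟪xs j, v⟫) • xs j‖ ≤ S * ‖v‖ := by
    rw [hS, Finset.sum_mul]
    refine norm_sum_le_of_le _ fun j _ => ?_
    have h0 := rp_nonneg xs c j x
    rw [norm_smul, Real.norm_eq_abs, abs_mul, abs_of_nonneg (by positivity)]
    calc _ ≤ 2 * rp xs c j x * (‖xs j‖ * ‖v‖) * ‖xs j‖ := by
          gcongr; exact abs_real_inner_le_norm _ _
      _ = _ := by ring
  set P := pz xs c (x + v) - pz xs c x with hP
  have h1 := hK x v
  have hPn : ‖P‖ ≤ (S + K) * ‖v‖ := by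
    calc ‖P‖ = ‖(P - ∑ j, (2 * rp xs c j x * ⟪xs j, v⟫) • xs j) + ∑ j, (2 * rp xs c j x * ⟪xs j, v⟫) • xs j‖ := by rw [sub_add_cancel]
      _ ≤ K * ‖v‖ ^ 2 + S * ‖v‖ := (norm_add_le _ _).trans (add_le_add h1 hlin)
      _ ≤ K * ‖v‖ + S * ‖v‖ := by gcongr
      _ = _ := by ring
  have hD : ‖v + κ • P‖ ≤ (1 + κ * (S + K)) * ‖v‖ := by
    refine (norm_add_le _ _).trans ?_
    rw [norm_smul, Real.norm_eq_abs, abs_of_nonneg hκ]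
    have := mul_le_mul_of_nonneg_left hPn hκ
    linarith
  have hD2 : m * ‖v + κ • P‖ ^ 2 ≤ m * (1 + κ * (S + K)) ^ 2 * ‖v‖ ^ 2 := by
    rw [mul_assoc, ← mul_pow]; gcongr
  have hin : ⟪q, P⟫ ≤ ⟪q, ∑ j, (2 * rp xs c j x * ⟪xs j, v⟫) • xs j⟫ + ‖q‖ * (K * ‖v‖ ^ 2) := by
    have : ⟪q, P⟫ = ⟪q, P - ∑ j, (2 * rp xs c j x * ⟪xs j, v⟫) • xs j⟫ + ⟪q, ∑ j, (2 * rp xs c j x * ⟪xs j, v⟫) • xs j⟫ := by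
      rw [← inner_add_right, sub_add_cancel]
    have e := real_inner_le_norm q (P - ∑ j, (2 * rp xs c j x * ⟪xs j, v⟫) • xs j)
    have e2 := mul_le_mul_of_nonneg_left h1 (norm_nonneg q)
    linarith
  have hbe : ⟪∑ j, bet xs c κ x q j • xs j, v⟫ = κ * ⟪q, ∑ j, (2 * rp xs c j x * ⟪xs j, v⟫) • xs j⟫ := by
    rw [sum_inner, inner_sum, Finset.mul_sum]
    refine Finset.sum_congr rfl fun j _ => ?_
    rw [real_inner_smul_left, real_inner_smul_right, bet, real_inner_comm q]; ring
  rw [inner_add_right, real_inner_smul_right, inner_add_left, hbe]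
  have := mul_le_mul_of_nonneg_left hin hκ
  linarith

set_option maxHeartbeats 1000000 in
theorem disc_min_a {n d s : ℕ} (xs : Fin s → Euc n) (c : Fin s → ℝ) {h κ M A : ℝ} (hh : 0 < h) (hκ : 0 ≤ κ)
    (hM : 0 < M) (hA : 0 ≤ A)
    {g : WithLp 2 (Euc n × Euc d) → Euc n} (hgL : GLip g)
    {φ : Euc n → ℝ} {U : Set (Euc d)}
    (ua : ℕ → Euc d) (xa : ℕ → Euc n) (x0 : Euc n) (Ru : ℝ) {N : ℕ}
    {x : ℕ → Euc n} {u w : ℕ → Euc d} (hx0 : x 0 = x0) (hxb : ∀ i, 1 ≤ i → ‖x i - xa i‖ ≤ 1)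
    (hub : ∀ i, ‖u i‖ ≤ Ru) (hwU : ∀ i, w i ∈ U)
    (hmin' : ∀ (x' : ℕ → Euc n) (u' w' : ℕ → Euc d), x' 0 = x0 → (∀ i, 1 ≤ i → ‖x' i - xa i‖ ≤ 1) →
        (∀ i, ‖u' i‖ ≤ Ru) → (∀ i, w' i ∈ U) →
        dTot xs c h κ M A g φ ua N x u w ≤ dTot xs c h κ M A g φ ua N x' u' w') (hm0 : 0 ≤ M / h) :
      (∀ i, i + 1 < N → ‖x (i + 1) - xa (i + 1)‖ < 1 → ‖u (i + 1)‖ < Ru →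
        ProxSub (fun z => ⟪(2 * (M / h)) • dR xs c h κ g x u (i + 1), g z⟫) (pmk (x (i + 1)) (u (i + 1)))
          (pmk (h⁻¹ • ((2 * (M / h)) • dR xs c h κ g x u (i + 1) - (2 * (M / h)) • dR xs c h κ g x u i -
            ∑ j, bet xs c κ (x (i + 1)) ((2 * (M / h)) • dR xs c h κ g x u i) j • xs j))
            (-((2 * M) • (u (i + 1) - w (i + 1)))))) := by
  -- interior stationarity
  intro i hi hxi hui
  set R0 := dR xs c h κ g x u i with hR0
  set R1 := dR xs c h κ g x u (i + 1) with hR1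
  set X := x (i + 1) with hX
  set V := u (i + 1) with hV
  obtain ⟨C1, hC10, hC1⟩ := pen_term xs c hm0 hκ X R0
  obtain ⟨K, hK0, hK⟩ := hgL (max ‖X‖ ‖V‖ + 1)
  set q0 := (2 * (M / h)) • R0 with hq0
  set q1 := (2 * (M / h)) • R1 with hq1
  set C2 := M / h * (1 + h * K) ^ 2 with hC2
  refine ⟨h⁻¹ * (C1 + 2 * C2 + M * h), by positivity, ?_⟩
  have hball : Metric.ball (pmk X V) (min 1 (min (1 - ‖X - xa (i + 1)‖) (Ru - ‖V‖))) ∈ 𝓝 (pmk X V) :=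
    Metric.ball_mem_nhds _ (by refine lt_min one_pos (lt_min ?_ ?_) <;> linarith)
  filter_upwards [hball] with z hz
  rw [← pmk_eta z] at hz ⊢
  set a := pfst z
  set b := psnd z
  rw [Metric.mem_ball, dist_eq_norm, pmk_sub, lt_min_iff, lt_min_iff] at hz
  obtain ⟨hz1, hz2, hz3⟩ := hz
  set v := a - X with hv
  set ν := b - V with hν
  have hvn := norm_le_pmk_left v ν
  have hνn := norm_le_pmk_right v ν
  have hav : a = X + v := by rw [hv]; abel
  have hbν : b = V + ν := by rw [hν]; abel
  set x' := Function.update x (i + 1) a with hx'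
  set u' := Function.update u (i + 1) b with hu'
  have hJ := hmin' x' u' w (by rw [hx', Function.update_of_ne (by omega)]; exact hx0) ?_ ?_ hwU
  rotate_left
  · intro l hl
    by_cases hl' : l = i + 1
    · rw [hl', hx', Function.update_self, hav]
      calc ‖X + v - xa (i + 1)‖ = ‖(X - xa (i + 1)) + v‖ := by abel_nf
        _ ≤ _ := (norm_add_le _ _).trans (by linarith)
    · rw [hx', Function.update_of_ne hl']; exact hxb l hl
  · intro l
    by_cases hl' : l = i + 1
    · rw [hl', hu', Function.update_self, hbν]
      exact (norm_add_le _ _).trans (by linarith)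
    · rw [hu', Function.update_of_ne hl']; exact hub l
  unfold dTot at hJ
  have hxN : x' N = x N := by rw [hx', Function.update_of_ne (by omega)]
  rw [hxN] at hJ
  have hdiff : 0 ≤ ∑ l ∈ Finset.range N, (dJ xs c h κ M A g ua x' u' w l - dJ xs c h κ M A g ua x u w l) := by
    rw [Finset.sum_sub_distrib]; linarith
  have hsub : ({i, i + 1} : Finset ℕ) ⊆ Finset.range N := by
    intro l hl; simp at hl; rw [Finset.mem_range]; omega
  rw [← Finset.sum_subset hsub, Finset.sum_pair (by omega)] at hdiff
  rotate_left
  · intro l _ hl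
    simp only [Finset.mem_insert, Finset.mem_singleton, not_or] at hl
    have e1 : x' l = x l := by rw [hx', Function.update_of_ne hl.2]
    have e2 : x' (l + 1) = x (l + 1) := by rw [hx', Function.update_of_ne (by omega)]
    have e3 : u' l = u l := by rw [hu', Function.update_of_ne hl.2]
    simp [dJ, dR, e1, e2, e3]
  have e1 : x' i = x i := by rw [hx', Function.update_of_ne (by omega)]
  have e2 : x' (i + 1) = X + v := by rw [hx', Function.update_self, hav]
  have e3 : x' (i + 1 + 1) = x (i + 1 + 1) := by rw [hx', Function.update_of_ne (by omega)]
  have e4 : u' i = u i := by rw [hu', Function.update_of_ne (by omega)]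
  have e5 : u' (i + 1) = V + ν := by rw [hu', Function.update_self, hbν]
  have f0 : dR xs c h κ g x' u' i = R0 + (v + κ • (pz xs c (X + v) - pz xs c X)) := by
    rw [hR0]; unfold dR; rw [e1, e2, e4, smul_sub]; abel
  set Δg := g (pmk (X + v) (V + ν)) - g (pmk X V) with hΔg
  have f1 : dR xs c h κ g x' u' (i + 1) = R1 + (h • Δg - v) := by
    rw [hR1]; unfold dR; rw [e2, e3, e5, hΔg, smul_sub]; abel
  have hΔ : ‖Δg‖ ≤ K * (‖v‖ + ‖ν‖) := by
    have := hK (X + v) X (V + ν) V ((norm_add_le _ _).trans (add_le_add (le_max_left _ _) (hvn.trans hz1.le)))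
      ((le_max_left _ _).trans (by linarith)) ((norm_add_le _ _).trans (add_le_add (le_max_right _ _) (hνn.trans hz1.le)))
      ((le_max_right _ _).trans (by linarith))
    simpa using this
  have hpen := hC1 v (hvn.trans hz1.le)
  have hdyn : M / h * ‖R1 + (h • Δg - v)‖ ^ 2 - M / h * ‖R1‖ ^ 2 ≤ h * ⟪q1, Δg⟫ - ⟪q1, v⟫ + 2 * C2 * (‖v‖ ^ 2 + ‖ν‖ ^ 2) := by
    rw [norm_sq_exp, ← hq1, inner_sub_right, real_inner_smul_right]
    have g1 : ‖h • Δg - v‖ ≤ (1 + h * K) * (‖v‖ + ‖ν‖) := by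
      refine (norm_sub_le _ _).trans ?_
      rw [norm_smul, Real.norm_eq_abs, abs_of_pos hh]
      have := mul_le_mul_of_nonneg_left hΔ hh.le
      nlinarith [norm_nonneg ν]
    have g2 : M / h * ‖h • Δg - v‖ ^ 2 ≤ C2 * (‖v‖ + ‖ν‖) ^ 2 := by
      rw [hC2, mul_assoc, ← mul_pow]; gcongr
    have g3 : C2 * (‖v‖ + ‖ν‖) ^ 2 ≤ C2 * (2 * (‖v‖ ^ 2 + ‖ν‖ ^ 2)) := by
      have : 0 ≤ C2 := by positivity
      gcongr; nlinarith [sq_nonneg (‖v‖ - ‖ν‖)]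
    linarith
  have hctl : M * h * ‖V + ν - w (i + 1)‖ ^ 2 - M * h * ‖V - w (i + 1)‖ ^ 2 = h * ⟪(2 * M) • (V - w (i + 1)), ν⟫ + M * h * ‖ν‖ ^ 2 := by
    have : V + ν - w (i + 1) = (V - w (i + 1)) + ν := by abel
    rw [this, norm_sq_exp, real_inner_smul_left, real_inner_smul_left]; ring
  have hd1 : dJ xs c h κ M A g ua x' u' w i - dJ xs c h κ M A g ua x u w i ≤ ⟪q0 + ∑ j, bet xs c κ X q0 j • xs j, v⟫ + C1 * ‖v‖ ^ 2 := by
    unfold dJ; rw [f0, e4, ← hR0]; linarith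
  have hd2 : dJ xs c h κ M A g ua x' u' w (i + 1) - dJ xs c h κ M A g ua x u w (i + 1) ≤ h * ⟪q1, Δg⟫ - ⟪q1, v⟫ + 2 * C2 * (‖v‖ ^ 2 + ‖ν‖ ^ 2)
      + (h * ⟪(2 * M) • (V - w (i + 1)), ν⟫ + M * h * ‖ν‖ ^ 2) := by
    unfold dJ; rw [f1, e5, ← hR1]; linarith
  rw [pmk_sub, pmk_inner, pmk_norm_sq, ← hv, ← hν, hav, hbν]
  set Q := ∑ j, bet xs c κ X q0 j • xs j with hQ
  have hfin : h * (⟪q1, g (pmk X V)⟫ + (⟪h⁻¹ • (q1 - q0 - Q), v⟫ + ⟪-((2 * M) • (V - w (i + 1))), ν⟫) - h⁻¹ * (C1 + 2 * C2 + M * h) * (‖v‖ ^ 2 + ‖ν‖ ^ 2)) ≤ h * ⟪q1, g (pmk (X + v) (V + ν))⟫ := by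
    have k1 : h * ⟪h⁻¹ • (q1 - q0 - Q), v⟫ = ⟪q1, v⟫ - ⟪q0 + Q, v⟫ := by
      rw [real_inner_smul_left, ← mul_assoc, mul_inv_cancel₀ hh.ne', one_mul, inner_sub_left, inner_sub_left, inner_add_left]; ring
    have k2 : h * (h⁻¹ * (C1 + 2 * C2 + M * h) * (‖v‖ ^ 2 + ‖ν‖ ^ 2)) = (C1 + 2 * C2 + M * h) * (‖v‖ ^ 2 + ‖ν‖ ^ 2) := by field_simp
    have k3 : ⟪q1, Δg⟫ = ⟪q1, g (pmk (X + v) (V + ν))⟫ - ⟪q1, g (pmk X V)⟫ := by rw [hΔg, inner_sub_right]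
    rw [k3] at hd2
    rw [mul_sub, mul_add, mul_add, k1, k2, inner_neg_left]
    have k4 : 0 ≤ C1 * ‖ν‖ ^ 2 := by positivity
    have k5 : 0 ≤ M * h * ‖v‖ ^ 2 := by positivity
    linarith
  exact le_of_mul_le_mul_left hfin hh

theorem disc_min_b {n d s : ℕ} (xs : Fin s → Euc n) (c : Fin s → ℝ) {h κ M A : ℝ} (hh : 0 < h) (hκ : 0 ≤ κ)
    (hM : 0 < M) (hA : 0 ≤ A)
    {g : WithLp 2 (Euc n × Euc d) → Euc n} (hgL : GLip g)
    {φ : Euc n → ℝ} {U : Set (Euc d)}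
    (ua : ℕ → Euc d) (xa : ℕ → Euc n) (x0 : Euc n) (Ru : ℝ) {N : ℕ}
    {x : ℕ → Euc n} {u w : ℕ → Euc d} (hx0 : x 0 = x0) (hxb : ∀ i, 1 ≤ i → ‖x i - xa i‖ ≤ 1)
    (hub : ∀ i, ‖u i‖ ≤ Ru) (hwU : ∀ i, w i ∈ U)
    (hmin' : ∀ (x' : ℕ → Euc n) (u' w' : ℕ → Euc d), x' 0 = x0 → (∀ i, 1 ≤ i → ‖x' i - xa i‖ ≤ 1) →
        (∀ i, ‖u' i‖ ≤ Ru) → (∀ i, w' i ∈ U) →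
        dTot xs c h κ M A g φ ua N x u w ≤ dTot xs c h κ M A g φ ua N x' u' w') (hm0 : 0 ≤ M / h) :
      (∀ i < N, (2 * M) • (u i - w i) + (2 * A) • (ua i - w i) ∈ limNormal U (w i)) := by
  intro i hi
  set t := 2 * (M + A) with ht
  have hMA : 0 < M + A := by linarith
  set a := (M + A)⁻¹ • (M • u i + A • ua i) with ha
  have hrel : (2 * M) • (u i - w i) + (2 * A) • (ua i - w i) = t • (a - w i) := by
    rw [ht, ha, mul_smul 2 (M + A), smul_sub (M + A), smul_smul (M + A), mul_inv_cancel₀ hMA.ne', one_smul]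
    module
  rw [hrel]
  refine mem_limNormal_of_proj (hwU i) (fun w1 hw1 => ?_) (by positivity)
  set w' := Function.update w i w1 with hw'
  have hJ := hmin' x u w' hx0 hxb hub (by
    intro l
    by_cases hl : l = i
    · rw [hl, hw', Function.update_self]; exact hw1
    · rw [hw', Function.update_of_ne hl]; exact hwU l)
  unfold dTot at hJ
  have hdiff : 0 ≤ ∑ l ∈ Finset.range N, (dJ xs c h κ M A g ua x u w' l - dJ xs c h κ M A g ua x u w l) := by
    rw [Finset.sum_sub_distrib]; linarith
  rw [Finset.sum_eq_single_of_mem i (Finset.mem_range.2 hi)] at hdiff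
  rotate_left
  · intro l _ hl
    have : w' l = w l := by rw [hw', Function.update_of_ne hl]
    simp [dJ, this]
  have e1 : w' i = w1 := by rw [hw', Function.update_self]
  unfold dJ at hdiff
  rw [e1] at hdiff
  have key : ∀ z : Euc d, M * ‖u i - z‖ ^ 2 + A * ‖z - ua i‖ ^ 2 = (M + A) * ‖a - z‖ ^ 2 + (M * ‖u i‖ ^ 2 + A * ‖ua i‖ ^ 2 - (M + A) * ‖a‖ ^ 2) := by
    intro z
    have k1 : (M + A) * ⟪a, z⟫ = M * ⟪u i, z⟫ + A * ⟪ua i, z⟫ := by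
      rw [ha, real_inner_smul_left, ← mul_assoc, mul_inv_cancel₀ hMA.ne', one_mul, inner_add_left, real_inner_smul_left, real_inner_smul_left]
    rw [norm_sub_sq_real, norm_sub_sq_real, norm_sub_sq_real, real_inner_comm (ua i) z]
    linarith
  have h1 : (M + A) * ‖a - w i‖ ^ 2 ≤ (M + A) * ‖a - w1‖ ^ 2 := by
    have a1 := key (w i); have a2 := key w1
    have : h * (M * ‖u i - w i‖ ^ 2 + A * ‖w i - ua i‖ ^ 2) ≤ h * (M * ‖u i - w1‖ ^ 2 + A * ‖w1 - ua i‖ ^ 2) := by linarith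
    have := le_of_mul_le_mul_left this hh
    linarith
  have h2 := le_of_mul_le_mul_left h1 hMA
  exact le_of_sq_le_sq h2 (norm_nonneg _) 

set_option maxHeartbeats 1000000 in
theorem disc_min_c {n d s : ℕ} (xs : Fin s → Euc n) (c : Fin s → ℝ) {h κ M A : ℝ} (hh : 0 < h) (hκ : 0 ≤ κ)
    (hM : 0 < M) (hA : 0 ≤ A)
    {g : WithLp 2 (Euc n × Euc d) → Euc n} (hgL : GLip g)
    {φ : Euc n → ℝ} {U : Set (Euc d)}
    (ua : ℕ → Euc d) (xa : ℕ → Euc n) (x0 : Euc n) (Ru : ℝ) {N : ℕ}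
    {x : ℕ → Euc n} {u w : ℕ → Euc d} (hx0 : x 0 = x0) (hxb : ∀ i, 1 ≤ i → ‖x i - xa i‖ ≤ 1)
    (hub : ∀ i, ‖u i‖ ≤ Ru) (hwU : ∀ i, w i ∈ U)
    (hmin' : ∀ (x' : ℕ → Euc n) (u' w' : ℕ → Euc d), x' 0 = x0 → (∀ i, 1 ≤ i → ‖x' i - xa i‖ ≤ 1) →
        (∀ i, ‖u' i‖ ≤ Ru) → (∀ i, w' i ∈ U) →
        dTot xs c h κ M A g φ ua N x u w ≤ dTot xs c h κ M A g φ ua N x' u' w') (hm0 : 0 ≤ M / h) :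
      (∀ i, i + 1 = N → ‖x N - xa N‖ < 1 → ProxSub φ (x N)
        (-((2 * (M / h)) • dR xs c h κ g x u i + ∑ j, bet xs c κ (x N) ((2 * (M / h)) • dR xs c h κ g x u i) j • xs j))) := by
  intro i hi hxi
  set R0 := dR xs c h κ g x u i with hR0
  set X := x N with hX
  obtain ⟨C1, hC10, hC1⟩ := pen_term xs c hm0 hκ X R0
  refine ⟨C1, hC10, ?_⟩
  filter_upwards [Metric.ball_mem_nhds X (show 0 < min 1 (1 - ‖X - xa N‖) from lt_min one_pos (by linarith))] with a ha
  rw [Metric.mem_ball, dist_eq_norm, lt_min_iff] at ha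
  set v := a - X with hv
  have hav : a = X + v := by rw [hv]; abel
  set x' := Function.update x N a with hx'
  have hJ := hmin' x' u w (by rw [hx', Function.update_of_ne (by omega)]; exact hx0) (by
    intro l hl
    by_cases hl' : l = N
    · rw [hl', hx', Function.update_self, hav]
      calc ‖X + v - xa N‖ = ‖(X - xa N) + v‖ := by abel_nf
        _ ≤ _ := (norm_add_le _ _).trans (by linarith [ha.2])
    · rw [hx', Function.update_of_ne hl']; exact hxb l hl) hub hwU
  unfold dTot at hJ
  have hxN : x' N = a := by rw [hx', Function.update_self]
  rw [hxN, ← hX] at hJ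
  have hdiff : 0 ≤ φ a - φ X + ∑ l ∈ Finset.range N, (dJ xs c h κ M A g ua x' u w l - dJ xs c h κ M A g ua x u w l) := by
    rw [Finset.sum_sub_distrib]; linarith
  rw [Finset.sum_eq_single_of_mem i (Finset.mem_range.2 (by omega))] at hdiff
  rotate_left
  · intro l hl hl'
    rw [Finset.mem_range] at hl
    have e1 : x' l = x l := by rw [hx', Function.update_of_ne (by omega)]
    have e2 : x' (l + 1) = x (l + 1) := by rw [hx', Function.update_of_ne (by omega)]
    simp [dJ, dR, e1, e2]
  have e1 : x' i = x i := by rw [hx', Function.update_of_ne (by omega)]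
  have e2 : x' (i + 1) = X + v := by rw [hi, hxN, hav]
  have e3 : x (i + 1) = X := by rw [hi]
  have f0 : dR xs c h κ g x' u i = R0 + (v + κ • (pz xs c (X + v) - pz xs c X)) := by
    rw [hR0]; unfold dR; rw [e1, e2, e3, smul_sub]; abel
  have hpen := hC1 v ha.1.le
  unfold dJ at hdiff
  rw [f0, ← hR0] at hdiff
  rw [inner_neg_left]
  linarith

theorem disc_min {n d s : ℕ} (xs : Fin s → Euc n) (c : Fin s → ℝ) {h κ M A : ℝ} (hh : 0 < h) (hκ : 0 ≤ κ)
    (hM : 0 < M) (hA : 0 ≤ A)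
    {g : WithLp 2 (Euc n × Euc d) → Euc n} (hgc : Continuous g) (hgL : GLip g)
    {φ : Euc n → ℝ} (hφ : Continuous φ) {U : Set (Euc d)} (hUc : IsCompact U) (hUne : U.Nonempty)
    (ua : ℕ → Euc d) (xa : ℕ → Euc n) (x0 : Euc n) (Ru : ℝ) (hRu : 0 ≤ Ru) {N : ℕ} :
    ∃ (x : ℕ → Euc n) (u w : ℕ → Euc d), x 0 = x0 ∧ (∀ i, 1 ≤ i → ‖x i - xa i‖ ≤ 1) ∧
      (∀ i, ‖u i‖ ≤ Ru) ∧ (∀ i, w i ∈ U) ∧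
      (∀ (x' : ℕ → Euc n) (u' w' : ℕ → Euc d), x' 0 = x0 → (∀ i, 1 ≤ i → ‖x' i - xa i‖ ≤ 1) →
        (∀ i, ‖u' i‖ ≤ Ru) → (∀ i, w' i ∈ U) →
        dTot xs c h κ M A g φ ua N x u w ≤ dTot xs c h κ M A g φ ua N x' u' w') ∧
      (∀ i, i + 1 < N → ‖x (i + 1) - xa (i + 1)‖ < 1 → ‖u (i + 1)‖ < Ru →
        ProxSub (fun z => ⟪(2 * (M / h)) • dR xs c h κ g x u (i + 1), g z⟫) (pmk (x (i + 1)) (u (i + 1)))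
          (pmk (h⁻¹ • ((2 * (M / h)) • dR xs c h κ g x u (i + 1) - (2 * (M / h)) • dR xs c h κ g x u i -
            ∑ j, bet xs c κ (x (i + 1)) ((2 * (M / h)) • dR xs c h κ g x u i) j • xs j))
            (-((2 * M) • (u (i + 1) - w (i + 1)))))) ∧
      (∀ i < N, (2 * M) • (u i - w i) + (2 * A) • (ua i - w i) ∈ limNormal U (w i)) ∧
      (∀ i, i + 1 = N → ‖x N - xa N‖ < 1 → ProxSub φ (x N)
        (-((2 * (M / h)) • dR xs c h κ g x u i + ∑ j, bet xs c κ (x N) ((2 * (M / h)) • dR xs c h κ g x u i) j • xs j))) := by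
  classical
  set Kx : ℕ → Set (Euc n) := fun i => if i = 0 then {x0} else Metric.closedBall (xa i) 1 with hKx
  set KK : Set ((ℕ → Euc n) × (ℕ → Euc d) × (ℕ → Euc d)) :=
    (univ.pi Kx) ×ˢ ((univ.pi fun _ => Metric.closedBall 0 Ru) ×ˢ (univ.pi fun _ => U)) with hKK
  have hKc : IsCompact KK := by
    refine IsCompact.prod (isCompact_univ_pi fun i => ?_) (IsCompact.prod (isCompact_univ_pi fun i => isCompact_closedBall _ _) (isCompact_univ_pi fun i => hUc))
    rw [hKx]; dsimp only; split_ifs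
    · exact isCompact_singleton
    · exact isCompact_closedBall _ _
  have hmem : ∀ (x' : ℕ → Euc n) (u' w' : ℕ → Euc d), (x', u', w') ∈ KK ↔ x' 0 = x0 ∧ (∀ i, 1 ≤ i → ‖x' i - xa i‖ ≤ 1) ∧
        (∀ i, ‖u' i‖ ≤ Ru) ∧ (∀ i, w' i ∈ U) := by
    intro x' u' w'
    simp only [hKK, hKx, mem_prod, mem_univ_pi, Metric.mem_closedBall, dist_zero_right]
    constructor
    · rintro ⟨h, h2, h3⟩
      refine ⟨by simpa using h 0, fun i hi => ?_, h2, h3⟩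
      have := h i
      rw [if_neg (by omega)] at this
      simpa [dist_eq_norm] using this
    · rintro ⟨h0, h1, h2, h3⟩
      refine ⟨fun i => ?_, h2, h3⟩
      split_ifs with hi
      · subst hi; simpa using h0
      · simpa [dist_eq_norm] using h1 i (by omega)
  have hne : KK.Nonempty := by
    obtain ⟨w0, hw0⟩ := hUne
    refine ⟨(fun i => if i = 0 then x0 else xa i, fun _ => 0, fun _ => w0), (hmem _ _ _).2 ⟨by simp, fun i hi => ?_, fun i => by simpa using hRu, fun _ => hw0⟩⟩
    rw [if_neg (by omega)]; simp
  have hcont : Continuous (fun p : (ℕ → Euc n) × (ℕ → Euc d) × (ℕ → Euc d) => dTot xs c h κ M A g φ ua N p.1 p.2.1 p.2.2) := by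
    unfold dTot dJ dR
    have hgp : ∀ i, Continuous (fun p : (ℕ → Euc n) × (ℕ → Euc d) × (ℕ → Euc d) => g (pmk (p.1 i) (p.2.1 i))) := fun i =>
      hgc.comp (continuous_pmk.comp (by fun_prop : Continuous fun p : (ℕ → Euc n) × (ℕ → Euc d) × (ℕ → Euc d) => (p.1 i, p.2.1 i)))
    have hpz : ∀ i, Continuous (fun p : (ℕ → Euc n) × (ℕ → Euc d) × (ℕ → Euc d) => pz xs c (p.1 i)) := fun i =>
      (continuous_pz xs c).comp (by fun_prop)
    refine (hφ.comp (by fun_prop)).add (continuous_finsetSum _ fun i _ => ?_)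
    have hRc : Continuous (fun p : (ℕ → Euc n) × (ℕ → Euc d) × (ℕ → Euc d) => p.1 (i + 1) - p.1 i + h • g (pmk (p.1 i) (p.2.1 i)) + κ • pz xs c (p.1 (i + 1))) :=
      ((by fun_prop : Continuous fun p : (ℕ → Euc n) × (ℕ → Euc d) × (ℕ → Euc d) => p.1 (i + 1) - p.1 i).add ((hgp i).const_smul h)).add ((hpz (i + 1)).const_smul κ)
    exact (((hRc.norm.pow 2).const_mul _).add (by fun_prop)).add (by fun_prop)
  obtain ⟨⟨x, u, w⟩, hin, hmin⟩ := hKc.exists_isMinOn hne hcont.continuousOn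
  obtain ⟨hx0, hxb, hub, hwU⟩ := (hmem x u w).1 hin
  have hmin' : ∀ (x' : ℕ → Euc n) (u' w' : ℕ → Euc d), x' 0 = x0 → (∀ i, 1 ≤ i → ‖x' i - xa i‖ ≤ 1) →
        (∀ i, ‖u' i‖ ≤ Ru) → (∀ i, w' i ∈ U) →
        dTot xs c h κ M A g φ ua N x u w ≤ dTot xs c h κ M A g φ ua N x' u' w' := by
    intro x' u' w' h1 h2 h3 h4
    exact hmin ((hmem x' u' w').2 ⟨h1, h2, h3, h4⟩)
  have hm0 : 0 ≤ M / h := by positivity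
  refine ⟨x, u, w, hx0, hxb, hub, hwU, hmin', disc_min_a xs c hh hκ hM hA hgL ua xa x0 Ru hx0 hxb hub hwU hmin' hm0, disc_min_b xs c hh hκ hM hA hgL ua xa x0 Ru hx0 hxb hub hwU hmin' hm0, disc_min_c xs c hh hκ hM hA hgL ua xa x0 Ru hx0 hxb hub hwU hmin' hm0⟩

theorem feas_bound {n d : ℕ} {T : ℝ} (hT : 0 < T) {x0 : Euc n} {C : Set (Euc n)} (hCc : IsClosed C)
    {U : Set (Euc d)} {g : WithLp 2 (Euc n × Euc d) → Euc n}
    {β : ℝ} (hβ : 0 < β) (hgrow : ∀ (x : Euc n), ∀ u ∈ U, ‖g (pmk x u)‖ ≤ β * (1 + ‖x‖))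
    {y y' : ℝ → Euc n} {u : ℝ → Euc d} (hf : FeasibleP T x0 C U g y y' u) :
    ∀ t ∈ Icc 0 T, 1 + ‖y t‖ ≤ (1 + ‖x0‖) * Real.exp (β * T) := by
  have hc := feas_cont hT hf.2.1 hf.2.2.1
  set Y : ℝ → Euc n := fun t => y (projIcc 0 T hT.le t) with hY
  have hYc : Continuous Y := by
    have : Continuous (fun t : Icc (0:ℝ) T => y t) := continuousOn_iff_continuous_restrict.1 hc
    exact this.comp continuous_projIcc
  have hYe : ∀ t ∈ Icc 0 T, Y t = y t := by
    intro t ht; rw [hY]; dsimp only; rw [projIcc_of_mem hT.le ht]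
  set F : ℝ → ℝ := fun t => 1 + ‖x0‖ + ∫ s in (0:ℝ)..t, β * (1 + ‖Y s‖) with hF
  have hintg : Continuous (fun s => β * (1 + ‖Y s‖)) := by fun_prop
  have hFd : ∀ t, HasDerivAt F (β * (1 + ‖Y t‖)) t := by
    intro t
    exact (intervalIntegral.integral_hasDerivAt_right (hintg.intervalIntegrable _ _)
      hintg.stronglyMeasurable.stronglyMeasurableAtFilter hintg.continuousAt).const_add _
  have hle : ∀ t ∈ Icc 0 T, 1 + ‖y t‖ ≤ F t := by
    intro t ht
    rw [hf.2.1 t ht, hF]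
    have h1 : ‖∫ s in (0:ℝ)..t, y' s‖ ≤ ∫ s in (0:ℝ)..t, β * (1 + ‖Y s‖) := by
      refine intervalIntegral.norm_integral_le_of_norm_le ht.1 ?_ (hintg.intervalIntegrable _ _)
      filter_upwards [feas_energy hT hCc hf, hf.2.2.2.2.2.1] with s hs1 hs2 hs
      have hs' : s ∈ Icc 0 T := ⟨hs.1.le, hs.2.trans ht.2⟩
      rw [hYe s hs']
      exact (hs1 hs').2.2.trans (hgrow _ _ (hs2 hs'))
    have := norm_add_le x0 (∫ s in (0:ℝ)..t, y' s)
    dsimp only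
    linarith
  have hanti : AntitoneOn (fun t => F t * Real.exp (-(β * t))) (Icc 0 T) := by
    have hd : ∀ t, HasDerivAt (fun t => F t * Real.exp (-(β * t))) ((β * (1 + ‖Y t‖)) * Real.exp (-(β * t)) + F t * (Real.exp (-(β * t)) * (-(β * 1)))) t := by
      intro t
      exact (hFd t).mul (((hasDerivAt_id t).const_mul β).neg.exp)
    refine antitoneOn_of_deriv_nonpos (convex_Icc 0 T) (fun t _ => (hd t).continuousAt.continuousWithinAt)
      (fun t _ => (hd t).differentiableAt.differentiableWithinAt) ?_
    intro t ht
    rw [interior_Icc] at ht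
    have ht' : t ∈ Icc 0 T := ⟨ht.1.le, ht.2.le⟩
    rw [(hd t).deriv, hYe t ht']
    have := mul_le_mul_of_nonneg_left (hle t ht') hβ.le
    nlinarith [Real.exp_pos (-(β * t))]
  intro t ht
  have h1 := hanti ⟨le_rfl, hT.le⟩ ht ht.1
  simp only [mul_zero, neg_zero, Real.exp_zero, mul_one] at h1
  have h0 : F 0 = 1 + ‖x0‖ := by simp [hF]
  rw [h0] at h1
  calc 1 + ‖y t‖ ≤ F t := hle t ht
    _ = F t * Real.exp (-(β * t)) * Real.exp (β * t) := by
        rw [mul_assoc, ← Real.exp_add]; simp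
    _ ≤ (1 + ‖x0‖) * Real.exp (β * t) := by gcongr
    _ ≤ _ := by gcongr; exact ht.2

theorem proj_near {n s : ℕ} (xs : Fin s → Euc n) (c : Fin s → ℝ) (hLI : LinearIndependent ℝ xs) :
    ∃ D : ℝ, 0 ≤ D ∧ ∀ x ε, (∀ j, rp xs c j x ≤ ε) → ∃ z, (∀ j, ⟪xs j, z⟫ ≤ c j) ∧ ‖x - z‖ ≤ D * ε := by
  classical
  obtain ⟨f, hf⟩ := exists_coords hLI
  set w : Fin s → Euc n := fun j => (InnerProductSpace.toDual ℝ (Euc n)).symm ((ContinuousLinearMap.proj j).comp f) with hw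
  have hww : ∀ i j, ⟪xs i, w j⟫ = if i = j then 1 else 0 := by
    intro i j
    rw [real_inner_comm, hw, InnerProductSpace.toDual_symm_apply]
    have := hf (Pi.single i 1)
    have e : ∑ k, (Pi.single i (1:ℝ) : Fin s → ℝ) k • xs k = xs i := by
      rw [Finset.sum_eq_single i] <;> simp +contextual [Pi.single_apply]
    rw [e] at this
    simp [this, Pi.single_apply, eq_comm]
  refine ⟨∑ j, ‖w j‖, Finset.sum_nonneg fun _ _ => norm_nonneg _, fun x ε h => ⟨x - ∑ j, rp xs c j x • w j, fun i => ?_, ?_⟩⟩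
  · rw [inner_sub_right, inner_sum]
    have : ∑ j, ⟪xs i, rp xs c j x • w j⟫ = rp xs c i x := by
      simp [real_inner_smul_right, hww]
    rw [this]
    have : ⟪xs i, x⟫ - c i ≤ rp xs c i x := le_max_left _ _
    linarith
  · rw [sub_sub_cancel, Finset.sum_mul]
    refine norm_sum_le_of_le _ fun j _ => ?_
    rw [norm_smul, Real.norm_eq_abs, abs_of_nonneg (rp_nonneg xs c j x), mul_comm]
    gcongr; exact h j

theorem disc_energy {n d s : ℕ} (xs : Fin s → Euc n) (c : Fin s → ℝ) {T : ℝ} (hT : 0 < T)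
    {g : WithLp 2 (Euc n × Euc d) → Euc n} {N : ℕ} (hN : 0 < N) {x : ℕ → Euc n} {v : ℕ → Euc d}
    (hx0 : ∀ j, ⟪xs j, x 0⟫ ≤ c j) {G : ℝ} (hG : ∀ i < N, ‖g (pmk (x i) (v i))‖ ≤ G) :
    ∀ i ≤ N, N * pW xs c (x i) ≤ ∑ j ∈ Finset.range i, (‖dR xs c (T / N) T g x v j‖ ^ 2 / (T / N) / 2 + (T / N) * G ^ 2 / 2) := by
  intro i
  induction i with
  | zero => intro _; simp [pW_zero xs c hx0]
  | succ i ih =>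
    intro hi
    have hN' : (0:ℝ) < N := Nat.cast_pos.2 hN
    rw [Finset.sum_range_succ]
    have h1 := ih (by omega)
    set h := T / (N:ℝ) with hh
    have hh0 : 0 < h := by positivity
    have hTh : T = h * N := by rw [hh]; field_simp
    have hcv := pW_convex xs c (x (i + 1)) (x i - x (i + 1))
    rw [add_sub_cancel] at hcv
    set Δ := x (i + 1) - x i with hΔ
    have e0 : x i - x (i + 1) = -Δ := by rw [hΔ]; abel
    rw [e0, inner_neg_right] at hcv
    set R := dR xs c h T g x v i with hR
    have hpz : T • pz xs c (x (i + 1)) = R - h • g (pmk (x i) (v i)) - Δ := by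
      rw [hR, dR, hΔ]; abel
    have hin : T * ⟪pz xs c (x (i + 1)), Δ⟫ = ⟪R, Δ⟫ - h * ⟪g (pmk (x i) (v i)), Δ⟫ - ‖Δ‖ ^ 2 := by
      rw [← real_inner_smul_left, hpz, inner_sub_left, inner_sub_left, real_inner_smul_left, real_inner_self_eq_norm_sq]
    have a1 := real_inner_le_norm R Δ
    have a2 := real_inner_le_norm (-g (pmk (x i) (v i))) Δ
    rw [inner_neg_left, norm_neg] at a2
    have a3 := hG i (by omega)
    have a4 : h * (-⟪g (pmk (x i) (v i)), Δ⟫) ≤ h * (G * ‖Δ‖) := by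
      gcongr; exact a2.trans (by gcongr)
    have a5 : T * ⟪pz xs c (x (i + 1)), Δ⟫ ≤ ‖R‖ ^ 2 / 2 + h ^ 2 * G ^ 2 / 2 := by
      nlinarith [sq_nonneg (‖R‖ - ‖Δ‖), sq_nonneg (h * G - ‖Δ‖)]
    have a6 : N * ⟪pz xs c (x (i + 1)), Δ⟫ ≤ ‖R‖ ^ 2 / h / 2 + h * G ^ 2 / 2 := by
      have e1 : h * (N * ⟪pz xs c (x (i + 1)), Δ⟫) ≤ h * (‖R‖ ^ 2 / h / 2 + h * G ^ 2 / 2) := by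
        have : h * (‖R‖ ^ 2 / h / 2 + h * G ^ 2 / 2) = ‖R‖ ^ 2 / 2 + h ^ 2 * G ^ 2 / 2 := by field_simp
        rw [this, ← mul_assoc, ← hTh]; exact a5
      exact le_of_mul_le_mul_left e1 hh0
    have a7 := mul_le_mul_of_nonneg_left hcv hN'.le
    linarith

theorem disc_pen {n d s : ℕ} (xs : Fin s → Euc n) (c : Fin s → ℝ) {T : ℝ} (hT : 0 < T)
    (g : WithLp 2 (Euc n × Euc d) → Euc n) (G : ℝ) {ε : ℝ} (hε : 0 < ε) :
    ∀ᶠ N : ℕ in atTop, ∀ (x : ℕ → Euc n) (v : ℕ → Euc d), (∀ j, ⟪xs j, x 0⟫ ≤ c j) →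
      (∀ i < N, ‖g (pmk (x i) (v i))‖ ≤ G) →
      ∑ j ∈ Finset.range N, ‖dR xs c (T / N) T g x v j‖ ^ 2 / (T / N) ≤ 1 →
      ∀ i ≤ N, ∀ j, rp xs c j (x i) ≤ ε := by
  have h1 : Tendsto (fun N : ℕ => (3 * (1 / 2 + T * G ^ 2 / 2)) / (N:ℝ)) atTop (𝓝 0) := tendsto_const_div_atTop_nhds_zero_nat _
  filter_upwards [eventually_gt_atTop 0, h1.eventually (gt_mem_nhds (by positivity : 0 < ε ^ 3))] with N hN hs x v hx0 hG hsum i hi j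
  have hN' : (0:ℝ) < N := Nat.cast_pos.2 hN
  have he := disc_energy xs c hT hN hx0 hG i hi
  have hle : N * pW xs c (x i) ≤ 1 / 2 + T * G ^ 2 / 2 := by
    refine he.trans ?_
    calc _ ≤ ∑ j ∈ Finset.range N, (‖dR xs c (T / N) T g x v j‖ ^ 2 / (T / N) / 2 + (T / N) * G ^ 2 / 2) := by
          refine Finset.sum_le_sum_of_subset_of_nonneg (Finset.range_mono hi) fun k _ _ => by positivity
      _ = (∑ j ∈ Finset.range N, ‖dR xs c (T / N) T g x v j‖ ^ 2 / (T / N)) / 2 + T * G ^ 2 / 2 := by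
          rw [Finset.sum_add_distrib, ← Finset.sum_div]
          simp; field_simp
      _ ≤ _ := by linarith
  have h3 := rp_le_of_pW xs c (x i) j
  have h4 : rp xs c j (x i) ^ 3 < ε ^ 3 := by
    refine lt_of_le_of_lt h3 (lt_of_le_of_lt ?_ hs)
    rw [le_div_iff₀ hN']; linarith
  exact (lt_of_pow_lt_pow_left₀ 3 hε.le h4).le

theorem disc_close {n d s : ℕ} (xs : Fin s → Euc n) (c : Fin s → ℝ) (hLI : LinearIndependent ℝ xs) {T : ℝ} (hT : 0 < T)
    {C : Set (Euc n)} (hC : C = {x | ∀ j, ⟪xs j, x⟫ ≤ c j})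
    {g : WithLp 2 (Euc n × Euc d) → Euc n} {R K G : ℝ} (hK0 : 0 ≤ K) (hG0 : 0 ≤ G)
    (hK : ∀ x x' u u', ‖x‖ ≤ R → ‖x'‖ ≤ R → ‖u‖ ≤ R → ‖u'‖ ≤ R →
      ‖g (pmk x u) - g (pmk x' u')‖ ≤ K * (‖x - x'‖ + ‖u - u'‖))
    (hG : ∀ x u, ‖x‖ ≤ R → ‖u‖ ≤ R → ‖g (pmk x u)‖ ≤ G) {ε : ℝ} (hε : 0 < ε) :
    ∃ δ > (0:ℝ), ∀ᶠ N : ℕ in atTop, ∀ (y ξ : ℝ → Euc n) (u : ℝ → Euc d) (x : ℕ → Euc n) (v : ℕ → Euc d),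
      NiceTraj T C g G (2 * G) y ξ u → AEStronglyMeasurable u (volume.restrict (Icc 0 T)) →
      (∀ᵐ t, t ∈ Icc 0 T → ‖u t‖ ≤ R) → (∀ t ∈ Icc 0 T, ‖y t‖ ≤ R) → x 0 = y 0 →
      (∀ i < N, ‖x i‖ ≤ R) → (∀ i < N, ‖v i‖ ≤ R) →
      ∑ j ∈ Finset.range N, ‖dR xs c (T / N) T g x v j‖ ^ 2 / (T / N) ≤ δ →
      ∑ j ∈ Finset.range N, (∫ t in (gp T N j)..(gp T N (j + 1)), ‖u t - v j‖ ^ 2) ≤ δ →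
      ∀ i ≤ N, ‖x i - y (gp T N i)‖ ≤ ε := by
  obtain ⟨D, hD0, hD⟩ := proj_near xs c hLI
  set Ex := Real.exp (4 * (T * (1 + 3 * K))) with hEx
  have hEx0 : 0 < Ex := Real.exp_pos _
  -- continuity of error functional at zero
  have hcont : Tendsto (fun δ : ℝ => Ex * (2 * (δ + K * δ + T * (2 * (2 * G) * (D * δ + G * δ) + K * G ^ 2 * δ ^ 2)))) (𝓝[>] 0) (𝓝 0) := by
    have : Continuous (fun δ : ℝ => Ex * (2 * (δ + K * δ + T * (2 * (2 * G) * (D * δ + G * δ) + K * G ^ 2 * δ ^ 2)))) := by fun_prop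
    have h2 := this.tendsto 0
    simp only [mul_zero, add_zero, ne_eq, OfNat.ofNat_ne_zero, not_false_eq_true, zero_pow] at h2
    exact h2.mono_left nhdsWithin_le_nhds
  obtain ⟨δ, hδ, hδ0⟩ := ((hcont.eventually (gt_mem_nhds (by positivity : 0 < ε ^ 2))).and self_mem_nhdsWithin).exists
  have hδ0 : 0 < δ := hδ0
  refine ⟨min δ 1, lt_min hδ0 one_pos, ?_⟩
  have hs1 : Tendsto (fun N : ℕ => T / (N:ℝ)) atTop (𝓝 0) := tendsto_const_div_atTop_nhds_zero_nat _
  have hs2 : Tendsto (fun N : ℕ => T / (N:ℝ) * (1 + 3 * K)) atTop (𝓝 0) := by simpa using hs1.mul_const (1 + 3 * K)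
  filter_upwards [eventually_gt_atTop 0, hs1.eventually (gt_mem_nhds hδ0), hs2.eventually (gt_mem_nhds (by norm_num : (0:ℝ) < 1 / 2)),
    disc_pen xs c hT g G hδ0] with N hN hN1 hN2 hpen y ξ u x v hy hum hub hyb hx0 hxR hvR hS1 hS2 i hi
  have hN' : (0:ℝ) < N := Nat.cast_pos.2 hN
  have hyC : y 0 ∈ C := hy.1 0 ⟨le_rfl, hT.le⟩
  have hp := hpen x v (by rw [hx0]; rw [hC] at hyC; exact hyC) (fun i hi => hG _ _ (hxR i hi) (hvR i hi)) (hS1.trans (min_le_right _ _))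
  have hE := lemmaE hT hK0 (by positivity : 0 ≤ 2 * G) hG0 hK hy hum hub hyb hN (x := x) (ζ := fun i => (N:ℝ) • pz xs c (x i))
    (Rr := fun i => dR xs c (T / N) T g x v i) (v := v) (σ := D * δ) (by positivity) hx0 hxR hvR
    (fun i hi => by
      rw [dR, smul_smul, div_mul_cancel₀ _ hN'.ne'])
    (fun i hi z hz => by
      rw [real_inner_smul_left]
      rw [hC] at hz
      exact mul_nonpos_of_nonneg_of_nonpos hN'.le (pz_inner_le xs c _ hz))
    (fun i hi => by
      obtain ⟨z, hz, hz2⟩ := hD (x (i + 1)) δ (fun j => hp (i + 1) (by omega) j)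
      exact ⟨z, by rw [hC]; exact hz, hz2⟩) hN2.le i hi
  refine le_of_sq_le_sq (hE.trans (le_trans ?_ hδ.le)) hε.le
  have hS1' := hS1.trans (min_le_left _ _)
  have hS2' := hS2.trans (min_le_left _ _)
  have : 0 ≤ T / N := by positivity
  gcongr

/-- Data for the core case. -/
structure Core {n d s : ℕ} (T : ℝ) (xs : Fin s → Euc n) (c : Fin s → ℝ) (C : Set (Euc n)) (x0 : Euc n)
    (φ : Euc n → ℝ) (U : Set (Euc d)) (g : WithLp 2 (Euc n × Euc d) → Euc n) (β : ℝ)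
    (xb xb' : ℝ → Euc n) (ub : ℝ → Euc d) (vb : ℝ → ℝ) : Prop where
  hT : 0 < T
  hC : C = {x | ∀ j, ⟪xs j, x⟫ ≤ c j}
  hx0 : x0 ∈ C
  hφ : LocallyLipschitz φ
  hUc : IsCompact U
  hUne : U.Nonempty
  hgc : Continuous g
  hgL : GLip g
  hβ : 0 < β
  hgrow : ∀ (x : Euc n), ∀ u ∈ U, ‖g (pmk x u)‖ ≤ β * (1 + ‖x‖)
  hfeas : FeasibleP T x0 C U g xb xb' ub
  hloc : LocMin T x0 C U g φ xb ub
  hLI : LinearIndependent ℝ xs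
  hTin : ∀ j, ⟪xs j, xb T⟫ < c j
  hv : ∀ a ∈ Icc 0 T, ∀ b ∈ Icc 0 T, a ≤ b → ‖ub b - ub a‖ ≤ vb b - vb a
  hrc : ∀ t ∈ Ico 0 T, ContinuousWithinAt ub (Ici t) t

theorem poly_closed {n s : ℕ} (xs : Fin s → Euc n) (c : Fin s → ℝ) : IsClosed {x : Euc n | ∀ j, ⟪xs j, x⟫ ≤ c j} := by
  have : {x : Euc n | ∀ j, ⟪xs j, x⟫ ≤ c j} = ⋂ j, {x | ⟪xs j, x⟫ ≤ c j} := by ext; simp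
  rw [this]
  exact isClosed_iInter fun j => isClosed_le (by fun_prop) continuous_const

theorem poly_convex {n s : ℕ} (xs : Fin s → Euc n) (c : Fin s → ℝ) : Convex ℝ {x : Euc n | ∀ j, ⟪xs j, x⟫ ≤ c j} := by
  intro x hx y hy a b ha hb hab j
  rw [inner_add_right, real_inner_smul_right, real_inner_smul_right]
  have h1 := mul_le_mul_of_nonneg_left (hx j) ha
  have h2 := mul_le_mul_of_nonneg_left (hy j) hb
  have : a * c j + b * c j = c j := by rw [← add_mul, hab, one_mul]
  linarith

theorem rc_ae_mem {d : ℕ} {T : ℝ} {ub : ℝ → Euc d} {U : Set (Euc d)} (hU : IsClosed U)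
    (h : ∀ᵐ t, t ∈ Icc 0 T → ub t ∈ U)
    (hrc : ∀ t ∈ Ico 0 T, ContinuousWithinAt ub (Ici t) t) : ∀ t ∈ Ico 0 T, ub t ∈ U := by
  intro t ht
  have hd : Dense {τ | τ ∈ Icc 0 T → ub τ ∈ U} := Measure.dense_of_ae h
  by_contra hcon
  have h1 : ∀ᶠ τ in 𝓝[Ici t] t, ub τ ∉ U := (hrc t ht).eventually (hU.isOpen_compl.mem_nhds hcon)
  have h2 : ∀ᶠ τ in 𝓝[>] t, ub τ ∉ U := h1.filter_mono (nhdsWithin_mono _ Ioi_subset_Ici_self)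
  obtain ⟨b, hb, hb2⟩ := (mem_nhdsGT_iff_exists_Ioo_subset).1 h2
  obtain ⟨τ, hτ1, hτ2⟩ := hd.exists_between (lt_min hb ht.2)
  exact hb2 ⟨hτ2.1, hτ2.2.trans_le (min_le_left _ _)⟩ (hτ1 ⟨ht.1.trans hτ2.1.le, (hτ2.2.trans_le (min_le_right _ _)).le⟩)

theorem competitor {n d s : ℕ} (xs : Fin s → Euc n) (c : Fin s → ℝ) {T : ℝ} (hT : 0 < T) {x0 : Euc n}
    (hx0 : ∀ j, ⟪xs j, x0⟫ ≤ c j) {U : Set (Euc d)} {g : WithLp 2 (Euc n × Euc d) → Euc n} {β : ℝ} (hβ : 0 < β)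
    (hgrow : ∀ (x : Euc n), ∀ u ∈ U, ‖g (pmk x u)‖ ≤ β * (1 + ‖x‖)) {N : ℕ} (hN : 0 < N) (ua : ℕ → Euc d) (hua : ∀ i, ua i ∈ U) :
    ∃ x : ℕ → Euc n, x 0 = x0 ∧ (∀ i, dR xs c (T / N) T g x ua i = 0) ∧
      ∀ i ≤ N, 1 + ‖x i‖ ≤ (1 + ‖x0‖) * Real.exp (β * T) := by
  choose P hP using pen_resolvent xs c hT.le
  set h := T / (N:ℝ) with hh
  have hh0 : 0 ≤ h := by positivity
  set x : ℕ → Euc n := fun i => Nat.rec x0 (fun i y => P (y - h • g (pmk y (ua i)))) i with hx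
  have hxs : ∀ i, x (i + 1) + T • pz xs c (x (i + 1)) = x i - h • g (pmk (x i) (ua i)) := fun i => hP _
  refine ⟨x, rfl, fun i => ?_, fun i hi => ?_⟩
  · unfold dR
    have : x (i + 1) - x i + h • g (pmk (x i) (ua i)) + T • pz xs c (x (i + 1)) = (x (i + 1) + T • pz xs c (x (i + 1))) - (x i - h • g (pmk (x i) (ua i))) := by abel
    rw [this, hxs, sub_self]
  · have h1 : ∀ i, 1 + ‖x0‖ + ‖x i - x0‖ ≤ (1 + ‖x0‖) * Real.exp (β * (i * h)) := by
      intro i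
      induction i with
      | zero =>
        have : x 0 = x0 := rfl
        simp [this]
      | succ i ih =>
        have e0 := hxs i
        have e1 := mul_nonneg_of_nonpos_of_nonpos (by linarith : -T ≤ 0) (pz_inner_le xs c (x (i + 1)) hx0)
        have e2 : x (i + 1) - x0 = (x i - x0 - h • g (pmk (x i) (ua i))) - T • pz xs c (x (i + 1)) := by
          have : x (i + 1) = x i - h • g (pmk (x i) (ua i)) - T • pz xs c (x (i + 1)) := eq_sub_of_add_eq e0
          nth_rewrite 1 [this]; abel
        have e3 : ‖x (i + 1) - x0‖ ^ 2 ≤ ‖x i - x0 - h • g (pmk (x i) (ua i))‖ * ‖x (i + 1) - x0‖ := by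
          have e4 : ‖x (i + 1) - x0‖ ^ 2 = ⟪x i - x0 - h • g (pmk (x i) (ua i)), x (i + 1) - x0⟫ - T * ⟪pz xs c (x (i + 1)), x (i + 1) - x0⟫ := by
            rw [← real_inner_self_eq_norm_sq]
            nth_rewrite 1 [e2]
            rw [inner_sub_left, real_inner_smul_left]
          have e5 : ⟪pz xs c (x (i + 1)), x0 - x (i + 1)⟫ = - ⟪pz xs c (x (i + 1)), x (i + 1) - x0⟫ := by
            rw [← inner_neg_right, neg_sub]
          rw [e5] at e1
          have := real_inner_le_norm (x i - x0 - h • g (pmk (x i) (ua i))) (x (i + 1) - x0)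
          linarith
        have e6 : ‖x (i + 1) - x0‖ ≤ ‖x i - x0 - h • g (pmk (x i) (ua i))‖ := by
          by_contra hcon
          push Not at hcon
          have : 0 < ‖x (i + 1) - x0‖ := (norm_nonneg _).trans_lt hcon
          nlinarith
        have e7 : ‖x i - x0 - h • g (pmk (x i) (ua i))‖ ≤ ‖x i - x0‖ + h * (β * (1 + ‖x i‖)) := by
          refine (norm_sub_le _ _).trans ?_
          rw [norm_smul, Real.norm_eq_abs, abs_of_nonneg hh0]
          gcongr; exact hgrow _ _ (hua i)
        have e8 : ‖x i‖ ≤ ‖x i - x0‖ + ‖x0‖ := by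
          have := norm_add_le (x i - x0) x0
          rwa [sub_add_cancel] at this
        have e9 : h * (β * (1 + ‖x i‖)) ≤ h * (β * (1 + ‖x0‖ + ‖x i - x0‖)) := mul_le_mul_of_nonneg_left (mul_le_mul_of_nonneg_left (by linarith) hβ.le) hh0
        calc 1 + ‖x0‖ + ‖x (i + 1) - x0‖ ≤ (1 + ‖x0‖ + ‖x i - x0‖) * (β * h + 1) := by linarith
          _ ≤ ((1 + ‖x0‖) * Real.exp (β * (i * h))) * Real.exp (β * h) := by
              gcongr
              exact Real.add_one_le_exp _
          _ = _ := by rw [mul_assoc, ← Real.exp_add]; push_cast; ring_nf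
    have e8 : ‖x i‖ ≤ ‖x i - x0‖ + ‖x0‖ := by
      have := norm_add_le (x i - x0) x0
      rwa [sub_add_cancel] at this
    have h2 : (1 + ‖x0‖) * Real.exp (β * (i * h)) ≤ (1 + ‖x0‖) * Real.exp (β * T) := by
      gcongr; exact (gp_mem hT hN hi).2
    linarith [h1 i]

theorem sq_ii {d : ℕ} {T R : ℝ} (hT : 0 < T) {u : ℝ → Euc d} (hum : AEStronglyMeasurable u (volume.restrict (Icc 0 T)))
    (hb : ∀ᵐ t, t ∈ Icc 0 T → ‖u t‖ ≤ R) (z : Euc d) {N i : ℕ} (hN : 0 < N) (hi : i < N) :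
    IntervalIntegrable (fun t => ‖u t - z‖ ^ 2) volume (gp T N i) (gp T N (i + 1)) := by
  have h1 := (ctrl_int (hum.sub (aestronglyMeasurable_const (b := z))) (R := R + ‖z‖) (by
    filter_upwards [hb] with t ht htt
    exact (norm_sub_le _ _).trans (by linarith [ht htt]))).2
  rw [intervalIntegrable_iff]
  exact h1.mono_set (uIoc_subset_uIcc.trans (uIcc_subset_Icc (gp_mem hT hN hi.le) (gp_mem hT hN hi)))

theorem ctrl_tri {d : ℕ} {T R : ℝ} (hT : 0 < T) {u : ℝ → Euc d} (hum : AEStronglyMeasurable u (volume.restrict (Icc 0 T)))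
    (hb : ∀ᵐ t, t ∈ Icc 0 T → ‖u t‖ ≤ R) (z v : ℕ → Euc d) {N : ℕ} (hN : 0 < N) :
    ∑ j ∈ Finset.range N, (∫ t in (gp T N j)..(gp T N (j + 1)), ‖u t - v j‖ ^ 2) ≤
      2 * ∑ j ∈ Finset.range N, (∫ t in (gp T N j)..(gp T N (j + 1)), ‖u t - z j‖ ^ 2) +
      2 * ∑ j ∈ Finset.range N, (T / N) * ‖z j - v j‖ ^ 2 := by
  rw [Finset.mul_sum, Finset.mul_sum, ← Finset.sum_add_distrib]
  refine Finset.sum_le_sum fun j hj => ?_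
  have hj := Finset.mem_range.1 hj
  have h1 := sq_ii hT hum hb (z j) hN hj
  have h2 := sq_ii hT hum hb (v j) hN hj
  have e : 2 * (∫ t in (gp T N j)..(gp T N (j + 1)), ‖u t - z j‖ ^ 2) + 2 * ((T / N) * ‖z j - v j‖ ^ 2) =
      ∫ t in (gp T N j)..(gp T N (j + 1)), (2 * ‖u t - z j‖ ^ 2 + 2 * ‖z j - v j‖ ^ 2) := by
    rw [intervalIntegral.integral_add (h1.const_mul 2) intervalIntegrable_const, intervalIntegral.integral_const_mul,
      intervalIntegral.integral_const, gp_succ, add_sub_cancel_left, smul_eq_mul]; ring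
  rw [e]
  refine intervalIntegral.integral_mono_on (gp_le hT) h2 ((h1.const_mul 2).add intervalIntegrable_const) fun t _ => ?_
  have : u t - v j = (u t - z j) + (z j - v j) := by abel
  rw [this]
  have h3 := norm_add_le (u t - z j) (z j - v j)
  have h4 : ‖u t - z j + (z j - v j)‖ ^ 2 ≤ (‖u t - z j‖ + ‖z j - v j‖) ^ 2 := by gcongr
  nlinarith [sq_nonneg (‖u t - z j‖ - ‖z j - v j‖)]

theorem ctrl_bv {d : ℕ} {T R : ℝ} (hT : 0 < T) {u : ℝ → Euc d} (hum : AEStronglyMeasurable u (volume.restrict (Icc 0 T)))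
    (hb : ∀ᵐ t, t ∈ Icc 0 T → ‖u t‖ ≤ R) {vb : ℝ → ℝ}
    (hv : ∀ a ∈ Icc 0 T, ∀ b ∈ Icc 0 T, a ≤ b → ‖u b - u a‖ ≤ vb b - vb a) {N : ℕ} (hN : 0 < N) :
    ∑ j ∈ Finset.range N, (∫ t in (gp T N j)..(gp T N (j + 1)), ‖u t - u (gp T N j)‖ ^ 2) ≤ (T / N) * (vb T - vb 0) ^ 2 := by
  have hstep : ∀ j < N, 0 ≤ vb (gp T N (j + 1)) - vb (gp T N j) := fun j hj =>
    (norm_nonneg _).trans (hv _ (gp_mem hT hN hj.le) _ (gp_mem hT hN hj) (gp_le hT))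
  have hVtel : ∑ j ∈ Finset.range N, (vb (gp T N (j + 1)) - vb (gp T N j)) = vb T - vb 0 := by
    rw [Finset.sum_range_sub (fun j => vb (gp T N j)), gp_last T hN, gp_zero]
  have h1 : ∀ j ∈ Finset.range N, (∫ t in (gp T N j)..(gp T N (j + 1)), ‖u t - u (gp T N j)‖ ^ 2) ≤
      (T / N) * ((vb T - vb 0) * (vb (gp T N (j + 1)) - vb (gp T N j))) := by
    intro j hj
    have hj' := Finset.mem_range.1 hj
    have hs := hstep j hj'
    have hsV : vb (gp T N (j + 1)) - vb (gp T N j) ≤ vb T - vb 0 := by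
      rw [← hVtel]
      exact Finset.single_le_sum (f := fun j => vb (gp T N (j + 1)) - vb (gp T N j)) (fun k hk => hstep k (Finset.mem_range.1 hk)) hj
    calc _ ≤ ∫ t in (gp T N j)..(gp T N (j + 1)), (vb (gp T N (j + 1)) - vb (gp T N j)) ^ 2 := by
          refine intervalIntegral.integral_mono_on (gp_le hT) (sq_ii hT hum hb _ hN hj') intervalIntegrable_const fun t ht => ?_
          have m1 := gp_mem hT hN hj'.le
          have m2 := gp_mem hT hN (Nat.succ_le_of_lt hj')
          have ht' : t ∈ Icc 0 T := ⟨m1.1.trans ht.1, ht.2.trans m2.2⟩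
          have a1 := hv _ m1 t ht' ht.1
          have a2 := (norm_nonneg _).trans (hv t ht' _ m2 ht.2)
          have a3 : ‖u t - u (gp T N j)‖ ≤ vb (gp T N (j + 1)) - vb (gp T N j) := by simp only [Nat.succ_eq_add_one] at a2; linarith
          gcongr
      _ = (T / N) * (vb (gp T N (j + 1)) - vb (gp T N j)) ^ 2 := by
          rw [intervalIntegral.integral_const, gp_succ, add_sub_cancel_left, smul_eq_mul]
      _ ≤ _ := by rw [sq]; gcongr
  refine (Finset.sum_le_sum h1).trans (le_of_eq ?_)
  rw [← Finset.mul_sum, ← Finset.mul_sum, hVtel, sq]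

/-- step control -/
def stepc {d : ℕ} (T : ℝ) (N : ℕ) (w : ℕ → Euc d) (t : ℝ) : Euc d := w (gidx T N t)

theorem stepc_meas {d : ℕ} (T : ℝ) (N : ℕ) (w : ℕ → Euc d) : Measurable (stepc T N w) := by
  have h1 : Measurable (gidx T N) := by
    unfold gidx
    exact Nat.measurable_floor.comp (by fun_prop)
  exact (measurable_from_nat (f := w)).comp h1

theorem stepc_pc {d : ℕ} {T : ℝ} (hT : 0 < T) {N : ℕ} (hN : 0 < N) (w : ℕ → Euc d) : PiecewiseConstOn (stepc T N w) T := by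
  refine ⟨N, gp T N, gp_zero T N, gp_last T hN, fun i _ => ?_, fun i _ t ht => ?_⟩
  · rw [gp_succ]; have : 0 < T / (N:ℝ) := by positivity
    linarith
  · unfold stepc; rw [gidx_eq hT hN ht, gidx_gp hT hN]

theorem stepc_int {d : ℕ} {T : ℝ} (hT : 0 < T) {N : ℕ} (hN : 0 < N) (w : ℕ → Euc d) (j : ℕ) (f : Euc d → ℝ → ℝ) :
    ∫ t in (gp T N j)..(gp T N (j + 1)), f (stepc T N w t) t = ∫ t in (gp T N j)..(gp T N (j + 1)), f (w j) t := by
  refine intervalIntegral.integral_congr_Ioo_of_le (gp_le hT) fun t ht => ?_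
  show f (stepc T N w t) t = f (w j) t
  unfold stepc
  rw [gidx_eq hT hN ⟨ht.1.le, ht.2⟩]

/-- closeness of discrete optimal processes -/
def DGood {n d s : ℕ} (T : ℝ) (xs : Fin s → Euc n) (c : Fin s → ℝ) (U : Set (Euc d))
    (g : WithLp 2 (Euc n × Euc d) → Euc n) (xb : ℝ → Euc n) (ub : ℝ → Euc d) (ε : ℝ) (N : ℕ)
    (x : ℕ → Euc n) (u w : ℕ → Euc d) : Prop :=
  (∀ i ≤ N, ‖x i - xb (gp T N i)‖ ≤ ε) ∧ (∀ i < N, ‖u i - w i‖ ≤ ε) ∧ (∀ i, w i ∈ U) ∧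
  ∑ i ∈ Finset.range N, (T / N) * ‖w i - ub (gp T N i)‖ ^ 2 ≤ ε ∧
  ∑ j ∈ Finset.range N, ‖dR xs c (T / N) T g x u j‖ ^ 2 / (T / N) ≤ ε ∧
  (∀ i ≤ N, ∀ j, rp xs c j (x i) ≤ ε)

/-- discrete stationarity -/
def DStat {n d s : ℕ} (T : ℝ) (xs : Fin s → Euc n) (c : Fin s → ℝ) (U : Set (Euc d))
    (g : WithLp 2 (Euc n × Euc d) → Euc n) (φ : Euc n → ℝ) (ub : ℝ → Euc d) (A : ℝ) (N : ℕ)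
    (x : ℕ → Euc n) (u w : ℕ → Euc d) (q : ℕ → Euc n) (ψ : ℕ → Euc d) : Prop :=
  (∀ i, i + 1 < N → ∃ ω, ProxSub (fun z => ⟪q (i + 2), g z⟫) (pmk (x (i + 1)) (u (i + 1))) (pmk ω (-ψ (i + 1))) ∧
    q (i + 2) - q (i + 1) - ∑ j, bet xs c T (x (i + 1)) (q (i + 1)) j • xs j = (T / N) • ω) ∧
  (∀ i < N, ψ i + (2 * A) • (ub (gp T N i) - w i) ∈ limNormal U (w i)) ∧
  ProxSub φ (x N) (-(q N + ∑ j, bet xs c T (x N) (q N) j • xs j))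

theorem one_level {n d s : ℕ} {T : ℝ} (hT : 0 < T) (xs : Fin s → Euc n) (c : Fin s → ℝ) {x0 : Euc n}
    (hx0 : ∀ j, ⟪xs j, x0⟫ ≤ c j) {φ : Euc n → ℝ} (hφ : Continuous φ) {U : Set (Euc d)} (hUc : IsCompact U)
    {g : WithLp 2 (Euc n × Euc d) → Euc n} (hgc : Continuous g) (hgL : GLip g) {β : ℝ} (hβ : 0 < β)
    (hgrow : ∀ (x : Euc n), ∀ u ∈ U, ‖g (pmk x u)‖ ≤ β * (1 + ‖x‖)) (xb : ℝ → Euc n) (ub : ℝ → Euc d)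
    (hxb0 : xb 0 = x0)
    (hub : ∀ t ∈ Ico 0 T, ub t ∈ U) {Ru : ℝ} (hRu : ∀ w ∈ U, ‖w‖ ≤ Ru) {A : ℝ} (hA : 0 ≤ A) {N : ℕ} (hN : 0 < N) :
    ∃ (xc x : ℕ → Euc n) (u w : ℕ → Euc d) (q : ℕ → Euc n) (ψ : ℕ → Euc d),
      xc 0 = x0 ∧ (∀ i < N, dR xs c (T / N) T g xc (fun i => ub (gp T N i)) i = 0) ∧
      (∀ i ≤ N, 1 + ‖xc i‖ ≤ (1 + ‖x0‖) * Real.exp (β * T)) ∧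
      x 0 = x0 ∧ (∀ i ≤ N, ‖x i - xb (gp T N i)‖ ≤ 1) ∧ (∀ i, ‖u i‖ ≤ Ru) ∧ (∀ i, w i ∈ U) ∧
      ((∀ i ≤ N, ‖xc i - xb (gp T N i)‖ ≤ 1) → φ (x N) + ∑ i ∈ Finset.range N,
        ((N:ℝ) ^ 2 * (‖dR xs c (T / N) T g x u i‖ ^ 2 / (T / N)) + (N:ℝ) ^ 2 * ((T / N) * ‖u i - w i‖ ^ 2) + A * ((T / N) * ‖w i - ub (gp T N i)‖ ^ 2)) ≤ φ (xc N)) ∧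
      ((∀ i ≤ N, ‖x i - xb (gp T N i)‖ < 1) → (∀ i < N, ‖u i‖ < Ru) → DStat T xs c U g φ ub A N x u w q ψ) := by
  classical
  have hN' : (0:ℝ) < N := Nat.cast_pos.2 hN
  have hh : 0 < T / (N:ℝ) := by positivity
  have hgpI : ∀ i < N, gp T N i ∈ Ico 0 T := by
    intro i hi
    refine ⟨(gp_mem hT hN hi.le).1, lt_of_lt_of_le ?_ (gp_mem hT hN (Nat.succ_le_of_lt hi)).2⟩
    rw [Nat.succ_eq_add_one, gp_succ]; linarith
  set w0 := ub (gp T N 0) with hw0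
  have hw0U : w0 ∈ U := hub _ (hgpI 0 hN)
  have hRu0 : 0 ≤ Ru := (norm_nonneg _).trans (hRu w0 hw0U)
  set ua : ℕ → Euc d := fun i => if i < N then ub (gp T N i) else w0 with hua
  have huaU : ∀ i, ua i ∈ U := by
    intro i; rw [hua]; dsimp only
    split_ifs with hi
    · exact hub _ (hgpI i hi)
    · exact hw0U
  have huae : ∀ i < N, ua i = ub (gp T N i) := fun i hi => by rw [hua]; dsimp only; rw [if_pos hi]
  obtain ⟨xc, hxc0, hxcR, hxcb⟩ := competitor xs c hT hx0 hβ hgrow hN ua huaU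
  set xa : ℕ → Euc n := fun i => if i ≤ N then xb (gp T N i) else xc i with hxa
  have hxae : ∀ i ≤ N, xa i = xb (gp T N i) := fun i hi => by rw [hxa]; dsimp only; rw [if_pos hi]
  obtain ⟨x, u, w, hx0', hxb, hu, hw, hmin, hs1, hs2, hs3⟩ := disc_min xs c hh hT.le (by positivity : 0 < (N:ℝ) ^ 2) hA hgc hgL hφ hUc ⟨w0, hw0U⟩
    ua xa x0 Ru hRu0 (N := N)
  refine ⟨xc, x, u, w, fun i => (2 * ((N:ℝ) ^ 2 / (T / N))) • dR xs c (T / N) T g x u (i - 1), fun i => (2 * (N:ℝ) ^ 2) • (u i - w i),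
    hxc0, fun i hi => ?_, hxcb, hx0', fun i hi => ?_, hu, hw, fun hclose => ?_, fun hxi hui => ?_⟩
  · have := hxcR i
    unfold dR at this ⊢
    rwa [huae i hi] at this
  · rcases Nat.eq_zero_or_pos i with rfl | hi0
    · rw [hx0', gp_zero, hxb0]; simp
    · rw [← hxae i hi]; exact hxb i hi0
  · have h1 := hmin xc ua ua hxc0 (fun i hi => by
      by_cases hiN : i ≤ N
      · rw [hxae i hiN]; exact hclose i hiN
      · rw [hxa]; dsimp only; rw [if_neg hiN]; simp) (fun i => hRu _ (huaU i)) huaU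
    unfold dTot at h1
    have h2 : ∑ i ∈ Finset.range N, dJ xs c (T / N) T ((N:ℝ) ^ 2) A g ua xc ua ua i = 0 :=
      Finset.sum_eq_zero fun i _ => by simp [dJ, hxcR i]
    rw [h2, add_zero] at h1
    refine le_trans (le_of_eq ?_) h1
    congr 1
    refine Finset.sum_congr rfl fun i hi => ?_
    rw [dJ, huae i (Finset.mem_range.1 hi)]
    field_simp
  · refine ⟨fun i hi => ⟨_, hs1 i hi ?_ (hui _ hi), ?_⟩, fun i hi => ?_, ?_⟩
    · rw [hxae _ hi.le]; exact hxi _ hi.le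
    · rw [smul_smul, mul_inv_cancel₀ hh.ne', one_smul]
      rfl
    · have := hs2 i hi
      rwa [huae i hi] at this
    · have := hs3 (N - 1) (by omega) (by rw [hxae N le_rfl]; exact hxi N le_rfl)
      exact this

set_option maxHeartbeats 4000000 in
theorem disc_conv {n d s : ℕ} {T : ℝ} {xs : Fin s → Euc n} {c : Fin s → ℝ} {C : Set (Euc n)} {x0 : Euc n}
    {φ : Euc n → ℝ} {U : Set (Euc d)} {g : WithLp 2 (Euc n × Euc d) → Euc n} {β : ℝ}
    {xb xb' : ℝ → Euc n} {ub : ℝ → Euc d} {vb : ℝ → ℝ} (H : Core T xs c C x0 φ U g β xb xb' ub vb) :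
    ∃ A > (0:ℝ), ∃ (X : ℕ → ℕ → Euc n) (V W : ℕ → ℕ → Euc d) (q : ℕ → ℕ → Euc n) (ψ : ℕ → ℕ → Euc d),
      (∀ ε > (0:ℝ), ∀ᶠ N in atTop, DGood T xs c U g xb ub ε N (X N) (V N) (W N)) ∧
      ∀ᶠ N in atTop, DStat T xs c U g φ ub A N (X N) (V N) (W N) (q N) (ψ N) := by
  obtain ⟨hT, hC, hx0, hφ, hUc, hUne, hgc, hgL, hβ, hgrow, hfeas, ⟨δ0, hδ0, hloc⟩, hLI, hTin, hv, hrc⟩ := H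
  have hCc : IsClosed C := by rw [hC]; exact poly_closed xs c
  have hCconv : Convex ℝ C := by rw [hC]; exact poly_convex xs c
  have hx0' : ∀ j, ⟪xs j, x0⟫ ≤ c j := by rw [hC] at hx0; exact hx0
  have hubU := rc_ae_mem hUc.isClosed hfeas.2.2.2.2.2.1 hrc
  obtain ⟨RU', hRU'⟩ := isBounded_iff_forall_norm_le.1 hUc.isBounded
  set RU := max RU' 0 with hRUd
  have hRU : ∀ w ∈ U, ‖w‖ ≤ RU := fun w hw => (hRU' w hw).trans (le_max_left _ _)
  have hRU0 : 0 ≤ RU := le_max_right _ _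
  set Rx := (1 + ‖x0‖) * Real.exp (β * T) with hRx
  have hRx1 : 1 ≤ Rx := by
    have h1 : 1 ≤ Real.exp (β * T) := Real.one_le_exp (by positivity)
    nlinarith [norm_nonneg x0]
  set R := Rx + RU + 2 with hR
  obtain ⟨K, hK0, hK⟩ := hgL R
  set G := ‖g (pmk 0 0)‖ + K * (R + R) with hGd
  have hR0 : 0 ≤ R := by linarith
  have hG0 : 0 ≤ G := by positivity
  have hG : ∀ x u, ‖x‖ ≤ R → ‖u‖ ≤ R → ‖g (pmk x u)‖ ≤ G := by
    intro x u hx hu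
    have h1 := hK x 0 u 0 hx (by simpa using hR0) hu (by simpa using hR0)
    rw [sub_zero, sub_zero] at h1
    have h2 := norm_add_le (g (pmk x u) - g (pmk 0 0)) (g (pmk 0 0))
    rw [sub_add_cancel] at h2
    have h3 : K * (‖x‖ + ‖u‖) ≤ K * (R + R) := by gcongr
    linarith
  have hnice : ∀ y y' u, FeasibleP T x0 C U g y y' u →
      NiceTraj T C g G (2 * G) y (fun t => -y' t - g (pmk (y t) (u t))) u ∧ (∀ t ∈ Icc 0 T, ‖y t‖ ≤ R) ∧ (∀ᵐ t, t ∈ Icc 0 T → ‖u t‖ ≤ R) := by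
    intro y y' u hf
    have hb := feas_bound hT hCc hβ hgrow hf
    have hb' : ∀ t ∈ Icc 0 T, ‖y t‖ ≤ R := fun t ht => by linarith [hb t ht]
    refine ⟨feas_nice hT hCc hgc hf fun t ht w hw => hG _ _ (hb' t ht) (by linarith [hRU w hw]), hb', ?_⟩
    filter_upwards [hf.2.2.2.2.2.1] with t ht htt
    linarith [hRU _ (ht htt)]
  obtain ⟨hxbN, hxbR, hubR⟩ := hnice _ _ _ hfeas
  have hubm := hfeas.2.2.2.2.1
  have hxbRx : ∀ t ∈ Icc 0 T, ‖xb t‖ ≤ Rx - 1 := fun t ht => by linarith [feas_bound hT hCc hβ hgrow hfeas t ht]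
  have hφc : Continuous φ := hφ.continuous
  have hcomp : IsCompact (Metric.closedBall (0 : Euc n) R) := isCompact_closedBall _ _
  obtain ⟨Φb', hΦb'⟩ := hcomp.exists_bound_of_continuousOn hφc.continuousOn
  set Φb := max Φb' 0
  have hΦb0 : 0 ≤ Φb := le_max_right _ _
  have hΦb : ∀ x, ‖x‖ ≤ R → |φ x| ≤ Φb := fun x hx => (hΦb' x (by simpa using hx)).trans (le_max_left _ _)
  have hφu := hcomp.uniformContinuousOn_of_continuous hφc.continuousOn
  rw [Metric.uniformContinuousOn_iff] at hφu
  obtain ⟨δ1, hδ1, hcl1⟩ := disc_close xs c hLI hT hC hK0 hG0 hK hG (by positivity : 0 < δ0 / 8)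
  -- choose A
  obtain ⟨A, hA0, hA1, hA2⟩ : ∃ A > (0:ℝ), 8 * Φb / A ≤ δ1 / 2 ∧ 4 * Φb / A ≤ δ0 / 2 := by
    refine ⟨16 * Φb / δ1 + 8 * Φb / δ0 + 1, by positivity, ?_, ?_⟩
    · rw [div_le_iff₀ (by positivity)]
      have : δ1 / 2 * (16 * Φb / δ1 + 8 * Φb / δ0 + 1) = 8 * Φb + δ1 / 2 * (8 * Φb / δ0 + 1) := by field_simp; ring
      rw [this]
      have : 0 ≤ δ1 / 2 * (8 * Φb / δ0 + 1) := by positivity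
      linarith
    · rw [div_le_iff₀ (by positivity)]
      have : δ0 / 2 * (16 * Φb / δ1 + 8 * Φb / δ0 + 1) = 4 * Φb + δ0 / 2 * (16 * Φb / δ1 + 1) := by field_simp; ring
      rw [this]
      have : 0 ≤ δ0 / 2 * (16 * Φb / δ1 + 1) := by positivity
      linarith
  have hlev : ∀ N : ℕ, ∃ (xc x : ℕ → Euc n) (u w : ℕ → Euc d) (q : ℕ → Euc n) (ψ : ℕ → Euc d), 0 < N →
      (xc 0 = x0 ∧ (∀ i < N, dR xs c (T / N) T g xc (fun i => ub (gp T N i)) i = 0) ∧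
      (∀ i ≤ N, 1 + ‖xc i‖ ≤ (1 + ‖x0‖) * Real.exp (β * T)) ∧
      x 0 = x0 ∧ (∀ i ≤ N, ‖x i - xb (gp T N i)‖ ≤ 1) ∧ (∀ i, ‖u i‖ ≤ RU + 1) ∧ (∀ i, w i ∈ U) ∧
      ((∀ i ≤ N, ‖xc i - xb (gp T N i)‖ ≤ 1) → φ (x N) + ∑ i ∈ Finset.range N,
        ((N:ℝ) ^ 2 * (‖dR xs c (T / N) T g x u i‖ ^ 2 / (T / N)) + (N:ℝ) ^ 2 * ((T / N) * ‖u i - w i‖ ^ 2) + A * ((T / N) * ‖w i - ub (gp T N i)‖ ^ 2)) ≤ φ (xc N)) ∧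
      ((∀ i ≤ N, ‖x i - xb (gp T N i)‖ < 1) → (∀ i < N, ‖u i‖ < RU + 1) → DStat T xs c U g φ ub A N x u w q ψ)) := by
    intro N
    by_cases hN : 0 < N
    · obtain ⟨xc, x, u, w, q, ψ, h⟩ := one_level hT xs c hx0' hφc hUc hgc hgL hβ hgrow xb ub hfeas.1 hubU (Ru := RU + 1) (fun w hw => by linarith [hRU w hw]) hA0.le hN
      exact ⟨xc, x, u, w, q, ψ, fun _ => h⟩
    · exact ⟨0, 0, 0, 0, 0, 0, fun h => absurd h hN⟩
  choose Xc X V W q ψ hlev using hlev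
  refine ⟨A, hA0, X, V, W, q, ψ, ?_⟩
  -- abbreviations
  set SR : ℕ → ℝ := fun N => ∑ j ∈ Finset.range N, ‖dR xs c (T / N) T g (X N) (V N) j‖ ^ 2 / (T / N) with hSR
  set SU : ℕ → ℝ := fun N => ∑ j ∈ Finset.range N, (T / N) * ‖V N j - W N j‖ ^ 2 with hSU
  set SW : ℕ → ℝ := fun N => ∑ j ∈ Finset.range N, (T / N) * ‖W N j - ub (gp T N j)‖ ^ 2 with hSW
  have hSR0 : ∀ N, 0 ≤ SR N := fun N => Finset.sum_nonneg fun _ _ => by positivity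
  have hSU0 : ∀ N, 0 ≤ SU N := fun N => Finset.sum_nonneg fun _ _ => by positivity
  have hSW0 : ∀ N, 0 ≤ SW N := fun N => Finset.sum_nonneg fun _ _ => by positivity
  have hs1 : Tendsto (fun N : ℕ => T / (N:ℝ)) atTop (𝓝 0) := tendsto_const_div_atTop_nhds_zero_nat _
  have hsm : ∀ B : ℝ, ∀ ε > (0:ℝ), ∀ᶠ N : ℕ in atTop, B * (T / (N:ℝ)) ≤ ε := by
    intro B ε hε
    have : Tendsto (fun N : ℕ => B * (T / (N:ℝ))) atTop (𝓝 0) := by simpa using hs1.const_mul B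
    filter_upwards [this.eventually (gt_mem_nhds hε)] with N hN using hN.le
  -- competitor convergence
  have hcomp1 : ∀ ε > (0:ℝ), ∀ᶠ N in atTop, ∀ i ≤ N, ‖Xc N i - xb (gp T N i)‖ ≤ ε := by
    intro ε hε
    obtain ⟨δ, hδ, hcl⟩ := disc_close xs c hLI hT hC hK0 hG0 hK hG hε
    filter_upwards [hcl, eventually_gt_atTop 0, hsm ((vb T - vb 0) ^ 2) δ hδ] with N hN hN0 hsN
    obtain ⟨l1, l2, l3, -⟩ := hlev N hN0
    refine hN xb _ ub (Xc N) (fun i => ub (gp T N i)) hxbN hubm hubR hxbR (by rw [l1, hfeas.1]) (fun i hi => by linarith [l3 i hi.le]) (fun i hi => ?_) ?_ ?_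
    · have : gp T N i ∈ Ico 0 T := by
        have hh : 0 < T / (N:ℝ) := by positivity
        refine ⟨(gp_mem hT hN0 hi.le).1, lt_of_lt_of_le ?_ (gp_mem hT hN0 (Nat.succ_le_of_lt hi)).2⟩
        rw [Nat.succ_eq_add_one, gp_succ]; linarith
      linarith [hRU _ (hubU _ this)]
    · rw [Finset.sum_eq_zero fun i hi => by rw [l2 i (Finset.mem_range.1 hi)]; simp]
      exact hδ.le
    · refine (ctrl_bv hT hubm hubR hv hN0).trans ?_
      linarith
  have hXR : ∀ N, 0 < N → ∀ i ≤ N, ‖X N i‖ ≤ R := by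
    intro N hN i hi
    obtain ⟨-, -, -, -, l5, -⟩ := hlev N hN
    have h1 := l5 i hi
    have h2 := hxbRx _ (gp_mem hT hN hi)
    have h3 := norm_add_le (X N i - xb (gp T N i)) (xb (gp T N i))
    rw [sub_add_cancel] at h3
    linarith
  have hVR : ∀ N, 0 < N → ∀ i < N, ‖V N i‖ ≤ R := by
    intro N hN i hi
    obtain ⟨-, -, -, -, -, l6, -⟩ := hlev N hN
    linarith [l6 i]
  -- cost inequality
  have hcost : ∀ᶠ N : ℕ in atTop, φ (X N N) + ((N:ℝ) ^ 2 * SR N + (N:ℝ) ^ 2 * SU N + A * SW N) ≤ φ (Xc N N) := by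
    filter_upwards [hcomp1 1 one_pos, eventually_gt_atTop 0] with N hN hN0
    obtain ⟨-, -, -, -, -, -, -, l8, -⟩ := hlev N hN0
    have := l8 hN
    have e : ∀ (F1 F2 F3 : ℕ → ℝ) (a b : ℝ), ∑ i ∈ Finset.range N, (a * F1 i + a * F2 i + b * F3 i) =
        a * (∑ i ∈ Finset.range N, F1 i) + a * (∑ i ∈ Finset.range N, F2 i) + b * ∑ i ∈ Finset.range N, F3 i := by
      intro F1 F2 F3 a b
      simp only [Finset.mul_sum, Finset.sum_add_distrib]
    rw [e] at this
    exact this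
  have hM : ∀ B : ℝ, ∀ ε > (0:ℝ), ∀ᶠ N : ℕ in atTop, B ≤ ε * (N:ℝ) ^ 2 := by
    intro B ε hε
    have h1 : Tendsto (fun N : ℕ => ε * (N:ℝ) ^ 2) atTop atTop :=
      ((tendsto_pow_atTop two_ne_zero).comp tendsto_natCast_atTop_atTop).const_mul_atTop hε
    exact h1.eventually_ge_atTop B
  -- crude bounds
  have hcrude : ∀ᶠ N : ℕ in atTop, (N:ℝ) ^ 2 * SR N ≤ 2 * Φb ∧ (N:ℝ) ^ 2 * SU N ≤ 2 * Φb ∧ A * SW N ≤ 2 * Φb := by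
    filter_upwards [hcost, eventually_gt_atTop 0] with N hN hN0
    obtain ⟨-, -, l3, -⟩ := hlev N hN0
    have h1 := abs_le.1 (hΦb _ (hXR N hN0 N le_rfl))
    have h2 := abs_le.1 (hΦb (Xc N N) (by linarith [l3 N le_rfl]))
    have a1 : 0 ≤ (N:ℝ) ^ 2 * SR N := mul_nonneg (by positivity) (hSR0 N)
    have a2 : 0 ≤ (N:ℝ) ^ 2 * SU N := mul_nonneg (by positivity) (hSU0 N)
    have a3 : 0 ≤ A * SW N := mul_nonneg hA0.le (hSW0 N)
    refine ⟨?_, ?_, ?_⟩ <;> linarith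
  have hSRt : ∀ ε > (0:ℝ), ∀ᶠ N : ℕ in atTop, SR N ≤ ε := by
    intro ε hε
    filter_upwards [hcrude, hM (2 * Φb) ε hε, eventually_gt_atTop 0] with N h1 h2 hN0
    have : (0:ℝ) < (N:ℝ) ^ 2 := by positivity
    have : (N:ℝ) ^ 2 * SR N ≤ (N:ℝ) ^ 2 * ε := by linarith [h1.1]
    exact le_of_mul_le_mul_left this (by positivity)
  have hSUt : ∀ ε > (0:ℝ), ∀ᶠ N : ℕ in atTop, SU N ≤ ε := by
    intro ε hε
    filter_upwards [hcrude, hM (2 * Φb) ε hε, eventually_gt_atTop 0] with N h1 h2 hN0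
    have : (0:ℝ) < (N:ℝ) ^ 2 := by positivity
    have : (N:ℝ) ^ 2 * SU N ≤ (N:ℝ) ^ 2 * ε := by linarith [h1.2.1]
    exact le_of_mul_le_mul_left this (by positivity)
  -- distance of controls
  have hctrlV : ∀ N, 0 < N → ∑ j ∈ Finset.range N, (∫ t in (gp T N j)..(gp T N (j + 1)), ‖ub t - V N j‖ ^ 2) ≤
      2 * ((vb T - vb 0) ^ 2 * (T / N)) + 4 * SW N + 4 * SU N := by
    intro N hN
    refine (ctrl_tri hT hubm hubR (fun j => ub (gp T N j)) (V N) hN).trans ?_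
    have h1 := ctrl_bv hT hubm hubR hv hN
    have h2 : ∑ j ∈ Finset.range N, (T / N) * ‖ub (gp T N j) - V N j‖ ^ 2 ≤ 2 * SW N + 2 * SU N := by
      rw [hSW, hSU]; dsimp only
      rw [Finset.mul_sum, Finset.mul_sum, ← Finset.sum_add_distrib]
      refine Finset.sum_le_sum fun j _ => ?_
      have h0 : 0 ≤ T / (N:ℝ) := by positivity
      have e : ub (gp T N j) - V N j = -((W N j - ub (gp T N j)) + (V N j - W N j)) := by abel
      have h3 := norm_add_le (W N j - ub (gp T N j)) (V N j - W N j)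
      rw [e, norm_neg]
      have h4 : ‖W N j - ub (gp T N j) + (V N j - W N j)‖ ^ 2 ≤ 2 * ‖W N j - ub (gp T N j)‖ ^ 2 + 2 * ‖V N j - W N j‖ ^ 2 := by
        have : ‖W N j - ub (gp T N j) + (V N j - W N j)‖ ^ 2 ≤ (‖W N j - ub (gp T N j)‖ + ‖V N j - W N j‖) ^ 2 := by gcongr
        nlinarith [sq_nonneg (‖W N j - ub (gp T N j)‖ - ‖V N j - W N j‖)]
      have := mul_le_mul_of_nonneg_left h4 h0
      linarith
    linarith
  have hXclose : ∀ ε > (0:ℝ), ∃ δ > (0:ℝ), ∀ᶠ N : ℕ in atTop, 4 * SW N ≤ δ → ∀ i ≤ N, ‖X N i - xb (gp T N i)‖ ≤ ε := by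
    intro ε hε
    obtain ⟨δ, hδ, hcl⟩ := disc_close xs c hLI hT hC hK0 hG0 hK hG hε
    refine ⟨δ / 2, by positivity, ?_⟩
    filter_upwards [hcl, eventually_gt_atTop 0, hsm (2 * (vb T - vb 0) ^ 2) (δ / 4) (by positivity), hSRt δ hδ, hSUt (δ / 16) (by positivity)] with N hN hN0 a1 a2 a3 hSWN
    obtain ⟨-, -, -, l4, -⟩ := hlev N hN0
    refine hN xb _ ub (X N) (V N) hxbN hubm hubR hxbR (by rw [l4, hfeas.1]) (fun i hi => hXR N hN0 i hi.le) (hVR N hN0) a2 ?_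
    refine (hctrlV N hN0).trans ?_
    linarith
  -- refined cost
  have hfine : ∀ ε > (0:ℝ), ∀ᶠ N : ℕ in atTop, (N:ℝ) ^ 2 * SR N + (N:ℝ) ^ 2 * SU N + A * SW N ≤ ε := by
    intro ε hε
    obtain ⟨η, hη, hφη⟩ := hφu (ε / 2) (by positivity)
    have hη2 : 0 < min (η / 2) (δ0 / 8) := lt_min (by positivity) (by positivity)
    obtain ⟨δ2, hδ2, hcl2⟩ := disc_close xs c hLI hT hC hK0 hG0 hK hG hη2
    filter_upwards [hcl1, hcl2, eventually_gt_atTop 0, hcomp1 (η / 2) (by positivity), hcost, hcrude,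
      hsm (2 * (vb T - vb 0) ^ 2) (δ1 / 4) (by positivity), hsm (2 * (vb T - vb 0) ^ 2) (δ0 / 2) (by positivity), hSRt δ1 hδ1, hSUt (δ1 / 16) (by positivity), hSRt δ2 hδ2, hSUt δ2 hδ2, hsm G (δ0 / 8) (by positivity)] with
      N hN1 hN2 hN0 hcN hcostN hcr a1 a1' a2 a3 a4 a5 a6
    obtain ⟨l1, l2, l3, l4, l5, l6, l7, -⟩ := hlev N hN0
    have hN' : (0:ℝ) < N := Nat.cast_pos.2 hN0
    have hSWA : SW N ≤ 2 * Φb / A := by rw [le_div_iff₀ hA0]; linarith [hcr.2.2]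
    have hSWA1 : 4 * SW N ≤ δ1 / 2 := by
      refine le_trans ?_ hA1
      have : 8 * Φb / A = 4 * (2 * Φb / A) := by ring
      linarith
    have hSWA2 : 2 * SW N ≤ δ0 / 2 := by
      refine le_trans ?_ hA2
      have : 4 * Φb / A = 2 * (2 * Φb / A) := by ring
      linarith
    have c1 := hN1 xb _ ub (X N) (V N) hxbN hubm hubR hxbR (by rw [l4, hfeas.1]) (fun i hi => hXR N hN0 i hi.le) (hVR N hN0) a2
      ((hctrlV N hN0).trans (by linarith))
    -- exact trajectory
    obtain ⟨y, y', hy⟩ := exists_traj hT hCc hCconv hx0 hgc hgL hUc hβ hgrow (stepc_meas T N (W N)) (fun t => l7 _)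
    obtain ⟨hyN, hyR, hyU⟩ := hnice _ _ _ hy
    have hstU : ∀ t, ‖stepc T N (W N) t‖ ≤ R := fun t => by linarith [hRU _ (l7 (gidx T N t)), show ‖stepc T N (W N) t‖ = ‖W N (gidx T N t)‖ from rfl]
    have c2 := hN2 y _ (stepc T N (W N)) (X N) (V N) hyN hy.2.2.2.2.1 hyU hyR (by rw [l4, hy.1]) (fun i hi => hXR N hN0 i hi.le) (hVR N hN0) a4 (by
      refine le_trans (le_of_eq ?_) a5
      rw [hSU]; dsimp only
      refine Finset.sum_congr rfl fun j _ => ?_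
      rw [stepc_int hT hN0 (W N) j (fun z t => ‖z - V N j‖ ^ 2), intervalIntegral.integral_const, gp_succ, add_sub_cancel_left, smul_eq_mul, norm_sub_rev])
    have c3 : φ (xb T) ≤ φ (y T) := by
      refine hloc y y' _ hy (stepc_pc hT hN0 (W N)) (fun t ht => ?_) ?_
      · set i := gidx T N t with hi
        have hiN : i ≤ N := gidx_le hT N ht.2
        have m := gp_mem hT hN0 hiN
        have b1 := gp_gidx_le hT hN0 ht.1
        have b2 := lt_gp_gidx hT hN0 t
        rw [← hi] at b1 b2
        have habs : |t - gp T N i| ≤ T / N := by rw [abs_of_nonneg (by linarith)]; linarith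
        have d1 := hyN.2.1 _ m t ht
        have d2 := hxbN.2.1 _ m t ht
        have d3 : G * |t - gp T N i| ≤ G * (T / N) := by gcongr
        have d4 := c1 i hiN
        have d5 := (c2 i hiN).trans (min_le_right _ _)
        have e : y t - xb t = (y t - y (gp T N i)) - (X N i - y (gp T N i)) + (X N i - xb (gp T N i)) - (xb t - xb (gp T N i)) := by abel
        rw [e]
        refine (norm_sub_le _ _).trans ?_
        have d6 := norm_add_le ((y t - y (gp T N i)) - (X N i - y (gp T N i))) (X N i - xb (gp T N i))
        have d7 := norm_sub_le (y t - y (gp T N i)) (X N i - y (gp T N i))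
        linarith
      · have hintg : IntegrableOn (fun t => ‖stepc T N (W N) t - ub t‖ ^ 2) (Icc 0 T) := by
          refine (ctrl_int (hy.2.2.2.2.1.sub hubm) (R := R + R) ?_).2
          filter_upwards [hubR] with t ht htt
          exact (norm_sub_le _ _).trans (add_le_add (hstU t) (ht htt))
        rw [grid_sum hT hN0 hintg]
        have e : ∀ j ∈ Finset.range N, ∫ t in (gp T N j)..(gp T N (j + 1)), ‖stepc T N (W N) t - ub t‖ ^ 2 = ∫ t in (gp T N j)..(gp T N (j + 1)), ‖ub t - W N j‖ ^ 2 := by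
          intro j _
          rw [stepc_int hT hN0 (W N) j (fun z t => ‖z - ub t‖ ^ 2)]
          simp only [norm_sub_rev]
        rw [Finset.sum_congr rfl e]
        refine (ctrl_tri hT hubm hubR (fun j => ub (gp T N j)) (W N) hN0).trans ?_
        have h1 := ctrl_bv hT hubm hubR hv hN0
        have h2 : ∑ j ∈ Finset.range N, (T / N) * ‖ub (gp T N j) - W N j‖ ^ 2 = SW N := by
          rw [hSW]; dsimp only
          exact Finset.sum_congr rfl fun j _ => by rw [norm_sub_rev]
        rw [h2]
        linarith
    have hgpN : gp T N N = T := gp_last T hN0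
    have hTm : T ∈ Icc 0 T := ⟨hT.le, le_rfl⟩
    have k1 := hφη (y T) (by simpa using hyR T hTm) (X N N) (by simpa using hXR N hN0 N le_rfl) (by
      rw [dist_comm, dist_eq_norm, ← hgpN]
      have := (c2 N le_rfl).trans (min_le_left _ _)
      linarith)
    have k2 := hφη (Xc N N) (by simp; linarith [l3 N le_rfl]) (xb T) (by simpa using hxbR T hTm) (by
      rw [dist_eq_norm, ← hgpN]
      linarith [hcN N le_rfl])
    rw [Real.dist_eq, abs_lt] at k1 k2
    linarith [k1.2, k2.2]
  have hSWt : ∀ ε > (0:ℝ), ∀ᶠ N : ℕ in atTop, SW N ≤ ε := by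
    intro ε hε
    filter_upwards [hfine (A * ε) (by positivity)] with N h1
    have a1 : 0 ≤ (N:ℝ) ^ 2 * SR N := mul_nonneg (by positivity) (hSR0 N)
    have a2 : 0 ≤ (N:ℝ) ^ 2 * SU N := mul_nonneg (by positivity) (hSU0 N)
    exact le_of_mul_le_mul_left (by linarith : A * SW N ≤ A * ε) hA0
  have hgood : ∀ ε > (0:ℝ), ∀ᶠ N in atTop, DGood T xs c U g xb ub ε N (X N) (V N) (W N) := by
    intro ε hε
    obtain ⟨δ, hδ, hXc⟩ := hXclose ε hε
    filter_upwards [hXc, hSWt (δ / 4) (by positivity), hSWt ε hε, hSRt ε hε, hSRt 1 one_pos, disc_pen xs c hT g G hε, hfine 1 one_pos,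
      hsm (1 / T ^ 2) (ε ^ 2) (by positivity), eventually_gt_atTop 0] with N h1 h2 h3 h4 h5 h6 h7 h8 hN0
    have hN' : (0:ℝ) < N := Nat.cast_pos.2 hN0
    obtain ⟨l1, l2, l3, l4, l5, l6, l7, -⟩ := hlev N hN0
    refine ⟨h1 (by linarith), fun i hi => ?_, l7, h3, h4, h6 (X N) (V N) (by rw [l4]; exact hx0') (fun i hi => hG _ _ (hXR N hN0 i hi.le) (hVR N hN0 i hi)) h5⟩
    have a1 : 0 ≤ (N:ℝ) ^ 2 * SR N := mul_nonneg (by positivity) (hSR0 N)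
    have a3 : 0 ≤ A * SW N := mul_nonneg hA0.le (hSW0 N)
    have b1 : (T / N) * ‖V N i - W N i‖ ^ 2 ≤ SU N :=
      Finset.single_le_sum (f := fun j => (T / N) * ‖V N j - W N j‖ ^ 2) (fun k _ => by positivity) (Finset.mem_range.2 hi)
    have b2 : (N:ℝ) ^ 2 * ((T / N) * ‖V N i - W N i‖ ^ 2) ≤ 1 := by
      have := mul_le_mul_of_nonneg_left b1 (by positivity : 0 ≤ (N:ℝ) ^ 2)
      linarith
    refine le_of_sq_le_sq (le_trans ?_ h8) hε.le
    have e1 : (N:ℝ) ^ 2 * ((T / N) * ‖V N i - W N i‖ ^ 2) = (N * T) * ‖V N i - W N i‖ ^ 2 := by field_simp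
    have e2 : 1 / T ^ 2 * (T / N) = 1 / (N * T) := by field_simp
    rw [e1] at b2
    rw [e2, le_div_iff₀ (by positivity)]
    linarith
  refine ⟨hgood, ?_⟩
  filter_upwards [hgood (1 / 2) (by norm_num), eventually_gt_atTop 0] with N hN hN0
  obtain ⟨-, -, -, -, -, -, l7, -, l9⟩ := hlev N hN0
  refine l9 (fun i hi => lt_of_le_of_lt (hN.1 i hi) (by norm_num)) fun i hi => ?_
  have h1 := hN.2.1 i hi
  have h2 := norm_add_le (V N i - W N i) (W N i)
  rw [sub_add_cancel] at h2
  linarith [hRU _ (l7 i)]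

theorem back_gronwall {a s : ℕ → ℝ} {θ : ℝ} (hθ : 0 ≤ θ) {N : ℕ} (ha : ∀ i, 0 ≤ a i)
    (hs : ∀ i, 0 ≤ s i) (h : ∀ i, 1 ≤ i → i < N → a i + s i ≤ (1 + θ) * a (i + 1)) :
    (∀ i, 1 ≤ i → i ≤ N → a i ≤ Real.exp (θ * N) * a N) ∧
    ∑ i ∈ Finset.Ico 1 N, s i ≤ a N + θ * N * (Real.exp (θ * N) * a N) := by
  have h1 : ∀ k i, 1 ≤ i → i + k = N → a i ≤ Real.exp (θ * k) * a N := by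
    intro k
    induction k with
    | zero => intro i h1 h2; simp at h2; subst h2; simp
    | succ k ih =>
      intro i hi1 hi2
      have e1 := h i hi1 (by omega)
      have e2 := ih (i + 1) (by omega) (by omega)
      have e3 : 1 + θ ≤ Real.exp θ := by linarith [Real.add_one_le_exp θ]
      calc a i ≤ (1 + θ) * a (i + 1) := by linarith [hs i]
        _ ≤ Real.exp θ * (Real.exp (θ * k) * a N) :=
            mul_le_mul e3 e2 (ha _) (Real.exp_pos _).le
        _ = Real.exp (θ * (k + 1 : ℕ)) * a N := by
            rw [← mul_assoc, ← Real.exp_add]; congr 2; push_cast; ring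
  have h2 : ∀ i, 1 ≤ i → i ≤ N → a i ≤ Real.exp (θ * N) * a N := by
    intro i hi1 hi2
    obtain ⟨k, rfl⟩ := Nat.exists_eq_add_of_le hi2
    refine (h1 k i hi1 rfl).trans (mul_le_mul_of_nonneg_right ?_ (ha _))
    apply Real.exp_le_exp.2
    push_cast
    nlinarith [Nat.cast_nonneg (α := ℝ) i]
  refine ⟨h2, ?_⟩
  set M := Real.exp (θ * N) * a N with hM
  have hM0 : 0 ≤ M := mul_nonneg (Real.exp_pos _).le (ha _)
  rcases Nat.lt_or_ge N 1 with hN | hN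
  · rw [Finset.Ico_eq_empty (by omega)]; simp
    have := ha N
    positivity
  have h3 : ∀ i ∈ Finset.Ico 1 N, s i ≤ (a (i + 1) - a i) + θ * M := by
    intro i hi
    rw [Finset.mem_Ico] at hi
    have e1 := h i hi.1 hi.2
    have e2 := mul_le_mul_of_nonneg_left (h2 (i + 1) (by omega) (by omega)) hθ
    linarith
  refine (Finset.sum_le_sum h3).trans ?_
  rw [Finset.sum_add_distrib, Finset.sum_Ico_sub _ hN, Finset.sum_const, Nat.card_Ico, nsmul_eq_mul, Nat.cast_sub hN]
  have := ha 1
  have : 0 ≤ θ * M := by positivity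
  push_cast
  nlinarith

/-- final discrete optimality data with uniform bounds -/
structure DFin {n d s : ℕ} (T : ℝ) (xs : Fin s → Euc n) (c : Fin s → ℝ) (U : Set (Euc d))
    (g : WithLp 2 (Euc n × Euc d) → Euc n) (φ : Euc n → ℝ) (ub : ℝ → Euc d) (A B : ℝ) (N : ℕ)
    (x : ℕ → Euc n) (u w : ℕ → Euc d) (q ω : ℕ → Euc n) (ψ : ℕ → Euc d) : Prop where
  prox : ∀ i, 1 ≤ i → i < N → ProxSub (fun z => ⟪q (i + 1), g z⟫) (pmk (x i) (u i)) (pmk (ω i) (-ψ i))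
  recq : ∀ i, 1 ≤ i → i < N → q (i + 1) = q i + ∑ j, bet xs c T (x i) (q i) j • xs j + (T / N) • ω i
  bω : ∀ i, 1 ≤ i → i < N → ‖ω i‖ ≤ B
  bψ : ∀ i, 1 ≤ i → i < N → ‖ψ i‖ ≤ B
  bq : ∀ i, 1 ≤ i → i ≤ N → ‖q i‖ ≤ B
  bb : ∑ i ∈ Finset.Ico 1 N, ∑ j, |bet xs c T (x i) (q i) j| ≤ B
  nor : ∀ i < N, ψ i + (2 * A) • (ub (gp T N i) - w i) ∈ limNormal U (w i)
  fin : ProxSub φ (x N) (-q N)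

theorem prox_bound {n d : ℕ} {g : WithLp 2 (Euc n × Euc d) → Euc n} {R K : ℝ} (hK0 : 0 ≤ K)
    (hK : ∀ x x' u u', ‖x‖ ≤ R + 1 → ‖x'‖ ≤ R + 1 → ‖u‖ ≤ R + 1 → ‖u'‖ ≤ R + 1 →
      ‖g (pmk x u) - g (pmk x' u')‖ ≤ K * (‖x - x'‖ + ‖u - u'‖)) {x : Euc n} {u : Euc d}
    (hx : ‖x‖ ≤ R) (hu : ‖u‖ ≤ R) {q : Euc n} {v : WithLp 2 (Euc n × Euc d)}
    (h : ProxSub (fun z => ⟪q, g z⟫) (pmk x u) v) : ‖v‖ ≤ 2 * K * ‖q‖ := by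
  refine h.norm_le (by positivity) ?_
  filter_upwards [Metric.ball_mem_nhds (pmk x u) one_pos] with w hw
  rw [mem_ball_iff_norm] at hw
  obtain ⟨x', u', rfl⟩ : ∃ x' u', w = pmk x' u' := ⟨pfst w, psnd w, (pmk_eta w).symm⟩
  rw [pmk_sub] at hw ⊢
  have h1 := norm_le_pmk_left (x' - x) (u' - u)
  have h2 := norm_le_pmk_right (x' - x) (u' - u)
  have h3 : ‖x'‖ ≤ R + 1 := by
    have := norm_add_le (x' - x) x; rw [sub_add_cancel] at this; linarith
  have h4 : ‖u'‖ ≤ R + 1 := by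
    have := norm_add_le (u' - u) u; rw [sub_add_cancel] at this; linarith
  have h5 := hK x' x u' u h3 (by linarith) h4 (by linarith)
  rw [← inner_sub_right]
  refine (real_inner_le_norm _ _).trans ?_
  have h6 : ‖g (pmk x' u') - g (pmk x u)‖ ≤ K * (2 * ‖pmk (x' - x) (u' - u)‖) :=
    h5.trans (mul_le_mul_of_nonneg_left (by linarith) hK0)
  have := mul_le_mul_of_nonneg_left h6 (norm_nonneg q)
  linarith

theorem rp_zero_of_lt {n s : ℕ} {xs : Fin s → Euc n} {c : Fin s → ℝ} {j : Fin s} {x : Euc n} (h : ⟪xs j, x⟫ ≤ c j) :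
    rp xs c j x = 0 := by
  unfold rp; exact max_eq_right (by linarith)

set_option maxHeartbeats 1000000 in
theorem mult_bd {n d s : ℕ} {T : ℝ} {xs : Fin s → Euc n} {c : Fin s → ℝ} {C : Set (Euc n)} {x0 : Euc n}
    {φ : Euc n → ℝ} {U : Set (Euc d)} {g : WithLp 2 (Euc n × Euc d) → Euc n} {β : ℝ}
    {xb xb' : ℝ → Euc n} {ub : ℝ → Euc d} {vb : ℝ → ℝ} (H : Core T xs c C x0 φ U g β xb xb' ub vb) :
    ∃ A > (0:ℝ), ∃ B > (0:ℝ), ∃ (X : ℕ → ℕ → Euc n) (V W : ℕ → ℕ → Euc d) (q ω : ℕ → ℕ → Euc n) (ψ : ℕ → ℕ → Euc d),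
      (∀ ε > (0:ℝ), ∀ᶠ N in atTop, DGood T xs c U g xb ub ε N (X N) (V N) (W N)) ∧
      ∀ᶠ N in atTop, DFin T xs c U g φ ub A B N (X N) (V N) (W N) (q N) (ω N) (ψ N) := by
  obtain ⟨A, hA, X, V, W, q, ψ, hgood, hstat⟩ := disc_conv H
  obtain ⟨hT, hC, hx0, hφ, hUc, hUne, hgc, hgL, hβ, hgrow, hfeas, -, hLI, hTin, hv, hrc⟩ := H
  have hCc : IsClosed C := by rw [hC]; exact poly_closed xs c
  obtain ⟨RU', hRU'⟩ := isBounded_iff_forall_norm_le.1 hUc.isBounded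
  set RU := max RU' 0 with hRUd
  have hRU : ∀ w ∈ U, ‖w‖ ≤ RU := fun w hw => (hRU' w hw).trans (le_max_left _ _)
  have hRU0 : 0 ≤ RU := le_max_right _ _
  set Rx := (1 + ‖x0‖) * Real.exp (β * T) with hRx
  have hRx0 : 0 ≤ Rx := by positivity
  set R := Rx + RU + 1 with hR
  obtain ⟨K, hK0, hK⟩ := hgL (R + 1)
  have hxbR : ∀ t ∈ Icc 0 T, ‖xb t‖ ≤ Rx := by
    intro t ht
    have := feas_bound hT hCc hβ hgrow hfeas t ht
    linarith
  obtain ⟨Φ, cL, ρ, hcL, hρ, hΦ1, hΦ2, hΦ3, hΦ4⟩ := lyapunov xs hLI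
  -- φ lipschitz near xb T
  obtain ⟨Lφ, Vφ, hVφ, hLφ⟩ := hφ (xb T)
  obtain ⟨r, hr, hrV⟩ := Metric.mem_nhds_iff.1 hVφ
  -- inactivity near xb T
  have hin : ∀ᶠ x in 𝓝 (xb T), ∀ j, ⟪xs j, x⟫ < c j := by
    rw [Filter.eventually_all]
    intro j
    have : ContinuousAt (fun x => ⟪xs j, x⟫) (xb T) := by fun_prop
    exact this.eventually_lt continuousAt_const (hTin j)
  obtain ⟨r2, hr2, hin⟩ := Metric.eventually_nhds_iff.1 hin
  set D := 2 * K / ρ with hD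
  have hD0 : 0 ≤ D := by positivity
  set E := Real.exp (D * T) * Lφ with hE
  have hE0 : 0 ≤ E := by positivity
  set Bq := E / ρ with hBq
  have hBq0 : 0 ≤ Bq := by positivity
  set Bb := (Lφ + D * T * E) / cL with hBb
  have hBb0 : 0 ≤ Bb := by positivity
  set B := Bq + 2 * K * Bq + Bb + 1 with hB
  have hKBq : 0 ≤ 2 * K * Bq := by positivity
  have main : ∀ᶠ N in atTop, ∃ ω, DFin T xs c U g φ ub A B N (X N) (V N) (W N) (q N) ω (ψ N) := by
    filter_upwards [hstat, hgood (min 1 (min (r/2) (r2/2))) (by positivity), eventually_gt_atTop 0] with N hS hG hN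
    obtain ⟨hS1, hS2, hS3⟩ := hS
    obtain ⟨hG1, hG2, hG3, -⟩ := hG
    have hN' : (0:ℝ) < N := Nat.cast_pos.2 hN
    have hh : 0 < T / (N:ℝ) := by positivity
    have hm1 : min 1 (min (r/2) (r2/2)) ≤ 1 := min_le_left _ _
    have hm2 : min 1 (min (r/2) (r2/2)) ≤ r/2 := (min_le_right _ _).trans (min_le_left _ _)
    have hm3 : min 1 (min (r/2) (r2/2)) ≤ r2/2 := (min_le_right _ _).trans (min_le_right _ _)
    have hXR : ∀ i ≤ N, ‖X N i‖ ≤ R := by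
      intro i hi
      have h1 := hG1 i hi
      have h2 := hxbR _ (gp_mem hT hN hi)
      have h3 := norm_add_le (X N i - xb (gp T N i)) (xb (gp T N i))
      rw [sub_add_cancel] at h3
      linarith
    have hVR : ∀ i < N, ‖V N i‖ ≤ R := by
      intro i hi
      have h1 := hG2 i hi
      have h2 := hRU _ (hG3 i)
      have h3 := norm_add_le (V N i - W N i) (W N i)
      rw [sub_add_cancel] at h3
      linarith
    have hXN : ‖X N N - xb T‖ ≤ min 1 (min (r/2) (r2/2)) := by
      have := hG1 N le_rfl
      rwa [gp_last T hN] at this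
    have hbN : ∑ j, bet xs c T (X N N) (q N N) j • xs j = 0 := by
      refine Finset.sum_eq_zero fun j _ => ?_
      have := hin (y := X N N) (by rw [dist_eq_norm]; linarith) j
      unfold bet
      rw [rp_zero_of_lt this.le]; simp
    rw [hbN, add_zero] at hS3
    have hqN : ‖q N N‖ ≤ Lφ := by
      rw [← norm_neg]
      refine hS3.norm_le Lφ.2 ?_
      have hmem : Metric.ball (xb T) r ∈ 𝓝 (X N N) :=
        Metric.isOpen_ball.mem_nhds (by rw [mem_ball_iff_norm]; linarith)
      filter_upwards [hmem] with w hw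
      have := hLφ.dist_le_mul w (hrV hw) (X N N) (hrV (by rw [mem_ball_iff_norm]; linarith))
      rw [dist_eq_norm, dist_eq_norm] at this
      exact (le_abs_self _).trans this
    have hS1' : ∀ i, ∃ ω, 1 ≤ i → i < N → ProxSub (fun z => ⟪q N (i + 1), g z⟫) (pmk (X N i) (V N i)) (pmk ω (-ψ N i)) ∧
        q N (i + 1) - q N i - ∑ j, bet xs c T (X N i) (q N i) j • xs j = (T / N) • ω := by
      intro i
      by_cases hi : 1 ≤ i ∧ i < N
      · obtain ⟨i, rfl⟩ := Nat.exists_eq_add_of_le' hi.1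
        obtain ⟨ω, h⟩ := hS1 i hi.2
        exact ⟨ω, fun _ _ => h⟩
      · exact ⟨0, fun h1 h2 => absurd ⟨h1, h2⟩ hi⟩
    choose ω hω using hS1'
    have hωq : ∀ i, 1 ≤ i → i < N → ‖pmk (ω i) (-ψ N i)‖ ≤ 2 * K * ‖q N (i + 1)‖ := fun i h1 h2 =>
      prox_bound hK0 hK (hXR i h2.le) (hVR i h2) (hω i h1 h2).1
    have hstep : ∀ i, 1 ≤ i → i < N → Φ (q N i) + cL * ∑ j, |bet xs c T (X N i) (q N i) j| ≤ (1 + D * (T / N)) * Φ (q N (i + 1)) := by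
      intro i h1 h2
      have e1 := hΦ4 (q N i) (fun j => T * (2 * rp xs c j (X N i))) (fun j => by
        have := rp_nonneg xs c j (X N i); positivity)
      have e2 : q N i + ∑ j, ((T * (2 * rp xs c j (X N i))) * ⟪xs j, q N i⟫) • xs j = q N (i + 1) + (-((T / N) • ω i)) := by
        rw [← (hω i h1 h2).2]; unfold bet; abel
      rw [e2] at e1
      have e3 := hΦ3 (q N (i + 1)) (-((T / N) • ω i))
      rw [norm_neg, norm_smul, Real.norm_of_nonneg hh.le] at e3
      have e4 : ‖ω i‖ ≤ 2 * K * ‖q N (i + 1)‖ := (norm_le_pmk_left _ _).trans (hωq i h1 h2)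
      have e5 : 2 * K * ‖q N (i + 1)‖ ≤ D * Φ (q N (i + 1)) := by
        have : 2 * K = D * ρ := by rw [hD]; field_simp
        rw [this, mul_assoc]
        exact mul_le_mul_of_nonneg_left (hΦ1 _) hD0
      have e6 := mul_le_mul_of_nonneg_left (e4.trans e5) hh.le
      have e7 : ∀ j, |bet xs c T (X N i) (q N i) j| = T * (2 * rp xs c j (X N i)) * |⟪xs j, q N i⟫| := by
        intro j
        unfold bet
        rw [abs_mul, abs_of_nonneg]
        have := rp_nonneg xs c j (X N i); positivity
      simp only [e7]
      linarith
    have hΦ0 : ∀ p, 0 ≤ Φ p := fun p => (by positivity : 0 ≤ ρ * ‖p‖).trans (hΦ1 p)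
    obtain ⟨hg1, hg2⟩ := back_gronwall (a := fun i => Φ (q N i)) (s := fun i => cL * ∑ j, |bet xs c T (X N i) (q N i) j|)
      (θ := D * (T / N)) (N := N) (by positivity) (fun i => hΦ0 _) (fun i => by positivity) hstep
    have hθN : D * (T / N) * N = D * T := by field_simp
    rw [hθN] at hg2
    simp only [hθN] at hg1
    have hΦN : Φ (q N N) ≤ Lφ := (hΦ2 _).trans hqN
    have hEb : Real.exp (D * T) * Φ (q N N) ≤ E := mul_le_mul_of_nonneg_left hΦN (Real.exp_pos _).le
    have hqb : ∀ i, 1 ≤ i → i ≤ N → ‖q N i‖ ≤ Bq := by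
      intro i h1 h2
      rw [hBq, le_div_iff₀ hρ]
      have := hg1 i h1 h2
      have := hΦ1 (q N i)
      linarith
    have hpb : ∀ i, 1 ≤ i → i < N → ‖pmk (ω i) (-ψ N i)‖ ≤ 2 * K * Bq := fun i h1 h2 =>
      (hωq i h1 h2).trans (mul_le_mul_of_nonneg_left (hqb (i+1) (by omega) (by omega)) (by positivity))
    refine ⟨ω, fun i h1 h2 => (hω i h1 h2).1, fun i h1 h2 => ?_, fun i h1 h2 => ?_, fun i h1 h2 => ?_, fun i h1 h2 => ?_, ?_, hS2, hS3⟩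
    · rw [← (hω i h1 h2).2]; abel
    · have := (norm_le_pmk_left _ _).trans (hpb i h1 h2)
      linarith
    · have := (norm_le_pmk_right _ _).trans (hpb i h1 h2)
      rw [norm_neg] at this
      linarith
    · have := hqb i h1 h2; linarith
    · rw [← Finset.mul_sum] at hg2
      have : ∑ i ∈ Finset.Ico 1 N, ∑ j, |bet xs c T (X N i) (q N i) j| ≤ Bb := by
        rw [hBb, le_div_iff₀ hcL]
        have := mul_le_mul_of_nonneg_left hEb (by positivity : 0 ≤ D * T)
        linarith
      linarith
  have main' : ∀ N, ∃ ω, (∃ ω, DFin T xs c U g φ ub A B N (X N) (V N) (W N) (q N) ω (ψ N)) → DFin T xs c U g φ ub A B N (X N) (V N) (W N) (q N) ω (ψ N) := by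
    intro N
    by_cases h : ∃ ω, DFin T xs c U g φ ub A B N (X N) (V N) (W N) (q N) ω (ψ N)
    · obtain ⟨ω, hω⟩ := h; exact ⟨ω, fun _ => hω⟩
    · exact ⟨0, fun h' => absurd h' h⟩
  choose ω hω using main'
  refine ⟨A, hA, B, by positivity, X, V, W, q, ω, ψ, hgood, ?_⟩
  filter_upwards [main] with N hN using hω N hN

theorem ultra_lim {E : Type*} [NormedAddCommGroup E] [ProperSpace E] (𝒰 : Ultrafilter ℕ) {a : ℕ → E} {R : ℝ}
    (h : ∀ᶠ m in (𝒰 : Filter ℕ), ‖a m‖ ≤ R) : ∃ y, Tendsto a 𝒰 (𝓝 y) := by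
  have : (Ultrafilter.map a 𝒰 : Filter E) ≤ 𝓟 (Metric.closedBall 0 R) := by
    rw [le_principal_iff]
    change ∀ᶠ m in (𝒰 : Filter ℕ), _
    filter_upwards [h] with m hm
    simpa using hm
  obtain ⟨y, hy, hl⟩ := (isCompact_closedBall (0:E) R).ultrafilter_le_nhds _ this
  exact ⟨y, hl⟩

theorem gidx_lt {T : ℝ} (hT : 0 < T) {m : ℕ} (hm : 0 < m) {t : ℝ} (ht : 0 ≤ t) (ht' : t < T) : gidx T m t < m := by
  by_contra h
  push Not at h
  have h1 := gp_gidx_le hT hm ht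
  have h2 : gp T m m ≤ gp T m (gidx T m t) := by
    unfold gp
    have : (m:ℝ) ≤ gidx T m t := by exact_mod_cast h
    gcongr
  rw [gp_last T hm] at h2
  linarith

theorem le_gidx {T : ℝ} (hT : 0 < T) {m : ℕ} (hm : 0 < m) {t : ℝ} {i : ℕ} (ht : gp T m i ≤ t) : i ≤ gidx T m t := by
  have := gidx_mono hT m ht
  rwa [gidx_gp hT hm] at this

theorem gidx_lt_of {T : ℝ} (hT : 0 < T) {m : ℕ} (hm : 0 < m) {t : ℝ} {i : ℕ} (ht : 0 ≤ t) (h : t < gp T m i) : gidx T m t < i := by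
  by_contra hh
  push Not at hh
  have h1 := gp_gidx_le hT hm ht
  have h2 : gp T m i ≤ gp T m (gidx T m t) := by
    unfold gp
    have : (i:ℝ) ≤ gidx T m t := by exact_mod_cast hh
    gcongr
  linarith

theorem gp_mono {T : ℝ} (hT : 0 < T) (m : ℕ) {i k : ℕ} (h : i ≤ k) : gp T m i ≤ gp T m k := by
  unfold gp
  have : (i:ℝ) ≤ k := by exact_mod_cast h
  gcongr

theorem gp_gidx_tendsto {T : ℝ} (hT : 0 < T) {𝒰 : Filter ℕ} (h𝒰 : 𝒰 ≤ atTop) {t : ℝ} (ht : 0 ≤ t) :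
    Tendsto (fun N => gp T N (gidx T N t + 1)) 𝒰 (𝓝 t) := by
  have hpos : ∀ᶠ m in 𝒰, 0 < m := h𝒰 (eventually_gt_atTop 0)
  have h1 : Tendsto (fun m : ℕ => t + T / (m:ℝ)) 𝒰 (𝓝 (t + 0)) :=
    ((tendsto_const_div_atTop_nhds_zero_nat T).mono_left h𝒰).const_add t
  rw [add_zero] at h1
  refine tendsto_of_tendsto_of_tendsto_of_le_of_le' tendsto_const_nhds h1 ?_ ?_
  · filter_upwards [hpos] with m hm
    rw [gp_succ]
    exact (lt_gp_gidx hT hm t).le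
  · filter_upwards [hpos] with m hm
    rw [gp_succ]
    linarith [gp_gidx_le hT hm ht]

theorem unif_tendsto {E : Type*} [NormedAddCommGroup E] {T : ℝ} (hT : 0 < T) {𝒰 : Filter ℕ} (h𝒰 : 𝒰 ≤ atTop)
    {Y : ℕ → ℕ → E} {z : ℝ → E} (hz : ∀ ε > (0:ℝ), ∀ᶠ N in 𝒰, ∀ i ≤ N, ‖Y N i - z (gp T N i)‖ ≤ ε) {t : ℝ}
    (ht : t ∈ Ico 0 T) (hc : ContinuousWithinAt z (Icc 0 T) t) :
    Tendsto (fun N => Y N (gidx T N t + 1)) 𝒰 (𝓝 (z t)) := by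
  have hpos : ∀ᶠ m in 𝒰, 0 < m := h𝒰 (eventually_gt_atTop 0)
  have h1 : Tendsto (fun N => z (gp T N (gidx T N t + 1))) 𝒰 (𝓝 (z t)) := by
    refine hc.tendsto.comp (tendsto_nhdsWithin_iff.2 ⟨gp_gidx_tendsto hT h𝒰 ht.1, ?_⟩)
    filter_upwards [hpos] with m hm
    exact gp_mem hT hm (gidx_lt hT hm ht.1 ht.2)
  have h2 : Tendsto (fun N => Y N (gidx T N t + 1) - z (gp T N (gidx T N t + 1))) 𝒰 (𝓝 0) := by
    rw [Metric.tendsto_nhds]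
    intro ε hε
    filter_upwards [hz (ε / 2) (by positivity), hpos] with N hN hm
    rw [dist_zero_right]
    linarith [hN _ (gidx_lt hT hm ht.1 ht.2)]
  have := h2.add h1
  simpa using this

theorem ultra_mono {T : ℝ} (hT : 0 < T) (𝒰 : Ultrafilter ℕ) (h𝒰 : (𝒰 : Filter ℕ) ≤ atTop) {a : ℕ → ℕ → ℝ}
    (ha : ∀ N i, 0 ≤ a N i) {B : ℝ} (hB : ∀ᶠ N in (𝒰 : Filter ℕ), ∑ k ∈ Finset.Ico 1 N, a N k ≤ B) :
    ∃ v : ℝ → ℝ, Monotone v ∧ (∀ t, T ≤ t → v t = v T) ∧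
      (∀ t, Tendsto (fun N => ∑ k ∈ Finset.Ico 1 (min (gidx T N t + 1) N), a N k) 𝒰 (𝓝 (v t))) := by
  have hpos : ∀ᶠ m in (𝒰 : Filter ℕ), 0 < m := h𝒰 (eventually_gt_atTop 0)
  have h1 : ∀ t, ∃ y, Tendsto (fun N => ∑ k ∈ Finset.Ico 1 (min (gidx T N t + 1) N), a N k) 𝒰 (𝓝 y) := by
    intro t
    apply ultra_lim 𝒰 (R := B)
    filter_upwards [hB] with N hN
    rw [Real.norm_of_nonneg (Finset.sum_nonneg fun i _ => ha N i)]
    refine (Finset.sum_le_sum_of_subset_of_nonneg ?_ fun i _ _ => ha N i).trans hN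
    exact Finset.Ico_subset_Ico_right (min_le_right _ _)
  choose v hv using h1
  refine ⟨v, fun s t hst => ?_, fun t ht => ?_, hv⟩
  · refine le_of_tendsto_of_tendsto' (hv s) (hv t) fun N => ?_
    refine Finset.sum_le_sum_of_subset_of_nonneg ?_ fun i _ _ => ha N i
    apply Finset.Ico_subset_Ico_right
    have := gidx_mono hT N hst
    omega
  · refine tendsto_nhds_unique_of_eventuallyEq (hv t) (hv T) ?_
    filter_upwards [hpos] with N hN
    have h1 : gidx T N T = N := by
      have := gidx_gp hT hN N
      rwa [gp_last T hN] at this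
    have h2 := gidx_mono hT N ht
    rw [h1] at h2
    rw [h1, min_eq_right (by omega), min_eq_right (by omega)]

theorem stiel {v : ℝ → ℝ} (hv : Monotone v) {T : ℝ} (hvT : ∀ t, T ≤ t → v t = v T) :
    ∃ μ : Measure ℝ, IsFiniteMeasure μ ∧ (∀ t ∈ Icc 0 T, ContinuousAt v t → μ (Ioc t T) = ENNReal.ofReal (v T - v t)) ∧
      ∀ t, ∀ δ > (0:ℝ), (∀ r ∈ Metric.ball t δ, v r = v t) → μ (Metric.ball t (δ / 2)) = 0 := by
  have hloc : ∀ t w, (∀ᶠ r in 𝓝[>] t, v r = w) → hv.stieltjesFunction t = w := by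
    intro t w h
    rw [Monotone.stieltjesFunction_eq]
    refine rightLim_eq_of_tendsto ?_
    exact (tendsto_congr' h).2 tendsto_const_nhds
  refine ⟨hv.stieltjesFunction.measure.restrict (Ioc 0 T), ⟨?_⟩, fun t ht hc => ?_, fun t δ hδ h => ?_⟩
  · rw [Measure.restrict_apply_univ, StieltjesFunction.measure_Ioc]; exact ENNReal.ofReal_lt_top
  · rw [Measure.restrict_apply measurableSet_Ioc, inter_eq_left.2 (Ioc_subset_Ioc_left ht.1), StieltjesFunction.measure_Ioc,
      hloc T (v T), Monotone.stieltjesFunction_eq, hc.continuousWithinAt.rightLim_eq]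
    filter_upwards [self_mem_nhdsWithin] with r hr
    exact hvT r (le_of_lt hr)
  · refine le_antisymm ((Measure.restrict_apply_le _ _).trans ?_) bot_le
    have hsub : Metric.ball t (δ / 2) ⊆ Ioc (t - δ/2) (t + δ/2) := by
      rw [Real.ball_eq_Ioo]; exact Ioo_subset_Ioc_self
    refine (measure_mono hsub).trans ?_
    have hnb : ∀ r, |r - t| < δ → hv.stieltjesFunction r = v t := by
      intro r hr
      apply hloc
      apply Filter.Eventually.filter_mono nhdsWithin_le_nhds
      filter_upwards [Metric.isOpen_ball.mem_nhds (show r ∈ Metric.ball t δ by rw [Metric.mem_ball, Real.dist_eq]; exact hr)] with s hs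
      exact h s hs
    rw [StieltjesFunction.measure_Ioc, hnb, hnb]
    · simp
    · rw [show t - δ/2 - t = -(δ/2) by ring, abs_neg, abs_of_pos (by positivity)]; linarith
    · rw [show t + δ/2 - t = δ/2 by ring, abs_of_pos (by positivity)]; linarith

theorem tv_zero {μ ν : Measure ℝ} [IsFiniteMeasure μ] [IsFiniteMeasure ν] {V : Set ℝ} (hV : MeasurableSet V)
    (h1 : μ V = 0) (h2 : ν V = 0) : (μ.toSignedMeasure - ν.toSignedMeasure).totalVariation V = 0 := by
  have key : (μ.toSignedMeasure - ν.toSignedMeasure) ≪ᵥ (μ + ν).toENNRealVectorMeasure := by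
    refine VectorMeasure.AbsolutelyContinuous.mk fun S hS h => ?_
    rw [Measure.toENNRealVectorMeasure_apply_measurable hS] at h
    simp only [Measure.coe_add, Pi.add_apply, add_eq_zero] at h
    rw [FunLike.coe_sub, Pi.sub_apply, Measure.toSignedMeasure_apply_measurable hS, Measure.toSignedMeasure_apply_measurable hS,
      measureReal_def, measureReal_def, h.1, h.2]
    simp
  rw [SignedMeasure.absolutelyContinuous_ennreal_iff, VectorMeasure.ennrealToMeasure_toENNRealVectorMeasure] at key
  exact key (by simp [h1, h2])

theorem bv_of_mono {E : Type*} [NormedAddCommGroup E] {q : ℝ → E} {F : ℝ → ℝ} {T : ℝ} (hT : 0 < T) 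
    (h : ∀ a ∈ Icc 0 T, ∀ b ∈ Icc 0 T, a ≤ b → ‖q b - q a‖ ≤ F b - F a) : BoundedVariationOn q (Icc 0 T) := by
  have hF : MonotoneOn F (Icc 0 T) := fun a ha b hb hab => by
    have := (norm_nonneg _).trans (h a ha b hb hab); linarith
  have h1 : eVariationOn q (Icc 0 T) ≤ eVariationOn F (Icc 0 T) := by
    refine iSup_le fun p => ?_
    refine le_trans (Finset.sum_le_sum fun i _ => ?_) (eVariationOn.sum_le (f := F) (n := p.1) p.2.2.1 p.2.2.2)
    rw [edist_dist, edist_dist, dist_eq_norm, Real.dist_eq]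
    apply ENNReal.ofReal_le_ofReal
    have := h _ (p.2.2.2 i) _ (p.2.2.2 (i+1)) (p.2.2.1 (Nat.le_succ i))
    exact this.trans (le_abs_self _)
  have h2 := (hF.eVariationOn_eq (left_mem_Icc.2 hT.le) (right_mem_Icc.2 hT.le)).le
  rw [inter_self] at h2
  exact ((h1.trans h2).trans_lt ENNReal.ofReal_lt_top).ne

/-- sums over a right window at `t` -/
theorem avg_limit {E : Type*} [NormedAddCommGroup E] [NormedSpace ℝ E] {T : ℝ} (hT : 0 < T)
    {𝒰 : Filter ℕ} [𝒰.NeBot] (h𝒰 : 𝒰 ≤ atTop) {ζ : ℕ → ℕ → E} {z : ℝ → E}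
    (hz : ∀ ε > (0:ℝ), ∀ᶠ N : ℕ in 𝒰, ∀ i ≤ N, ‖(∑ k ∈ Finset.Ico 1 i, (T / N) • ζ N k) - z (gp T N i)‖ ≤ ε)
    (hzc : Continuous z) {B : ℝ} (hB0 : 0 ≤ B) (hB : ∀ᶠ N in 𝒰, ∀ i, 1 ≤ i → i < N → ‖ζ N i‖ ≤ B) {t : ℝ} (ht : t ∈ Ioo 0 T)
    {D : E} (hD : HasDerivAt z D t) {K : Set E} (hKc : IsClosed K) (hKv : Convex ℝ K) (hKn : K.Nonempty)
    {e : ℕ → ℕ → ℝ} (he : ∀ ε > (0:ℝ), ∀ᶠ N : ℕ in 𝒰, ∑ i ∈ Finset.range N, (T / N) * (e N i) ^ 2 ≤ ε)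
    (hgood : ∀ ε > (0:ℝ), ∃ δ > (0:ℝ), ∀ᶠ N in 𝒰, ∀ i, 1 ≤ i → i < N → t < gp T N i → gp T N i < t + δ → |e N i| ≤ δ →
      ∃ v ∈ K, ‖ζ N i - v‖ ≤ ε) : D ∈ K := by
  obtain ⟨k0, hk0⟩ := hKn
  have hpos : ∀ᶠ m in 𝒰, 0 < m := h𝒰 (eventually_gt_atTop 0)
  rw [← hKc.closure_eq, Metric.mem_closure_iff]
  intro ε0 hε0
  set M := 3 + B + ‖k0‖ with hM
  have hM0 : 0 < M := by positivity
  set ε := ε0 / (2 * M) with hε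
  have hεp : 0 < ε := by positivity
  obtain ⟨δ, hδ, hg⟩ := hgood ε hεp
  -- derivative
  have hslope : ∀ᶠ r in 𝓝[>] t, ‖(r - t)⁻¹ • (z r - z t) - D‖ < ε := by
    have := hD.tendsto_slope
    have h2 := this.mono_left (nhdsWithin_mono t (show Ioi t ⊆ {t}ᶜ from fun x hx => ne_of_gt hx))
    have h3 := (tendsto_iff_norm_sub_tendsto_zero.1 h2).eventually_lt_const hεp
    filter_upwards [h3] with r hr
    rwa [slope_def_module] at hr
  have hr1 : ∀ᶠ r in 𝓝[>] t, r < min T (t + δ) :=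
    Filter.Eventually.filter_mono nhdsWithin_le_nhds (eventually_lt_nhds (lt_min ht.2 (by linarith)))
  obtain ⟨r, ⟨hr1, hr2⟩, hr3⟩ := ((hslope.and hr1).and self_mem_nhdsWithin).exists
  have hr3 : t < r := hr3
  have hrT : r < T := hr2.trans_le (min_le_left _ _)
  have hrδ : r < t + δ := hr2.trans_le (min_le_right _ _)
  have hr0 : 0 < r := ht.1.trans hr3
  set δ' := r - t with hδ'
  have hδ'0 : 0 < δ' := by linarith
  -- windows
  set a : ℕ → ℕ := fun N => gidx T N t + 1 with ha
  set b : ℕ → ℕ := fun N => gidx T N r + 1 with hb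
  have hga : Tendsto (fun N => gp T N (a N)) 𝒰 (𝓝 t) := gp_gidx_tendsto hT h𝒰 ht.1.le
  have hgb : Tendsto (fun N => gp T N (b N)) 𝒰 (𝓝 r) := gp_gidx_tendsto hT h𝒰 hr0.le
  have hlen : Tendsto (fun N => gp T N (b N) - gp T N (a N)) 𝒰 (𝓝 δ') := hgb.sub hga
  have hZa : Tendsto (fun N => ∑ k ∈ Finset.Ico 1 (a N), (T / N) • ζ N k) 𝒰 (𝓝 (z t)) :=
    unif_tendsto (Y := fun N i => ∑ k ∈ Finset.Ico 1 i, (T / N) • ζ N k) hT h𝒰 hz ⟨ht.1.le, ht.2⟩ hzc.continuousWithinAt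
  have hZb : Tendsto (fun N => ∑ k ∈ Finset.Ico 1 (b N), (T / N) • ζ N k) 𝒰 (𝓝 (z r)) :=
    unif_tendsto (Y := fun N i => ∑ k ∈ Finset.Ico 1 i, (T / N) • ζ N k) hT h𝒰 hz ⟨hr0.le, hrT⟩ hzc.continuousWithinAt
  have hab : ∀ N, a N ≤ b N := fun N => Nat.succ_le_succ (gidx_mono hT N hr3.le)
  have havg : Tendsto (fun N => (gp T N (b N) - gp T N (a N))⁻¹ • ∑ k ∈ Finset.Ico (a N) (b N), (T / N) • ζ N k) 𝒰
      (𝓝 (δ'⁻¹ • (z r - z t))) := by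
    refine (hlen.inv₀ hδ'0.ne').smul ((hZb.sub hZa).congr fun N => ?_)
    rw [sub_eq_iff_eq_add, add_comm, Finset.sum_Ico_consecutive _ (by simp [ha]) (hab N)]
  have hfin : ∀ᶠ N in 𝒰, ‖((gp T N (b N) - gp T N (a N))⁻¹ • ∑ k ∈ Finset.Ico (a N) (b N), (T / N) • ζ N k) - D‖ < ε :=
    (havg.sub_const D).norm.eventually_lt_const hr1
  have hhalf : ∀ᶠ N in 𝒰, δ' / 2 < gp T N (b N) - gp T N (a N) := hlen.eventually_const_lt (by linarith)
  obtain ⟨N, hN1, hN2, hN3, hN4, hN5, hN0⟩ := (hfin.and (hhalf.and (hg.and (hB.and ((he (ε * δ ^ 2 * (δ' / 2)) (by positivity)).and hpos))))).exists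
  have hN' : (0:ℝ) < N := Nat.cast_pos.2 hN0
  have hh : 0 < T / (N:ℝ) := by positivity
  set F := Finset.Ico (a N) (b N) with hF
  have hcard : ((F.card : ℕ) : ℝ) * (T / N) = gp T N (b N) - gp T N (a N) := by
    rw [hF, Nat.card_Ico, Nat.cast_sub (hab N)]; unfold gp; ring
  have hcpos : 0 < (F.card : ℝ) := by
    by_contra h
    push Not at h
    have : (F.card : ℝ) * (T / N) ≤ 0 := mul_nonpos_of_nonpos_of_nonneg h hh.le
    linarith
  have hFn : F.Nonempty := Finset.card_pos.1 (by exact_mod_cast hcpos)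
  have hFm : ∀ k ∈ F, 1 ≤ k ∧ k < N ∧ t < gp T N k ∧ gp T N k < t + δ := by
    intro k hk
    rw [hF, Finset.mem_Ico] at hk
    have h1 : k ≤ gidx T N r := Nat.lt_succ_iff.1 hk.2
    refine ⟨?_, lt_of_le_of_lt h1 (gidx_lt hT hN0 hr0.le hrT), ?_, ?_⟩
    · have := hk.1; simp only [ha] at this; omega
    · have h2 := lt_gp_gidx hT hN0 t
      rw [← gp_succ] at h2
      exact h2.trans_le (gp_mono hT N hk.1)
    · exact ((gp_mono hT N h1).trans (gp_gidx_le hT hN0 hr0.le)).trans_lt hrδ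
  set G := F.filter (fun k => |e N k| ≤ δ) with hG
  have hbadc : ((F \ G).card : ℝ) ≤ ε * F.card := by
    have h1 : ((F \ G).card : ℝ) * ((T / N) * δ ^ 2) ≤ ε * δ ^ 2 * (δ' / 2) := by
      refine le_trans ?_ hN5
      rw [← nsmul_eq_mul, ← Finset.sum_const]
      refine (Finset.sum_le_sum (g := fun i => (T / N) * (e N i) ^ 2) fun i hi => ?_).trans
        (Finset.sum_le_sum_of_subset_of_nonneg ?_ fun i _ _ => by positivity)
      · rw [hG, Finset.mem_sdiff, Finset.mem_filter] at hi
        have : δ < |e N i| := by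
          by_contra hh'
          exact hi.2 ⟨hi.1, not_lt.1 hh'⟩
        rw [← sq_abs (e N i)]
        have := this.le
        gcongr
      · intro i hi
        rw [Finset.mem_range]
        exact (hFm i (Finset.mem_sdiff.1 hi).1).2.1
    have h2 : ε * δ ^ 2 * (δ' / 2) ≤ ε * δ ^ 2 * (F.card * (T / N)) := by
      rw [hcard]; exact mul_le_mul_of_nonneg_left hN2.le (by positivity)
    have h3 := h1.trans h2
    have h4 : 0 < (T / N) * δ ^ 2 := by positivity
    have h5 : ((F \ G).card : ℝ) * ((T / N) * δ ^ 2) ≤ (ε * F.card) * ((T / N) * δ ^ 2) := by linarith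
    exact le_of_mul_le_mul_right h5 h4
  obtain ⟨v, hvK, hv⟩ := avg_near hKv hk0 (Finset.filter_subset _ F) hFn (ζ N) hεp.le hB0
    (fun i hi => by
      rw [Finset.mem_filter] at hi
      obtain ⟨h1, h2, h3, h4⟩ := hFm i hi.1
      exact hN3 i h1 h2 h3 h4 hi.2)
    (fun i hi => hN4 i (hFm i hi).1 (hFm i hi).2.1) hbadc
  refine ⟨v, hvK, ?_⟩
  have e1 : (gp T N (b N) - gp T N (a N))⁻¹ • ∑ k ∈ F, (T / N) • ζ N k = (F.card : ℝ)⁻¹ • ∑ k ∈ F, ζ N k := by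
    rw [← Finset.smul_sum, smul_smul, ← hcard]
    congr 1
    field_simp
  rw [e1] at hN1
  rw [dist_eq_norm]
  have e2 : D - v = -(((F.card : ℝ)⁻¹ • ∑ k ∈ F, ζ N k) - D) + (((F.card : ℝ)⁻¹ • ∑ k ∈ F, ζ N k) - v) := by abel
  rw [e2]
  refine (norm_add_le _ _).trans_lt ?_
  rw [norm_neg]
  have e3 : ε * M = ε0 / 2 := by rw [hε]; field_simp
  have e4 : ε * M = ε * (1 + B + ‖k0‖) + 2 * ε := by rw [hM]; ring
  linarith

/-- filter of grid indices in right windows at `t` -/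
def Wf (T : ℝ) (𝒰 : Filter ℕ) (t : ℝ) : Filter (ℕ × ℕ) :=
  Filter.comap Prod.fst 𝒰 ⊓ Filter.comap (fun p : ℕ × ℕ => gp T p.1 p.2) (𝓝[>] t)

theorem Wf_gp (T : ℝ) (𝒰 : Filter ℕ) (t : ℝ) : Tendsto (fun p : ℕ × ℕ => gp T p.1 p.2) (Wf T 𝒰 t) (𝓝[>] t) :=
  tendsto_comap.mono_left inf_le_right

theorem Wf_fst (T : ℝ) (𝒰 : Filter ℕ) (t : ℝ) : Tendsto (fun p : ℕ × ℕ => p.1) (Wf T 𝒰 t) 𝒰 :=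
  tendsto_comap.mono_left inf_le_left

theorem Wf_exists {T : ℝ} {𝒰 : Filter ℕ} {t : ℝ} {P : ℕ × ℕ → Prop} (h : ∀ᶠ p in Wf T 𝒰 t, P p) :
    ∃ δ > (0:ℝ), ∀ᶠ N in 𝒰, ∀ i, t < gp T N i → gp T N i < t + δ → P (N, i) := by
  unfold Wf at h
  obtain ⟨S1, hS1, S2, hS2, hS⟩ := Filter.mem_inf_iff_superset.1 h
  obtain ⟨A, hA, hA1⟩ := Filter.mem_comap.1 hS1
  obtain ⟨D, hD, hD1⟩ := Filter.mem_comap.1 hS2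
  obtain ⟨u, hu, huD⟩ := mem_nhdsGT_iff_exists_Ioo_subset.1 hD
  refine ⟨u - t, sub_pos.2 hu, ?_⟩
  filter_upwards [hA] with N hN i h1 h2
  exact hS ⟨hA1 hN, hD1 (huD ⟨h1, by linarith⟩)⟩

theorem Wf_idx {T : ℝ} (hT : 0 < T) {𝒰 : Filter ℕ} (h𝒰 : 𝒰 ≤ atTop) {t : ℝ} (ht : t ∈ Ico 0 T) :
    ∀ᶠ p in Wf T 𝒰 t, 0 < p.1 ∧ 1 ≤ p.2 ∧ p.2 < p.1 := by
  have h1 : ∀ᶠ r in 𝓝[>] t, t < r ∧ r < T := by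
    filter_upwards [Ioo_mem_nhdsGT ht.2] with r hr using hr
  filter_upwards [(Wf_gp T 𝒰 t).eventually h1, (Wf_fst T 𝒰 t).eventually (h𝒰 (eventually_gt_atTop 0))] with p hp hp0
  refine ⟨hp0, ?_, ?_⟩
  · by_contra h
    have : p.2 = 0 := by omega
    rw [this, gp_zero] at hp
    linarith [ht.1, hp.1]
  · by_contra h
    have := gp_mono hT p.1 (not_lt.1 h)
    rw [gp_last T hp0] at this
    linarith [hp.2]

theorem Wf_shift {T : ℝ} (hT : 0 < T) {𝒰 : Filter ℕ} (h𝒰 : 𝒰 ≤ atTop) (t : ℝ) :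
    Tendsto (fun p : ℕ × ℕ => (p.1, p.2 + 1)) (Wf T 𝒰 t) (Wf T 𝒰 t) := by
  conv_rhs => unfold Wf
  refine tendsto_inf.2 ⟨tendsto_comap_iff.2 (Wf_fst T 𝒰 t), tendsto_comap_iff.2 ?_⟩
  have h0 : Tendsto (fun p : ℕ × ℕ => T / (p.1:ℝ)) (Wf T 𝒰 t) (𝓝 0) :=
    ((tendsto_const_div_atTop_nhds_zero_nat T).mono_left h𝒰).comp (Wf_fst T 𝒰 t)
  have h1 := tendsto_nhdsWithin_iff.1 (Wf_gp T 𝒰 t)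
  refine tendsto_nhdsWithin_iff.2 ⟨?_, ?_⟩
  · have := h1.1.add h0
    rw [add_zero] at this
    refine this.congr fun p => ?_
    simp only [Function.comp, gp_succ]
  · filter_upwards [h1.2] with p hp
    simp only [Function.comp, gp_succ, mem_Ioi] at hp ⊢
    have : 0 ≤ T / (p.1:ℝ) := by positivity
    linarith

theorem Wf_unif {E : Type*} [NormedAddCommGroup E] {T : ℝ} (hT : 0 < T) {𝒰 : Filter ℕ} (h𝒰 : 𝒰 ≤ atTop)
    {Y : ℕ → ℕ → E} {z : ℝ → E} (hz : ∀ ε > (0:ℝ), ∀ᶠ N in 𝒰, ∀ i ≤ N, ‖Y N i - z (gp T N i)‖ ≤ ε) {t : ℝ}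
    (ht : t ∈ Ico 0 T) (hc : Tendsto z (𝓝[>] t) (𝓝 (z t))) :
    Tendsto (fun p : ℕ × ℕ => Y p.1 p.2) (Wf T 𝒰 t) (𝓝 (z t)) := by
  have h1 := hc.comp (Wf_gp T 𝒰 t)
  have h2 : Tendsto (fun p : ℕ × ℕ => Y p.1 p.2 - z (gp T p.1 p.2)) (Wf T 𝒰 t) (𝓝 0) := by
    rw [Metric.tendsto_nhds]
    intro ε hε
    filter_upwards [(Wf_fst T 𝒰 t).eventually (hz (ε / 2) (by positivity)), Wf_idx hT h𝒰 ht] with p hp hi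
    rw [dist_zero_right]
    linarith [hp p.2 hi.2.2.le]
  have := h2.add h1
  simpa [Function.comp] using this

theorem Wf_mono {T : ℝ} (hT : 0 < T) {𝒰 : Filter ℕ} (h𝒰 : 𝒰 ≤ atTop) {a : ℕ → ℕ → ℝ}
    (ha : ∀ N i, 0 ≤ a N i) {v : ℝ → ℝ}
    (hv : ∀ t, Tendsto (fun N => ∑ k ∈ Finset.Ico 1 (min (gidx T N t + 1) N), a N k) 𝒰 (𝓝 (v t))) {t : ℝ}
    (ht : t ∈ Ico 0 T) (hc : ContinuousAt v t) :
    Tendsto (fun p : ℕ × ℕ => ∑ k ∈ Finset.Ico 1 p.2, a p.1 k) (Wf T 𝒰 t) (𝓝 (v t)) := by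
  rw [Metric.tendsto_nhds]
  intro ε hε
  have hr : ∀ᶠ r in 𝓝[>] t, |v r - v t| < ε / 2 ∧ r < T := by
    have h1 := (Metric.tendsto_nhds.1 hc.tendsto (ε / 2) (by positivity)).filter_mono (nhdsWithin_le_nhds (s := Ioi t))
    filter_upwards [h1, Ioo_mem_nhdsGT ht.2] with r hr1 hr2
    exact ⟨hr1, hr2.2⟩
  obtain ⟨r, ⟨hr1, hrT⟩, hr2⟩ := (hr.and self_mem_nhdsWithin).exists
  have hr2 : t < r := hr2
  have e1 := Metric.tendsto_nhds.1 (hv t) (ε / 2) (by positivity)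
  have e2 := Metric.tendsto_nhds.1 (hv r) (ε / 2) (by positivity)
  filter_upwards [(Wf_fst T 𝒰 t).eventually e1, (Wf_fst T 𝒰 t).eventually e2, Wf_idx hT h𝒰 ht,
    (Wf_gp T 𝒰 t).eventually (Ioo_mem_nhdsGT hr2)] with p h1 h2 h3 h4
  have hr0 : 0 ≤ r := ht.1.trans hr2.le
  have g1 := gidx_lt hT h3.1 hr0 hrT
  have g2 := gidx_lt hT h3.1 ht.1 ht.2
  have g3 := gidx_lt_of hT h3.1 ht.1 h4.1
  have g4 := le_gidx hT h3.1 h4.2.le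
  rw [min_eq_left (by omega)] at h1 h2
  have m1 : ∑ k ∈ Finset.Ico 1 (gidx T p.1 t + 1), a p.1 k ≤ ∑ k ∈ Finset.Ico 1 p.2, a p.1 k :=
    Finset.sum_le_sum_of_subset_of_nonneg (Finset.Ico_subset_Ico_right (by omega)) fun i _ _ => ha _ i
  have m2 : ∑ k ∈ Finset.Ico 1 p.2, a p.1 k ≤ ∑ k ∈ Finset.Ico 1 (gidx T p.1 r + 1), a p.1 k :=
    Finset.sum_le_sum_of_subset_of_nonneg (Finset.Ico_subset_Ico_right (by omega)) fun i _ _ => ha _ i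
  rw [Real.dist_eq, abs_lt] at *
  constructor <;> linarith [h1.1, h1.2, h2.1, h2.2, hr1.1, hr1.2]

theorem avg_limit' {E : Type*} [NormedAddCommGroup E] [NormedSpace ℝ E] {T : ℝ} (hT : 0 < T)
    {𝒰 : Filter ℕ} [𝒰.NeBot] (h𝒰 : 𝒰 ≤ atTop) {ζ : ℕ → ℕ → E} {z : ℝ → E}
    (hz : ∀ ε > (0:ℝ), ∀ᶠ N : ℕ in 𝒰, ∀ i ≤ N, ‖(∑ k ∈ Finset.Ico 1 i, (T / N) • ζ N k) - z (gp T N i)‖ ≤ ε)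
    (hzc : Continuous z) {B : ℝ} (hB0 : 0 ≤ B) (hB : ∀ᶠ N in 𝒰, ∀ i, 1 ≤ i → i < N → ‖ζ N i‖ ≤ B) {t : ℝ} (ht : t ∈ Ioo 0 T)
    {D : E} (hD : HasDerivAt z D t) {K : Set E} (hKc : IsClosed K) (hKv : Convex ℝ K) (hKn : K.Nonempty)
    {e : ℕ → ℕ → ℝ} (he : ∀ ε > (0:ℝ), ∀ᶠ N : ℕ in 𝒰, ∑ i ∈ Finset.range N, (T / N) * (e N i) ^ 2 ≤ ε)
    (hgood : ∀ ε > (0:ℝ), ∃ δ > (0:ℝ), ∀ᶠ p in Wf T 𝒰 t, |e p.1 p.2| ≤ δ →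
      ∃ v ∈ K, ‖ζ p.1 p.2 - v‖ ≤ ε) : D ∈ K := by
  refine avg_limit hT h𝒰 hz hzc hB0 hB ht hD hKc hKv hKn he fun ε hε => ?_
  obtain ⟨δ, hδ, h⟩ := hgood ε hε
  obtain ⟨δ', hδ', h⟩ := Wf_exists h
  refine ⟨min δ δ', by positivity, ?_⟩
  filter_upwards [h] with N hN i _ _ h1 h2 h3
  exact hN i h1 (h2.trans_le (by linarith [min_le_right δ δ'])) (h3.trans (min_le_left _ _))

/-- limiting data -/
structure LimD {n d s : ℕ} (T : ℝ) (xs : Fin s → Euc n) (c : Fin s → ℝ) (U : Set (Euc d))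
    (g : WithLp 2 (Euc n × Euc d) → Euc n) (φ : Euc n → ℝ) (xb : ℝ → Euc n) (ub : ℝ → Euc d) (A B : ℝ) (𝒰 : Filter ℕ)
    (X : ℕ → ℕ → Euc n) (V W : ℕ → ℕ → Euc d) (q ω : ℕ → ℕ → Euc n) (ψ : ℕ → ℕ → Euc d)
    (L : NNReal) (z1 z3 : ℝ → Euc n) (z2 : ℝ → Euc d) (qT : Euc n) (vp vm : Fin s → ℝ → ℝ) : Prop where
  h𝒰 : 𝒰 ≤ atTop
  hB : 0 < B
  good : ∀ ε > (0:ℝ), ∀ᶠ N in 𝒰, DGood T xs c U g xb ub ε N (X N) (V N) (W N)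
  fin : ∀ᶠ N in 𝒰, DFin T xs c U g φ ub A B N (X N) (V N) (W N) (q N) (ω N) (ψ N)
  l1 : LipschitzWith L z1
  l2 : LipschitzWith L z2
  l3 : LipschitzWith L z3
  c1 : ∀ ε > (0:ℝ), ∀ᶠ N : ℕ in 𝒰, ∀ i ≤ N, ‖(∑ k ∈ Finset.Ico 1 i, (T / N) • ω N k) - z1 (gp T N i)‖ ≤ ε
  c2 : ∀ ε > (0:ℝ), ∀ᶠ N : ℕ in 𝒰, ∀ i ≤ N, ‖(∑ k ∈ Finset.Ico 1 i, (T / N) • ψ N k) - z2 (gp T N i)‖ ≤ ε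
  c3 : ∀ ε > (0:ℝ), ∀ᶠ N : ℕ in 𝒰, ∀ i ≤ N, ‖(∑ k ∈ Finset.Ico 1 i, (T / N) • g (pmk (X N k) (V N k))) - z3 (gp T N i)‖ ≤ ε
  b3 : ∀ᶠ N in 𝒰, ∀ i, 1 ≤ i → i < N → ‖g (pmk (X N i) (V N i))‖ ≤ B
  hqT : Tendsto (fun N => q N N) 𝒰 (𝓝 qT)
  mp : ∀ j, Monotone (vp j)
  mm : ∀ j, Monotone (vm j)
  Tp : ∀ j t, T ≤ t → vp j t = vp j T
  Tm : ∀ j t, T ≤ t → vm j t = vm j T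
  tp : ∀ j t, Tendsto (fun N => ∑ k ∈ Finset.Ico 1 (min (gidx T N t + 1) N), max (bet xs c T (X N k) (q N k) j) 0) 𝒰 (𝓝 (vp j t))
  tm : ∀ j t, Tendsto (fun N => ∑ k ∈ Finset.Ico 1 (min (gidx T N t + 1) N), max (-bet xs c T (X N k) (q N k) j) 0) 𝒰 (𝓝 (vm j t))

def qlim {n s : ℕ} (T : ℝ) (xs : Fin s → Euc n) (z1 : ℝ → Euc n) (qT : Euc n) (vp vm : Fin s → ℝ → ℝ) (t : ℝ) : Euc n :=
  qT - (z1 T - z1 t) - ∑ j, ((vp j T - vm j T) - (vp j t - vm j t)) • xs j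

theorem LimD.q_tendsto {n d s : ℕ} {T : ℝ} (hT : 0 < T) {xs : Fin s → Euc n} {c : Fin s → ℝ} {U : Set (Euc d)}
    {g : WithLp 2 (Euc n × Euc d) → Euc n} {φ : Euc n → ℝ} {xb : ℝ → Euc n} {ub : ℝ → Euc d} {A B : ℝ} {𝒰 : Filter ℕ}
    {X : ℕ → ℕ → Euc n} {V W : ℕ → ℕ → Euc d} {q ω : ℕ → ℕ → Euc n} {ψ : ℕ → ℕ → Euc d}
    {L : NNReal} {z1 z3 : ℝ → Euc n} {z2 : ℝ → Euc d} {qT : Euc n} {vp vm : Fin s → ℝ → ℝ}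
    (H : LimD T xs c U g φ xb ub A B 𝒰 X V W q ω ψ L z1 z3 z2 qT vp vm) {t : ℝ} (ht : t ∈ Ico 0 T)
    (hp : ∀ j, ContinuousAt (vp j) t) (hm : ∀ j, ContinuousAt (vm j) t) :
    Tendsto (fun p : ℕ × ℕ => q p.1 p.2) (Wf T 𝒰 t) (𝓝 (qlim T xs z1 qT vp vm t)) := by
  have hpos : ∀ᶠ m in 𝒰, 0 < m := H.h𝒰 (eventually_gt_atTop 0)
  have hNN : ∀ N, 0 < N → min (gidx T N T + 1) N = N := by
    intro N hN
    have := gidx_gp hT hN N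
    rw [gp_last T hN] at this
    omega
  have hF := Wf_fst T 𝒰 t
  have t1 := H.hqT.comp hF
  have t2 : Tendsto (fun N : ℕ => ∑ k ∈ Finset.Ico 1 N, (T / N) • ω N k) 𝒰 (𝓝 (z1 T)) := by
    rw [Metric.tendsto_nhds]
    intro ε hε
    filter_upwards [H.c1 (ε / 2) (by positivity), hpos] with N hN hN0
    have := hN N le_rfl
    rw [gp_last T hN0] at this
    rw [dist_eq_norm]; linarith
  have t3 := Wf_unif hT H.h𝒰 H.c1 ht (H.l1.continuous.continuousAt.tendsto.mono_left nhdsWithin_le_nhds)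
  have t4 : ∀ j, Tendsto (fun N => ∑ k ∈ Finset.Ico 1 N, max (bet xs c T (X N k) (q N k) j) 0) 𝒰 (𝓝 (vp j T)) := by
    intro j
    refine (H.tp j T).congr' ?_
    filter_upwards [hpos] with N hN
    rw [hNN N hN]
  have t5 : ∀ j, Tendsto (fun N => ∑ k ∈ Finset.Ico 1 N, max (-bet xs c T (X N k) (q N k) j) 0) 𝒰 (𝓝 (vm j T)) := by
    intro j
    refine (H.tm j T).congr' ?_
    filter_upwards [hpos] with N hN
    rw [hNN N hN]
  have t6 : ∀ j, _ := fun j => Wf_mono hT H.h𝒰 (a := fun N k => max (bet xs c T (X N k) (q N k) j) 0) (fun _ _ => le_max_right _ _) (H.tp j) ht (hp j)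
  have t7 : ∀ j, _ := fun j => Wf_mono hT H.h𝒰 (a := fun N k => max (-bet xs c T (X N k) (q N k) j) 0) (fun _ _ => le_max_right _ _) (H.tm j) ht (hm j)
  have t8 := (t1.sub ((t2.comp hF).sub t3)).sub (tendsto_finsetSum Finset.univ fun j _ =>
    ((((t4 j).comp hF).sub ((t5 j).comp hF)).sub ((t6 j).sub (t7 j))).smul_const (xs j))
  refine t8.congr' ?_
  filter_upwards [hF.eventually H.fin, Wf_idx hT H.h𝒰 ht] with p hp hi
  obtain ⟨N, i⟩ := p
  simp only [Function.comp] at hp hi ⊢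
  have hsplit : ∀ {E : Type} [AddCommGroup E] (f : ℕ → E), ∑ k ∈ Finset.Ico 1 N, f k - ∑ k ∈ Finset.Ico 1 i, f k = ∑ k ∈ Finset.Ico i N, f k := by
    intro E _ f
    rw [sub_eq_iff_eq_add, add_comm, Finset.sum_Ico_consecutive _ hi.2.1 hi.2.2.le]
  have e1 : q N N - q N i = ∑ k ∈ Finset.Ico i N, (q N (k + 1) - q N k) := (Finset.sum_Ico_sub _ hi.2.2.le).symm
  have e2 : ∑ k ∈ Finset.Ico i N, (q N (k + 1) - q N k) = ∑ k ∈ Finset.Ico i N, (∑ j, bet xs c T (X N k) (q N k) j • xs j + (T / N) • ω N k) := by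
    refine Finset.sum_congr rfl fun k hk => ?_
    rw [Finset.mem_Ico] at hk
    rw [hp.recq k (by omega) hk.2]; abel
  rw [Finset.sum_add_distrib, Finset.sum_comm] at e2
  have e3 : ∀ j, (∑ k ∈ Finset.Ico 1 N, max (bet xs c T (X N k) (q N k) j) 0 - ∑ k ∈ Finset.Ico 1 N, max (-bet xs c T (X N k) (q N k) j) 0) -
      (∑ k ∈ Finset.Ico 1 i, max (bet xs c T (X N k) (q N k) j) 0 - ∑ k ∈ Finset.Ico 1 i, max (-bet xs c T (X N k) (q N k) j) 0) =
      ∑ k ∈ Finset.Ico i N, bet xs c T (X N k) (q N k) j := by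
    intro j
    rw [← Finset.sum_sub_distrib, ← Finset.sum_sub_distrib, hsplit]
    refine Finset.sum_congr rfl fun k _ => ?_
    rcases le_total 0 (bet xs c T (X N k) (q N k) j) with h | h
    · rw [max_eq_left h, max_eq_right (by linarith)]; ring
    · rw [max_eq_right h, max_eq_left (by linarith)]; ring
  simp only [e3, hsplit, Finset.sum_smul]
  rw [e2] at e1
  rw [sub_eq_iff_eq_add] at e1
  rw [e1]; abel

theorem DFin.mono {n d s : ℕ} {T : ℝ} {xs : Fin s → Euc n} {c : Fin s → ℝ} {U : Set (Euc d)}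
    {g : WithLp 2 (Euc n × Euc d) → Euc n} {φ : Euc n → ℝ} {ub : ℝ → Euc d} {A B B' : ℝ} {N : ℕ}
    {x : ℕ → Euc n} {u w : ℕ → Euc d} {q ω : ℕ → Euc n} {ψ : ℕ → Euc d} (h : B ≤ B')
    (H : DFin T xs c U g φ ub A B N x u w q ω ψ) : DFin T xs c U g φ ub A B' N x u w q ω ψ where
  prox := H.prox
  recq := H.recq
  bω := fun i h1 h2 => (H.bω i h1 h2).trans h
  bψ := fun i h1 h2 => (H.bψ i h1 h2).trans h
  bq := fun i h1 h2 => (H.bq i h1 h2).trans h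
  bb := H.bb.trans h
  nor := H.nor
  fin := H.fin

theorem ultra_int {k : ℕ} {T : ℝ} (hT : 0 < T) (𝒰 : Ultrafilter ℕ) (h𝒰 : (𝒰 : Filter ℕ) ≤ atTop)
    {ζ : ℕ → ℕ → Euc k} {B : ℝ} (hB0 : 0 ≤ B) (hB : ∀ᶠ N in (𝒰 : Filter ℕ), ∀ i, 1 ≤ i → i < N → ‖ζ N i‖ ≤ B) :
    ∃ z : ℝ → Euc k, LipschitzWith B.toNNReal z ∧
      ∀ ε > (0:ℝ), ∀ᶠ N : ℕ in (𝒰 : Filter ℕ), ∀ i ≤ N, ‖(∑ k ∈ Finset.Ico 1 i, (T / N) • ζ N k) - z (gp T N i)‖ ≤ ε := by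
  have hinc : ∀ᶠ N : ℕ in (𝒰 : Filter ℕ), ∀ i < N, ‖(∑ k ∈ Finset.Ico 1 (i + 1), (T / N) • ζ N k) - ∑ k ∈ Finset.Ico 1 i, (T / N) • ζ N k‖ ≤ B * (T / N) := by
    filter_upwards [hB] with N hN i hi
    have h0 : 0 ≤ T / (N : ℝ) := by positivity
    rcases Nat.eq_zero_or_pos i with rfl | h
    · simp; positivity
    · rw [Finset.sum_Ico_succ_top (by omega), add_sub_cancel_left, norm_smul, Real.norm_of_nonneg h0, mul_comm]
      exact mul_le_mul_of_nonneg_right (hN i h hi) h0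
  have hbd : ∀ᶠ N : ℕ in (𝒰 : Filter ℕ), ∀ i ≤ N, ‖∑ k ∈ Finset.Ico 1 i, (T / N) • ζ N k‖ ≤ B * T := by
    filter_upwards [hB, h𝒰 (eventually_gt_atTop 0)] with N hN hN0 i hi
    have h0 : 0 ≤ T / (N : ℝ) := by positivity
    calc ‖∑ k ∈ Finset.Ico 1 i, (T / N) • ζ N k‖ ≤ ∑ k ∈ Finset.Ico 1 i, ‖(T / (N:ℝ)) • ζ N k‖ := norm_sum_le _ _
      _ ≤ ∑ k ∈ Finset.Ico 1 i, (T / N) * B := by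
          refine Finset.sum_le_sum fun k hk => ?_
          rw [Finset.mem_Ico] at hk
          rw [norm_smul, Real.norm_of_nonneg h0]
          exact mul_le_mul_of_nonneg_left (hN k hk.1 (by omega)) h0
      _ = ((i - 1 : ℕ) : ℝ) * ((T / N) * B) := by simp
      _ ≤ N * ((T / N) * B) := by
          have : ((i - 1 : ℕ) : ℝ) ≤ N := by exact_mod_cast (by omega)
          exact mul_le_mul_of_nonneg_right this (by positivity)
      _ = B * T := by
          have : (N:ℝ) ≠ 0 := by positivity
          field_simp
  obtain ⟨z, h1, -, h3⟩ := ultra_lip hT 𝒰 h𝒰 hB0 (Y := fun N i => ∑ k ∈ Finset.Ico 1 i, (T / (N:ℝ)) • ζ N k) hbd hinc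
  exact ⟨z, h1, h3⟩

theorem exists_limD {n d s : ℕ} {T : ℝ} {xs : Fin s → Euc n} {c : Fin s → ℝ} {C : Set (Euc n)} {x0 : Euc n}
    {φ : Euc n → ℝ} {U : Set (Euc d)} {g : WithLp 2 (Euc n × Euc d) → Euc n} {β : ℝ}
    {xb xb' : ℝ → Euc n} {ub : ℝ → Euc d} {vb : ℝ → ℝ} (H : Core T xs c C x0 φ U g β xb xb' ub vb) :
    ∃ (A B : ℝ) (𝒰 : Filter ℕ) (_ : 𝒰.NeBot) (X : ℕ → ℕ → Euc n) (V W : ℕ → ℕ → Euc d) (q ω : ℕ → ℕ → Euc n)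
      (ψ : ℕ → ℕ → Euc d) (L : NNReal) (z1 z3 : ℝ → Euc n) (z2 : ℝ → Euc d) (qT : Euc n) (vp vm : Fin s → ℝ → ℝ),
      LimD T xs c U g φ xb ub A B 𝒰 X V W q ω ψ L z1 z3 z2 qT vp vm := by
  obtain ⟨A, hA, B, hB, X, V, W, q, ω, ψ, hgood, hfin⟩ := mult_bd H
  obtain ⟨hT, hC, hx0, hφ, hUc, hUne, hgc, hgL, hβ, hgrow, hfeas, -, hLI, hTin, hv, hrc⟩ := H
  have hCc : IsClosed C := by rw [hC]; exact poly_closed xs c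
  obtain ⟨RU, hRU⟩ := isBounded_iff_forall_norm_le.1 hUc.isBounded
  set Rx := (1 + ‖x0‖) * Real.exp (β * T) with hRx
  obtain ⟨Bg, hBg⟩ := (isCompact_closedBall (0 : WithLp 2 (Euc n × Euc d)) ((Rx + 1) + (RU + 1))).exists_bound_of_continuousOn hgc.continuousOn
  set 𝒰 : Ultrafilter ℕ := Ultrafilter.of atTop with h𝒰d
  have h𝒰 : (𝒰 : Filter ℕ) ≤ atTop := Ultrafilter.of_le _
  set B' := max B Bg with hB'
  have hB'0 : 0 < B' := lt_max_of_lt_left hB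
  have hfin' : ∀ᶠ N in (𝒰 : Filter ℕ), DFin T xs c U g φ ub A B' N (X N) (V N) (W N) (q N) (ω N) (ψ N) := by
    filter_upwards [h𝒰 hfin] with N hN using hN.mono (le_max_left _ _)
  have b3 : ∀ᶠ N in (𝒰 : Filter ℕ), ∀ i, 1 ≤ i → i < N → ‖g (pmk (X N i) (V N i))‖ ≤ B' := by
    filter_upwards [h𝒰 (hgood 1 one_pos), h𝒰 (eventually_gt_atTop 0)] with N hN hN0 i _ hi
    refine (hBg _ ?_).trans (le_max_right _ _)
    rw [mem_closedBall_zero_iff]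
    refine (pmk_norm_le _ _).trans (add_le_add ?_ ?_)
    · have h1 := hN.1 i hi.le
      have h2 := feas_bound hT hCc hβ hgrow hfeas (gp T N i) (gp_mem hT hN0 hi.le)
      have h3 := norm_le_insert' (X N i) (xb (gp T N i))
      linarith
    · have h1 := hN.2.1 i hi
      have h2 := hRU _ (hN.2.2.1 i)
      have h3 := norm_le_insert' (V N i) (W N i)
      linarith
  obtain ⟨z1, l1, c1⟩ := ultra_int hT 𝒰 h𝒰 (ζ := ω) hB'0.le (hfin'.mono fun N h => h.bω)
  obtain ⟨z2, l2, c2⟩ := ultra_int hT 𝒰 h𝒰 (ζ := ψ) hB'0.le (hfin'.mono fun N h => h.bψ)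
  obtain ⟨z3, l3, c3⟩ := ultra_int hT 𝒰 h𝒰 (ζ := fun N i => g (pmk (X N i) (V N i))) hB'0.le b3
  obtain ⟨qT, hqT⟩ := ultra_lim 𝒰 (a := fun N => q N N) (R := B') (by
    filter_upwards [hfin', h𝒰 (eventually_gt_atTop 0)] with N hN hN0
    exact hN.bq N hN0 le_rfl)
  have hbs : ∀ j, ∀ᶠ N in (𝒰 : Filter ℕ), ∑ i ∈ Finset.Ico 1 N, |bet xs c T (X N i) (q N i) j| ≤ B' := by
    intro j
    filter_upwards [hfin'] with N hN
    refine le_trans (Finset.sum_le_sum fun i _ => ?_) hN.bb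
    exact Finset.single_le_sum (f := fun j => |bet xs c T (X N i) (q N i) j|) (fun j _ => abs_nonneg _) (Finset.mem_univ j)
  have hp : ∀ j, _ := fun j => ultra_mono hT 𝒰 h𝒰 (a := fun N k => max (bet xs c T (X N k) (q N k) j) 0) (B := B')
    (fun _ _ => le_max_right _ _) ((hbs j).mono fun N hN => le_trans (Finset.sum_le_sum fun i _ => max_le (le_abs_self _) (abs_nonneg _)) hN)
  have hm : ∀ j, _ := fun j => ultra_mono hT 𝒰 h𝒰 (a := fun N k => max (-bet xs c T (X N k) (q N k) j) 0) (B := B')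
    (fun _ _ => le_max_right _ _) ((hbs j).mono fun N hN => le_trans (Finset.sum_le_sum fun i _ => max_le (neg_le_abs _) (abs_nonneg _)) hN)
  choose vp mp Tp tp using hp
  choose vm mm Tm tm using hm
  exact ⟨A, B', 𝒰, inferInstance, X, V, W, q, ω, ψ, _, z1, z3, z2, qT, vp, vm,
    ⟨h𝒰, hB'0, fun ε hε => h𝒰 (hgood ε hε), hfin', l1, l2, l3, c1, c2, c3, b3, hqT, mp, mm, Tp, Tm, tp, tm⟩⟩

theorem pmk_sum {n d : ℕ} {ι : Type*} (s : Finset ι) (a : ι → Euc n) (b : ι → Euc d) :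
    ∑ i ∈ s, pmk (a i) (b i) = pmk (∑ i ∈ s, a i) (∑ i ∈ s, b i) := by
  classical
  induction s using Finset.induction_on with
  | empty => simp; rfl
  | insert i s hi ih => rw [Finset.sum_insert hi, Finset.sum_insert hi, Finset.sum_insert hi, ih, pmk_add]

def inlC (n d : ℕ) : Euc n →L[ℝ] WithLp 2 (Euc n × Euc d) :=
  LinearMap.mkContinuous { toFun := fun x => pmk x 0, map_add' := fun x y => by rw [pmk_add, add_zero], map_smul' := fun t x => by rw [RingHom.id_apply, pmk_smul, smul_zero] } 1
    (fun x => by simpa using pmk_norm_le x (0 : Euc d))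
def inrC (n d : ℕ) : Euc d →L[ℝ] WithLp 2 (Euc n × Euc d) :=
  LinearMap.mkContinuous { toFun := fun x => pmk 0 x, map_add' := fun x y => by rw [pmk_add, add_zero], map_smul' := fun t x => by rw [RingHom.id_apply, pmk_smul, smul_zero] } 1
    (fun x => by simpa using pmk_norm_le (0 : Euc n) x)
theorem pmk_eq (n d : ℕ) (x : Euc n) (y : Euc d) : pmk x y = inlC n d x + inrC n d y := by
  change pmk x y = pmk x 0 + pmk 0 y
  rw [pmk_add, add_zero, zero_add]

theorem avg_limit2 {E F G : Type*} [NormedAddCommGroup E] [NormedSpace ℝ E] [NormedAddCommGroup F] [NormedSpace ℝ F]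
    [NormedAddCommGroup G] [NormedSpace ℝ G] (L1 : E →L[ℝ] G) (L2 : F →L[ℝ] G) {T : ℝ} (hT : 0 < T)
    {𝒰 : Filter ℕ} [𝒰.NeBot] (h𝒰 : 𝒰 ≤ atTop) {ζ : ℕ → ℕ → G} {a : ℝ → E} {b : ℝ → F}
    (hz : ∀ ε > (0:ℝ), ∀ᶠ N : ℕ in 𝒰, ∀ i ≤ N, ‖(∑ k ∈ Finset.Ico 1 i, (T / N) • ζ N k) - (L1 (a (gp T N i)) + L2 (b (gp T N i)))‖ ≤ ε)
    (hac : Continuous a) (hbc : Continuous b) {B : ℝ} (hB0 : 0 ≤ B) (hB : ∀ᶠ N in 𝒰, ∀ i, 1 ≤ i → i < N → ‖ζ N i‖ ≤ B) {t : ℝ} (ht : t ∈ Ioo 0 T)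
    {a' : E} {b' : F} (ha : HasDerivAt a a' t) (hb : HasDerivAt b b' t)
    {K : Set G} (hKc : IsClosed K) (hKv : Convex ℝ K) (hKn : K.Nonempty)
    {e : ℕ → ℕ → ℝ} (he : ∀ ε > (0:ℝ), ∀ᶠ N : ℕ in 𝒰, ∑ i ∈ Finset.range N, (T / N) * (e N i) ^ 2 ≤ ε)
    (hgood : ∀ ε > (0:ℝ), ∃ δ > (0:ℝ), ∀ᶠ p in Wf T 𝒰 t, |e p.1 p.2| ≤ δ →
      ∃ v ∈ K, ‖ζ p.1 p.2 - v‖ ≤ ε) : L1 a' + L2 b' ∈ K :=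
  avg_limit' hT h𝒰 (z := fun t => L1 (a t) + L2 (b t)) hz (by fun_prop) hB0 hB ht
    ((L1.hasFDerivAt.comp_hasDerivAt t ha).add (L2.hasFDerivAt.comp_hasDerivAt t hb)) hKc hKv hKn he hgood

theorem GLip.ball {n d : ℕ} {g : WithLp 2 (Euc n × Euc d) → Euc n} (hg : GLip g) (zb : WithLp 2 (Euc n × Euc d)) :
    ∃ K : ℝ, 0 ≤ K ∧ ∀ z ∈ Metric.ball zb 1, ∀ w ∈ Metric.ball zb 1, ‖g z - g w‖ ≤ K * ‖z - w‖ := by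
  obtain ⟨K, hK, h⟩ := hg (‖zb‖ + 1)
  refine ⟨2 * K, by positivity, fun z hz w hw => ?_⟩
  have hb : ∀ z ∈ Metric.ball zb 1, ‖z‖ ≤ ‖zb‖ + 1 := fun z hz => by
    rw [mem_ball_iff_norm] at hz
    linarith [norm_le_insert' z zb]
  have h1 := hb z hz
  have h2 := hb w hw
  rw [← pmk_eta z, ← pmk_eta w] at *
  generalize pfst z = x at *
  generalize psnd z = u at *
  generalize pfst w = x' at *
  generalize psnd w = u' at *
  have := h x x' u u' ((norm_le_pmk_left _ _).trans h1) ((norm_le_pmk_left _ _).trans h2)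
    ((norm_le_pmk_right _ _).trans h1) ((norm_le_pmk_right _ _).trans h2)
  rw [pmk_sub]
  have e1 := norm_le_pmk_left (x - x') (u - u')
  have e2 := norm_le_pmk_right (x - x') (u - u')
  nlinarith

theorem GLip.locLip {n d : ℕ} {g : WithLp 2 (Euc n × Euc d) → Euc n} (hg : GLip g) (q : Euc n) :
    LocallyLipschitz (fun z => ⟪q, g z⟫) := by
  intro z
  obtain ⟨K, hK, h⟩ := hg.ball z
  refine ⟨(‖q‖ * K).toNNReal, Metric.ball z 1, Metric.ball_mem_nhds _ one_pos, LipschitzOnWith.of_dist_le_mul fun x hx y hy => ?_⟩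
  rw [Real.coe_toNNReal _ (by positivity), Real.dist_eq, dist_eq_norm, ← inner_sub_right, mul_assoc]
  exact (abs_real_inner_le_norm _ _).trans (mul_le_mul_of_nonneg_left (h x hx y hy) (norm_nonneg _))

theorem ext_sum {ι M : Type*} [Fintype ι] [AddCommMonoid M] {m : ℕ} (e : ι ↪ Fin m) (f : ι → M) (f' : Fin m → M)
    (h1 : ∀ i, f' (e i) = f i) (h2 : ∀ k, (k ∉ range e) → f' k = 0) : ∑ k, f' k = ∑ i, f i := by
  symm
  refine Finset.sum_of_injOn e e.injective.injOn (by simp) ?_ (by simp [h1])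
  intro k _ hk
  exact h2 k (by simpa using hk)

theorem hull_compact {E : Type*} [NormedAddCommGroup E] [InnerProductSpace ℝ E] [FiniteDimensional ℝ E]
    {S : Set E} (hS : IsClosed S) (R : ℝ) : IsClosed (convexHull ℝ (S ∩ Metric.closedBall 0 R)) := by
  have : ProperSpace E := FiniteDimensional.proper_real E
  have hc : IsCompact (S ∩ Metric.closedBall 0 R) := (isCompact_closedBall (0:E) R).inter_left hS
  generalize S ∩ Metric.closedBall 0 R = K at hc
  set m := Module.finrank ℝ E + 1 with hm
  set F : (Fin m → ℝ) × (Fin m → E) → E := fun p => ∑ i, p.1 i • p.2 i with hF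
  have hFc : Continuous F := by fun_prop
  have h1 : IsCompact (F '' (stdSimplex ℝ (Fin m) ×ˢ Set.pi univ fun _ => K)) :=
    ((isCompact_stdSimplex ℝ (Fin m)).prod (isCompact_univ_pi fun _ => hc)).image hFc
  have h2 : convexHull ℝ K = F '' (stdSimplex ℝ (Fin m) ×ˢ Set.pi univ fun _ => K) := by
    apply Subset.antisymm
    · intro x hx
      obtain ⟨ι, _, z, w, hz, hai, hw, hw1, hx⟩ := eq_pos_convex_span_of_mem_convexHull hx
      have hcard : Fintype.card ι ≤ m := by
        exact hai.card_le_finrank_succ.trans (Nat.add_le_add_right (Submodule.finrank_le _) 1)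
      obtain ⟨e⟩ : Nonempty (ι ↪ Fin m) := Function.Embedding.nonempty_of_card_le (by simpa using hcard)
      have hne : Nonempty ι := by
        by_contra h
        rw [not_nonempty_iff] at h
        simp at hw1
      refine ⟨(Function.extend e w 0, Function.extend e z fun _ => z hne.some), ⟨⟨fun k => ?_, ?_⟩, fun k _ => ?_⟩, ?_⟩
      · simp only []
        by_cases hk : k ∈ range e
        · obtain ⟨i, rfl⟩ := hk
          rw [e.injective.extend_apply]; exact (hw i).le
        · rw [Function.extend_apply' _ _ _ hk]; simp
      · rw [← hw1]
        exact ext_sum e w _ (fun i => e.injective.extend_apply _ _ _) fun k hk => Function.extend_apply' _ _ _ hk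
      · simp only []
        by_cases hk : k ∈ range e
        · obtain ⟨i, rfl⟩ := hk
          rw [e.injective.extend_apply]; exact hz ⟨i, rfl⟩
        · rw [Function.extend_apply' _ _ _ hk]; exact hz ⟨_, rfl⟩
      · rw [← hx]
        simp only [hF]
        refine ext_sum e (fun i => w i • z i) _ (fun i => ?_) fun k hk => ?_
        · rw [e.injective.extend_apply, e.injective.extend_apply]
        · rw [Function.extend_apply' _ _ _ hk]; simp
    · rintro x ⟨⟨w, z⟩, ⟨hw, hz⟩, rfl⟩
      exact (convex_convexHull ℝ K).sum_mem (fun i _ => hw.1 i) hw.2 fun i _ => subset_convexHull ℝ K (hz i trivial)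
  rw [h2]
  exact h1.isClosed

section LimConseq

variable {n d s : ℕ} {T : ℝ} {xs : Fin s → Euc n} {c : Fin s → ℝ} {C : Set (Euc n)} {x0 : Euc n}
    {φ : Euc n → ℝ} {U : Set (Euc d)} {g : WithLp 2 (Euc n × Euc d) → Euc n} {β : ℝ}
    {xb xb' : ℝ → Euc n} {ub : ℝ → Euc d} {vb : ℝ → ℝ} {A B : ℝ} {𝒰 : Filter ℕ}
    {X : ℕ → ℕ → Euc n} {V W : ℕ → ℕ → Euc d} {q ω : ℕ → ℕ → Euc n} {ψ : ℕ → ℕ → Euc d}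
    {L : NNReal} {z1 z3 : ℝ → Euc n} {z2 : ℝ → Euc d} {qT : Euc n} {vp vm : Fin s → ℝ → ℝ}

theorem Core.xb_cont (HC : Core T xs c C x0 φ U g β xb xb' ub vb) : ContinuousOn xb (Icc 0 T) :=
  feas_cont HC.hT HC.hfeas.2.1 HC.hfeas.2.2.1

theorem LimD.e_small (H : LimD T xs c U g φ xb ub A B 𝒰 X V W q ω ψ L z1 z3 z2 qT vp vm) :
    ∀ ε > (0:ℝ), ∀ᶠ N : ℕ in 𝒰, ∑ i ∈ Finset.range N, (T / N) * ‖W N i - ub (gp T N i)‖ ^ 2 ≤ ε := by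
  intro ε hε
  filter_upwards [H.good ε hε] with N hN using hN.2.2.2.1

theorem LimD.X_tendsto (HC : Core T xs c C x0 φ U g β xb xb' ub vb)
    (H : LimD T xs c U g φ xb ub A B 𝒰 X V W q ω ψ L z1 z3 z2 qT vp vm) {t : ℝ} (ht : t ∈ Ico 0 T) :
    Tendsto (fun p : ℕ × ℕ => X p.1 p.2) (Wf T 𝒰 t) (𝓝 (xb t)) := by
  refine Wf_unif HC.hT H.h𝒰 (fun ε hε => (H.good ε hε).mono fun N hN => hN.1) ht ?_
  have h1 : Tendsto xb (𝓝[Icc 0 T] t) (𝓝 (xb t)) := HC.xb_cont t ⟨ht.1, ht.2.le⟩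
  refine h1.mono_left ?_
  rw [nhdsWithin_le_iff]
  filter_upwards [Ioo_mem_nhdsGT ht.2] with r hr
  exact ⟨ht.1.trans hr.1.le, hr.2.le⟩

theorem LimD.near (HC : Core T xs c C x0 φ U g β xb xb' ub vb)
    (H : LimD T xs c U g φ xb ub A B 𝒰 X V W q ω ψ L z1 z3 z2 qT vp vm) {t : ℝ} (ht : t ∈ Ico 0 T) {ε : ℝ} (hε : 0 < ε) :
    ∃ δ > (0:ℝ), ∀ᶠ p in Wf T 𝒰 t, |‖W p.1 p.2 - ub (gp T p.1 p.2)‖| ≤ δ →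
      ‖pmk (X p.1 p.2) (V p.1 p.2) - pmk (xb t) (ub t)‖ < ε ∧ ‖W p.1 p.2 - ub t‖ < ε ∧ ‖W p.1 p.2 - ub (gp T p.1 p.2)‖ < ε := by
  refine ⟨ε / 8, by positivity, ?_⟩
  have h1 := Metric.tendsto_nhds.1 (H.X_tendsto HC ht) (ε / 8) (by positivity)
  have h2 : Tendsto ub (𝓝[>] t) (𝓝 (ub t)) := Tendsto.mono_left (HC.hrc t ht) (nhdsWithin_mono _ Ioi_subset_Ici_self)
  have h3 := Metric.tendsto_nhds.1 (h2.comp (Wf_gp T 𝒰 t)) (ε / 8) (by positivity)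
  filter_upwards [h1, h3, (Wf_fst T 𝒰 t).eventually (H.good (ε / 8) (by positivity)), Wf_idx HC.hT H.h𝒰 ht] with p p1 p3 p4 p5 pe
  rw [abs_norm] at pe
  simp only [Function.comp, dist_eq_norm] at p1 p3
  have p6 := p4.2.1 p.2 p5.2.2
  have p7 := norm_add_le (W p.1 p.2 - ub (gp T p.1 p.2)) (ub (gp T p.1 p.2) - ub t)
  rw [sub_add_sub_cancel] at p7
  have p8 := norm_add_le (V p.1 p.2 - W p.1 p.2) (W p.1 p.2 - ub t)
  rw [sub_add_sub_cancel] at p8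
  have p9 := pmk_norm_le (X p.1 p.2 - xb t) (V p.1 p.2 - ub t)
  rw [← pmk_sub] at p9
  exact ⟨by linarith, by linarith, by linarith⟩

theorem LimD.el [𝒰.NeBot] (HC : Core T xs c C x0 φ U g β xb xb' ub vb)
    (H : LimD T xs c U g φ xb ub A B 𝒰 X V W q ω ψ L z1 z3 z2 qT vp vm) {t : ℝ} (ht : t ∈ Ioo 0 T)
    (hp : ∀ j, ContinuousAt (vp j) t) (hm : ∀ j, ContinuousAt (vm j) t) {D1 : Euc n} {D2 : Euc d}
    (hD1 : HasDerivAt z1 D1 t) (hD2 : HasDerivAt z2 D2 t) :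
    pmk D1 (-D2) ∈ convexHull ℝ (limSubdiff (fun pt => ⟪qlim T xs z1 qT vp vm t, g pt⟫) (pmk (xb t) (ub t))) := by
  have ht' : t ∈ Ico 0 T := ⟨ht.1.le, ht.2⟩
  set Q := qlim T xs z1 qT vp vm t with hQ
  set S := limSubdiff (fun pt => ⟪Q, g pt⟫) (pmk (xb t) (ub t)) with hS
  obtain ⟨v1, hv1⟩ := limSubdiff_nonempty (HC.hgL.locLip Q) (pmk (xb t) (ub t))
  have hSc : IsClosed S := by
    refine isClosed_of_closure_subset fun v hv => ?_
    refine limSubdiff_closed (HC.hgL.locLip Q).continuous.continuousAt fun ε hε => ?_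
    obtain ⟨v', h1, h2⟩ := Metric.mem_closure_iff.1 hv ε hε
    exact ⟨_, v', by simpa using hε, by rwa [← dist_eq_norm, dist_comm], h1⟩
  set R := max (2 * B + 1) ‖v1‖ with hR
  obtain ⟨K, hK, hKb⟩ := HC.hgL.ball (pmk (xb t) (ub t))
  have hB := H.hB
  have key : pmk D1 (-D2) ∈ convexHull ℝ (S ∩ Metric.closedBall 0 R) := by
    rw [pmk_eq]
    refine avg_limit2 (inlC n d) (inrC n d) HC.hT H.h𝒰 (ζ := fun N i => pmk (ω N i) (-ψ N i)) (a := z1) (b := fun t => -z2 t) (B := 2 * B) ?_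
      H.l1.continuous H.l2.continuous.neg (by positivity) ?_ ht hD1 hD2.neg (hull_compact hSc R) (convex_convexHull ℝ _) ?_ H.e_small ?_
    · intro ε hε
      filter_upwards [H.c1 (ε / 2) (by positivity), H.c2 (ε / 2) (by positivity)] with N h1 h2 i hi
      simp only [pmk_smul]
      rw [pmk_sum, ← pmk_eq, pmk_sub]
      refine (pmk_norm_le _ _).trans ?_
      have e1 := h1 i hi
      have e2 := h2 i hi
      have e3 : ∑ k ∈ Finset.Ico 1 i, (T / (N:ℝ)) • -ψ N k - -z2 (gp T N i) = -(∑ k ∈ Finset.Ico 1 i, (T / (N:ℝ)) • ψ N k - z2 (gp T N i)) := by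
        simp only [smul_neg, Finset.sum_neg_distrib]; abel
      rw [e3, norm_neg]; linarith
    · filter_upwards [H.fin] with N hN i h1 h2
      refine (pmk_norm_le _ _).trans ?_
      rw [norm_neg]; linarith [hN.bω i h1 h2, hN.bψ i h1 h2]
    · exact ⟨v1, subset_convexHull ℝ _ ⟨hv1, by rw [mem_closedBall_zero_iff]; exact le_max_right _ _⟩⟩
    · intro ε hε
      obtain ⟨δ, hδ, hu⟩ := subdiff_usc hK one_pos (pmk (xb t) (ub t)) hKb Q (min ε 1) (by positivity)
      obtain ⟨δ', hδ', hn⟩ := H.near HC ht' hδ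
      refine ⟨δ', hδ', ?_⟩
      have hq := (H.q_tendsto HC.hT ht' hp hm).comp (Wf_shift HC.hT H.h𝒰 t)
      filter_upwards [hn, Metric.tendsto_nhds.1 hq δ hδ, (Wf_fst T 𝒰 t).eventually H.fin, Wf_idx HC.hT H.h𝒰 ht'] with p p1 p2 p3 p4 pe
      simp only [Function.comp, dist_eq_norm] at p2
      obtain ⟨v0, h0, h0'⟩ := hu _ _ _ p2 (p1 pe).1 (p3.prox p.2 p4.2.1 p4.2.2)
      refine ⟨v0, subset_convexHull ℝ _ ⟨h0, ?_⟩, (h0'.trans_le (min_le_left _ _)).le⟩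
      rw [mem_closedBall_zero_iff]
      have e1 := h0'.trans_le (min_le_right _ _)
      have e2 : ‖pmk (ω p.1 p.2) (-ψ p.1 p.2)‖ ≤ 2 * B := by
        refine (pmk_norm_le _ _).trans ?_
        rw [norm_neg]; linarith [p3.bω p.2 p4.2.1 p4.2.2, p3.bψ p.2 p4.2.1 p4.2.2]
      have e3 := norm_le_insert (pmk (ω p.1 p.2) (-ψ p.1 p.2)) v0
      refine le_trans ?_ (le_max_left _ _)
      linarith
  exact convexHull_mono inter_subset_left key

theorem LimD.nrm [𝒰.NeBot] (HC : Core T xs c C x0 φ U g β xb xb' ub vb)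
    (H : LimD T xs c U g φ xb ub A B 𝒰 X V W q ω ψ L z1 z3 z2 qT vp vm) {t : ℝ} (ht : t ∈ Ioo 0 T)
    {D2 : Euc d} (hD2 : HasDerivAt z2 D2 t) :
    D2 ∈ convexHull ℝ (limNormal U (ub t)) := by
  have ht' : t ∈ Ico 0 T := ⟨ht.1.le, ht.2⟩
  have hut : ub t ∈ U := rc_ae_mem HC.hUc.isClosed HC.hfeas.2.2.2.2.2.1 HC.hrc t ht'
  have hSc : IsClosed (limNormal U (ub t)) := by
    refine isClosed_of_closure_subset fun v hv => ?_
    refine limNormal_closed _ _ _ fun ε hε => ?_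
    obtain ⟨v', h1, h2⟩ := Metric.mem_closure_iff.1 hv ε hε
    exact ⟨_, v', by simpa using hε, by rwa [← dist_eq_norm, dist_comm], h1⟩
  have hB := H.hB
  have key : D2 ∈ convexHull ℝ (limNormal U (ub t) ∩ Metric.closedBall 0 (B + 1)) := by
    refine avg_limit' HC.hT H.h𝒰 (ζ := ψ) (z := z2) (B := B) H.c2 H.l2.continuous hB.le ?_ ht
      hD2 (hull_compact hSc _) (convex_convexHull ℝ _) ?_ H.e_small ?_
    · filter_upwards [H.fin] with N hN using hN.bψ
    · exact ⟨0, subset_convexHull ℝ _ ⟨zero_mem_limNormal hut, by simp; positivity⟩⟩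
    · intro ε hε
      obtain ⟨δ, hδ, hu⟩ := limNormal_usc U (ub t) (B + 1) (ε / 2) (by positivity)
      set κ := min δ (min (ε / 2) 1 / (2 * |A| + 1)) with hκ
      have hκ0 : 0 < κ := by positivity
      obtain ⟨δ', hδ', hn⟩ := H.near HC ht' hκ0
      refine ⟨δ', hδ', ?_⟩
      filter_upwards [hn, (Wf_fst T 𝒰 t).eventually H.fin, Wf_idx HC.hT H.h𝒰 ht'] with p p1 p3 p4 pe
      obtain ⟨-, q1, q2⟩ := p1 pe
      have e1 : ‖(2 * A) • (ub (gp T p.1 p.2) - W p.1 p.2)‖ ≤ min (ε / 2) 1 := by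
        rw [norm_smul, norm_sub_rev, Real.norm_eq_abs, abs_mul, abs_two]
        have h1 : ‖W p.1 p.2 - ub (gp T p.1 p.2)‖ ≤ min (ε / 2) 1 / (2 * |A| + 1) := q2.le.trans (min_le_right _ _)
        rw [le_div_iff₀ (by positivity)] at h1
        nlinarith [norm_nonneg (W p.1 p.2 - ub (gp T p.1 p.2)), abs_nonneg A]
      have e2 := p3.bψ p.2 p4.2.1 p4.2.2
      have e3 := norm_add_le (ψ p.1 p.2) ((2 * A) • (ub (gp T p.1 p.2) - W p.1 p.2))
      have e4 := min_le_left (ε / 2) 1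
      have e5 := min_le_right (ε / 2) 1
      obtain ⟨v0, h0, h1, h2⟩ := hu _ _ (q1.trans_le (min_le_left _ _)) (p3.nor p.2 p4.2.2) (by linarith)
      refine ⟨v0, subset_convexHull ℝ _ ⟨h0, by rw [mem_closedBall_zero_iff]; exact h1⟩, ?_⟩
      have e6 := norm_sub_le (ψ p.1 p.2 + (2 * A) • (ub (gp T p.1 p.2) - W p.1 p.2) - v0) ((2 * A) • (ub (gp T p.1 p.2) - W p.1 p.2))
      rw [show ψ p.1 p.2 + (2 * A) • (ub (gp T p.1 p.2) - W p.1 p.2) - v0 - (2 * A) • (ub (gp T p.1 p.2) - W p.1 p.2) = ψ p.1 p.2 - v0 by abel] at e6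
      linarith
  exact convexHull_mono inter_subset_left key

theorem LimD.dz3 [𝒰.NeBot] (HC : Core T xs c C x0 φ U g β xb xb' ub vb)
    (H : LimD T xs c U g φ xb ub A B 𝒰 X V W q ω ψ L z1 z3 z2 qT vp vm) {t : ℝ} (ht : t ∈ Ioo 0 T)
    {D3 : Euc n} (hD3 : HasDerivAt z3 D3 t) : D3 = g (pmk (xb t) (ub t)) := by
  have ht' : t ∈ Ico 0 T := ⟨ht.1.le, ht.2⟩
  have key : D3 ∈ ({g (pmk (xb t) (ub t))} : Set (Euc n)) := by
    refine avg_limit' HC.hT H.h𝒰 (ζ := fun N i => g (pmk (X N i) (V N i))) (z := z3) (B := B) H.c3 H.l3.continuous H.hB.le H.b3 ht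
      hD3 isClosed_singleton (convex_singleton _) ⟨_, rfl⟩ H.e_small ?_
    intro ε hε
    obtain ⟨δ, hδ, hu⟩ := Metric.continuousAt_iff.1 (HC.hgc.continuousAt (x := pmk (xb t) (ub t))) ε hε
    obtain ⟨δ', hδ', hn⟩ := H.near HC ht' hδ
    refine ⟨δ', hδ', ?_⟩
    filter_upwards [hn] with p p1 pe
    refine ⟨_, rfl, ?_⟩
    have := hu (x := pmk (X p.1 p.2) (V p.1 p.2)) (by rw [dist_eq_norm]; exact (p1 pe).1)
    rw [dist_eq_norm] at this
    exact this.le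
  exact key

end LimConseq

section LimConseq2

variable {n d s : ℕ} {T : ℝ} {xs : Fin s → Euc n} {c : Fin s → ℝ} {C : Set (Euc n)} {x0 : Euc n}
    {φ : Euc n → ℝ} {U : Set (Euc d)} {g : WithLp 2 (Euc n × Euc d) → Euc n} {β : ℝ}
    {xb xb' : ℝ → Euc n} {ub : ℝ → Euc d} {vb : ℝ → ℝ} {A B : ℝ} {𝒰 : Filter ℕ}
    {X : ℕ → ℕ → Euc n} {V W : ℕ → ℕ → Euc d} {q ω : ℕ → ℕ → Euc n} {ψ : ℕ → ℕ → Euc d}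
    {L : NNReal} {z1 z3 : ℝ → Euc n} {z2 : ℝ → Euc d} {qT : Euc n} {vp vm : Fin s → ℝ → ℝ}

/-- transversality -/
theorem LimD.trans [𝒰.NeBot] (HC : Core T xs c C x0 φ U g β xb xb' ub vb)
    (H : LimD T xs c U g φ xb ub A B 𝒰 X V W q ω ψ L z1 z3 z2 qT vp vm) : -qT ∈ limSubdiff φ (xb T) := by
  refine limSubdiff_closed HC.hφ.continuous.continuousAt fun ε hε => ?_
  have h := ((Metric.tendsto_nhds.1 H.hqT ε hε).and ((H.good (ε / 2) (by positivity)).and (H.fin.and (H.h𝒰 (eventually_gt_atTop 0))))).exists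
  obtain ⟨N, h1, h2, h3, h4⟩ := h
  refine ⟨X N N, -q N N, ?_, ?_, h3.fin.mem_limSubdiff⟩
  · have := h2.1 N le_rfl
    rw [gp_last T h4] at this
    linarith
  · rw [dist_eq_norm] at h1
    rw [neg_sub_neg, norm_sub_rev]; exact h1

/-- constancy near inactive times -/
theorem LimD.inactive (HC : Core T xs c C x0 φ U g β xb xb' ub vb) [𝒰.NeBot]
    (H : LimD T xs c U g φ xb ub A B 𝒰 X V W q ω ψ L z1 z3 z2 qT vp vm) {t : ℝ} (ht : t ∈ Ico 0 T)
    (hin : ∀ j, ⟪xs j, xb t⟫ < c j) :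
    ∃ δ > (0:ℝ), ∀ j, (∀ r ∈ Metric.ball t δ, vp j r = vp j t) ∧ (∀ r ∈ Metric.ball t δ, vm j r = vm j t) := by
  have hT := HC.hT
  have hop : IsOpen {x : Euc n | ∀ j, ⟪xs j, x⟫ < c j} := by
    have : {x : Euc n | ∀ j, ⟪xs j, x⟫ < c j} = ⋂ j, {x | ⟪xs j, x⟫ < c j} := by ext; simp
    rw [this]
    exact isOpen_iInter_of_finite fun j => isOpen_lt (by fun_prop) continuous_const
  obtain ⟨ρ, hρ, hball⟩ := Metric.isOpen_iff.1 hop (xb t) hin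
  obtain ⟨δ, hδ, hx⟩ := Metric.continuousWithinAt_iff.1 (HC.xb_cont t ⟨ht.1, ht.2.le⟩) (ρ / 2) (by positivity)
  have hzero : ∀ᶠ N in 𝒰, 0 < N ∧ ∀ i ≤ N, gp T N i ∈ Metric.ball t δ → ∀ j, bet xs c T (X N i) (q N i) j = 0 := by
    filter_upwards [H.good (ρ / 2) (by positivity), H.h𝒰 (eventually_gt_atTop 0)] with N hN hN0
    refine ⟨hN0, fun i hi hgi j => ?_⟩
    have h1 := hx (gp_mem hT hN0 hi) hgi
    have h2 := hN.1 i hi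
    have h3 : X N i ∈ Metric.ball (xb t) ρ := by
      rw [mem_ball_iff_norm]
      rw [dist_eq_norm] at h1
      have := norm_add_le (X N i - xb (gp T N i)) (xb (gp T N i) - xb t)
      rw [sub_add_sub_cancel] at this
      linarith
    unfold bet
    rw [rp_zero_of_lt (hball h3 j).le]; ring
  have key : ∀ (f : ℝ → ℝ), f 0 = 0 → ∀ j, ∀ v : ℝ → ℝ,
      (∀ t, Tendsto (fun N => ∑ k ∈ Finset.Ico 1 (min (gidx T N t + 1) N), f (bet xs c T (X N k) (q N k) j)) 𝒰 (𝓝 (v t))) →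
      ∀ r ∈ Metric.ball t δ, ∀ r' ∈ Metric.ball t δ, r ≤ r' → v r = v r' := by
    intro f hf j v hv r hr r' hr' hrr
    refine tendsto_nhds_unique (hv r) ((hv r').congr' ?_)
    filter_upwards [hzero] with N hN
    symm
    refine Finset.sum_subset (Finset.Ico_subset_Ico_right ?_) fun k hk hk' => ?_
    · have := gidx_mono hT N hrr
      omega
    · rw [Finset.mem_Ico] at hk hk'
      have hk1 : gidx T N r + 1 ≤ k := by omega
      have hk2 : k ≤ gidx T N r' := by omega
      have hr'0 : 0 ≤ r' := by
        by_contra hneg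
        push Not at hneg
        have : gidx T N r' = 0 := by
          unfold gidx
          refine Nat.floor_of_nonpos ?_
          exact div_nonpos_of_nonpos_of_nonneg (mul_nonpos_of_nonpos_of_nonneg hneg.le (Nat.cast_nonneg _)) hT.le
        omega
      have e1 := (gp_mono hT N hk2).trans (gp_gidx_le hT hN.1 hr'0)
      have e2 := lt_gp_gidx hT hN.1 r
      rw [← gp_succ] at e2
      have e3 := e2.trans_le (gp_mono hT N hk1)
      rw [hN.2 k (by omega) ?_ j, hf]
      rw [mem_ball_iff_norm, Real.norm_eq_abs, abs_lt] at hr hr' ⊢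
      constructor <;> linarith [hr.1, hr'.2]
  have key2 : ∀ (v : ℝ → ℝ), (∀ r ∈ Metric.ball t δ, ∀ r' ∈ Metric.ball t δ, r ≤ r' → v r = v r') → ∀ r ∈ Metric.ball t δ, v r = v t := by
    intro v hv r hr
    have ht0 := Metric.mem_ball_self (x := t) hδ
    rcases le_total r t with h | h
    · exact hv r hr t ht0 h
    · exact (hv t ht0 r hr h).symm
  exact ⟨δ, hδ, fun j => ⟨key2 _ (key (fun x => max x 0) (by simp) j _ (H.tp j)), key2 _ (key (fun x => max (-x) 0) (by simp) j _ (H.tm j))⟩⟩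

theorem qlim_bv (hT : 0 < T) (l1 : LipschitzWith L z1) (mp : ∀ j, Monotone (vp j)) (mm : ∀ j, Monotone (vm j)) :
    BoundedVariationOn (qlim T xs z1 qT vp vm) (Icc 0 T) := by
  refine bv_of_mono (F := fun t => L * t + ∑ j, (vp j t + vm j t) * ‖xs j‖) hT fun a _ b _ hab => ?_
  have e : qlim T xs z1 qT vp vm b - qlim T xs z1 qT vp vm a = (z1 b - z1 a) + ∑ j, ((vp j b - vp j a) - (vm j b - vm j a)) • xs j := by
    unfold qlim
    have : ∑ j, ((vp j b - vp j a) - (vm j b - vm j a)) • xs j = ∑ j, ((vp j T - vm j T) - (vp j a - vm j a)) • xs j - ∑ j, ((vp j T - vm j T) - (vp j b - vm j b)) • xs j := by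
      rw [← Finset.sum_sub_distrib]
      refine Finset.sum_congr rfl fun j _ => ?_
      rw [← sub_smul]; congr 1; ring
    rw [this]; abel
  rw [e]
  have h1 := l1.dist_le_mul b a
  rw [dist_eq_norm, Real.dist_eq, abs_of_nonneg (sub_nonneg.2 hab)] at h1
  have h2 : ‖∑ j, ((vp j b - vp j a) - (vm j b - vm j a)) • xs j‖ ≤ ∑ j, ((vp j b + vm j b) * ‖xs j‖ - (vp j a + vm j a) * ‖xs j‖) := by
    refine (norm_sum_le _ _).trans (Finset.sum_le_sum fun j _ => ?_)
    rw [norm_smul, ← sub_mul]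
    refine mul_le_mul_of_nonneg_right ?_ (norm_nonneg _)
    rw [Real.norm_eq_abs, abs_le]
    constructor <;> linarith [mp j hab, mm j hab]
  rw [Finset.sum_sub_distrib] at h2
  have := norm_add_le (z1 b - z1 a) (∑ j, ((vp j b - vp j a) - (vm j b - vm j a)) • xs j)
  linarith

theorem LimD.comp8 [𝒰.NeBot] (HC : Core T xs c C x0 φ U g β xb xb' ub vb)
    (H : LimD T xs c U g φ xb ub A B 𝒰 X V W q ω ψ L z1 z3 z2 qT vp vm) {t : ℝ} (ht : t ∈ Ioo 0 T)
    (hp : ∀ j, ContinuousAt (vp j) t) (hm : ∀ j, ContinuousAt (vm j) t) {D D3 : Euc n}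
    (hD : HasDerivAt xb D t) (hD3 : HasDerivAt z3 D3 t) {α : Fin s → ℝ} (hα : ∑ j, α j • xs j = -D - D3)
    {j : Fin s} (hj : ⟪xs j, qlim T xs z1 qT vp vm t⟫ ≠ 0) : α j = 0 := by
  have hT := HC.hT
  have hB := H.hB
  have ht' : t ∈ Ico 0 T := ⟨ht.1.le, ht.2⟩
  obtain ⟨f, hf⟩ := exists_coords HC.hLI
  set fj : Euc n →L[ℝ] ℝ := (ContinuousLinearMap.proj j).comp f with hfj
  have hfs : ∀ a : Fin s → ℝ, fj (∑ j, a j • xs j) = a j := fun a => by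
    simp only [hfj, ContinuousLinearMap.comp_apply, hf, ContinuousLinearMap.proj_apply]
  set m := |⟪xs j, qlim T xs z1 qT vp vm t⟫| / 2 with hm'
  have hm0 : 0 < m := by have := abs_pos.2 hj; positivity
  have hwin : ∀ᶠ p in Wf T 𝒰 t, (0 < p.1 ∧ 1 ≤ p.2 ∧ p.2 < p.1) ∧ m < |⟪xs j, q p.1 p.2⟫| := by
    have h1 : Tendsto (fun p : ℕ × ℕ => |⟪xs j, q p.1 p.2⟫|) (Wf T 𝒰 t) (𝓝 |⟪xs j, qlim T xs z1 qT vp vm t⟫|) :=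
      (tendsto_const_nhds.inner (H.q_tendsto hT ht' hp hm)).abs
    exact (Wf_idx hT H.h𝒰 ht').and (h1.eventually_const_lt (by rw [hm']; have := abs_pos.2 hj; linarith))
  obtain ⟨δ0, hδ0, hw⟩ := Wf_exists hwin
  have key : ∀ r, t < r → r < t + δ0 → r < T → fj (xb r - xb t + (z3 r - z3 t)) = 0 := by
    intro r hr1 hr2 hr3
    have hr' : r ∈ Ico 0 T := ⟨ht.1.le.trans hr1.le, hr3⟩
    have hx : ∀ r ∈ Ico 0 T, Tendsto (fun N => X N (gidx T N r + 1)) 𝒰 (𝓝 (xb r)) := fun r hr =>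
      unif_tendsto hT H.h𝒰 (fun ε hε => (H.good ε hε).mono fun N hN => hN.1) hr (HC.xb_cont r ⟨hr.1, hr.2.le⟩)
    have hz : ∀ r ∈ Ico 0 T, Tendsto (fun N : ℕ => ∑ k ∈ Finset.Ico 1 (gidx T N r + 1), (T / N) • g (pmk (X N k) (V N k))) 𝒰 (𝓝 (z3 r)) := fun r hr =>
      unif_tendsto (Y := fun N i => ∑ k ∈ Finset.Ico 1 i, (T / (N:ℝ)) • g (pmk (X N k) (V N k))) hT H.h𝒰 H.c3 hr H.l3.continuous.continuousWithinAt
    have hlim := (fj.continuous.tendsto _).comp (((hx r hr').sub (hx t ht')).add ((hz r hr').sub (hz t ht')))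
    have hlim0 : Tendsto (fj ∘ fun N : ℕ => X N (gidx T N r + 1) - X N (gidx T N t + 1) +
        (∑ k ∈ Finset.Ico 1 (gidx T N r + 1), (T / N) • g (pmk (X N k) (V N k)) -
          ∑ k ∈ Finset.Ico 1 (gidx T N t + 1), (T / N) • g (pmk (X N k) (V N k)))) 𝒰 (𝓝 0) := by
      rw [Metric.tendsto_nhds]
      intro ε hε
      set M := ‖fj‖ * (T + 1) + B / (2 * m) with hM
      have hM0 : 0 < M := by positivity
      set κ := ε / (2 * M) with hκ
      have hκ0 : 0 < κ := by positivity
      have hsm : ∀ᶠ N : ℕ in 𝒰, T / (N:ℝ) < t + δ0 - r :=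
        ((tendsto_const_div_atTop_nhds_zero_nat T).mono_left H.h𝒰).eventually_lt_const (by linarith)
      filter_upwards [hw, H.good (κ ^ 2) (by positivity), H.good κ hκ0, H.fin, hsm, H.h𝒰 (eventually_gt_atTop 0)] with N h1 h2 h2' h3 h4 h5
      have hh : 0 < T / (N:ℝ) := by positivity
      have hab : gidx T N t + 1 ≤ gidx T N r + 1 := by have := gidx_mono hT N hr1.le; omega
      have ha := lt_gp_gidx hT h5 t
      rw [← gp_succ] at ha
      have hb : gp T N (gidx T N r + 1) < t + δ0 := by
        rw [gp_succ]; linarith [gp_gidx_le hT h5 hr'.1]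
      have hidx : ∀ i, gidx T N t + 1 ≤ i → i ≤ gidx T N r + 1 → (0 < N ∧ 1 ≤ i ∧ i < N) ∧ m < |⟪xs j, q N i⟫| :=
        fun i i1 i2 => h1 i (ha.trans_le (gp_mono hT N i1)) ((gp_mono hT N i2).trans_lt hb)
      rw [Function.comp_apply]
      generalize gidx T N t + 1 = a at *
      generalize gidx T N r + 1 = b at *
      have e1 : X N b - X N a = ∑ k ∈ Finset.Ico a b, (X N (k + 1) - X N k) := (Finset.sum_Ico_sub _ hab).symm
      have e2 : ∑ k ∈ Finset.Ico 1 b, (T / (N:ℝ)) • g (pmk (X N k) (V N k)) -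
          ∑ k ∈ Finset.Ico 1 a, (T / (N:ℝ)) • g (pmk (X N k) (V N k)) = ∑ k ∈ Finset.Ico a b, (T / (N:ℝ)) • g (pmk (X N k) (V N k)) := by
        rw [sub_eq_iff_eq_add, add_comm, Finset.sum_Ico_consecutive _ (hidx a le_rfl hab).1.2.1 hab]
      have e3 : X N b - X N a + (∑ k ∈ Finset.Ico 1 b, (T / (N:ℝ)) • g (pmk (X N k) (V N k)) -
          ∑ k ∈ Finset.Ico 1 a, (T / (N:ℝ)) • g (pmk (X N k) (V N k))) =
          ∑ k ∈ Finset.Ico a b, (dR xs c (T / N) T g (X N) (V N) k - T • pz xs c (X N (k + 1))) := by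
        rw [e1, e2, ← Finset.sum_add_distrib]
        refine Finset.sum_congr rfl fun k _ => ?_
        unfold dR; abel
      rw [e3, map_sum, Real.dist_eq, sub_zero]
      have hbN : b < N := (hidx b hab le_rfl).1.2.2
      have hS1 : ∑ k ∈ Finset.Ico a b, ‖dR xs c (T / N) T g (X N) (V N) k‖ ≤ κ * (T + 1) := by
        have hY : ∀ k, ‖dR xs c (T / N) T g (X N) (V N) k‖ ≤ κ * (T / N) + (1 / κ) * (‖dR xs c (T / N) T g (X N) (V N) k‖ ^ 2 / (T / N)) := by
          intro k
          set y := ‖dR xs c (T / N) T g (X N) (V N) k‖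
          set h := T / (N:ℝ)
          have : (1 / κ) * (y ^ 2 / h) * (κ * h) = y ^ 2 := by field_simp
          have hpos : 0 < κ * h := by positivity
          have hy : 0 ≤ y := norm_nonneg _
          by_contra hcon
          push Not at hcon
          have h0 : 0 ≤ (1 / κ) * (y ^ 2 / h) := by positivity
          nlinarith
        calc ∑ k ∈ Finset.Ico a b, ‖dR xs c (T / N) T g (X N) (V N) k‖
            ≤ ∑ k ∈ Finset.range N, ‖dR xs c (T / N) T g (X N) (V N) k‖ := by
              refine Finset.sum_le_sum_of_subset_of_nonneg (fun k hk => ?_) fun _ _ _ => norm_nonneg _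
              rw [Finset.mem_Ico] at hk; rw [Finset.mem_range]; omega
          _ ≤ ∑ k ∈ Finset.range N, (κ * (T / N) + (1 / κ) * (‖dR xs c (T / N) T g (X N) (V N) k‖ ^ 2 / (T / N))) := Finset.sum_le_sum fun k _ => hY k
          _ = κ * T + (1 / κ) * ∑ k ∈ Finset.range N, ‖dR xs c (T / N) T g (X N) (V N) k‖ ^ 2 / (T / N) := by
              rw [Finset.sum_add_distrib, Finset.mul_sum, Finset.sum_const, Finset.card_range, nsmul_eq_mul]
              congr 1
              field_simp
          _ ≤ κ * T + (1 / κ) * κ ^ 2 := by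
              have := mul_le_mul_of_nonneg_left h2.2.2.2.2.1 (by positivity : 0 ≤ 1 / κ)
              linarith
          _ = κ * (T + 1) := by field_simp
      have hS2 : ∑ k ∈ Finset.Ico a b, T * rp xs c j (X N (k + 1)) ^ 2 ≤ κ * (B / (2 * m)) := by
        calc ∑ k ∈ Finset.Ico a b, T * rp xs c j (X N (k + 1)) ^ 2
            = ∑ k ∈ Finset.Ico (a + 1) (b + 1), T * rp xs c j (X N k) ^ 2 := by
              rw [Finset.sum_Ico_add' (fun k => T * rp xs c j (X N k) ^ 2) a b 1]
          _ ≤ ∑ k ∈ Finset.Ico (a + 1) (b + 1), (κ / (2 * m)) * |bet xs c T (X N k) (q N k) j| := by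
              refine Finset.sum_le_sum fun k hk => ?_
              rw [Finset.mem_Ico] at hk
              have k1 := hidx k (by omega) (by omega)
              have k2 := h2'.2.2.2.2.2 k k1.1.2.2.le j
              have k3 := rp_nonneg xs c j (X N k)
              unfold bet
              rw [abs_mul, abs_of_nonneg (by positivity : 0 ≤ T * (2 * rp xs c j (X N k)))]
              generalize rp xs c j (X N k) = y at *
              have e : κ / (2 * m) * (T * (2 * y) * |⟪xs j, q N k⟫|) = (T * y) * (κ * (|⟪xs j, q N k⟫| / m)) := by field_simp
              rw [e, show T * y ^ 2 = (T * y) * y by ring]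
              refine mul_le_mul_of_nonneg_left (k2.trans ?_) (by positivity)
              have : 1 ≤ |⟪xs j, q N k⟫| / m := by rw [le_div_iff₀ hm0]; linarith [k1.2]
              nlinarith
          _ = (κ / (2 * m)) * ∑ k ∈ Finset.Ico (a + 1) (b + 1), |bet xs c T (X N k) (q N k) j| := by rw [Finset.mul_sum]
          _ ≤ (κ / (2 * m)) * B := by
              refine mul_le_mul_of_nonneg_left ?_ (by positivity)
              refine le_trans ?_ h3.bb
              calc _ ≤ ∑ k ∈ Finset.Ico 1 N, |bet xs c T (X N k) (q N k) j| := by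
                    refine Finset.sum_le_sum_of_subset_of_nonneg (fun k hk => ?_) fun _ _ _ => abs_nonneg _
                    rw [Finset.mem_Ico] at hk ⊢; omega
                _ ≤ _ := Finset.sum_le_sum fun i _ => Finset.single_le_sum (f := fun j => |bet xs c T (X N i) (q N i) j|) (fun j _ => abs_nonneg _) (Finset.mem_univ j)
          _ = κ * (B / (2 * m)) := by ring
      have hterm : ∀ k, |fj (dR xs c (T / N) T g (X N) (V N) k - T • pz xs c (X N (k + 1)))| ≤
          ‖fj‖ * ‖dR xs c (T / N) T g (X N) (V N) k‖ + T * rp xs c j (X N (k + 1)) ^ 2 := by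
        intro k
        have e : fj (pz xs c (X N (k + 1))) = rp xs c j (X N (k + 1)) ^ 2 := by
          unfold pz; exact hfs fun j => rp xs c j (X N (k + 1)) ^ 2
        rw [map_sub, map_smul, e, smul_eq_mul]
        have h1 := fj.le_opNorm (dR xs c (T / N) T g (X N) (V N) k)
        rw [Real.norm_eq_abs] at h1
        have h2 := abs_sub (fj (dR xs c (T / N) T g (X N) (V N) k)) (T * rp xs c j (X N (k + 1)) ^ 2)
        rw [abs_of_nonneg (by positivity : 0 ≤ T * rp xs c j (X N (k + 1)) ^ 2)] at h2
        linarith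
      calc |∑ k ∈ Finset.Ico a b, fj (dR xs c (T / N) T g (X N) (V N) k - T • pz xs c (X N (k + 1)))|
          ≤ ∑ k ∈ Finset.Ico a b, |fj (dR xs c (T / N) T g (X N) (V N) k - T • pz xs c (X N (k + 1)))| := Finset.abs_sum_le_sum_abs _ _
        _ ≤ ∑ k ∈ Finset.Ico a b, (‖fj‖ * ‖dR xs c (T / N) T g (X N) (V N) k‖ + T * rp xs c j (X N (k + 1)) ^ 2) := Finset.sum_le_sum fun k _ => hterm k
        _ ≤ ‖fj‖ * (κ * (T + 1)) + κ * (B / (2 * m)) := by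
            rw [Finset.sum_add_distrib, ← Finset.mul_sum]
            exact add_le_add (mul_le_mul_of_nonneg_left hS1 (norm_nonneg _)) hS2
        _ = κ * M := by rw [hM]; ring
        _ = ε / 2 := by rw [hκ]; field_simp
        _ < ε := by linarith
    exact tendsto_nhds_unique hlim hlim0
  have hder : HasDerivAt (fun r => fj (xb r - xb t + (z3 r - z3 t))) (fj (D + D3)) t :=
    fj.hasFDerivAt.comp_hasDerivAt t ((hD.sub_const _).add (hD3.sub_const _))
  have h1 : HasDerivWithinAt (fun r => fj (xb r - xb t + (z3 r - z3 t))) 0 (Ici t) t := by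
    refine (hasDerivWithinAt_const t (Ici t) (0:ℝ)).congr_of_eventuallyEq ?_ (by simp)
    filter_upwards [Ico_mem_nhdsGE (lt_min (by linarith : t < t + δ0) ht.2)] with r hr
    rcases hr.1.eq_or_lt with h | h
    · rw [← h]; simp
    · exact key r h (hr.2.trans_le (min_le_left _ _)) (hr.2.trans_le (min_le_right _ _))
  have h2 := (uniqueDiffWithinAt_Ici t).eq_deriv _ hder.hasDerivWithinAt h1
  have h3 : fj (∑ j, α j • xs j) = -fj (D + D3) := by rw [hα, ← map_neg]; congr 1; abel
  rw [hfs, h2, neg_zero] at h3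
  exact h3

end LimConseq2

theorem lip_sq_int {E : Type*} [NormedAddCommGroup E] [NormedSpace ℝ E] [FiniteDimensional ℝ E] [MeasurableSpace E] [BorelSpace E]
    {L : NNReal} {z : ℝ → E} (hz : LipschitzWith L z) (T : ℝ) :
    AEStronglyMeasurable (deriv z) (volume.restrict (Icc 0 T)) ∧ IntegrableOn (fun t => ‖deriv z t‖ ^ 2) (Icc 0 T) := by
  haveI : CompleteSpace E := FiniteDimensional.complete ℝ E
  have h1 : Measurable (deriv z) := measurable_deriv z
  refine ⟨h1.aestronglyMeasurable, ?_⟩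
  refine Measure.integrableOn_of_bounded (M := (L:ℝ) ^ 2) (by simp) (h1.norm.pow_const 2).aestronglyMeasurable (ae_of_all _ fun t => ?_)
  rw [Real.norm_of_nonneg (by positivity)]
  exact pow_le_pow_left₀ (norm_nonneg _) (norm_deriv_le_of_lipschitz hz) 2

/-- the limiting optimality system in the core case -/
theorem core_thm {n d s : ℕ} {T : ℝ} {xs : Fin s → Euc n} {c : Fin s → ℝ} {C : Set (Euc n)} {x0 : Euc n}
    {φ : Euc n → ℝ} {U : Set (Euc d)} {g : WithLp 2 (Euc n × Euc d) → Euc n} {β : ℝ}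
    {xb xb' : ℝ → Euc n} {ub : ℝ → Euc d} {vb : ℝ → ℝ} (HC : Core T xs c C x0 φ U g β xb xb' ub vb) :
    ∃ (p p' q : ℝ → Euc n) (γ : Fin s → SignedMeasure ℝ) (ψ : ℝ → Euc d),
      (∀ t ∈ Icc 0 T, p t = p 0 + ∫ τ in (0:ℝ)..t, p' τ) ∧
      IntegrableOn p' (Icc 0 T) ∧
      IntegrableOn (fun t => ‖p' t‖ ^ 2) (Icc 0 T) ∧
      BoundedVariationOn q (Icc 0 T) ∧
      AEStronglyMeasurable ψ (volume.restrict (Icc 0 T)) ∧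
      IntegrableOn (fun t => ‖ψ t‖ ^ 2) (Icc 0 T) ∧
      (∀ᵐ t, t ∈ Icc 0 T → pmk (p' t) (-ψ t) ∈
          convexHull ℝ (limSubdiff (fun pt => ⟪q t, g pt⟫) (pmk (xb t) (ub t)))) ∧
      (∀ᵐ t, t ∈ Icc 0 T → ψ t ∈ convexHull ℝ (limNormal U (ub t))) ∧
      (∃ S : Set ℝ, S.Countable ∧ ∀ t ∈ Icc 0 T \ S, q t = p t - ∑ j, (γ j (Ioc t T)) • xs j) ∧
      -p T ∈ limSubdiff φ (xb T) ∧
      (∀ᵐ t, t ∈ Icc 0 T → ∀ (α : Fin s → ℝ) (j : Fin s),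
        ∑ j, α j • xs j = -xb' t - g (pmk (xb t) (ub t)) → ⟪xs j, q t⟫ ≠ 0 → α j = 0) ∧
      (∀ t ∈ Ico 0 T, (∀ j, ⟪xs j, xb t⟫ < c j) →
        ∃ δ > (0:ℝ), ∀ V : Set ℝ, MeasurableSet V → V ⊆ Ico 0 T ∩ Metric.ball t δ →
          ∀ j, (γ j).totalVariation V = 0) := by
  obtain ⟨A, B, 𝒰, hne, X, V, W, q, ω, ψ, L, z1, z3, z2, qT, vp, vm, H⟩ := exists_limD HC
  have hT := HC.hT
  choose μp fp mp1 mp2 using fun j => stiel (H.mp j) (H.Tp j)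
  choose μm fm mm1 mm2 using fun j => stiel (H.mm j) (H.Tm j)
  set S : Set ℝ := (⋃ j, {t | ¬ ContinuousAt (vp j) t}) ∪ ⋃ j, {t | ¬ ContinuousAt (vm j) t} with hS
  have hSc : S.Countable :=
    (countable_iUnion fun j => (H.mp j).countable_not_continuousAt).union
      (countable_iUnion fun j => (H.mm j).countable_not_continuousAt)
  have hcp : ∀ t, t ∉ S → (∀ j, ContinuousAt (vp j) t) ∧ ∀ j, ContinuousAt (vm j) t := by
    intro t ht
    constructor
    · intro j
      by_contra h
      exact ht (Or.inl (mem_iUnion.2 ⟨j, h⟩))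
    · intro j
      by_contra h
      exact ht (Or.inr (mem_iUnion.2 ⟨j, h⟩))
  have hae : ∀ᵐ t : ℝ, t ∈ Icc 0 T → t ∈ Ioo 0 T ∧ t ∉ S ∧ HasDerivAt xb (xb' t) t ∧
      HasDerivAt z1 (deriv z1 t) t ∧ HasDerivAt z2 (deriv z2 t) t ∧ HasDerivAt z3 (deriv z3 t) t := by
    filter_upwards [feas_deriv hT HC.hfeas.2.1 HC.hfeas.2.2.1, hSc.ae_notMem volume, H.l1.ae_differentiableAt_real,
      H.l2.ae_differentiableAt_real, H.l3.ae_differentiableAt_real] with t h1 h2 h3 h4 h5 ht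
    exact ⟨(h1 ht).1, h2, (h1 ht).2, h3.hasDerivAt, h4.hasDerivAt, h5.hasDerivAt⟩
  refine ⟨fun t => qT - (z1 T - z1 t), deriv z1, qlim T xs z1 qT vp vm,
    fun j => (μp j).toSignedMeasure - (μm j).toSignedMeasure, deriv z2, fun t ht => ?_, ?_, (lip_sq_int H.l1 T).2,
    qlim_bv hT H.l1 H.mp H.mm, (lip_sq_int H.l2 T).1, (lip_sq_int H.l2 T).2, ?_, ?_, ⟨S, hSc, fun t ht => ?_⟩, ?_, ?_, fun t ht hin => ?_⟩
  · rw [← lip_ftc H.l1 0 t]; module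
  · rw [← intervalIntegrable_iff_integrableOn_Icc_of_le hT.le]; exact lip_deriv_ii H.l1 0 T
  · filter_upwards [hae] with t h ht
    obtain ⟨h1, h2, h3, h4, h5, h6⟩ := h ht
    exact H.el HC h1 (hcp t h2).1 (hcp t h2).2 h4 h5
  · filter_upwards [hae] with t h ht
    obtain ⟨h1, h2, h3, h4, h5, h6⟩ := h ht
    exact H.nrm HC h1 h5
  · unfold qlim
    congr 1
    refine Finset.sum_congr rfl fun j _ => ?_
    congr 1
    rw [FunLike.coe_sub, Pi.sub_apply, Measure.toSignedMeasure_apply_measurable measurableSet_Ioc,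
      Measure.toSignedMeasure_apply_measurable measurableSet_Ioc, measureReal_def, measureReal_def,
      mp1 j t ht.1 ((hcp t ht.2).1 j), mm1 j t ht.1 ((hcp t ht.2).2 j),
      ENNReal.toReal_ofReal (sub_nonneg.2 (H.mp j ht.1.2)), ENNReal.toReal_ofReal (sub_nonneg.2 (H.mm j ht.1.2))]
    ring
  · have := H.trans HC
    simpa using this
  · filter_upwards [hae] with t h ht α j hα hj
    obtain ⟨h1, h2, h3, h4, h5, h6⟩ := h ht
    have e := H.dz3 HC h1 h6
    exact H.comp8 HC h1 (hcp t h2).1 (hcp t h2).2 h3 h6 (by rw [e]; exact hα) hj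
  · obtain ⟨δ, hδ, h⟩ := H.inactive HC ht hin
    refine ⟨δ / 2, by positivity, fun V hV hsub j => ?_⟩
    haveI := fp j
    haveI := fm j
    exact tv_zero hV (measure_mono_null (fun x hx => (hsub hx).2) (mp2 j t δ hδ (h j).1))
      (measure_mono_null (fun x hx => (hsub hx).2) (mm2 j t δ hδ (h j).2))

theorem gLip_of {n d : ℕ} {g : WithLp 2 (Euc n × Euc d) → Euc n}
    (hgLip : ∀ B : Set (WithLp 2 (Euc n × Euc d)), Bornology.IsBounded B → ∃ K : NNReal, LipschitzOnWith K g B) :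
    GLip g := by
  intro R
  obtain ⟨K, hK⟩ := hgLip (Metric.closedBall 0 (2 * R)) Metric.isBounded_closedBall
  refine ⟨K, K.2, fun x x' u u' h1 h2 h3 h4 => ?_⟩
  have m1 : pmk x u ∈ Metric.closedBall (0 : WithLp 2 (Euc n × Euc d)) (2 * R) := by
    rw [mem_closedBall_zero_iff]; linarith [pmk_norm_le x u]
  have m2 : pmk x' u' ∈ Metric.closedBall (0 : WithLp 2 (Euc n × Euc d)) (2 * R) := by
    rw [mem_closedBall_zero_iff]; linarith [pmk_norm_le x' u']
  have := hK.dist_le_mul _ m1 _ m2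
  rw [dist_eq_norm, dist_eq_norm, pmk_sub] at this
  exact this.trans (mul_le_mul_of_nonneg_left (pmk_norm_le _ _) K.2)

theorem gcont_of {n d : ℕ} {g : WithLp 2 (Euc n × Euc d) → Euc n}
    (hgLip : ∀ B : Set (WithLp 2 (Euc n × Euc d)), Bornology.IsBounded B → ∃ K : NNReal, LipschitzOnWith K g B) :
    Continuous g := by
  rw [continuous_iff_continuousAt]
  intro z
  obtain ⟨K, hK⟩ := hgLip (Metric.ball z 1) Metric.isBounded_ball
  exact hK.continuousOn.continuousAt (Metric.ball_mem_nhds z one_pos)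

/-- signed point mass -/
def dl (T a : ℝ) : SignedMeasure ℝ :=
  (a.toNNReal • Measure.dirac T).toSignedMeasure - ((-a).toNNReal • Measure.dirac T).toSignedMeasure

theorem dl_apply {T a : ℝ} {V : Set ℝ} (hV : MeasurableSet V) (h : T ∈ V) : dl T a V = a := by
  unfold dl
  rw [FunLike.coe_sub, Pi.sub_apply, Measure.toSignedMeasure_apply_measurable hV,
      Measure.toSignedMeasure_apply_measurable hV, measureReal_def, measureReal_def]
  simp only [Measure.smul_apply, Measure.dirac_apply' _ hV, indicator_of_mem h]
  simp [ENNReal.smul_def]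

theorem dl_tv {T a : ℝ} {V : Set ℝ} (hV : MeasurableSet V) (h : T ∉ V) : (dl T a).totalVariation V = 0 := by
  refine tv_zero hV ?_ ?_
  · simp [Measure.dirac_apply' _ hV, h]
  · simp [Measure.dirac_apply' _ hV, h]

theorem dl_tv_pos {T a : ℝ} {V : Set ℝ} (hV : MeasurableSet V) (h : T ∈ V) (ha : a ≠ 0) : 0 < (dl T a).totalVariation V := by
  refine pos_iff_ne_zero.2 fun h0 => ha ?_
  rw [← dl_apply (a := a) hV h]
  exact SignedMeasure.null_of_totalVariation_zero _ h0

theorem eta_exists {n d s : ℕ} {T : ℝ} (hT : 0 < T) {xs : Fin s → Euc n} {c : Fin s → ℝ}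
    {C : Set (Euc n)} (hC : C = {x | ∀ j, ⟪xs j, x⟫ ≤ c j}) {x0 : Euc n}
    {U : Set (Euc d)} {g : WithLp 2 (Euc n × Euc d) → Euc n} (hgc : Continuous g)
    {xb xb' : ℝ → Euc n} {ub : ℝ → Euc d} (hfeas : FeasibleP T x0 C U g xb xb' ub)
    {β : ℝ} (hgrow : ∀ (x : Euc n), ∀ u ∈ U, ‖g (pmk x u)‖ ≤ β * (1 + ‖x‖))
    (hβ : 0 < β)
    (hP : ∀ t ∈ Icc 0 T, PLICQ xs c (xb t)) :
    ∃ η : Fin s → ℝ → ℝ, (∀ j, Measurable (η j)) ∧ (∀ j t, 0 ≤ η j t) ∧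
      (∀ j, IntegrableOn (fun t => (η j t) ^ 2) (Icc 0 T)) ∧
      (∀ᵐ t, t ∈ Icc 0 T → ∑ j, η j t • xs j = -xb' t - g (pmk (xb t) (ub t))) ∧
      (∀ᵐ t, t ∈ Icc 0 T → ∀ j, ⟪xs j, xb t⟫ < c j → η j t = 0) := by
  have hCc : IsClosed C := by rw [hC]; exact poly_closed xs c
  have hcont := feas_cont hT hfeas.2.1 hfeas.2.2.1
  have hen := feas_energy hT hCc hfeas
  have ham : AEStronglyMeasurable (fun t => -xb' t - g (pmk (xb t) (ub t))) (volume.restrict (Icc 0 T)) :=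
    hfeas.2.2.1.aestronglyMeasurable.neg.sub (gcomp_meas hgc hcont hfeas.2.2.2.2.1)
  obtain ⟨a, ham1, ham2⟩ := ham.aemeasurable
  set S : Fin s → Set ℝ := fun j => {t | ⟪xs j, xb (projIcc 0 T hT.le t)⟫ = c j} with hS
  have hxc : Continuous fun t => xb (projIcc 0 T hT.le t) := by
    have : Continuous (fun t : Icc (0:ℝ) T => xb t) := continuousOn_iff_continuous_restrict.1 hcont
    exact this.comp continuous_projIcc
  obtain ⟨η, B, h1, h2, h3, h4⟩ := eta_select xs a ham1 S fun j =>
    (isClosed_eq (continuous_const.inner hxc) continuous_const).measurableSet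
  have hae : ∀ᵐ t, t ∈ Icc 0 T → -xb' t - g (pmk (xb t) (ub t)) = a t := (ae_restrict_iff' measurableSet_Icc).1 ham2
  have hproj : ∀ t ∈ Icc 0 T, xb (projIcc 0 T hT.le t) = xb t := fun t ht => by rw [projIcc_of_mem hT.le ht]
  have key : ∀ᵐ t, t ∈ Icc 0 T → (∀ j, t ∉ S j → η j t = 0) ∧ ∑ j, η j t • xs j = a t := by
    filter_upwards [hae, hen] with t e1 e2 ht
    obtain ⟨α, a1, a2, a3⟩ := normal_rep xs c hC (hP t ht) (e2 ht).1
    refine h4 t ⟨α, a1, fun j hj => a2 j fun h => hj ?_, a3.trans (e1 ht)⟩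
    rw [hS]; simp only [mem_ofPred_eq]; rw [hproj t ht]; exact h
  obtain ⟨G, hG⟩ : ∃ G : ℝ, ∀ᵐ t, t ∈ Icc 0 T → ‖g (pmk (xb t) (ub t))‖ ≤ G := by
    refine ⟨β * ((1 + ‖x0‖) * Real.exp (β * T)), ?_⟩
    filter_upwards [hfeas.2.2.2.2.2.1] with t h ht
    exact (hgrow _ _ (h ht)).trans (mul_le_mul_of_nonneg_left (feas_bound hT hCc hβ hgrow hfeas t ht) hβ.le)
  refine ⟨η, h1, h2, fun j => ?_, ?_, ?_⟩
  · refine Measure.integrableOn_of_bounded (M := (|B| * (G + G)) ^ 2) (by simp) ((h1 j).pow_const 2).aestronglyMeasurable ?_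
    rw [ae_restrict_iff' measurableSet_Icc]
    filter_upwards [hae, hen, hG] with t e1 e2 e3 ht
    rw [Real.norm_of_nonneg (by positivity)]
    refine pow_le_pow_left₀ (h2 j t) ((h3 j t).trans ?_) 2
    have : ‖a t‖ ≤ G + G := by
      rw [← e1 ht]
      refine (norm_sub_le _ _).trans ?_
      rw [norm_neg]
      exact add_le_add ((e2 ht).2.2.trans (e3 ht)) (e3 ht)
    exact (mul_le_mul_of_nonneg_right (le_abs_self B) (norm_nonneg _)).trans (mul_le_mul_of_nonneg_left this (abs_nonneg _))
  · filter_upwards [hae, key] with t e1 e2 ht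
    rw [(e2 ht).2, e1 ht]
  · filter_upwards [key] with t e2 ht j hj
    refine (e2 ht).1 j fun h => ?_
    rw [hS] at h; simp only [mem_ofPred_eq] at h; rw [hproj t ht] at h
    exact hj.ne h

/-- maximum condition from the normal cone inclusion -/
theorem max_of_normal {d : ℕ} {U : Set (Euc d)} (hU : Convex ℝ U) {u v : Euc d} (hu : u ∈ U)
    (hv : v ∈ convexHull ℝ (limNormal U u)) : ∀ w ∈ U, ⟪v, w⟫ ≤ ⟪v, u⟫ := by
  have h : convexHull ℝ (limNormal U u) ⊆ {v | ∀ w ∈ U, ⟪v, w - u⟫ ≤ 0} := by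
    refine convexHull_min (fun v hv => limNormal_convex hU hu hv) ?_
    intro x hx y hy a b ha hb _ w hw
    rw [inner_add_left, real_inner_smul_left, real_inner_smul_left]
    have := mul_nonpos_of_nonneg_of_nonpos ha (hx w hw)
    have := mul_nonpos_of_nonneg_of_nonpos hb (hy w hw)
    linarith
  intro w hw
  have := h hv w hw
  rw [inner_sub_right] at this
  linarith

/-- without contacts the constraint can be dropped -/
theorem core_free {n d s : ℕ} {T : ℝ} (hT : 0 < T) {xs : Fin s → Euc n} {c : Fin s → ℝ}
    {C : Set (Euc n)} (hC : C = {x | ∀ j, ⟪xs j, x⟫ ≤ c j}) {x0 : Euc n} {φ : Euc n → ℝ} (hφ : LocallyLipschitz φ)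
    {U : Set (Euc d)} (hUc : IsCompact U) (hUne : U.Nonempty)
    {g : WithLp 2 (Euc n × Euc d) → Euc n} (hgc : Continuous g) (hgL : GLip g) {β : ℝ}
    (hβ : 0 < β) (hgrow : ∀ (x : Euc n), ∀ u ∈ U, ‖g (pmk x u)‖ ≤ β * (1 + ‖x‖))
    {xb xb' : ℝ → Euc n} {ub : ℝ → Euc d} (hfeas : FeasibleP T x0 C U g xb xb' ub)
    (hloc : LocMin T x0 C U g φ xb ub) {vb : ℝ → ℝ}
    (hv : ∀ a ∈ Icc 0 T, ∀ b ∈ Icc 0 T, a ≤ b → ‖ub b - ub a‖ ≤ vb b - vb a)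
    (hrc : ∀ t ∈ Ico 0 T, ContinuousWithinAt ub (Ici t) t)
    (hP : ∀ t ∈ Icc 0 T, PLICQ xs c (xb t))
    (hin : ∀ t ∈ Icc 0 T, ∀ j, ⟪xs j, xb t⟫ < c j) :
    Core T (fun _ : Fin 0 => (0 : Euc n)) (fun _ => 0) univ x0 φ U g β xb xb' ub vb := by
  have hcont := feas_cont hT hfeas.2.1 hfeas.2.2.1
  refine ⟨hT, by ext; simp, mem_univ _, hφ, hUc, hUne, hgc, hgL, hβ, hgrow, ?_, ?_, linearIndependent_empty_type, fun j => j.elim0, hv, hrc⟩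
  · obtain ⟨f1, f2, f3, f4, f5, f6, f7⟩ := hfeas
    refine ⟨f1, f2, f3, f4, f5, f6, ?_⟩
    filter_upwards [f7] with t h ht
    obtain ⟨v, hv1, hv2⟩ := h ht
    obtain ⟨α, a1, a2, a3⟩ := normal_rep xs c hC (hP t ht) hv1
    refine ⟨0, ⟨mem_univ _, by simp⟩, ?_⟩
    have : v = 0 := by
      rw [← a3]; exact Finset.sum_eq_zero fun j _ => by rw [a2 j (hin t ht j).ne, zero_smul]
    rw [hv2, this]
  · obtain ⟨δ, hδ, h⟩ := hloc
    have hop : IsOpen {x : Euc n | ∀ j, ⟪xs j, x⟫ < c j} := by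
      have : {x : Euc n | ∀ j, ⟪xs j, x⟫ < c j} = ⋂ j, {x | ⟪xs j, x⟫ < c j} := by ext; simp
      rw [this]
      exact isOpen_iInter_of_finite fun j => isOpen_lt (by fun_prop) continuous_const
    obtain ⟨ρ, hρ, hsub⟩ := (isCompact_Icc.image_of_continuousOn hcont).exists_cthickening_subset_open hop
      (by rintro _ ⟨t, ht, rfl⟩; exact hin t ht)
    refine ⟨min δ ρ, lt_min hδ hρ, fun y y' u hf hu hy hu2 => ?_⟩
    refine h y y' u ?_ hu (fun t ht => (hy t ht).trans (min_le_left _ _)) (hu2.trans (min_le_left _ _))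
    obtain ⟨f1, f2, f3, f4, f5, f6, f7⟩ := hf
    refine ⟨f1, f2, f3, f4, f5, f6, ?_⟩
    filter_upwards [f7] with t h ht
    obtain ⟨v, hv1, hv2⟩ := h ht
    have hv0 : v = 0 := by
      have := hv1.2 (y t + v) (mem_univ _)
      rw [add_sub_cancel_left, real_inner_self_eq_norm_sq] at this
      exact norm_eq_zero.1 (pow_eq_zero_iff two_ne_zero |>.1 (le_antisymm this (by positivity)))
    refine ⟨0, ⟨?_, by simp⟩, by rw [hv2, hv0]⟩
    have hmem : y t ∈ Metric.cthickening ρ (xb '' Icc 0 T) :=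
      Metric.mem_cthickening_of_dist_le _ (xb t) _ _ ⟨t, ht, rfl⟩ (by rw [dist_eq_norm]; exact (hy t ht).trans (min_le_right _ _))
    rw [hC]
    exact fun j => (hsub hmem j).le

theorem bv_bound {d : ℕ} {T : ℝ} {ub : ℝ → Euc d} (hT : 0 < T) (h : BoundedVariationOn ub (Icc 0 T)) :
    ∀ a ∈ Icc 0 T, ∀ b ∈ Icc 0 T, a ≤ b →
      ‖ub b - ub a‖ ≤ variationOnFromTo ub (Icc 0 T) 0 b - variationOnFromTo ub (Icc 0 T) 0 a := by
  intro a ha b hb hab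
  have h0 : (0:ℝ) ∈ Icc 0 T := ⟨le_rfl, hT.le⟩
  have := variationOnFromTo.add h.locallyBoundedVariationOn h0 ha hb
  rw [← this, add_sub_cancel_left, variationOnFromTo.eq_of_le _ _ hab, ← dist_eq_norm, dist_edist, edist_comm]
  refine ENNReal.toReal_mono (h.mono inter_subset_left) ?_
  exact eVariationOn.edist_le _ ⟨ha, le_rfl, hab⟩ ⟨hb, hab, le_rfl⟩

/-- degenerate multipliers -/
theorem deg_case {n d s : ℕ} {T : ℝ} (hT : 0 < T) {xs : Fin s → Euc n} {c : Fin s → ℝ}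
    {C : Set (Euc n)} (hC : C = {x | ∀ j, ⟪xs j, x⟫ ≤ c j}) {φ : Euc n → ℝ}
    {Uset : Set (Euc d)} {g : WithLp 2 (Euc n × Euc d) → Euc n}
    {xb xb' : ℝ → Euc n} {ub : ℝ → Euc d}
    (hUae : ∀ᵐ t ∂(volume : Measure ℝ), t ∈ Set.Icc 0 T → ub t ∈ Uset) (hφ : LocallyLipschitz φ)
    (a ηT : Fin s → ℝ) {η : Fin s → ℝ → ℝ} (e1 : ∀ j, Measurable (η j)) (e2 : ∀ j t, 0 ≤ η j t)
    (e3 : ∀ j, IntegrableOn (fun t => (η j t) ^ 2) (Icc 0 T))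
    (e4 : ∀ᵐ t ∂(volume : Measure ℝ), t ∈ Set.Icc 0 T → -xb' t = ∑ j, η j t • xs j + g (pmk (xb t) (ub t)))
    (e5 : ∀ᵐ t, t ∈ Icc 0 T → ∀ j, ⟪xs j, xb t⟫ < c j → η j t = 0)
    (hTC : xb T ∈ C) (h1 : ∀ j, 0 ≤ ηT j) (h2 : ∀ j, ⟪xs j, xb T⟫ < c j → ηT j = 0)
    (h3 : ∑ j, (a j + ηT j) • xs j = 0) (h4 : ∃ j, a j ≠ 0)
    (h5 : (∀ t ∈ Set.Ico 0 T, ∀ j, ⟪xs j, xb t⟫ < c j) → ∑ j, a j • xs j ≠ 0) :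
    ∃ (lam : ℝ) (p p' q : ℝ → Euc n)
      (γ : Fin s → MeasureTheory.SignedMeasure ℝ)
      (η : Fin s → ℝ → ℝ) (ψ : ℝ → Euc d) (ηT : Fin s → ℝ),
      0 ≤ lam ∧
      -- p ∈ W^{1,2}([0,T];ℝⁿ)
      (∀ t ∈ Set.Icc 0 T, p t = p 0 + ∫ τ in (0:ℝ)..t, p' τ) ∧
      IntegrableOn p' (Set.Icc 0 T) ∧
      IntegrableOn (fun t => ‖p' t‖ ^ 2) (Set.Icc 0 T) ∧
      -- q of bounded variation
      BoundedVariationOn q (Set.Icc 0 T) ∧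
      -- η^j ∈ L²([0,T];ℝ₊)
      (∀ j, Measurable (η j)) ∧
      (∀ j t, 0 ≤ η j t) ∧
      (∀ j, IntegrableOn (fun t => (η j t) ^ 2) (Set.Icc 0 T)) ∧
      -- ψ ∈ L²([0,T];ℝ^d)
      AEStronglyMeasurable ψ (volume.restrict (Set.Icc 0 T)) ∧
      IntegrableOn (fun t => ‖ψ t‖ ^ 2) (Set.Icc 0 T) ∧
      (∀ j, 0 ≤ ηT j) ∧
      -- (1) primal arc representation
      (∀ᵐ t ∂(volume : Measure ℝ), t ∈ Set.Icc 0 T →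
        -xb' t = ∑ j, η j t • xs j + g (pmk (xb t) (ub t))) ∧
      -- (2) extended Euler–Lagrange inclusion
      (∀ᵐ t ∂(volume : Measure ℝ), t ∈ Set.Icc 0 T →
        pmk (p' t) (-ψ t) ∈
          convexHull ℝ (limSubdiff (fun pt => ⟪q t, g pt⟫) (pmk (xb t) (ub t)))) ∧
      -- (3) ψ(t) ∈ co N(ū(t);U)
      (∀ᵐ t ∂(volume : Measure ℝ), t ∈ Set.Icc 0 T →
        ψ t ∈ convexHull ℝ (limNormal Uset (ub t))) ∧
      -- (4) the BV adjoint arc q, off a countable set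
      (∃ S : Set ℝ, S.Countable ∧ ∀ t ∈ Set.Icc 0 T \ S,
        q t = p t - ∑ j, (γ j (Set.Ioc t T)) • xs j) ∧
      -- (5) global maximization condition for convex U
      (Convex ℝ Uset → ∀ᵐ t ∂(volume : Measure ℝ), t ∈ Set.Icc 0 T →
        ∀ u ∈ Uset, ⟪ψ t, u⟫ ≤ ⟪ψ t, ub t⟫) ∧
      -- (6) transversality conditions
      (∃ θ ∈ limSubdiff φ (xb T), -p T - ∑ j, ηT j • xs j = lam • θ) ∧
      ((∑ j, ηT j • xs j) ∈ convNormal C (xb T)) ∧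
      -- (7) complementary slackness
      (∀ᵐ t ∂(volume : Measure ℝ), t ∈ Set.Icc 0 T →
        ∀ j, ⟪xs j, xb t⟫ < c j → η j t = 0) ∧
      (∀ j, ⟪xs j, xb T⟫ < c j → ηT j = 0) ∧
      -- (8) complementarity under linear independence
      ((∀ᵐ t ∂(volume : Measure ℝ), t ∈ Set.Ico 0 T →
          LinearIndependent ℝ
            (fun jj : {j : Fin s // ⟪xs j, xb t⟫ = c j} => xs jj)) →
        ∀ᵐ t ∂(volume : Measure ℝ), t ∈ Set.Ico 0 T →
          ∀ j, 0 < η j t → ⟪xs j, q t⟫ = 0) ∧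
      -- (9) measure nonatomicity condition
      (∀ t ∈ Set.Ico 0 T, (∀ j, ⟪xs j, xb t⟫ < c j) →
        ∃ δ > (0:ℝ), ∀ V : Set ℝ, MeasurableSet V →
          V ⊆ Set.Ico 0 T ∩ Metric.ball t δ →
          ∀ j, (γ j).totalVariation V = 0) ∧
      -- (10) general nontriviality
      (0 < lam ∨ (∃ t ∈ Set.Icc 0 T, p t ≠ 0) ∨
        0 < ∑ j, (γ j).totalVariation (Set.Icc 0 T)) ∧
      -- (11) enhanced nontriviality
      ((∀ t ∈ Set.Ico 0 T, ∀ j, ⟪xs j, xb t⟫ < c j) →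
        (0 < lam ∨ ∃ t ∈ Set.Icc 0 T, p t ≠ 0)) := by
  have hTm : T ∈ Icc 0 T := ⟨hT.le, le_rfl⟩
  simp only [add_smul, Finset.sum_add_distrib] at h3
  obtain ⟨θ, hθ⟩ := limSubdiff_nonempty hφ (xb T)
  have hle := hTC
  rw [hC] at hle
  refine ⟨0, fun _ => ∑ j, a j • xs j, fun _ => 0, fun _ => 0, fun j => dl T (a j), η, fun _ => 0, ηT, le_rfl, by simp, by simp, by simp, ?_,
    e1, e2, e3, aestronglyMeasurable_const, by simp, h1, e4, ?_, ?_, ⟨{T}, countable_singleton T, fun t ht => ?_⟩, ?_, ⟨θ, hθ, ?_⟩, ⟨hTC, fun y hy => ?_⟩,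
    e5, h2, ?_, fun t ht _ => ⟨1, one_pos, fun V hV hsub j => dl_tv hV fun h => (hsub h).1.2.ne rfl⟩, Or.inr (Or.inr ?_),
    fun h => Or.inr ⟨T, hTm, h5 h⟩⟩
  · exact bv_of_mono (F := fun _ => 0) hT (by simp)
  · refine ae_of_all _ fun t _ => subset_convexHull ℝ _ ?_
    have e : pmk (0 : Euc n) (-(0 : Euc d)) = 0 := by rw [neg_zero]; rfl
    rw [e]
    refine ProxSub.mem_limSubdiff ?_
    exact ⟨0, le_rfl, by simp⟩
  · filter_upwards [hUae] with t h ht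
    exact subset_convexHull ℝ _ (zero_mem_limNormal (h ht))
  · have htT : t < T := lt_of_le_of_ne ht.1.2 ht.2
    simp only [dl_apply measurableSet_Ioc (⟨htT, le_rfl⟩ : T ∈ Ioc t T), sub_self]
  · intro _
    refine ae_of_all _ fun t _ u _ => by simp
  · rw [zero_smul, ← neg_add', h3, neg_zero]
  · rw [hC] at hy
    rw [sum_inner]
    refine Finset.sum_nonpos fun j _ => ?_
    rw [real_inner_smul_left]
    rcases (hle j).lt_or_eq with h | h
    · rw [h2 j h, zero_mul]
    · rw [inner_sub_right, h]
      exact mul_nonpos_of_nonneg_of_nonpos (h1 j) (by linarith [hy j])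
  · intro _
    refine ae_of_all _ fun t _ j _ => by simp
  · obtain ⟨j, hj⟩ := h4
    exact (dl_tv_pos measurableSet_Icc hTm hj).trans_le
      (Finset.single_le_sum (f := fun j => (dl T (a j)).totalVariation (Icc 0 T)) (fun _ _ => bot_le) (Finset.mem_univ j))

/-- necessary optimality conditions for relaxed `W^{1,2} × L²` local
minimizers of the nonsmooth sweeping control problem `(P)`. -/
theorem statement11 (n d s : ℕ) (T : ℝ) (hT : 0 < T)
    (xs : Fin s → Euc n) (c : Fin s → ℝ)
    (C : Set (Euc n)) (hC : C = {x | ∀ j, ⟪xs j, x⟫ ≤ c j})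
    (x0 : Euc n) (hx0 : x0 ∈ C)
    (φ : Euc n → ℝ) (hφ : LocallyLipschitz φ)
    (Uset : Set (Euc d)) (hUc : IsCompact Uset) (hUne : Uset.Nonempty)
    (g : WithLp 2 (Euc n × Euc d) → Euc n)
    (hgLip : ∀ B : Set (WithLp 2 (Euc n × Euc d)), Bornology.IsBounded B →
      ∃ K : NNReal, LipschitzOnWith K g B)
    (hgrow : ∃ β > (0:ℝ), ∀ (x : Euc n), ∀ u ∈ Uset, ‖g (pmk x u)‖ ≤ β * (1 + ‖x‖))
    (xb xb' : ℝ → Euc n) (ub : ℝ → Euc d)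
    (hfeas : FeasibleP T x0 C Uset g xb xb' ub)
    (hrelax : ∃ ε > (0:ℝ), RelaxedLocalMin T x0 C Uset g φ xb xb' ub ε)
    (hPLICQ : ∀ t ∈ Set.Icc 0 T, PLICQ xs c (xb t))
    (hubBV : BoundedVariationOn ub (Set.Icc 0 T))
    (hubrc : ∀ t ∈ Set.Ico 0 T, ContinuousWithinAt ub (Set.Ici t) t) :
    ∃ (lam : ℝ) (p p' q : ℝ → Euc n)
      (γ : Fin s → MeasureTheory.SignedMeasure ℝ)
      (η : Fin s → ℝ → ℝ) (ψ : ℝ → Euc d) (ηT : Fin s → ℝ),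
      0 ≤ lam ∧
      -- p ∈ W^{1,2}([0,T];ℝⁿ)
      (∀ t ∈ Set.Icc 0 T, p t = p 0 + ∫ τ in (0:ℝ)..t, p' τ) ∧
      IntegrableOn p' (Set.Icc 0 T) ∧
      IntegrableOn (fun t => ‖p' t‖ ^ 2) (Set.Icc 0 T) ∧
      -- q of bounded variation
      BoundedVariationOn q (Set.Icc 0 T) ∧
      -- η^j ∈ L²([0,T];ℝ₊)
      (∀ j, Measurable (η j)) ∧
      (∀ j t, 0 ≤ η j t) ∧
      (∀ j, IntegrableOn (fun t => (η j t) ^ 2) (Set.Icc 0 T)) ∧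
      -- ψ ∈ L²([0,T];ℝ^d)
      AEStronglyMeasurable ψ (volume.restrict (Set.Icc 0 T)) ∧
      IntegrableOn (fun t => ‖ψ t‖ ^ 2) (Set.Icc 0 T) ∧
      (∀ j, 0 ≤ ηT j) ∧
      -- (1) primal arc representation
      (∀ᵐ t ∂(volume : Measure ℝ), t ∈ Set.Icc 0 T →
        -xb' t = ∑ j, η j t • xs j + g (pmk (xb t) (ub t))) ∧
      -- (2) extended Euler–Lagrange inclusion
      (∀ᵐ t ∂(volume : Measure ℝ), t ∈ Set.Icc 0 T →
        pmk (p' t) (-ψ t) ∈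
          convexHull ℝ (limSubdiff (fun pt => ⟪q t, g pt⟫) (pmk (xb t) (ub t)))) ∧
      -- (3) ψ(t) ∈ co N(ū(t);U)
      (∀ᵐ t ∂(volume : Measure ℝ), t ∈ Set.Icc 0 T →
        ψ t ∈ convexHull ℝ (limNormal Uset (ub t))) ∧
      -- (4) the BV adjoint arc q, off a countable set
      (∃ S : Set ℝ, S.Countable ∧ ∀ t ∈ Set.Icc 0 T \ S,
        q t = p t - ∑ j, (γ j (Set.Ioc t T)) • xs j) ∧
      -- (5) global maximization condition for convex U
      (Convex ℝ Uset → ∀ᵐ t ∂(volume : Measure ℝ), t ∈ Set.Icc 0 T →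
        ∀ u ∈ Uset, ⟪ψ t, u⟫ ≤ ⟪ψ t, ub t⟫) ∧
      -- (6) transversality conditions
      (∃ θ ∈ limSubdiff φ (xb T), -p T - ∑ j, ηT j • xs j = lam • θ) ∧
      ((∑ j, ηT j • xs j) ∈ convNormal C (xb T)) ∧
      -- (7) complementary slackness
      (∀ᵐ t ∂(volume : Measure ℝ), t ∈ Set.Icc 0 T →
        ∀ j, ⟪xs j, xb t⟫ < c j → η j t = 0) ∧
      (∀ j, ⟪xs j, xb T⟫ < c j → ηT j = 0) ∧
      -- (8) complementarity under linear independence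
      ((∀ᵐ t ∂(volume : Measure ℝ), t ∈ Set.Ico 0 T →
          LinearIndependent ℝ
            (fun jj : {j : Fin s // ⟪xs j, xb t⟫ = c j} => xs jj)) →
        ∀ᵐ t ∂(volume : Measure ℝ), t ∈ Set.Ico 0 T →
          ∀ j, 0 < η j t → ⟪xs j, q t⟫ = 0) ∧
      -- (9) measure nonatomicity condition
      (∀ t ∈ Set.Ico 0 T, (∀ j, ⟪xs j, xb t⟫ < c j) →
        ∃ δ > (0:ℝ), ∀ V : Set ℝ, MeasurableSet V →
          V ⊆ Set.Ico 0 T ∩ Metric.ball t δ →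
          ∀ j, (γ j).totalVariation V = 0) ∧
      -- (10) general nontriviality
      (0 < lam ∨ (∃ t ∈ Set.Icc 0 T, p t ≠ 0) ∨
        0 < ∑ j, (γ j).totalVariation (Set.Icc 0 T)) ∧
      -- (11) enhanced nontriviality
      ((∀ t ∈ Set.Ico 0 T, ∀ j, ⟪xs j, xb t⟫ < c j) →
        (0 < lam ∨ ∃ t ∈ Set.Icc 0 T, p t ≠ 0)) := by
  obtain ⟨β, hβ, hgrow⟩ := hgrow
  obtain ⟨ε, hε, hrelax⟩ := hrelax
  have hgL : GLip g := gLip_of hgLip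
  have hgc : Continuous g := gcont_of hgLip
  have hCc : IsClosed C := by rw [hC]; exact poly_closed xs c
  have hmemC := feas_memC hT hCc hfeas
  have hTm : T ∈ Icc 0 T := ⟨hT.le, le_rfl⟩
  have hle : ∀ t ∈ Icc 0 T, ∀ j, ⟪xs j, xb t⟫ ≤ c j := by
    intro t ht
    have := hmemC t ht
    rw [hC] at this
    exact this
  obtain ⟨η, e1, e2, e3, e4, e5⟩ := eta_exists hT hC hgc hfeas hgrow hβ hPLICQ
  have he4 : ∀ᵐ t ∂(volume : Measure ℝ), t ∈ Set.Icc 0 T →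
        -xb' t = ∑ j, η j t • xs j + g (pmk (xb t) (ub t)) := by
    filter_upwards [e4] with t h ht
    rw [h ht]; abel
  have hloc := loc_min hT hCc hgc hgL hUc hβ hgrow hfeas hε hrelax
  have hUae := hfeas.2.2.2.2.2.1
  by_cases hA : ∃ j, ⟪xs j, xb T⟫ = c j
  · obtain ⟨j0, hj0⟩ := hA
    classical
    refine deg_case hT hC hUae hφ (fun j => -(Pi.single j0 1 : Fin s → ℝ) j) (Pi.single j0 1) e1 e2 e3 he4 e5 ?_ ?_ ?_ ?_ ?_ ?_
    · exact hmemC T hTm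
    · intro j
      by_cases h : j = j0
      · subst h; simp
      · simp [h]
    · intro j hj
      have : j ≠ j0 := by rintro rfl; exact hj.ne hj0
      simp [this]
    · simp
    · exact ⟨j0, by simp⟩
    · intro _ h0
      have h1 := hPLICQ T hTm (Pi.single j0 1) (fun j => by
        by_cases h : j = j0
        · subst h; simp
        · simp [h]) (fun j hj => by
          have : j ≠ j0 := by rintro rfl; exact hj hj0
          simp [this]) (by simpa using h0) j0
      simp at h1
  push Not at hA
  have hTin : ∀ j, ⟪xs j, xb T⟫ < c j := fun j => lt_of_le_of_ne (hle T hTm j) (hA j)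
  by_cases hN : ∀ t ∈ Ico 0 T, ∀ j, ⟪xs j, xb t⟫ < c j
  · have hin : ∀ t ∈ Icc 0 T, ∀ j, ⟪xs j, xb t⟫ < c j := by
      intro t ht
      rcases ht.2.eq_or_lt with h | h
      · rw [h]; exact hTin
      · exact hN t ⟨ht.1, h⟩
    have HC := core_free hT hC hφ hUc hUne hgc hgL hβ hgrow hfeas hloc (bv_bound hT hubBV) hubrc hPLICQ hin
    obtain ⟨p, p', q, γ, ψ, r1, r2, r3, r4, r5, r6, r7, r8, ⟨S, hS, r9⟩, r10, r11, r12⟩ := core_thm HC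
    refine ⟨1, p, p', q, fun _ => 0, η, ψ, fun _ => 0, zero_le_one, r1, r2, r3, r4, e1, e2, e3, r5, r6, fun _ => le_rfl, he4, r7, r8,
      ⟨S, hS, fun t ht => ?_⟩, ?_, ⟨-p T, r10, by simp⟩, ⟨hmemC T hTm, by simp⟩, e5, fun _ _ => rfl, ?_, ?_, Or.inl one_pos, fun _ => Or.inl one_pos⟩
    · have := r9 t ht
      simpa using this
    · intro hUcv
      filter_upwards [r8, hUae] with t h1 h2 ht
      exact max_of_normal hUcv (h2 ht) (h1 ht)
    · intro _
      filter_upwards [e5] with t h ht j hj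
      have := h ⟨ht.1, ht.2.le⟩ j (hN t ht j)
      exact absurd hj (by rw [this]; exact lt_irrefl _)
    · intro t ht _
      refine ⟨1, one_pos, fun V _ _ j => ?_⟩
      rw [SignedMeasure.totalVariation_zero]; simp
  by_cases hLI : LinearIndependent ℝ xs
  · have HC : Core T xs c C x0 φ Uset g β xb xb' ub (variationOnFromTo ub (Icc 0 T) 0) :=
      ⟨hT, hC, hx0, hφ, hUc, hUne, hgc, hgL, hβ, hgrow, hfeas, hloc, hLI, hTin, bv_bound hT hubBV, hubrc⟩
    obtain ⟨p, p', q, γ, ψ, r1, r2, r3, r4, r5, r6, r7, r8, r9, r10, r11, r12⟩ := core_thm HC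
    refine ⟨1, p, p', q, γ, η, ψ, fun _ => 0, zero_le_one, r1, r2, r3, r4, e1, e2, e3, r5, r6, fun _ => le_rfl, he4, r7, r8,
      r9, ?_, ⟨-p T, r10, by simp⟩, ⟨hmemC T hTm, by simp⟩, e5, fun _ _ => rfl, ?_, r12, Or.inl one_pos, fun _ => Or.inl one_pos⟩
    · intro hUcv
      filter_upwards [r8, hUae] with t h1 h2 ht
      exact max_of_normal hUcv (h2 ht) (h1 ht)
    · intro _
      filter_upwards [e4, r11] with t h1 h2 ht j hj
      by_contra hcon
      have ht' : t ∈ Icc 0 T := ⟨ht.1, ht.2.le⟩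
      exact hj.ne' (h2 ht' (fun j => η j t) j (h1 ht') hcon)
  · rw [Fintype.not_linearIndependent_iff] at hLI
    obtain ⟨a, ha, j0, hj0⟩ := hLI
    refine deg_case hT hC hUae hφ a 0 e1 e2 e3 he4 e5 (hmemC T hTm) (fun _ => le_rfl) (fun _ _ => rfl) ?_ ⟨j0, hj0⟩ (fun h => absurd h hN)
    simpa using ha
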